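/- Let k be an algebraically closed field of characteristic zero and let X be a rational normal projective surface over k with a unique singular point x, admitting a resolution of singularities π : X̃ → X with X̃ smooth projective rational, π an isomorphism over X∖{x}, and exceptional divisor E := π⁻¹(x) a cycle of three lines (a union of three copies of ℙ¹ meeting pairwise in single points, with empty triple intersection). Then [X] ≡ 2 mod 𝕃 in K₀(Var_k); in particular X is a rational normal projective surface with [X] ≢ 1 mod 𝕃. -/

import Mathlib

open AlgebraicGeometry CategoryTheory CategoryTheory.Limits MvPolynomial

universe u v

noncomputable section

attribute [local instance] MvPolynomial.gradedAlgebra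

/-- The base scheme `Spec k`. -/
abbrev SpecBase (k : Type u) [Field k] : Scheme.{u} := Spec (CommRingCat.of k)

/-- The affine line `𝔸¹_k` as a scheme over `k`. -/
def AffineLine (k : Type u) [Field k] : Scheme.{u} := Spec (CommRingCat.of (Polynomial k))

/-- The structure morphism of `𝔸¹_k`. -/
def AffineLine.toSpec (k : Type u) [Field k] : AffineLine k ⟶ SpecBase k :=
  Spec.map (CommRingCat.ofHom (algebraMap k (Polynomial k)))

/-- Projective `n`-space `ℙⁿ_k = Proj k[x₀, …, xₙ]` over `k`. -/
def ProjSpace (k : Type u) [Field k] (n : ℕ) : Scheme.{u} :=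
  Proj (homogeneousSubmodule (Fin (n + 1)) k)

/-- The structure morphism of `ℙⁿ_k`. -/
def ProjSpace.toSpec (k : Type u) [Field k] (n : ℕ) : ProjSpace k n ⟶ SpecBase k :=
  Proj.toSpecZero _ ≫ Spec.map (CommRingCat.ofHom (algebraMap k _))

/-- `X` (a scheme over `k` via `sX : X ⟶ Spec k`) is the reduced closed subvariety of `ℙⁿ_k`
cut out by the family `S` of polynomials, i.e. `X → ℙⁿ_k` is a closed immersion of the reduced
scheme `X` onto the zero locus of `S`, compatibly with the structure morphisms. -/
def IsProjSubvariety (k : Type u) [Field k] (n : ℕ) (S : Set (MvPolynomial (Fin (n + 1)) k))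
    (X : Scheme.{u}) (sX : X ⟶ SpecBase k) : Prop :=
  IsReduced X ∧ ∃ i : X ⟶ ProjSpace k n, IsClosedImmersion i ∧ i ≫ ProjSpace.toSpec k n = sX ∧
    Set.range i.base = ProjectiveSpectrum.zeroLocus (homogeneousSubmodule (Fin (n + 1)) k) S

/-- `X` has a `k`-rational point, i.e. the structure morphism has a section. -/
def HasRatPoint (k : Type u) [Field k] (X : Scheme.{u}) (sX : X ⟶ SpecBase k) : Prop :=
  ∃ p : SpecBase k ⟶ X, p ≫ sX = 𝟙 (SpecBase k)

/-- A motivic measure on varieties over `k` with values in a commutative ring `R`: an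
assignment, to every scheme over `k`, of an element of `R` which, on separated schemes of
finite type over `k` (i.e. on the category `Var_k`, reducedness being irrelevant), is
invariant under isomorphisms over `k`, satisfies the scissor relations
`[X] = [X ∖ Z] + [Z]` for closed subschemes `Z ⊆ X`, is multiplicative on fibre products
over `k`, and sends `Spec k` to `1`.  These are exactly the defining relations of the
Grothendieck ring of varieties `K₀(Var_k)`, so an identity holds in `K₀(Var_k)` if and
only if it holds for every motivic measure. -/
structure MotivicMeasure (k : Type u) [Field k] (R : Type v) [CommRing R] where
  cl : ∀ (X : Scheme.{u}), (X ⟶ SpecBase k) → R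
  cl_point : cl (SpecBase k) (𝟙 (SpecBase k)) = 1
  cl_iso : ∀ {X Y : Scheme.{u}} (sX : X ⟶ SpecBase k) (sY : Y ⟶ SpecBase k) (e : X ≅ Y),
    LocallyOfFiniteType sX → QuasiCompact sX → IsSeparated sX →
    e.hom ≫ sY = sX → cl X sX = cl Y sY
  cl_scissor : ∀ {X Z : Scheme.{u}} (sX : X ⟶ SpecBase k) (i : Z ⟶ X),
    LocallyOfFiniteType sX → QuasiCompact sX → IsSeparated sX →
    IsClosedImmersion i → ∀ U : X.Opens, (U : Set X) = (Set.range i.base)ᶜ →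
    cl X sX = cl U.toScheme (U.ι ≫ sX) + cl Z (i ≫ sX)
  cl_prod : ∀ {X Y : Scheme.{u}} (sX : X ⟶ SpecBase k) (sY : Y ⟶ SpecBase k),
    LocallyOfFiniteType sX → QuasiCompact sX → IsSeparated sX →
    LocallyOfFiniteType sY → QuasiCompact sY → IsSeparated sY →
    cl (pullback sX sY) (pullback.fst sX sY ≫ sX) = cl X sX * cl Y sY

/-- The class of the affine line, `𝕃 = [𝔸¹_k]`, under a motivic measure. -/
def MotivicMeasure.lef {k : Type u} [Field k] {R : Type v} [CommRing R]
    (μ : MotivicMeasure k R) : R :=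
  μ.cl (AffineLine k) (AffineLine.toSpec k)

/-- `X` and `Y` are birational over `k`: they contain isomorphic dense open subschemes. -/
def BirationalOver (k : Type u) [Field k] (X Y : Scheme.{u})
    (sX : X ⟶ SpecBase k) (sY : Y ⟶ SpecBase k) : Prop :=
  ∃ (U : X.Opens) (V : Y.Opens) (e : U.toScheme ≅ V.toScheme),
    Dense (U : Set X) ∧ Dense (V : Set Y) ∧ e.hom ≫ V.ι ≫ sY = U.ι ≫ sX

end

namespace MotivicSurface

noncomputable section

/-- A motivic measure on affine schemes of finite type for which the affine line has class `0`. -/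
structure AlgMeasure (k : Type u) [Field k] (Q : Type u) [CommRing Q] where
  cl : ∀ (A : Type u) [CommRing A] [Algebra k A], Q
  iso : ∀ {A B : Type u} [CommRing A] [Algebra k A] [CommRing B] [Algebra k B],
    Algebra.FiniteType k A → (A ≃ₐ[k] B) → cl A = cl B
  scissor : ∀ {A : Type u} [CommRing A] [Algebra k A], Algebra.FiniteType k A → ∀ f : A,
    cl A = cl (Localization.Away f) + cl (A ⧸ Ideal.span {f})
  point : cl k = 1
  poly : ∀ {A : Type u} [CommRing A] [Algebra k A], Algebra.FiniteType k A →
    cl (Polynomial A) = 0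

section Points

variable {k : Type u} [Field k]

theorem exists_point [IsAlgClosed k] (A : Type u) [CommRing A] [Algebra k A] [Nontrivial A]
    [Algebra.FiniteType k A] : Nonempty (A →ₐ[k] k) := by
  obtain ⟨m, hm⟩ := Ideal.exists_maximal A
  let : Field (A ⧸ m) := Ideal.Quotient.field m
  have : Algebra.FiniteType k (A ⧸ m) :=
    Algebra.FiniteType.of_surjective (Ideal.Quotient.mkₐ k m) Ideal.Quotient.mk_surjective
  have : Module.Finite k (A ⧸ m) := finite_of_finite_type_of_isJacobsonRing k (A ⧸ m)
  have hb := IsAlgClosed.algebraMap_bijective_of_isIntegral (k := k) (K := A ⧸ m)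
  exact ⟨((AlgEquiv.ofBijective (Algebra.ofId k (A ⧸ m)) hb).symm : (A ⧸ m) →ₐ[k] k).comp
    (Ideal.Quotient.mkₐ k m)⟩

theorem exists_point_prime [IsAlgClosed k] {A : Type u} [CommRing A] [Algebra k A]
    [Algebra.FiniteType k A] (P : Ideal A) [P.IsPrime] {h : A} (hh : h ∉ P) :
    ∃ θ : A →ₐ[k] k, (∀ x ∈ P, θ x = 0) ∧ θ h ≠ 0 := by
  have : Algebra.FiniteType k (A ⧸ P) :=
    Algebra.FiniteType.of_surjective (Ideal.Quotient.mkₐ k P) Ideal.Quotient.mk_surjective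
  let h' : A ⧸ P := Ideal.Quotient.mk P h
  have hh' : h' ≠ 0 := fun e => hh (Ideal.Quotient.eq_zero_iff_mem.1 e)
  have : Algebra.FiniteType (A ⧸ P) (Localization.Away h') :=
    IsLocalization.finiteType_of_monoid_fg (Submonoid.powers h') _
  have : Algebra.FiniteType k (Localization.Away h') :=
    Algebra.FiniteType.trans (S := A ⧸ P) inferInstance inferInstance
  have : Nontrivial (Localization.Away h') :=
    (IsLocalization.injective (Localization.Away h')
      (powers_le_nonZeroDivisors_of_noZeroDivisors hh')).nontrivial
  obtain ⟨φ⟩ := exists_point (k := k) (Localization.Away h')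
  refine ⟨(φ.comp (IsScalarTower.toAlgHom k (A ⧸ P) (Localization.Away h'))).comp
    (Ideal.Quotient.mkₐ k P), ?_, ?_⟩
  · intro x hx
    simp [Ideal.Quotient.eq_zero_iff_mem.2 hx]
  · have hu : IsUnit (algebraMap (A ⧸ P) (Localization.Away h') h') :=
      IsLocalization.Away.algebraMap_isUnit h'
    exact (hu.map φ).ne_zero

/-- The indicator function of the zero locus of an ideal. -/
def zind {A : Type u} [CommRing A] [Algebra k A] (I : Ideal A) :
    (A →ₐ[k] k) → ℤ := by
  classical exact fun θ => if ∀ x ∈ I, θ x = 0 then 1 else 0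

variable {A : Type u} [CommRing A] [Algebra k A]

theorem zind_eq_one {I : Ideal A} {θ : A →ₐ[k] k} (h : ∀ x ∈ I, θ x = 0) : zind I θ = 1 := by
  simp only [zind]; exact if_pos h

theorem zind_eq_zero {I : Ideal A} {θ : A →ₐ[k] k} {x : A} (hx : x ∈ I) (h : θ x ≠ 0) :
    zind I θ = 0 := by
  simp only [zind]; exact if_neg fun H => h (H x hx)

theorem zind_sup (I J : Ideal A) (θ : A →ₐ[k] k) : zind (I ⊔ J) θ = zind I θ * zind J θ := by
  by_cases hI : ∀ x ∈ I, θ x = 0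
  · by_cases hJ : ∀ x ∈ J, θ x = 0
    · rw [zind_eq_one hI, zind_eq_one hJ, zind_eq_one, one_mul]
      have : I ⊔ J ≤ RingHom.ker θ := sup_le (fun x hx => hI x hx) (fun x hx => hJ x hx)
      exact fun x hx => this hx
    · push Not at hJ
      obtain ⟨x, hx, hn⟩ := hJ
      rw [zind_eq_zero hx hn, zind_eq_zero (Ideal.mem_sup_right hx) hn, mul_zero]
  · push Not at hI
    obtain ⟨x, hx, hn⟩ := hI
    rw [zind_eq_zero hx hn, zind_eq_zero (Ideal.mem_sup_left hx) hn, zero_mul]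

end Points

namespace AlgMeasure

variable {k : Type u} [Field k] {Q : Type u} [CommRing Q] (μ : AlgMeasure k Q)
  {A : Type u} [CommRing A] [Algebra k A]

/-- The class of the closed subscheme defined by an ideal. -/
def c (I : Ideal A) : Q := μ.cl (A ⧸ I)

theorem cl_of_subsingleton [Subsingleton A] [Algebra.FiniteType k A] : μ.cl A = 0 := by
  have h := μ.scissor (A := A) inferInstance 0
  have e1 : μ.cl A = μ.cl (Localization.Away (0 : A)) := by
    have : Subsingleton (Localization.Away (0 : A)) :=
      (algebraMap A (Localization.Away (0 : A))).codomain_trivial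
    exact μ.iso inferInstance
      (AlgEquiv.ofBijective (IsScalarTower.toAlgHom k A (Localization.Away (0 : A)))
        ⟨Function.injective_of_subsingleton _, fun x => ⟨0, Subsingleton.elim _ _⟩⟩)
  have e2 : μ.cl A = μ.cl (A ⧸ Ideal.span {(0 : A)}) := by
    have : Subsingleton (A ⧸ Ideal.span {(0 : A)}) :=
      (Ideal.Quotient.mk (Ideal.span {(0 : A)})).codomain_trivial
    exact μ.iso inferInstance
      (AlgEquiv.ofBijective (Ideal.Quotient.mkₐ k (Ideal.span {(0 : A)}))
        ⟨Function.injective_of_subsingleton _, Ideal.Quotient.mk_surjective⟩)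
  rw [← e1, ← e2] at h
  simpa using h

theorem cl_localization_eq [Algebra.FiniteType k A] (f : A) {B : Type u} [CommRing B]
    [Algebra k B] (g : A →ₐ[k] B) (hf : IsUnit (g f))
    (hs : ∀ y : B, ∃ (a : A) (n : ℕ), y * g f ^ n = g a)
    (hi : ∀ a : A, g a = 0 → ∃ n : ℕ, f ^ n * a = 0) :
    μ.cl (Localization.Away f) = μ.cl B := by
  let := g.toRingHom.toAlgebra
  have hg : ∀ a, algebraMap A B a = g a := fun a => rfl
  have : IsScalarTower k A B := IsScalarTower.of_algebraMap_eq fun x => by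
    rw [hg]; simp
  have : IsLocalization.Away f B := by
    refine ⟨?_, ?_, ?_⟩
    · rintro ⟨y, n, rfl⟩
      simpa [hg] using hf.pow n
    · intro y
      obtain ⟨a, n, h⟩ := hs y
      exact ⟨⟨a, ⟨f ^ n, n, rfl⟩⟩, by simpa [hg] using h⟩
    · intro a b hab
      rw [hg, hg, ← sub_eq_zero, ← map_sub] at hab
      obtain ⟨n, hn⟩ := hi _ hab
      exact ⟨⟨f ^ n, n, rfl⟩, by simpa [mul_sub, sub_eq_zero] using hn⟩
  have : Algebra.FiniteType A (Localization.Away f) :=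
    IsLocalization.finiteType_of_monoid_fg (Submonoid.powers f) _
  have : Algebra.FiniteType k (Localization.Away f) :=
    Algebra.FiniteType.trans (S := A) inferInstance inferInstance
  exact μ.iso inferInstance
    ((IsLocalization.algEquiv (Submonoid.powers f) (Localization.Away f) B).restrictScalars k)

theorem c_sup_span [Algebra.FiniteType k A] (I : Ideal A) (f : A) {B : Type u} [CommRing B]
    [Algebra k B] (g : A →ₐ[k] B) (hf : IsUnit (g f))
    (hs : ∀ y : B, ∃ (a : A) (n : ℕ), y * g f ^ n = g a)
    (hI : ∀ a ∈ I, g a = 0)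
    (hi : ∀ a : A, g a = 0 → ∃ n : ℕ, f ^ n * a ∈ I) :
    μ.c I = μ.cl B + μ.c (I ⊔ Ideal.span {f}) := by
  have h1 := μ.scissor (A := A ⧸ I) inferInstance (Ideal.Quotient.mk I f)
  rw [μ.cl_localization_eq (Ideal.Quotient.mk I f) (Ideal.Quotient.liftₐ I g hI) (by simpa)] at h1
  · refine h1.trans (congrArg _ ?_)
    have e : Ideal.span {Ideal.Quotient.mk I f} = (Ideal.span {f}).map (Ideal.Quotient.mkₐ k I) := by
      rw [Ideal.map_span]; simp
    rw [e]
    exact μ.iso inferInstance (DoubleQuot.quotQuotEquivQuotSupₐ k I (Ideal.span {f}))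
  · intro y
    obtain ⟨a, n, h⟩ := hs y
    exact ⟨Ideal.Quotient.mk I a, n, h⟩
  · intro a
    obtain ⟨a, rfl⟩ := Ideal.Quotient.mk_surjective a
    intro h
    obtain ⟨n, hn⟩ := hi a h
    exact ⟨n, by rw [← map_pow, ← map_mul]; exact Ideal.Quotient.eq_zero_iff_mem.2 hn⟩

theorem c_top [Algebra.FiniteType k A] : μ.c (⊤ : Ideal A) = 0 := by
  have : Subsingleton (A ⧸ (⊤ : Ideal A)) := Ideal.Quotient.subsingleton_iff.2 rfl
  exact μ.cl_of_subsingleton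

theorem c_modular [Algebra.FiniteType k A] (I : Ideal A) (a b : A) (hab : a * b ∈ I) :
    μ.c I + μ.c (I ⊔ Ideal.span {a} ⊔ Ideal.span {b}) =
      μ.c (I ⊔ Ideal.span {a}) + μ.c (I ⊔ Ideal.span {b}) := by
  let B := Localization.Away (Ideal.Quotient.mk I a)
  let g : A →ₐ[k] B := (IsScalarTower.toAlgHom k (A ⧸ I) B).comp (Ideal.Quotient.mkₐ k I)
  have hu : IsUnit (g a) := IsLocalization.Away.algebraMap_isUnit (Ideal.Quotient.mk I a)
  have hs : ∀ y : B, ∃ (x : A) (n : ℕ), y * g a ^ n = g x := by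
    intro y
    obtain ⟨⟨x, ⟨_, n, rfl⟩⟩, h⟩ :=
      IsLocalization.surj (Submonoid.powers (Ideal.Quotient.mk I a)) y
    obtain ⟨x, rfl⟩ := Ideal.Quotient.mk_surjective x
    exact ⟨x, n, by simpa [g] using h⟩
  have hi : ∀ x : A, g x = 0 → ∃ n : ℕ, a ^ n * x ∈ I := by
    intro x hx
    obtain ⟨⟨_, n, rfl⟩, h⟩ := (IsLocalization.map_eq_zero_iff
      (Submonoid.powers (Ideal.Quotient.mk I a)) B (Ideal.Quotient.mk I x)).1 hx
    refine ⟨n, Ideal.Quotient.eq_zero_iff_mem.1 ?_⟩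
    simpa using h
  have hI : ∀ x ∈ I, g x = 0 := fun x hx => by
    have : Ideal.Quotient.mk I x = 0 := Ideal.Quotient.eq_zero_iff_mem.2 hx
    simp [g, this]
  have hb : g b = 0 := by
    have : g a * g b = 0 := by rw [← map_mul]; exact hI _ hab
    exact (hu.mul_right_eq_zero).1 this
  have h1 := μ.c_sup_span I a g hu hs hI hi
  have h2 := μ.c_sup_span (I ⊔ Ideal.span {b}) a g hu hs (by
    have : I ⊔ Ideal.span {b} ≤ RingHom.ker g :=
      sup_le (fun x hx => hI x hx) ((Ideal.span_singleton_le_iff_mem _).2 hb)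
    exact fun x hx => this hx)
    (fun x hx => (hi x hx).imp fun n hn => Ideal.mem_sup_left hn)
  rw [h1, h2, sup_right_comm]
  ring

theorem c_sum_eq_zero [IsAlgClosed k] [Algebra.FiniteType k A] {ι : Type u} (s : Finset ι)
    (n : ι → ℤ) (W : Ideal A) : ∀ I : ι → Ideal A, (∀ i ∈ s, W ≤ I i) →
    (∀ θ : A →ₐ[k] k, ∑ i ∈ s, n i * zind (I i) θ = 0) → ∑ i ∈ s, n i • μ.c (I i) = 0 := by
  classical
  have : IsNoetherianRing A := Algebra.FiniteType.isNoetherianRing k A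
  induction W using IsNoetherian.induction (R := A) (M := A) with
  | _ W ih =>
  intro I hW h0
  by_cases hWt : W = ⊤
  · refine Finset.sum_eq_zero fun i hi => ?_
    have : I i = ⊤ := top_le_iff.1 (hWt ▸ hW i hi)
    rw [this, c_top, smul_zero]
  by_cases hp : Ideal.IsPrime W
  · -- the coefficient of `W` vanishes, the others contain a common element outside `W`
    let t := s.filter fun i => I i ≠ W
    have hex : ∀ i ∈ t, ∃ h ∈ I i, h ∉ W := by
      intro i hi
      obtain ⟨his, hne⟩ := Finset.mem_filter.1 hi
      exact Set.not_subset.1 fun hle => hne (le_antisymm hle (hW i his))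
    choose! h hmem hnot using hex
    have hprod : ∏ i ∈ t, h i ∉ W := fun hc => by
      obtain ⟨i, hi, hc⟩ := (Ideal.IsPrime.prod_mem_iff (p := W)).1 hc
      exact hnot i hi hc
    have hpI : ∀ i ∈ t, ∏ j ∈ t, h j ∈ I i := fun i hi =>
      Ideal.mem_of_dvd _ (Finset.dvd_prod_of_mem h hi) (hmem i hi)
    obtain ⟨θ, hθ, hθ'⟩ := exists_point_prime (k := k) W hprod
    have hsplit : ∀ {M : Type u} [AddCommGroup M] (F : ι → M),
        ∑ i ∈ s, F i = ∑ i ∈ t, F i + ∑ i ∈ s.filter (fun i => ¬ I i ≠ W), F i := fun F =>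
      (Finset.sum_filter_add_sum_filter_not s _ F).symm
    have hsplitZ : ∀ (F : ι → ℤ),
        ∑ i ∈ s, F i = ∑ i ∈ t, F i + ∑ i ∈ s.filter (fun i => ¬ I i ≠ W), F i := fun F =>
      (Finset.sum_filter_add_sum_filter_not s _ F).symm
    have hco : ∑ i ∈ s.filter (fun i => ¬ I i ≠ W), n i = 0 := by
      have := h0 θ
      rw [hsplitZ, Finset.sum_eq_zero (s := t), zero_add] at this
      · rw [← this]
        refine Finset.sum_congr rfl fun i hi => ?_
        have hiW : I i = W := by simpa using (Finset.mem_filter.1 hi).2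
        rw [hiW, zind_eq_one hθ, mul_one]
      · intro i hi
        rw [zind_eq_zero (hpI i hi) hθ', mul_zero]
    have hW' : ∀ i ∈ s.filter (fun i => ¬ I i ≠ W), I i = W := fun i hi => by
      simpa using (Finset.mem_filter.1 hi).2
    have key := ih (W ⊔ Ideal.span {∏ i ∈ t, h i}) (lt_of_le_of_ne le_sup_left fun e => hprod
      (e ▸ Ideal.mem_sup_right (Ideal.mem_span_singleton_self _)))
      (fun i => I i ⊔ Ideal.span {∏ i ∈ t, h i})
      (fun i hi => sup_le_sup_right (hW i hi) _) (fun θ => by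
        simp_rw [zind_sup, ← mul_assoc, ← Finset.sum_mul, h0 θ, zero_mul])
    rw [hsplit] at key ⊢
    have e1 : ∀ F : Ideal A → Q, ∑ i ∈ s.filter (fun i => ¬ I i ≠ W), n i • F (I i) = 0 := by
      intro F
      rw [Finset.sum_congr rfl fun i hi => by rw [hW' i hi], ← Finset.sum_smul, hco, zero_smul]
    rw [e1 (fun J => μ.c (J ⊔ Ideal.span {∏ i ∈ t, h i})), add_zero] at key
    rw [e1 μ.c, add_zero, ← key]
    refine Finset.sum_congr rfl fun i hi => ?_
    rw [sup_eq_left.2 ((Ideal.span_singleton_le_iff_mem _).2 (hpI i hi))]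
  · obtain ⟨a, b, hab, ha, hb⟩ : ∃ a b, a * b ∈ W ∧ a ∉ W ∧ b ∉ W := by
      by_contra! hc
      exact hp ⟨hWt, fun {x y} hxy => or_iff_not_imp_left.2 (hc x y hxy)⟩
    have key : ∀ J : Ideal A, W < W ⊔ J → ∑ i ∈ s, n i • μ.c (I i ⊔ J) = 0 := fun J hJ =>
      ih (W ⊔ J) hJ (fun i => I i ⊔ J) (fun i hi => sup_le_sup_right (hW i hi) _) (fun θ => by
        simp_rw [zind_sup, ← mul_assoc, ← Finset.sum_mul, h0 θ, zero_mul])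
    have lt_of : ∀ (J : Ideal A) (x : A), x ∈ J → x ∉ W → W < W ⊔ J := fun J x hx hxW =>
      lt_of_le_of_ne le_sup_left fun e => hxW (e ▸ Ideal.mem_sup_right hx)
    have ka := key (Ideal.span {a}) (lt_of _ a (Ideal.mem_span_singleton_self _) ha)
    have kb := key (Ideal.span {b}) (lt_of _ b (Ideal.mem_span_singleton_self _) hb)
    have kab := key (Ideal.span {a} ⊔ Ideal.span {b})
      (lt_of _ a (Ideal.mem_sup_left (Ideal.mem_span_singleton_self _)) ha)
    have : ∑ i ∈ s, n i • μ.c (I i) + ∑ i ∈ s, n i • μ.c (I i ⊔ (Ideal.span {a} ⊔ Ideal.span {b}))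
        = ∑ i ∈ s, n i • μ.c (I i ⊔ Ideal.span {a}) + ∑ i ∈ s, n i • μ.c (I i ⊔ Ideal.span {b}) := by
      rw [← Finset.sum_add_distrib, ← Finset.sum_add_distrib]
      refine Finset.sum_congr rfl fun i hi => ?_
      rw [← smul_add, ← smul_add, ← sup_assoc, μ.c_modular (I i) a b (hW i hi hab)]
    rw [ka, kb, kab] at this
    simpa using this

end AlgMeasure

section Con

variable {k : Type u} [Field k] {A B : Type u} [CommRing A] [Algebra k A] [CommRing B] [Algebra k B]

/-- Integral combinations of indicator functions of zero loci. -/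
def lin (x : Ideal A →₀ ℤ) : (A →ₐ[k] k) → ℤ := fun θ => x.sum fun I n => n * zind I θ

/-- Constructible functions on the points of an algebra. -/
def IsCon (φ : (A →ₐ[k] k) → ℤ) : Prop := ∃ x : Ideal A →₀ ℤ, lin x = φ

theorem lin_add (x y : Ideal A →₀ ℤ) : lin (k := k) (x + y) = lin x + lin y := by
  funext θ
  exact Finsupp.sum_add_index' (by simp) (by intros; ring)

theorem lin_neg (x : Ideal A →₀ ℤ) : lin (k := k) (-x) = - lin x := by
  have := lin_add (k := k) x (-x)
  rw [add_neg_cancel] at this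
  have h0 : lin (k := k) (0 : Ideal A →₀ ℤ) = 0 := by funext θ; simp [lin]
  rw [h0] at this
  exact (neg_eq_of_add_eq_zero_right this.symm).symm

theorem lin_single (I : Ideal A) (n : ℤ) :
    lin (k := k) (Finsupp.single I n) = fun θ => n * zind I θ := by
  funext θ
  simp [lin]

theorem isCon_zind (I : Ideal A) : IsCon (k := k) (zind I) :=
  ⟨Finsupp.single I 1, by rw [lin_single]; simp⟩

theorem IsCon.add {φ ψ : (A →ₐ[k] k) → ℤ} (hφ : IsCon φ) (hψ : IsCon ψ) : IsCon (φ + ψ) := by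
  obtain ⟨x, rfl⟩ := hφ
  obtain ⟨y, rfl⟩ := hψ
  exact ⟨x + y, lin_add x y⟩

theorem IsCon.neg {φ : (A →ₐ[k] k) → ℤ} (hφ : IsCon φ) : IsCon (-φ) := by
  obtain ⟨x, rfl⟩ := hφ
  exact ⟨-x, lin_neg x⟩

theorem IsCon.sub {φ ψ : (A →ₐ[k] k) → ℤ} (hφ : IsCon φ) (hψ : IsCon ψ) : IsCon (φ - ψ) :=
  sub_eq_add_neg φ ψ ▸ hφ.add hψ.neg

theorem isCon_zero : IsCon (0 : (A →ₐ[k] k) → ℤ) := ⟨0, by funext θ; simp [lin]⟩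

/-- Induction principle for constructible functions. -/
theorem IsCon.induction {P : ((A →ₐ[k] k) → ℤ) → Prop} (h0 : P 0) (hz : ∀ I, P (zind I))
    (ha : ∀ φ ψ, P φ → P ψ → P (φ + ψ)) (hn : ∀ φ, P φ → P (-φ)) {φ : (A →ₐ[k] k) → ℤ}
    (h : IsCon φ) : P φ := by
  obtain ⟨x, rfl⟩ := h
  have h0' : lin (k := k) (0 : Ideal A →₀ ℤ) = 0 := by funext θ; simp [lin]
  induction x using Finsupp.induction_linear with
  | zero => rwa [h0']
  | add x y hx hy => rw [lin_add]; exact ha _ _ hx hy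
  | single I n =>
    induction n using Int.induction_on with
    | zero => rw [Finsupp.single_zero, h0']; exact h0
    | succ n ih =>
      rw [Finsupp.single_add, lin_add]
      refine ha _ _ ih ?_
      rw [lin_single]; simpa using hz I
    | pred n ih =>
      rw [sub_eq_add_neg, Finsupp.single_add, lin_add]
      refine ha _ _ ih ?_
      rw [Finsupp.single_neg, lin_neg]
      refine hn _ ?_
      rw [lin_single]; simpa using hz I

theorem IsCon.mul {φ ψ : (A →ₐ[k] k) → ℤ} (hφ : IsCon φ) (hψ : IsCon ψ) : IsCon (φ * ψ) := by
  refine IsCon.induction (P := fun φ => IsCon (φ * ψ)) (by simpa using isCon_zero) (fun I => ?_)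
    (fun a b ha hb => by rw [add_mul]; exact ha.add hb)
    (fun a ha => by rw [neg_mul]; exact ha.neg) hφ
  refine IsCon.induction (P := fun ψ => IsCon (zind I * ψ)) (by simpa using isCon_zero)
    (fun J => ?_) (fun a b ha hb => by rw [mul_add]; exact ha.add hb)
    (fun a ha => by rw [mul_neg]; exact ha.neg) hψ
  have : zind (k := k) I * zind J = zind (I ⊔ J) := by
    funext θ; exact (zind_sup I J θ).symm
  rw [this]
  exact isCon_zind _

theorem zind_bot : zind (k := k) (⊥ : Ideal A) = 1 := by
  funext θ
  exact zind_eq_one fun x hx => by rw [(Submodule.mem_bot A).1 hx, map_zero]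

theorem isCon_one : IsCon (1 : (A →ₐ[k] k) → ℤ) := zind_bot (k := k) (A := A) ▸ isCon_zind _

theorem IsCon.comp {φ : (A →ₐ[k] k) → ℤ} (hφ : IsCon φ) (g : A →ₐ[k] B) :
    IsCon fun η : B →ₐ[k] k => φ (η.comp g) := by
  refine IsCon.induction (P := fun φ => IsCon fun η : B →ₐ[k] k => φ (η.comp g)) isCon_zero
    (fun I => ?_) (fun _ _ ha hb => ha.add hb) (fun _ ha => ha.neg) hφ
  have : (fun η : B →ₐ[k] k => zind I (η.comp g)) = zind (I.map g) := by
    funext η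
    by_cases h : ∀ x ∈ I, η (g x) = 0
    · rw [zind_eq_one (by simpa using h), zind_eq_one]
      have : I.map g ≤ RingHom.ker η := Ideal.map_le_iff_le_comap.2 fun x hx => h x hx
      exact fun x hx => this hx
    · push Not at h
      obtain ⟨x, hx, hn⟩ := h
      rw [zind_eq_zero hx (by simpa using hn), zind_eq_zero (Ideal.mem_map_of_mem g hx) hn]
  rw [this]
  exact isCon_zind _

/-- A constructible function is constant on a nonempty open subset of an irreducible closed set. -/
theorem IsCon.exists_const {φ : (A →ₐ[k] k) → ℤ} (hφ : IsCon φ) (P : Ideal A) [P.IsPrime] :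
    ∃ h : A, h ∉ P ∧ ∃ c : ℤ, ∀ θ : A →ₐ[k] k, (∀ x ∈ P, θ x = 0) → θ h ≠ 0 → φ θ = c := by
  refine IsCon.induction (P := fun φ => ∃ h : A, h ∉ P ∧ ∃ c : ℤ, ∀ θ : A →ₐ[k] k,
    (∀ x ∈ P, θ x = 0) → θ h ≠ 0 → φ θ = c) ?_ (fun I => ?_) ?_ ?_ hφ
  · exact ⟨1, (Ideal.ne_top_iff_one P).1 (Ideal.IsPrime.ne_top'), 0, fun _ _ _ => rfl⟩
  · by_cases hI : I ≤ P
    · exact ⟨1, (Ideal.ne_top_iff_one P).1 (Ideal.IsPrime.ne_top'), 1,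
        fun θ h _ => zind_eq_one fun x hx => h x (hI hx)⟩
    · obtain ⟨x, hx, hxP⟩ := Set.not_subset.1 hI
      exact ⟨x, hxP, 0, fun θ _ h => zind_eq_zero hx h⟩
  · rintro φ ψ ⟨h, hP, c, hc⟩ ⟨h', hP', c', hc'⟩
    refine ⟨h * h', fun H => (Ideal.IsPrime.mem_or_mem ‹P.IsPrime› H).elim hP hP', c + c',
      fun θ hθ hn => ?_⟩
    rw [map_mul] at hn
    exact congrArg₂ (· + ·) (hc θ hθ (left_ne_zero_of_mul hn)) (hc' θ hθ (right_ne_zero_of_mul hn))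
  · rintro φ ⟨h, hP, c, hc⟩
    exact ⟨h, hP, -c, fun θ hθ hn => congrArg Neg.neg (hc θ hθ hn)⟩

/-- Indicator function of a set of points. -/
def ind (S : Set (A →ₐ[k] k)) : (A →ₐ[k] k) → ℤ := S.indicator 1

/-- Constructible sets of points. -/
def ConSet (S : Set (A →ₐ[k] k)) : Prop := IsCon (ind S)

theorem ind_inter (S T : Set (A →ₐ[k] k)) : ind (S ∩ T) = ind S * ind T := by
  rw [ind, Set.inter_indicator_one]; rfl

theorem ind_compl (S : Set (A →ₐ[k] k)) : ind Sᶜ = 1 - ind S := Set.indicator_compl _ _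

theorem ConSet.inter {S T : Set (A →ₐ[k] k)} (hS : ConSet S) (hT : ConSet T) : ConSet (S ∩ T) := by
  rw [ConSet, ind_inter]; exact IsCon.mul hS hT

theorem ConSet.compl {S : Set (A →ₐ[k] k)} (hS : ConSet S) : ConSet Sᶜ := by
  rw [ConSet, ind_compl]; exact isCon_one.sub hS

theorem ConSet.union {S T : Set (A →ₐ[k] k)} (hS : ConSet S) (hT : ConSet T) : ConSet (S ∪ T) := by
  rw [← compl_compl (S ∪ T), Set.compl_union]
  exact (hS.compl.inter hT.compl).compl

theorem ConSet.diff {S T : Set (A →ₐ[k] k)} (hS : ConSet S) (hT : ConSet T) : ConSet (S \ T) :=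
  hS.inter hT.compl

theorem conSet_zero (I : Ideal A) : ConSet {θ : A →ₐ[k] k | ∀ x ∈ I, θ x = 0} := by
  have : ind {θ : A →ₐ[k] k | ∀ x ∈ I, θ x = 0} = zind I := by
    classical
    funext θ
    simp only [ind, zind, Set.indicator, Set.mem_ofPred_eq, Pi.one_apply]
  rw [ConSet, this]
  exact isCon_zind _

theorem conSet_eq_zero (f : A) : ConSet {θ : A →ₐ[k] k | θ f = 0} := by
  convert conSet_zero (k := k) (Ideal.span {f}) using 1
  ext θ
  refine ⟨fun h => ?_, fun h => h f (Ideal.mem_span_singleton_self f)⟩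
  have : Ideal.span {f} ≤ RingHom.ker θ := (Ideal.span_singleton_le_iff_mem _).2 h
  exact fun x hx => this hx

theorem conSet_ne_zero (f : A) : ConSet {θ : A →ₐ[k] k | θ f ≠ 0} := (conSet_eq_zero f).compl

theorem conSet_univ : ConSet (Set.univ : Set (A →ₐ[k] k)) := by
  rw [ConSet, ind, Set.indicator_univ]; exact isCon_one

theorem conSet_empty : ConSet (∅ : Set (A →ₐ[k] k)) := by
  rw [ConSet, ind, Set.indicator_empty]; exact isCon_zero

theorem zind_ker (θ : A →ₐ[k] k) : zind (RingHom.ker θ) = ind {θ} := by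
  funext η
  by_cases h : η = θ
  · subst h
    rw [zind_eq_one fun x hx => hx, ind, Set.indicator_of_mem (Set.mem_singleton _)]; rfl
  · rw [ind, Set.indicator_of_notMem (by simpa using h)]
    obtain ⟨x, hx⟩ : ∃ x, η x ≠ θ x := by
      by_contra! H; exact h (AlgHom.ext H)
    refine zind_eq_zero (x := x - algebraMap k A (θ x)) (by simp [RingHom.mem_ker]) ?_
    simpa [sub_eq_zero] using hx

theorem conSet_singleton (θ : A →ₐ[k] k) : ConSet {θ} := by
  rw [ConSet, ← zind_ker]; exact isCon_zind _

theorem conSet_biUnion {ι : Type*} (s : Finset ι) (S : ι → Set (A →ₐ[k] k))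
    (h : ∀ i ∈ s, ConSet (S i)) : ConSet (⋃ i ∈ s, S i) := by
  classical
  induction s using Finset.induction_on with
  | empty => simpa using conSet_empty
  | insert a s ha ih =>
    rw [Finset.set_biUnion_insert]
    exact (h a (Finset.mem_insert_self a s)).union
      (ih fun i hi => h i (Finset.mem_insert_of_mem hi))

theorem ConSet.preimage {S : Set (A →ₐ[k] k)} (hS : ConSet S) (g : A →ₐ[k] B) :
    ConSet {η : B →ₐ[k] k | η.comp g ∈ S} := IsCon.comp hS g

theorem ind_union_disjoint {S T : Set (A →ₐ[k] k)} (h : Disjoint S T) :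
    ind (S ∪ T) = ind S + ind T := Set.indicator_union_of_disjoint h _

end Con

namespace AlgMeasure

variable {k : Type u} [Field k] {Q : Type u} [CommRing Q] (μ : AlgMeasure k Q)
  {A B : Type u} [CommRing A] [Algebra k A] [CommRing B] [Algebra k B]

/-- The linear extension of the class of closed subschemes. -/
def clin (x : Ideal A →₀ ℤ) : Q := x.sum fun I n => n • μ.c I

open Classical in
/-- The integral of a constructible function. -/
def nu (φ : (A →ₐ[k] k) → ℤ) : Q :=
  if h : IsCon φ then μ.clin h.choose else 0

theorem clin_add (x y : Ideal A →₀ ℤ) : μ.clin (x + y) = μ.clin x + μ.clin y :=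
  Finsupp.sum_add_index' (by simp) (by intros; rw [add_smul])

theorem clin_neg (x : Ideal A →₀ ℤ) : μ.clin (-x) = - μ.clin x := by
  have h := μ.clin_add x (-x)
  rw [add_neg_cancel] at h
  have h0 : μ.clin (0 : Ideal A →₀ ℤ) = 0 := by simp [clin]
  rw [h0] at h
  exact (neg_eq_of_add_eq_zero_right h.symm).symm

variable [IsAlgClosed k] [Algebra.FiniteType k A] [Algebra.FiniteType k B]

theorem nu_lin (x : Ideal A →₀ ℤ) : μ.nu (lin x) = μ.clin x := by
  have h : IsCon (k := k) (lin x) := ⟨x, rfl⟩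
  rw [nu, dif_pos h]
  have hx := h.choose_spec
  rw [← sub_eq_zero, sub_eq_add_neg, ← clin_neg, ← clin_add]
  refine μ.c_sum_eq_zero _ _ ⊥ (fun I => I) (fun _ _ => bot_le) fun θ => ?_
  have : lin (h.choose + -x) θ = 0 := by rw [lin_add, lin_neg, hx]; simp
  exact this

theorem nu_add {φ ψ : (A →ₐ[k] k) → ℤ} (hφ : IsCon φ) (hψ : IsCon ψ) :
    μ.nu (φ + ψ) = μ.nu φ + μ.nu ψ := by
  obtain ⟨x, rfl⟩ := hφ
  obtain ⟨y, rfl⟩ := hψ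
  rw [← lin_add, nu_lin, nu_lin, nu_lin, clin_add]

theorem nu_neg {φ : (A →ₐ[k] k) → ℤ} (hφ : IsCon φ) : μ.nu (-φ) = - μ.nu φ := by
  obtain ⟨x, rfl⟩ := hφ
  rw [← lin_neg, nu_lin, nu_lin, clin_neg]

theorem nu_sub {φ ψ : (A →ₐ[k] k) → ℤ} (hφ : IsCon φ) (hψ : IsCon ψ) :
    μ.nu (φ - ψ) = μ.nu φ - μ.nu ψ := by
  rw [sub_eq_add_neg, μ.nu_add hφ hψ.neg, μ.nu_neg hψ, ← sub_eq_add_neg]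

theorem nu_zero : μ.nu (0 : (A →ₐ[k] k) → ℤ) = 0 := by
  have := μ.nu_add (A := A) isCon_zero isCon_zero
  simpa using this

theorem nu_zind (I : Ideal A) : μ.nu (zind (k := k) I) = μ.c I := by
  have : zind (k := k) I = lin (Finsupp.single I 1) := by rw [lin_single]; simp
  rw [this, nu_lin]
  simp [clin]

theorem nu_one : μ.nu (1 : (A →ₐ[k] k) → ℤ) = μ.cl A := by
  rw [← zind_bot, nu_zind]
  exact μ.iso inferInstance (AlgEquiv.quotientBot k A)

theorem nu_singleton (θ : A →ₐ[k] k) : μ.nu (ind {θ}) = 1 := by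
  rw [← zind_ker, nu_zind, ← μ.point]
  refine μ.iso inferInstance (Ideal.quotientKerAlgEquivOfSurjective (f := θ) fun x =>
    ⟨algebraMap k A x, by simp⟩)

theorem nu_union {S T : Set (A →ₐ[k] k)} (hS : ConSet S) (hT : ConSet T) (h : Disjoint S T) :
    μ.nu (ind (S ∪ T)) = μ.nu (ind S) + μ.nu (ind T) := by
  rw [ind_union_disjoint h, μ.nu_add hS hT]

theorem nu_biUnion {ι : Type*} (s : Finset ι) (S : ι → Set (A →ₐ[k] k))
    (h : ∀ i ∈ s, ConSet (S i)) (hd : (s : Set ι).PairwiseDisjoint S) :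
    μ.nu (ind (⋃ i ∈ s, S i)) = ∑ i ∈ s, μ.nu (ind (S i)) := by
  classical
  induction s using Finset.induction_on with
  | empty =>
    have : ind (∅ : Set (A →ₐ[k] k)) = 0 := Set.indicator_empty _
    simp [this, nu_zero]
  | insert a s ha ih =>
    rw [Finset.set_biUnion_insert, Finset.sum_insert ha, μ.nu_union
      (h a (Finset.mem_insert_self a s))
      (conSet_biUnion s S fun i hi => h i (Finset.mem_insert_of_mem hi)),
      ih (fun i hi => h i (Finset.mem_insert_of_mem hi))
        (hd.subset (by simp))]
    rw [Set.disjoint_iUnion₂_right]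
    intro i hi
    exact hd (by simp) (by simp [hi]) (by rintro rfl; exact ha hi)

theorem nu_finset (s : Finset (A →ₐ[k] k)) : μ.nu (ind (s : Set (A →ₐ[k] k))) = s.card := by
  have := μ.nu_biUnion s (fun θ => {θ}) (fun θ _ => conSet_singleton θ)
    (fun a _ b _ hab => by simpa using hab)
  simp only [nu_singleton, Finset.sum_const, nsmul_eq_mul, mul_one] at this
  rw [← this]
  congr 2
  ext θ; simp

end AlgMeasure

section LocallyClosed

variable {k : Type u} [Field k] {A B : Type u} [CommRing A] [Algebra k A] [CommRing B] [Algebra k B]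

/-- `g : A → B` is a quotient of the localization of `A` at `b`. -/
structure IsLCI (g : A →ₐ[k] B) (b : A) : Prop where
  unit : IsUnit (g b)
  surj : ∀ y : B, ∃ (a : A) (n : ℕ), y * g b ^ n = g a

variable {g : A →ₐ[k] B} {b : A} (h : IsLCI g b)
include h

theorem IsLCI.exists_point {θ : A →ₐ[k] k} (hθ : ∀ a, g a = 0 → θ a = 0) (hb : θ b ≠ 0) :
    ∃ η : B →ₐ[k] k, η.comp g = θ := by
  choose a n ha using h.surj
  have wd : ∀ (y : B) (x : A) (m : ℕ), y * g b ^ m = g x → θ (a y) / θ b ^ n y = θ x / θ b ^ m := by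
    intro y x m hx
    rw [div_eq_div_iff (pow_ne_zero _ hb) (pow_ne_zero _ hb), ← sub_eq_zero, ← map_pow, ← map_pow,
      ← map_mul, ← map_mul, ← map_sub]
    refine hθ _ ?_
    rw [map_sub, map_mul, map_mul, ← ha, ← hx, map_pow, map_pow]
    ring
  have wa : ∀ x : A, θ (a (g x)) / θ b ^ n (g x) = θ x := fun x => by
    rw [wd (g x) x 0 (by simp)]; simp
  let η : B →ₐ[k] k :=
    { toFun := fun y => θ (a y) / θ b ^ n y
      map_one' := by rw [wd 1 1 0 (by simp)]; simp
      map_mul' := fun y z => by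
        rw [wd (y * z) (a y * a z) (n y + n z) (by rw [map_mul, ← ha, ← ha]; ring), map_mul, pow_add,
          div_mul_div_comm]
      map_zero' := by rw [wd 0 0 0 (by simp)]; simp
      map_add' := fun y z => by
        rw [wd (y + z) (a y * b ^ n z + a z * b ^ n y) (n y + n z) (by
          rw [map_add, map_mul, map_mul, ← ha, ← ha, map_pow, map_pow]; ring),
          div_add_div _ _ (pow_ne_zero _ hb) (pow_ne_zero _ hb), ← pow_add]
        simp [mul_comm]
      commutes' := fun r => by
        rw [wd _ (algebraMap k A r) 0 (by simp)]; simp }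
  exact ⟨η, AlgHom.ext wa⟩

theorem IsLCI.inj {η η' : B →ₐ[k] k} (he : η.comp g = η'.comp g) : η = η' := by
  ext y
  obtain ⟨a, n, ha⟩ := h.surj y
  have h1 := congrArg η ha
  have h2 := congrArg η' ha
  have e : ∀ x, η (g x) = η' (g x) := fun x => DFunLike.congr_fun he x
  rw [map_mul, map_pow] at h1 h2
  rw [e, e, ← h2] at h1
  exact mul_right_cancel₀ (pow_ne_zero _ (h.unit.map η').ne_zero) h1

theorem IsLCI.zind_comp (I : Ideal B) (η : B →ₐ[k] k) :
    (zind (I.comap g) - zind (I.comap g ⊔ Ideal.span {b}) : (A →ₐ[k] k) → ℤ) (η.comp g)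
      = zind I η := by
  have hb : (η.comp g) b ≠ 0 := (h.unit.map η).ne_zero
  rw [Pi.sub_apply, zind_eq_zero (Ideal.mem_sup_right (Ideal.mem_span_singleton_self b)) hb,
    sub_zero]
  by_cases hI : ∀ x ∈ I, η x = 0
  · rw [zind_eq_one (I := I) (θ := η) hI]
    exact zind_eq_one fun x hx => hI _ hx
  · push Not at hI
    obtain ⟨y, hy, hn⟩ := hI
    obtain ⟨a, n, ha⟩ := h.surj y
    rw [zind_eq_zero hy hn, zind_eq_zero (x := a)]
    · rw [Ideal.mem_comap, ← ha]; exact I.mul_mem_right _ hy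
    · change η (g a) ≠ 0
      rw [← ha, map_mul, map_pow]
      exact mul_ne_zero hn (pow_ne_zero _ hb)

theorem IsLCI.zind_notMem (I : Ideal B) (θ : A →ₐ[k] k) (hθ : ¬ ∃ η : B →ₐ[k] k, η.comp g = θ) :
    (zind (I.comap g) - zind (I.comap g ⊔ Ideal.span {b}) : (A →ₐ[k] k) → ℤ) θ = 0 := by
  rw [Pi.sub_apply, zind_sup]
  by_cases hI : ∀ x ∈ I.comap g, θ x = 0
  · have hb : θ b = 0 := by
      by_contra hb
      exact hθ (h.exists_point (fun a ha => hI a (by rw [Ideal.mem_comap, ha]; exact I.zero_mem)) hb)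
    rw [zind_eq_one (I := Ideal.span {b}), mul_one, sub_self]
    have : Ideal.span {b} ≤ RingHom.ker θ := (Ideal.span_singleton_le_iff_mem _).2 hb
    exact fun x hx => this hx
  · push Not at hI
    obtain ⟨x, hx, hn⟩ := hI
    rw [zind_eq_zero hx hn]; simp

/-- Integrals of constructible functions are preserved by extension by zero along a locally closed
immersion. -/
theorem IsLCI.nu_eq [IsAlgClosed k] [Algebra.FiniteType k A] [Algebra.FiniteType k B]
    {Q : Type u} [CommRing Q] (μ : AlgMeasure k Q)
    {φ : (A →ₐ[k] k) → ℤ} {ψ : (B →ₐ[k] k) → ℤ} (hψ : IsCon ψ)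
    (h1 : ∀ η : B →ₐ[k] k, φ (η.comp g) = ψ η)
    (h2 : ∀ θ : A →ₐ[k] k, (¬ ∃ η : B →ₐ[k] k, η.comp g = θ) → φ θ = 0) :
    IsCon φ ∧ μ.nu φ = μ.nu ψ := by
  have uniq : ∀ φ' : (A →ₐ[k] k) → ℤ, (∀ η : B →ₐ[k] k, φ' (η.comp g) = ψ η) →
      (∀ θ : A →ₐ[k] k, (¬ ∃ η : B →ₐ[k] k, η.comp g = θ) → φ' θ = 0) → φ = φ' := by
    intro φ' h1' h2'
    funext θ
    by_cases hθ : ∃ η : B →ₐ[k] k, η.comp g = θ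
    · obtain ⟨η, rfl⟩ := hθ
      rw [h1, h1']
    · rw [h2 θ hθ, h2' θ hθ]
  suffices H : ∃ φ' : (A →ₐ[k] k) → ℤ, (∀ η : B →ₐ[k] k, φ' (η.comp g) = ψ η) ∧
      (∀ θ : A →ₐ[k] k, (¬ ∃ η : B →ₐ[k] k, η.comp g = θ) → φ' θ = 0) ∧
      IsCon φ' ∧ μ.nu φ' = μ.nu ψ by
    obtain ⟨φ', h1', h2', h3, h4⟩ := H
    rw [uniq φ' h1' h2']
    exact ⟨h3, h4⟩
  clear uniq h1 h2
  suffices H : IsCon ψ ∧ ∃ φ' : (A →ₐ[k] k) → ℤ, (∀ η : B →ₐ[k] k, φ' (η.comp g) = ψ η) ∧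
      (∀ θ : A →ₐ[k] k, (¬ ∃ η : B →ₐ[k] k, η.comp g = θ) → φ' θ = 0) ∧
      IsCon φ' ∧ μ.nu φ' = μ.nu ψ from H.2
  refine IsCon.induction (P := fun ψ => IsCon ψ ∧ ∃ φ' : (A →ₐ[k] k) → ℤ,
      (∀ η : B →ₐ[k] k, φ' (η.comp g) = ψ η) ∧
      (∀ θ : A →ₐ[k] k, (¬ ∃ η : B →ₐ[k] k, η.comp g = θ) → φ' θ = 0) ∧
      IsCon φ' ∧ μ.nu φ' = μ.nu ψ) ?_ ?_ ?_ ?_ hψ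
  · exact ⟨isCon_zero, 0, fun _ => rfl, fun _ _ => rfl, isCon_zero, by rw [μ.nu_zero, μ.nu_zero]⟩
  · intro I
    refine ⟨isCon_zind I, _, h.zind_comp I, h.zind_notMem I, (isCon_zind _).sub (isCon_zind _), ?_⟩
    rw [μ.nu_sub (isCon_zind _) (isCon_zind _), μ.nu_zind, μ.nu_zind, μ.nu_zind, sub_eq_iff_eq_add]
    refine μ.c_sup_span (I.comap g) b ((Ideal.Quotient.mkₐ k I).comp g) (by
      simpa using h.unit.map (Ideal.Quotient.mk I)) ?_ ?_ ?_
    · intro y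
      obtain ⟨y, rfl⟩ := Ideal.Quotient.mk_surjective y
      obtain ⟨a, n, ha⟩ := h.surj y
      exact ⟨a, n, by simpa using congrArg (Ideal.Quotient.mk I) ha⟩
    · intro a ha
      exact Ideal.Quotient.eq_zero_iff_mem.2 ha
    · intro a ha
      exact ⟨0, by simpa using Ideal.Quotient.eq_zero_iff_mem.1 ha⟩
  · rintro φ ψ ⟨c1, φ', a1, a2, a3, a4⟩ ⟨c2, ψ', b1, b2, b3, b4⟩
    exact ⟨c1.add c2, φ' + ψ', fun η => congrArg₂ (· + ·) (a1 η) (b1 η),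
      fun θ hθ => by rw [Pi.add_apply, a2 θ hθ, b2 θ hθ, add_zero], a3.add b3, by
        rw [μ.nu_add a3 b3, μ.nu_add c1 c2, a4, b4]⟩
  · rintro φ ⟨c1, φ', a1, a2, a3, a4⟩
    exact ⟨c1.neg, -φ', fun η => congrArg Neg.neg (a1 η),
      fun θ hθ => by rw [Pi.neg_apply, a2 θ hθ, neg_zero], a3.neg, by
        rw [μ.nu_neg a3, μ.nu_neg c1, a4]⟩

end LocallyClosed

/-- A local subring of `K` containing `k`, together with its residue map to a field `L`. -/
@[ext]
structure LPt (k K L : Type u) [Field k] [Field K] [Algebra k K] [Field L] [Algebra k L] where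
  O : Subalgebra k K
  res : O →ₐ[k] L
  inv : ∀ x : O, res x ≠ 0 → (x : K)⁻¹ ∈ O

namespace LPt

variable {k K L : Type u} [Field k] [Field K] [Algebra k K] [Field L] [Algebra k L]

/-- `x` is regular at `P` with value `c`. -/
def At (P : LPt k K L) (x : K) (c : L) : Prop := ∃ h : x ∈ P.O, P.res ⟨x, h⟩ = c

variable {P P' : LPt k K L} {x y : K} {c d : L}

theorem At.mem (h : P.At x c) : x ∈ P.O := h.1

theorem at_of_mem (h : x ∈ P.O) : P.At x (P.res ⟨x, h⟩) := ⟨h, rfl⟩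

theorem exists_at (h : x ∈ P.O) : ∃ c, P.At x c := ⟨_, at_of_mem h⟩

theorem at_coe (x : P.O) : P.At x (P.res x) := ⟨x.2, rfl⟩

theorem At.unique (h : P.At x c) (h' : P.At x d) : c = d := by
  obtain ⟨_, rfl⟩ := h
  obtain ⟨_, rfl⟩ := h'
  rfl

theorem At.add (h : P.At x c) (h' : P.At y d) : P.At (x + y) (c + d) := by
  obtain ⟨h, rfl⟩ := h
  obtain ⟨h', rfl⟩ := h'
  exact ⟨P.O.add_mem h h', by rw [← map_add]; rfl⟩

theorem At.mul (h : P.At x c) (h' : P.At y d) : P.At (x * y) (c * d) := by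
  obtain ⟨h, rfl⟩ := h
  obtain ⟨h', rfl⟩ := h'
  exact ⟨P.O.mul_mem h h', by rw [← map_mul]; rfl⟩

theorem At.neg (h : P.At x c) : P.At (-x) (-c) := by
  obtain ⟨h, rfl⟩ := h
  exact ⟨P.O.neg_mem h, by rw [← map_neg]; rfl⟩

theorem At.sub (h : P.At x c) (h' : P.At y d) : P.At (x - y) (c - d) := by
  rw [sub_eq_add_neg, sub_eq_add_neg]; exact h.add h'.neg

theorem at_algebraMap (r : k) : P.At (algebraMap k K r) (algebraMap k L r) :=
  ⟨P.O.algebraMap_mem r, P.res.commutes r⟩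

theorem at_one : P.At 1 1 := ⟨P.O.one_mem, map_one P.res⟩

theorem at_zero : P.At 0 0 := ⟨P.O.zero_mem, map_zero P.res⟩

theorem At.pow (h : P.At x c) (n : ℕ) : P.At (x ^ n) (c ^ n) := by
  induction n with
  | zero => simpa using at_one
  | succ n ih => rw [pow_succ, pow_succ]; exact ih.mul h

theorem At.ne_zero (h : P.At x c) (hc : c ≠ 0) : x ≠ 0 := by
  rintro rfl
  exact hc (h.unique at_zero)

theorem At.inv (h : P.At x c) (hc : c ≠ 0) : P.At x⁻¹ c⁻¹ := by
  obtain ⟨d, hd⟩ := exists_at (P.inv ⟨x, h.1⟩ (by obtain ⟨_, rfl⟩ := h; exact hc))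
  have h1 := h.mul hd
  rw [mul_inv_cancel₀ (h.ne_zero hc)] at h1
  rwa [inv_eq_of_mul_eq_one_right (h1.unique at_one)]

theorem At.div (h : P.At x c) (h' : P.At y d) (hd : d ≠ 0) : P.At (x / y) (c / d) := by
  rw [div_eq_mul_inv, div_eq_mul_inv]; exact h.mul (h'.inv hd)

instance : PartialOrder (LPt k K L) where
  le P P' := ∀ x c, P.At x c → P'.At x c
  le_refl P x c h := h
  le_trans P₁ P₂ P₃ h h' x c hx := h' x c (h x c hx)
  le_antisymm P₁ P₂ h h' := by
    have hO : P₁.O = P₂.O := by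
      ext x
      exact ⟨fun hx => (h x _ (at_of_mem hx)).1, fun hx => (h' x _ (at_of_mem hx)).1⟩
    obtain ⟨O, r, i⟩ := P₁
    obtain ⟨O', r', i'⟩ := P₂
    obtain rfl : O = O' := hO
    have : r = r' := by
      ext x
      obtain ⟨_, hx⟩ := h x (r x) ⟨x.2, rfl⟩
      exact hx.symm
    subst this
    rfl

theorem At.mono (h : P.At x c) (hP : P ≤ P') : P'.At x c := hP x c h

theorem mem_mono (hP : P ≤ P') (h : x ∈ P.O) : x ∈ P'.O := (hP x _ (at_of_mem h)).1

/-- A place: a local subring which is a valuation ring. -/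
def IsPlace (P : LPt k K L) : Prop := ∀ x : K, x ∈ P.O ∨ x⁻¹ ∈ P.O

/-- A local subring from a compatible relation. -/
def ofRel (r : K → L → Prop) (h_unique : ∀ x c d, r x c → r x d → c = d)
    (h_add : ∀ x y c d, r x c → r y d → r (x + y) (c + d))
    (h_mul : ∀ x y c d, r x c → r y d → r (x * y) (c * d))
    (h_alg : ∀ t : k, r (algebraMap k K t) (algebraMap k L t))
    (h_inv : ∀ x c, r x c → c ≠ 0 → r x⁻¹ c⁻¹) : LPt k K L where
  O :=
    { carrier := {x | ∃ c, r x c}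
      mul_mem' := by rintro x y ⟨c, hc⟩ ⟨d, hd⟩; exact ⟨_, h_mul _ _ _ _ hc hd⟩
      add_mem' := by rintro x y ⟨c, hc⟩ ⟨d, hd⟩; exact ⟨_, h_add _ _ _ _ hc hd⟩
      algebraMap_mem' := fun t => ⟨_, h_alg t⟩ }
  res :=
    { toFun := fun x => x.2.choose
      map_one' := h_unique 1 _ _ (Exists.choose_spec _) (by simpa using h_alg 1)
      map_zero' := h_unique 0 _ _ (Exists.choose_spec _) (by simpa using h_alg 0)
      map_mul' := fun x y => h_unique _ _ _ (Exists.choose_spec _)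
        (h_mul _ _ _ _ (Exists.choose_spec _) (Exists.choose_spec _))
      map_add' := fun x y => h_unique _ _ _ (Exists.choose_spec _)
        (h_add _ _ _ _ (Exists.choose_spec _) (Exists.choose_spec _))
      commutes' := fun t => h_unique _ _ _ (Exists.choose_spec _) (h_alg t) }
  inv := fun x hx => ⟨_, h_inv _ _ x.2.choose_spec hx⟩

theorem at_ofRel {r : K → L → Prop} {h1 h2 h3} {h4 : ∀ t : k, r _ _} {h5} :
    (ofRel r h1 h2 h3 h4 h5).At x c ↔ r x c := by
  constructor
  · rintro ⟨h, rfl⟩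
    exact h.choose_spec
  · intro h
    exact ⟨⟨c, h⟩, h1 _ _ _ (Exists.choose_spec (p := fun c => r x c) _) h⟩

variable {R : Type u} [CommRing R] [Algebra k R]

/-- The local ring of a point `g` on the image of `f`. -/
def ofHoms (f : R →ₐ[k] K) (g : R →ₐ[k] L) (h : ∀ r, f r = 0 → g r = 0) : LPt k K L :=
  ofRel (fun x c => ∃ a b, g b ≠ 0 ∧ x * f b = f a ∧ c * g b = g a)
    (by
      rintro x c d ⟨a, b, hb, h1, h2⟩ ⟨a', b', hb', h1', h2'⟩
      have : g (a * b' - a' * b) = 0 := h _ (by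
        rw [map_sub, map_mul, map_mul, ← h1, ← h1']; ring)
      rw [map_sub, map_mul, map_mul, ← h2, ← h2'] at this
      have e : (c - d) * (g b * g b') = 0 := by rw [← this]; ring
      exact sub_eq_zero.1 ((mul_eq_zero.1 e).resolve_right (mul_ne_zero hb hb')))
    (by
      rintro x y c d ⟨a, b, hb, h1, h2⟩ ⟨a', b', hb', h1', h2'⟩
      refine ⟨a * b' + a' * b, b * b', by rw [map_mul]; exact mul_ne_zero hb hb', ?_, ?_⟩
      · simp only [map_add, map_mul, ← h1, ← h1']; ring
      · simp only [map_add, map_mul, ← h2, ← h2']; ring)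
    (by
      rintro x y c d ⟨a, b, hb, h1, h2⟩ ⟨a', b', hb', h1', h2'⟩
      refine ⟨a * a', b * b', by rw [map_mul]; exact mul_ne_zero hb hb', ?_, ?_⟩
      · simp only [map_mul, ← h1, ← h1']; ring
      · simp only [map_mul, ← h2, ← h2']; ring)
    (fun t => ⟨algebraMap k R t, 1, by simp, by simp, by simp⟩)
    (by
      rintro x c ⟨a, b, hb, h1, h2⟩ hc
      have ha : g a ≠ 0 := by rw [← h2]; exact mul_ne_zero hc hb
      have hx : x ≠ 0 := by
        rintro rfl
        exact ha (h a (by rw [← h1, zero_mul]))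
      exact ⟨b, a, ha, by rw [← h1]; field_simp, by rw [← h2]; field_simp⟩)

variable {f : R →ₐ[k] K} {g : R →ₐ[k] L} {h : ∀ r, f r = 0 → g r = 0}

theorem at_ofHoms : (ofHoms f g h).At x c ↔ ∃ a b, g b ≠ 0 ∧ x * f b = f a ∧ c * g b = g a :=
  at_ofRel

theorem at_ofHoms_self (r : R) : (ofHoms f g h).At (f r) (g r) :=
  at_ofHoms.2 ⟨r, 1, by simp, by simp, by simp⟩

theorem mem_ofHoms : x ∈ (ofHoms f g h).O ↔ ∃ a b, g b ≠ 0 ∧ x * f b = f a := by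
  constructor
  · intro hx
    obtain ⟨a, b, hb, h1, -⟩ := at_ofHoms.1 (at_of_mem hx)
    exact ⟨a, b, hb, h1⟩
  · rintro ⟨a, b, hb, h1⟩
    exact (at_ofHoms.2 ⟨a, b, hb, h1, div_mul_cancel₀ (g a) hb⟩ : (ofHoms f g h).At x _).1

theorem ofHoms_le_iff : ofHoms f g h ≤ P ↔ ∀ r, P.At (f r) (g r) := by
  refine ⟨fun H r => H _ _ (at_ofHoms_self r), fun H x c hx => ?_⟩
  obtain ⟨a, b, hb, h1, h2⟩ := at_ofHoms.1 hx
  have e : x = f a / f b := by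
    rw [eq_div_iff ((H b).ne_zero hb)]; exact h1
  have e' : c = g a / g b := by rw [eq_div_iff hb]; exact h2
  rw [e, e']
  exact (H a).div (H b) hb

/-- Evaluation of polynomials over a local subring at an element of `K`. -/
def evK (P : LPt k K L) (x : K) : Polynomial P.O →ₐ[k] K :=
  (Polynomial.aeval (R := P.O) x).restrictScalars k

/-- Reduction of polynomials over a local subring. -/
def red (P : LPt k K L) : Polynomial P.O →ₐ[k] Polynomial L :=
  Polynomial.mapAlgHom P.res

/-- Evaluation of the reduction of polynomials at an element of the residue field. -/
def evL (P : LPt k K L) (c : L) : Polynomial P.O →ₐ[k] L :=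
  ((Polynomial.aeval (R := L) c).restrictScalars k).comp P.red

theorem evL_apply (F : Polynomial P.O) : P.evL c F = (P.red F).eval c := by
  simp [evL, Polynomial.aeval_def, Polynomial.eval₂_eq_eval_map]

theorem red_coeff (F : Polynomial P.O) (n : ℕ) : (P.red F).coeff n = P.res (F.coeff n) := by
  simp [red]

@[simp] theorem evK_X : P.evK x Polynomial.X = x := by simp [evK]
@[simp] theorem evK_C (a : P.O) : P.evK x (Polynomial.C a) = a := by
  simp [evK, Subalgebra.algebraMap_def]
@[simp] theorem red_X : P.red Polynomial.X = Polynomial.X := by simp [red]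
@[simp] theorem red_C (a : P.O) : P.red (Polynomial.C a) = Polynomial.C (P.res a) := by simp [red]
@[simp] theorem evL_X : P.evL c Polynomial.X = c := by simp [evL_apply]
@[simp] theorem evL_C (a : P.O) : P.evL c (Polynomial.C a) = P.res a := by simp [evL_apply]

theorem evK_eq_sum (F : Polynomial P.O) : P.evK x F = F.sum fun i a => (a : K) * x ^ i := by
  simp [evK, Polynomial.aeval_def, Polynomial.eval₂_eq_sum, Subalgebra.algebraMap_def]

theorem evK_at (hP : P ≤ P') (hx : P'.At x c) (F : Polynomial P.O) :
    P'.At (P.evK x F) (P.evL c F) := by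
  induction F using Polynomial.induction_on' with
  | add p q hp hq => rw [map_add, map_add]; exact hp.add hq
  | monomial n a =>
    rw [← Polynomial.C_mul_X_pow_eq_monomial, map_mul, map_mul, map_pow, map_pow]
    simp only [evK_X, evK_C, evL_X, evL_C]
    exact ((at_coe a).mono hP).mul (hx.pow n)

section Existence

variable (M : LPt k K k)

theorem red_surjective : Function.Surjective M.red :=
  Polynomial.map_surjective _ fun c => ⟨algebraMap k M.O c, by simp⟩

theorem mem_of_max_of_ne_top [IsAlgClosed k] (hM : IsMax M) (x : K)
    (h1 : ∀ F, M.evK x F = 0 → M.red F ≠ 1) : x ∈ M.O := by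
  let J : Ideal (Polynomial k) := (RingHom.ker (M.evK x)).map M.red
  have hJ : J ≠ ⊤ := by
    rw [Ideal.ne_top_iff_one]
    intro h
    obtain ⟨F, hF, hF'⟩ := (Ideal.mem_map_iff_of_surjective M.red M.red_surjective).1 h
    exact h1 F hF hF'
  obtain ⟨N, hN, hJN⟩ := Ideal.exists_le_maximal J hJ
  have hNn : N.IsPrime := hN.isPrime
  obtain ⟨p, hp⟩ := (IsPrincipalIdealRing.principal N).principal
  have hpc : ∃ c : k, p.IsRoot c := by
    by_cases hd : p.degree = 0
    · exfalso
      rw [Polynomial.eq_C_of_degree_eq_zero hd] at hp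
      refine hN.ne_top ((Ideal.eq_top_iff_one N).2 ?_)
      have hc : p.coeff 0 ≠ 0 := by
        intro h0
        rw [Polynomial.eq_C_of_degree_eq_zero hd, h0] at hd
        simp at hd
      rw [hp]
      exact Ideal.mem_span_singleton.2 ⟨Polynomial.C (p.coeff 0)⁻¹, by
        rw [← Polynomial.C_mul, mul_inv_cancel₀ hc, Polynomial.C_1]⟩
    · exact IsAlgClosed.exists_root p hd
  obtain ⟨c, hc⟩ := hpc
  have hz : ∀ F, M.evK x F = 0 → M.evL c F = 0 := by
    intro F hF
    have : M.red F ∈ N := hJN (Ideal.mem_map_of_mem M.red hF)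
    rw [hp] at this
    obtain ⟨q, hq⟩ := Ideal.mem_span_singleton.1 this
    rw [evL_apply, hq, Polynomial.eval_mul, hc.eq_zero, zero_mul]
  have hle : M ≤ ofHoms (M.evK x) (M.evL c) hz := by
    rintro y d ⟨hy, rfl⟩
    have := at_ofHoms_self (h := hz) (Polynomial.C (⟨y, hy⟩ : M.O))
    simpa using this
  have hx : (ofHoms (M.evK x) (M.evL c) hz).At x c := by
    have := at_ofHoms_self (h := hz) (Polynomial.X : Polynomial M.O)
    simpa using this
  exact (hx.mono (hM hle)).1

theorem isPlace_of_isMax [IsAlgClosed k] (hM : IsMax M) : M.IsPlace := by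
  intro x
  by_contra! hx
  obtain ⟨hx, hxi⟩ := hx
  obtain ⟨F, hF, hF1⟩ : ∃ F, M.evK x F = 0 ∧ M.red F = 1 := by
    by_contra! h; exact hx (M.mem_of_max_of_ne_top hM x h)
  obtain ⟨G, hG, hG1⟩ : ∃ F, M.evK x⁻¹ F = 0 ∧ M.red F = 1 := by
    by_contra! h; exact hxi (M.mem_of_max_of_ne_top hM _ h)
  have hx0 : x ≠ 0 := by rintro rfl; exact hx M.O.zero_mem
  have hc0 : M.res (F.coeff 0) = 1 := by rw [← red_coeff, hF1]; simp
  have hne : F.coeff 0 ≠ 0 := by intro h; rw [h, map_zero] at hc0; exact zero_ne_one hc0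
  let w : M.O := ⟨((F.coeff 0 : M.O) : K)⁻¹, M.inv _ (by rw [hc0]; exact one_ne_zero)⟩
  have hw : w * F.coeff 0 = 1 := Subtype.ext (inv_mul_cancel₀ (fun h => hne (Subtype.ext h)))
  have hint : IsIntegral M.O x⁻¹ := by
    refine ⟨Polynomial.C w * F.reverse, Polynomial.monic_C_mul_of_mul_leadingCoeff_eq_one (by
      rw [Polynomial.reverse_leadingCoeff, Polynomial.trailingCoeff_eq_coeff_zero hne, hw]), ?_⟩
    have : Invertible x := invertibleOfNonzero hx0
    rw [Polynomial.eval₂_mul]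
    have := (Polynomial.eval₂_reverse_eq_zero_iff (algebraMap M.O K) x F).2 hF
    rw [invOf_eq_inv] at this
    rw [this, mul_zero]
  have hI : Algebra.IsIntegral M.O (Algebra.adjoin M.O {x⁻¹}) :=
    Algebra.IsIntegral.adjoin (by simpa using hint)
  have hmax : (RingHom.ker M.res).IsMaximal :=
    RingHom.ker_isMaximal_of_surjective M.res fun c => ⟨algebraMap k M.O c, by simp⟩
  obtain ⟨N, hN, hNc⟩ := Ideal.exists_ideal_over_maximal_of_isIntegral
    (S := Algebra.adjoin M.O {x⁻¹}) (RingHom.ker M.res) (by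
      rw [(RingHom.injective_iff_ker_eq_bot _).1]
      · exact bot_le
      · intro a b hab
        exact Subtype.ext (congrArg (fun z : Algebra.adjoin M.O {x⁻¹} => (z : K)) hab))
  let y : Algebra.adjoin M.O {x⁻¹} := ⟨x⁻¹, Algebra.subset_adjoin rfl⟩
  have hy : Polynomial.aeval y G = 0 := by
    apply Subtype.ext
    have : ((Polynomial.aeval y G : Algebra.adjoin M.O {x⁻¹}) : K)
        = Polynomial.aeval (x⁻¹) G := (Polynomial.aeval_algHom_apply
          (Algebra.adjoin M.O {x⁻¹}).val y G).symm
    rw [this]; exact hG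
  have key : Polynomial.aeval y G - 1 ∈ N := by
    have : Polynomial.aeval y (G - 1) ∈ N := by
      rw [Polynomial.aeval_eq_sum_range]
      refine N.sum_mem fun i _ => ?_
      rw [Algebra.smul_def]
      refine N.mul_mem_right _ ?_
      have : (G - 1).coeff i ∈ RingHom.ker M.res := by
        rw [RingHom.mem_ker, ← red_coeff, map_sub, hG1, map_one, sub_self, Polynomial.coeff_zero]
      rw [← hNc] at this
      exact this
    simpa using this
  rw [hy, zero_sub] at key
  exact hN.ne_top ((Ideal.eq_top_iff_one N).2 (by simpa using N.neg_mem key))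

theorem exists_place_ge [IsAlgClosed k] (P : LPt k K k) : ∃ V : LPt k K k, P ≤ V ∧ V.IsPlace := by
  obtain ⟨M, hM, hmax⟩ := zorn_le_nonempty_Ici₀ P (fun c _ hc y hy => by
    refine ⟨ofRel (fun x d => ∃ z ∈ c, z.At x d) ?_ ?_ ?_ ?_ ?_, ?_⟩
    · rintro x d d' ⟨z, hz, h⟩ ⟨z', hz', h'⟩
      rcases hc.total hz hz' with hle | hle
      · exact (h.mono hle).unique h'
      · exact h.unique (h'.mono hle)
    · rintro x x' d d' ⟨z, hz, h⟩ ⟨z', hz', h'⟩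
      rcases hc.total hz hz' with hle | hle
      · exact ⟨z', hz', (h.mono hle).add h'⟩
      · exact ⟨z, hz, h.add (h'.mono hle)⟩
    · rintro x x' d d' ⟨z, hz, h⟩ ⟨z', hz', h'⟩
      rcases hc.total hz hz' with hle | hle
      · exact ⟨z', hz', (h.mono hle).mul h'⟩
      · exact ⟨z, hz, h.mul (h'.mono hle)⟩
    · exact fun t => ⟨y, hy, at_algebraMap t⟩
    · rintro x d ⟨z, hz, h⟩ hd
      exact ⟨z, hz, h.inv hd⟩
    · exact fun z hz x d h => at_ofRel.2 ⟨z, hz, h⟩) P le_rfl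
  exact ⟨M, hM, M.isPlace_of_isMax hmax⟩

/-- A place regular at no point where `x` has a pole takes the value `0` at `x⁻¹`. -/
theorem IsPlace.at_inv_zero {V : LPt k K k} (hV : V.IsPlace) {x : K} (hx : x ∉ V.O) :
    V.At x⁻¹ 0 := by
  obtain ⟨c, hc⟩ := exists_at ((hV x).resolve_left hx)
  by_cases h0 : c = 0
  · exact h0 ▸ hc
  · exact absurd (by simpa using (hc.inv h0).1) hx

end Existence

end LPt

/-- A finitely generated algebra embedded in the field `K`. -/
structure Chart (k K : Type u) [Field k] [Field K] [Algebra k K] where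
  A : Type u
  [ring : CommRing A]
  [alg : Algebra k A]
  [ft : Algebra.FiniteType k A]
  e : A →ₐ[k] K
  inj : Function.Injective e

attribute [instance] Chart.ring Chart.alg Chart.ft

namespace Chart

variable {k K : Type u} [Field k] [Field K] [Algebra k K]

/-- The local ring of a point of a chart. -/
def pt (c : Chart k K) (θ : c.A →ₐ[k] k) : LPt k K k :=
  LPt.ofHoms c.e θ fun r h => by rw [c.inj (h.trans (map_zero c.e).symm), map_zero]

variable {c d : Chart k K}

theorem pt_at (θ : c.A →ₐ[k] k) (r : c.A) : (c.pt θ).At (c.e r) (θ r) := LPt.at_ofHoms_self r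

theorem pt_le_iff {θ : c.A →ₐ[k] k} {P : LPt k K k} : c.pt θ ≤ P ↔ ∀ r, P.At (c.e r) (θ r) :=
  LPt.ofHoms_le_iff

theorem pt_injective (c : Chart k K) : Function.Injective c.pt := by
  intro θ η h
  ext r
  exact (pt_at θ r).unique (h ▸ pt_at η r)

theorem mem_pt {θ : c.A →ₐ[k] k} {x : K} :
    x ∈ (c.pt θ).O ↔ ∃ a b, θ b ≠ 0 ∧ x * c.e b = c.e a := LPt.mem_ofHoms

theorem exists_denom {θ : c.A →ₐ[k] k} {P : LPt k K k} (hP : c.pt θ = P)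
    (hd : ∀ b, d.e b ∈ P.O) :
    ∃ f : c.A, θ f ≠ 0 ∧ ∀ b : d.A, ∃ (a : c.A) (n : ℕ), d.e b * c.e f ^ n = c.e a := by
  subst hP
  choose num den hden h using fun b => mem_pt.1 (hd b)
  obtain ⟨s, hs⟩ := (Algebra.FiniteType.out : (⊤ : Subalgebra k d.A).FG)
  refine ⟨∏ b ∈ s, den b, by rw [map_prod]; exact Finset.prod_ne_zero_iff.2 fun b _ => hden b, ?_⟩
  set f := ∏ b ∈ s, den b
  classical
  intro b
  have hb : b ∈ Algebra.adjoin k (s : Set d.A) := by rw [hs]; trivial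
  induction hb using Algebra.adjoin_induction with
  | mem x hx =>
    refine ⟨num x * ∏ b ∈ s.erase x, den b, 1, ?_⟩
    rw [map_mul, ← h x, pow_one, mul_assoc, ← map_mul, Finset.mul_prod_erase s den hx]
  | algebraMap r => exact ⟨algebraMap k c.A r, 0, by simp⟩
  | add x y _ _ hx hy =>
    obtain ⟨a, n, ha⟩ := hx
    obtain ⟨a', n', ha'⟩ := hy
    refine ⟨a * f ^ n' + a' * f ^ n, n + n', ?_⟩
    simp only [map_add, map_mul, map_pow, ← ha, ← ha']; ring
  | mul x y _ _ hx hy =>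
    obtain ⟨a, n, ha⟩ := hx
    obtain ⟨a', n', ha'⟩ := hy
    refine ⟨a * a', n + n', ?_⟩
    simp only [map_mul, ← ha, ← ha']; ring

/-- `D(f)` in the chart `c` is identified with some `D(g)` in the chart `d` through `b`. -/
structure Glue (c d b : Chart k K) (f : c.A) (g : d.A) where
  i : c.A →ₐ[k] b.A
  j : d.A →ₐ[k] b.A
  hi : ∀ a, b.e (i a) = c.e a
  hj : ∀ a, b.e (j a) = d.e a
  lci_i : IsLCI i f
  lci_j : IsLCI j g

theorem pt_comp {b : Chart k K} {i : c.A →ₐ[k] b.A} (hi : ∀ a, b.e (i a) = c.e a) {f : c.A}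
    (h : IsLCI i f) (ζ : b.A →ₐ[k] k) : c.pt (ζ.comp i) = b.pt ζ := by
  apply le_antisymm
  · rw [pt_le_iff]
    intro r
    rw [← hi]
    exact pt_at ζ (i r)
  · rw [pt_le_iff]
    intro y
    obtain ⟨a, n, ha⟩ := h.surj y
    have hu : IsUnit (ζ (i f)) := h.unit.map ζ
    refine LPt.at_ofHoms.2 ⟨a, f ^ n, ?_, ?_, ?_⟩
    · simpa using fun h0 => absurd h0 hu.ne_zero
    · rw [map_pow, ← hi, ← hi, ← ha]; simp
    · simp only [AlgHom.comp_apply, ← ha]; simp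

theorem exists_comp {b : Chart k K} {i : c.A →ₐ[k] b.A} (hi : ∀ a, b.e (i a) = c.e a) {f : c.A}
    (h : IsLCI i f) {θ : c.A →ₐ[k] k} (hf : θ f ≠ 0) : ∃ ζ : b.A →ₐ[k] k, ζ.comp i = θ := by
  refine h.exists_point (fun a ha => ?_) hf
  have : a = 0 := c.inj (by rw [← hi, ha, map_zero, map_zero])
  rw [this, map_zero]

theorem exists_glue {θ : c.A →ₐ[k] k} {η : d.A →ₐ[k] k} (h : c.pt θ = d.pt η) :
    ∃ (b : Chart k K) (f : c.A) (g : d.A), θ f ≠ 0 ∧ Nonempty (Glue c d b f g) := by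
  obtain ⟨f₁, hf₁, hf⟩ := exists_denom (d := d) h fun b => (pt_at η b).mem
  obtain ⟨g₁, hg₁, hg⟩ := exists_denom (d := c) h.symm fun b => (pt_at θ b).mem
  obtain ⟨a, n, ha⟩ := hf g₁
  obtain ⟨b, m, hb⟩ := hg f₁
  have hF : c.e f₁ ≠ 0 := (pt_at θ f₁).ne_zero hf₁
  have hG : d.e g₁ ≠ 0 := (pt_at η g₁).ne_zero hg₁
  set F := c.e f₁
  set G := d.e g₁
  have hθa : θ a ≠ 0 := by
    have h1 : (d.pt η).At (G * F ^ n) (η g₁ * θ f₁ ^ n) :=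
      (pt_at η g₁).mul ((h ▸ pt_at θ f₁).pow n)
    rw [ha] at h1
    rw [(pt_at θ a).unique (h ▸ h1)]
    exact mul_ne_zero hg₁ (pow_ne_zero _ hf₁)
  have hfe : c.e (f₁ * a) = F ^ (n + 1) * G := by rw [map_mul, ← ha]; ring
  have hge : d.e (g₁ * b) = G ^ (m + 1) * F := by rw [map_mul, ← hb]; ring
  let φ : Polynomial c.A →ₐ[k] K := Polynomial.eval₂AlgHom c.e (c.e (f₁ * a))⁻¹ fun _ =>
    mul_comm _ _
  have hφC : ∀ x, φ (Polynomial.C x) = c.e x := fun x => by simp [φ]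
  have hφX : φ Polynomial.X = (c.e (f₁ * a))⁻¹ := by simp [φ]
  have hf0 : c.e (f₁ * a) ≠ 0 := by rw [hfe]; positivity
  have hφ : ∀ p, ∃ x N, φ p * c.e (f₁ * a) ^ N = c.e x := by
    intro p
    induction p using Polynomial.induction_on' with
    | add p q hp hq =>
      obtain ⟨x, N, hx⟩ := hp
      obtain ⟨y, M, hy⟩ := hq
      refine ⟨x * (f₁ * a) ^ M + y * (f₁ * a) ^ N, N + M, ?_⟩
      rw [map_add, map_add, map_mul c.e x, map_mul c.e y, map_pow, map_pow, ← hx, ← hy]; ring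
    | monomial i x =>
      refine ⟨x, i, ?_⟩
      rw [← Polynomial.C_mul_X_pow_eq_monomial, map_mul, map_pow, hφC, hφX, mul_assoc, ← mul_pow,
        inv_mul_cancel₀ hf0, one_pow, mul_one]
  have hc : ∀ x, c.e x ∈ φ.range := fun x => ⟨Polynomial.C x, hφC x⟩
  have hfi : (c.e (f₁ * a))⁻¹ ∈ φ.range := ⟨Polynomial.X, hφX⟩
  have hGm : G * F ^ n ∈ φ.range := ha ▸ hc a
  have hFi : F⁻¹ ∈ φ.range := by
    have := φ.range.mul_mem hfi hGm
    rwa [show (c.e (f₁ * a))⁻¹ * (G * F ^ n) = F⁻¹ by rw [hfe]; field_simp; ring] at this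
  have hGi : G⁻¹ ∈ φ.range := by
    have := φ.range.mul_mem hfi (φ.range.pow_mem (hc f₁) (n + 1))
    rwa [show (c.e (f₁ * a))⁻¹ * (c.e f₁) ^ (n + 1) = G⁻¹ by rw [hfe]; field_simp; rfl] at this
  have hd : ∀ y, d.e y ∈ φ.range := by
    intro y
    obtain ⟨x, N, hx⟩ := hf y
    have := φ.range.mul_mem (hc x) (φ.range.pow_mem hFi N)
    rwa [← hx, mul_assoc, ← mul_pow, mul_inv_cancel₀ hF, one_pow, mul_one] at this
  have : Algebra.FiniteType k φ.range := Algebra.FiniteType.of_surjective φ.rangeRestrict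
    φ.rangeRestrict_surjective
  refine ⟨⟨φ.range, φ.range.val, Subtype.val_injective⟩, f₁ * a, g₁ * b,
    by rw [map_mul]; exact mul_ne_zero hf₁ hθa, ⟨⟨c.e.codRestrict φ.range hc,
    d.e.codRestrict φ.range hd, fun _ => rfl, fun _ => rfl, ⟨?_, ?_⟩, ⟨?_, ?_⟩⟩⟩⟩
  · exact IsUnit.of_mul_eq_one ⟨_, hfi⟩ (Subtype.ext (mul_inv_cancel₀ hf0))
  · rintro ⟨_, p, rfl⟩
    obtain ⟨x, N, hx⟩ := hφ p
    exact ⟨x, N, Subtype.ext hx⟩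
  · refine IsUnit.of_mul_eq_one ⟨G⁻¹ ^ (m + 1) * F⁻¹,
      φ.range.mul_mem (φ.range.pow_mem hGi _) hFi⟩ (Subtype.ext ?_)
    change d.e (g₁ * b) * (G⁻¹ ^ (m + 1) * F⁻¹) = 1
    rw [hge, mul_mul_mul_comm, ← mul_pow, mul_inv_cancel₀ hG, mul_inv_cancel₀ hF]; simp
  · rintro ⟨_, p, rfl⟩
    obtain ⟨x, N, hx⟩ := hφ p
    obtain ⟨y, m', hy⟩ := hg x
    refine ⟨y * b ^ m' * g₁ ^ (m * (N * (n + 1)) + N * n), N * (n + 1) + m', Subtype.ext ?_⟩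
    change φ p * d.e (g₁ * b) ^ (N * (n + 1) + m') = d.e _
    have e1 : d.e (y * b ^ m' * g₁ ^ (m * (N * (n + 1)) + N * n)) =
        φ p * (F ^ (n + 1) * G) ^ N * G ^ m' * (F * G ^ m) ^ m' * G ^ (m * (N * (n + 1)) + N * n) := by
      rw [map_mul, map_mul, ← hy, ← hx, map_pow, map_pow, ← hb, hfe]
    rw [e1, hge]; ring

/-- The points of `c` whose local ring is in a set. -/
def pre (c : Chart k K) (S : Set (LPt k K k)) : Set (c.A →ₐ[k] k) := {θ | c.pt θ ∈ S}

theorem pre_image (c : Chart k K) (C : Set (c.A →ₐ[k] k)) : c.pre (c.pt '' C) = C :=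
  Set.preimage_image_eq C c.pt_injective

variable [IsAlgClosed k] {Q : Type u} [CommRing Q] (μ : AlgMeasure k Q)

theorem Glue.exists_iff {b : Chart k K} {f : c.A} {g : d.A} (G : Glue c d b f g)
    {θ : c.A →ₐ[k] k} {η : d.A →ₐ[k] k} :
    (θ f ≠ 0 ∧ c.pt θ = d.pt η) ↔ ∃ ζ : b.A →ₐ[k] k, ζ.comp G.i = θ ∧ ζ.comp G.j = η := by
  constructor
  · rintro ⟨hf, h⟩
    obtain ⟨ζ, rfl⟩ := exists_comp G.hi G.lci_i hf
    refine ⟨ζ, rfl, d.pt_injective ?_⟩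
    rw [← h, pt_comp G.hi G.lci_i, pt_comp G.hj G.lci_j]
  · rintro ⟨ζ, rfl, rfl⟩
    exact ⟨(G.lci_i.unit.map ζ).ne_zero, by rw [pt_comp G.hi G.lci_i, pt_comp G.hj G.lci_j]⟩

theorem Glue.match {b : Chart k K} {f : c.A} {g : d.A} (G : Glue c d b f g)
    {D : Set (d.A →ₐ[k] k)} (hD : ConSet D) :
    ConSet {θ : c.A →ₐ[k] k | θ f ≠ 0 ∧ c.pt θ ∈ d.pt '' D} ∧
    ConSet {η | η ∈ D ∧ ∃ θ : c.A →ₐ[k] k, θ f ≠ 0 ∧ c.pt θ = d.pt η} ∧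
    μ.nu (ind {θ : c.A →ₐ[k] k | θ f ≠ 0 ∧ c.pt θ ∈ d.pt '' D}) =
      μ.nu (ind {η | η ∈ D ∧ ∃ θ : c.A →ₐ[k] k, θ f ≠ 0 ∧ c.pt θ = d.pt η}) := by
  have hT : ConSet {ζ : b.A →ₐ[k] k | ζ.comp G.j ∈ D} := hD.preimage G.j
  have e1 : ∀ θ : c.A →ₐ[k] k, (θ f ≠ 0 ∧ c.pt θ ∈ d.pt '' D) ↔
      ∃ ζ : b.A →ₐ[k] k, ζ.comp G.i = θ ∧ ζ.comp G.j ∈ D := by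
    intro θ
    constructor
    · rintro ⟨hf, η, hη, h⟩
      obtain ⟨ζ, h1, rfl⟩ := G.exists_iff.1 ⟨hf, h.symm⟩
      exact ⟨ζ, h1, hη⟩
    · rintro ⟨ζ, h1, h2⟩
      obtain ⟨hf, h⟩ := G.exists_iff.2 ⟨ζ, h1, rfl⟩
      exact ⟨hf, _, h2, h.symm⟩
  have e2 : ∀ η : d.A →ₐ[k] k, (η ∈ D ∧ ∃ θ : c.A →ₐ[k] k, θ f ≠ 0 ∧ c.pt θ = d.pt η) ↔
      ∃ ζ : b.A →ₐ[k] k, ζ.comp G.j = η ∧ ζ.comp G.j ∈ D := by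
    intro η
    constructor
    · rintro ⟨hη, θ, h⟩
      obtain ⟨ζ, -, rfl⟩ := G.exists_iff.1 h
      exact ⟨ζ, rfl, hη⟩
    · rintro ⟨ζ, rfl, h2⟩
      exact ⟨h2, _, G.exists_iff.2 ⟨ζ, rfl, rfl⟩⟩
  have key : ∀ {a : Chart k K} {i : a.A →ₐ[k] b.A} {f : a.A}, IsLCI i f →
      IsCon (ind {θ : a.A →ₐ[k] k | ∃ ζ : b.A →ₐ[k] k, ζ.comp i = θ ∧ ζ.comp G.j ∈ D}) ∧
      μ.nu (ind {θ : a.A →ₐ[k] k | ∃ ζ : b.A →ₐ[k] k, ζ.comp i = θ ∧ ζ.comp G.j ∈ D}) =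
        μ.nu (ind {ζ : b.A →ₐ[k] k | ζ.comp G.j ∈ D}) := by
    intro a i f hi
    refine hi.nu_eq μ hT (fun ζ => ?_) (fun θ hθ => ?_)
    · by_cases h : ζ.comp G.j ∈ D
      · rw [ind, ind, Set.indicator_of_mem, Set.indicator_of_mem]
        · rfl
        · exact h
        · exact ⟨ζ, rfl, h⟩
      · rw [ind, ind, Set.indicator_of_notMem, Set.indicator_of_notMem]
        · exact h
        · rintro ⟨ζ', h1, h2⟩
          exact h (hi.inj h1 ▸ h2)
    · rw [ind, Set.indicator_of_notMem]
      rintro ⟨ζ, h1, -⟩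
      exact hθ ⟨ζ, h1⟩
  simp only [e1, e2]
  exact ⟨(key G.lci_i).1, (key G.lci_j).1, (key G.lci_i).2.trans (key G.lci_j).2.symm⟩

theorem match_list (fs : List c.A)
    (hfs : ∀ f ∈ fs, ∃ (b : Chart k K) (g : d.A), Nonempty (Glue c d b f g)) :
    ∀ {D : Set (d.A →ₐ[k] k)}, ConSet D →
    ConSet {θ : c.A →ₐ[k] k | (∃ f ∈ fs, θ f ≠ 0) ∧ c.pt θ ∈ d.pt '' D} ∧
    ConSet {η | η ∈ D ∧ ∃ θ : c.A →ₐ[k] k, (∃ f ∈ fs, θ f ≠ 0) ∧ c.pt θ = d.pt η} ∧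
    μ.nu (ind {θ : c.A →ₐ[k] k | (∃ f ∈ fs, θ f ≠ 0) ∧ c.pt θ ∈ d.pt '' D}) =
      μ.nu (ind {η | η ∈ D ∧ ∃ θ : c.A →ₐ[k] k, (∃ f ∈ fs, θ f ≠ 0) ∧ c.pt θ = d.pt η}) := by
  induction fs with
  | nil =>
    intro D hD
    simp only [List.not_mem_nil, false_and, exists_false, and_false]
    refine ⟨conSet_empty, conSet_empty, ?_⟩
    have h1 : ind (∅ : Set (c.A →ₐ[k] k)) = 0 := Set.indicator_empty _
    have h2 : ind (∅ : Set (d.A →ₐ[k] k)) = 0 := Set.indicator_empty _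
    exact (congrArg μ.nu h1).trans (μ.nu_zero.trans (μ.nu_zero.symm.trans (congrArg μ.nu h2.symm)))
  | cons f fs ih =>
    intro D hD
    obtain ⟨b, g, ⟨G⟩⟩ := hfs f (by simp)
    obtain ⟨h1, h2, h3⟩ := G.match μ hD
    obtain ⟨i1, i2, i3⟩ := ih (fun f hf => hfs f (by simp [hf])) (hD.diff h2)
    set S := {θ : c.A →ₐ[k] k | θ f ≠ 0 ∧ c.pt θ ∈ d.pt '' D}
    set D' := {η | η ∈ D ∧ ∃ θ : c.A →ₐ[k] k, θ f ≠ 0 ∧ c.pt θ = d.pt η}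
    have e1 : {θ : c.A →ₐ[k] k | (∃ f' ∈ f :: fs, θ f' ≠ 0) ∧ c.pt θ ∈ d.pt '' D} =
        S ∪ {θ : c.A →ₐ[k] k | (∃ f ∈ fs, θ f ≠ 0) ∧ c.pt θ ∈ d.pt '' (D \ D')} := by
      ext θ
      constructor
      · rintro ⟨⟨f', hf', hθ⟩, η, hη, h⟩
        by_cases hf : θ f = 0
        · right
          have : f' ∈ fs := by
            rcases List.mem_cons.1 hf' with rfl | h'
            · exact absurd hf hθ
            · exact h'
          refine ⟨⟨f', this, hθ⟩, η, ⟨hη, ?_⟩, h⟩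
          rintro ⟨-, θ', hθ', h'⟩
          rw [c.pt_injective (h'.trans h)] at hθ'
          exact hθ' hf
        · exact Or.inl ⟨hf, η, hη, h⟩
      · rintro (⟨hf, h⟩ | ⟨⟨f', hf', hθ⟩, η, hη, h⟩)
        · exact ⟨⟨f, by simp, hf⟩, h⟩
        · exact ⟨⟨f', by simp [hf'], hθ⟩, η, hη.1, h⟩
    have e2 : {η | η ∈ D ∧ ∃ θ : c.A →ₐ[k] k, (∃ f' ∈ f :: fs, θ f' ≠ 0) ∧ c.pt θ = d.pt η} =
        D' ∪ {η | η ∈ D \ D' ∧ ∃ θ : c.A →ₐ[k] k, (∃ f ∈ fs, θ f ≠ 0) ∧ c.pt θ = d.pt η} := by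
      ext η
      constructor
      · rintro ⟨hη, θ, ⟨f', hf', hθ⟩, h⟩
        by_cases hD' : η ∈ D'
        · exact Or.inl hD'
        · refine Or.inr ⟨⟨hη, hD'⟩, θ, ⟨f', ?_, hθ⟩, h⟩
          rcases List.mem_cons.1 hf' with rfl | h'
          · exact absurd ⟨hη, θ, hθ, h⟩ hD'
          · exact h'
      · rintro (⟨hη, θ, hf, h⟩ | ⟨hη, θ, ⟨f', hf', hθ⟩, h⟩)
        · exact ⟨hη, θ, ⟨f, by simp, hf⟩, h⟩
        · exact ⟨hη.1, θ, ⟨f', by simp [hf'], hθ⟩, h⟩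
    have d1 : Disjoint S {θ : c.A →ₐ[k] k | (∃ f ∈ fs, θ f ≠ 0) ∧ c.pt θ ∈ d.pt '' (D \ D')} := by
      rw [Set.disjoint_left]
      rintro θ ⟨hf, -⟩ ⟨-, η, hη, h⟩
      exact hη.2 ⟨hη.1, θ, hf, h.symm⟩
    have d2 : Disjoint D' {η | η ∈ D \ D' ∧
        ∃ θ : c.A →ₐ[k] k, (∃ f ∈ fs, θ f ≠ 0) ∧ c.pt θ = d.pt η} := by
      rw [Set.disjoint_left]
      exact fun η h h' => h'.1.2 h
    rw [e1, e2, μ.nu_union h1 i1 d1, μ.nu_union h2 i2 d2, h3, i3]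
    exact ⟨h1.union i1, h2.union i2, rfl⟩

theorem exists_list (c d : Chart k K) : ∃ fs : List c.A,
    (∀ f ∈ fs, ∃ (b : Chart k K) (g : d.A), Nonempty (Glue c d b f g)) ∧
    ∀ (θ : c.A →ₐ[k] k) (η : d.A →ₐ[k] k), c.pt θ = d.pt η → ∃ f ∈ fs, θ f ≠ 0 := by
  have : IsNoetherianRing c.A := Algebra.FiniteType.isNoetherianRing k c.A
  let T : Set c.A := {f | ∃ (b : Chart k K) (g : d.A), Nonempty (Glue c d b f g)}
  obtain ⟨t, htT, ht⟩ := Submodule.fg_span_iff_fg_span_finset_subset (R := c.A) T |>.1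
    (IsNoetherian.noetherian _)
  refine ⟨t.toList, fun f hf => htT (by simpa using hf), fun θ η h => ?_⟩
  by_contra! h0
  obtain ⟨b, f, g, hf, hG⟩ := exists_glue h
  have hle : Submodule.span c.A T ≤ RingHom.ker θ := by
    rw [ht, Submodule.span_le]
    exact fun x hx => h0 x (by simpa using hx)
  exact hf (hle (Submodule.subset_span ⟨b, g, hG⟩))

/-- Constructible sets are transported between charts, preserving the class. -/
theorem matching (c d : Chart k K) {D : Set (d.A →ₐ[k] k)} (hD : ConSet D) :
    ConSet (c.pre (d.pt '' D)) ∧ ConSet (D ∩ d.pre (Set.range c.pt)) ∧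
    μ.nu (ind (c.pre (d.pt '' D))) = μ.nu (ind (D ∩ d.pre (Set.range c.pt))) := by
  obtain ⟨fs, h1, h2⟩ := exists_list c d
  have h := match_list μ fs h1 hD
  have e1 : {θ : c.A →ₐ[k] k | (∃ f ∈ fs, θ f ≠ 0) ∧ c.pt θ ∈ d.pt '' D} = c.pre (d.pt '' D) := by
    ext θ
    exact ⟨fun h => h.2, fun h => ⟨by obtain ⟨η, -, h⟩ := h; exact h2 θ η h.symm, h⟩⟩
  have e2 : {η | η ∈ D ∧ ∃ θ : c.A →ₐ[k] k, (∃ f ∈ fs, θ f ≠ 0) ∧ c.pt θ = d.pt η} =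
      D ∩ d.pre (Set.range c.pt) := by
    ext η
    constructor
    · rintro ⟨hη, θ, -, h⟩
      exact ⟨hη, θ, h⟩
    · rintro ⟨hη, θ, h⟩
      exact ⟨hη, θ, h2 θ η h, h⟩
  rwa [e1, e2] at h

end Chart

section

variable {k K : Type u} [Field k] [Field K] [Algebra k K] {Q : Type u} [CommRing Q]

/-- `q` is the class of the set `S` of local rings, computed by charts in `G`. -/
def HasClass (μ : AlgMeasure k Q) (G : Set (Chart k K)) (S : Set (LPt k K k)) (q : Q) : Prop :=
  ∃ (ι : Type) (_ : Fintype ι) (ch : ι → Chart k K) (C : ∀ i, Set ((ch i).A →ₐ[k] k)),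
    (∀ i, ch i ∈ G) ∧ (∀ i, ConSet (C i)) ∧
    (Pairwise fun i j => Disjoint ((ch i).pt '' C i) ((ch j).pt '' C j)) ∧
    S = ⋃ i, (ch i).pt '' C i ∧ q = ∑ i, μ.nu (ind (C i))

namespace HasClass

variable {μ : AlgMeasure k Q} {G G' : Set (Chart k K)} {S T : Set (LPt k K k)} {q r : Q}

theorem mono (h : HasClass μ G S q) (hG : G ⊆ G') : HasClass μ G' S q := by
  obtain ⟨ι, _, ch, C, h1, h2⟩ := h
  exact ⟨ι, _, ch, C, fun i => hG (h1 i), h2⟩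

theorem empty : HasClass μ G ∅ 0 :=
  ⟨Empty, inferInstance, Empty.elim, fun i => i.elim, fun i => i.elim, fun i => i.elim,
    fun i => i.elim, by simp, by simp⟩

theorem of_chart {c : Chart k K} (hc : c ∈ G) {C : Set (c.A →ₐ[k] k)} (hC : ConSet C) :
    HasClass μ G (c.pt '' C) (μ.nu (ind C)) :=
  ⟨Unit, inferInstance, fun _ => c, fun _ => C, fun _ => hc, fun _ => hC,
    fun i j h => absurd (Subsingleton.elim i j) h, (Set.iUnion_const _).symm, by simp⟩

theorem union (hS : HasClass μ G S q) (hT : HasClass μ G T r) (hd : Disjoint S T) :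
    HasClass μ G (S ∪ T) (q + r) := by
  obtain ⟨ι, _, ch, C, h1, h2, h3, rfl, rfl⟩ := hS
  obtain ⟨κ, _, ch', C', h1', h2', h3', rfl, rfl⟩ := hT
  refine ⟨ι ⊕ κ, inferInstance, Sum.elim ch ch', fun x => match x with | .inl i => C i | .inr j => C' j,
    ?_, ?_, ?_, ?_, ?_⟩
  · rintro (i | j)
    exacts [h1 i, h1' j]
  · rintro (i | j)
    exacts [h2 i, h2' j]
  · rintro (i | i) (j | j) hij
    · exact h3 (fun h => hij (by rw [h]))
    · exact hd.mono (Set.subset_iUnion_of_subset i le_rfl) (Set.subset_iUnion_of_subset j le_rfl)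
    · exact hd.symm.mono (Set.subset_iUnion_of_subset i le_rfl)
        (Set.subset_iUnion_of_subset j le_rfl)
    · exact h3' (fun h => hij (by rw [h]))
  · ext P
    simp only [Set.mem_union, Set.mem_iUnion, Sum.exists]
    exact Iff.rfl
  · rw [Fintype.sum_sum_type]
    rfl

theorem biUnion {ι : Type*} (s : Finset ι) {S : ι → Set (LPt k K k)} {q : ι → Q}
    (h : ∀ i ∈ s, HasClass μ G (S i) (q i)) (hd : (s : Set ι).PairwiseDisjoint S) :
    HasClass μ G (⋃ i ∈ s, S i) (∑ i ∈ s, q i) := by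
  classical
  induction s using Finset.induction_on with
  | empty => simpa using empty
  | insert a s ha ih =>
    rw [Finset.set_biUnion_insert, Finset.sum_insert ha]
    refine (h a (by simp)).union (ih (fun i hi => h i (by simp [hi]))
      (hd.subset (by simp))) ?_
    rw [Set.disjoint_iUnion₂_right]
    intro i hi
    exact hd (by simp) (by simp [hi]) (by rintro rfl; exact ha hi)

variable [IsAlgClosed k]

theorem conSet_pre (h : HasClass μ G S q) (c : Chart k K) : ConSet (c.pre S) := by
  obtain ⟨ι, _, ch, C, h1, h2, h3, rfl, rfl⟩ := h
  have : c.pre (⋃ i, (ch i).pt '' C i) = ⋃ i ∈ (Finset.univ : Finset ι), c.pre ((ch i).pt '' C i) := by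
    ext θ
    simp [Chart.pre]
  rw [this]
  exact conSet_biUnion _ _ fun i _ => (Chart.matching μ c (ch i) (h2 i)).1

theorem singleton {c : Chart k K} (hc : c ∈ G) (θ : c.A →ₐ[k] k) : HasClass μ G {c.pt θ} 1 := by
  have := of_chart (μ := μ) hc (conSet_singleton θ)
  rwa [μ.nu_singleton, Set.image_singleton] at this

theorem split (h : HasClass μ G S q) (hT : ∀ c : Chart k K, ConSet (c.pre T)) :
    ∃ r r', HasClass μ G (S ∩ T) r ∧ HasClass μ G (S \ T) r' ∧ q = r + r' := by
  obtain ⟨ι, hι, ch, C, h1, h2, h3, rfl, rfl⟩ := h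
  refine ⟨∑ i, μ.nu (ind (C i ∩ (ch i).pre T)), ∑ i, μ.nu (ind (C i \ (ch i).pre T)), ⟨ι, hι, ch, fun i => C i ∩ (ch i).pre T, h1, fun i => (h2 i).inter (hT _),
    fun i j hij => (h3 hij).mono (Set.image_mono Set.inter_subset_left)
      (Set.image_mono Set.inter_subset_left), ?_, rfl⟩,
    ⟨ι, hι, ch, fun i => C i \ (ch i).pre T, h1, fun i => (h2 i).diff (hT _),
    fun i j hij => (h3 hij).mono (Set.image_mono Set.sdiff_subset)
      (Set.image_mono Set.sdiff_subset), ?_, rfl⟩, ?_⟩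
  · ext P
    simp only [Set.mem_inter_iff, Set.mem_iUnion, Set.mem_image, Chart.pre]
    constructor
    · rintro ⟨⟨i, θ, hθ, rfl⟩, hP⟩
      exact ⟨i, θ, ⟨hθ, hP⟩, rfl⟩
    · rintro ⟨i, θ, ⟨hθ, hP⟩, rfl⟩
      exact ⟨⟨i, θ, hθ, rfl⟩, hP⟩
  · ext P
    simp only [Set.mem_sdiff, Set.mem_iUnion, Set.mem_image, Chart.pre]
    constructor
    · rintro ⟨⟨i, θ, hθ, rfl⟩, hP⟩
      exact ⟨i, θ, ⟨hθ, hP⟩, rfl⟩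
    · rintro ⟨i, θ, ⟨hθ, hP⟩, rfl⟩
      exact ⟨⟨i, θ, hθ, rfl⟩, hP⟩
  · rw [← Finset.sum_add_distrib]
    refine Finset.sum_congr rfl fun i _ => ?_
    rw [← μ.nu_union ((h2 i).inter (hT _)) ((h2 i).diff (hT _))
      (Set.disjoint_left.2 fun x hx hx' => hx'.2 hx.2), Set.inter_union_sdiff]

theorem nu_eq_of_image_eq {c d : Chart k K} {C : Set (c.A →ₐ[k] k)} {D : Set (d.A →ₐ[k] k)}
    (hD : ConSet D) (h : c.pt '' C = d.pt '' D) : μ.nu (ind C) = μ.nu (ind D) := by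
  obtain ⟨-, -, h3⟩ := Chart.matching μ c d hD
  rw [← h, Chart.pre_image] at h3
  rw [h3, Set.inter_eq_left.2]
  intro η hη
  obtain ⟨θ, -, h'⟩ := h.symm ▸ Set.mem_image_of_mem d.pt hη
  exact ⟨θ, h'⟩

theorem chart_sum {c : Chart k K} {D : Set (c.A →ₐ[k] k)} (hD : ConSet D)
    {ι : Type} [Fintype ι] {T : ι → Set (LPt k K k)} (hT : ∀ i, ConSet (c.pre (T i)))
    (hd : Pairwise fun i j => Disjoint (T i) (T j)) (hs : c.pt '' D ⊆ ⋃ i, T i) :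
    μ.nu (ind D) = ∑ i, μ.nu (ind (D ∩ c.pre (T i))) := by
  rw [← μ.nu_biUnion _ _ fun i _ => hD.inter (hT i)]
  · congr 2
    ext θ
    simp only [Finset.mem_univ, Set.iUnion_true, Set.mem_iUnion, Set.mem_inter_iff,
      exists_and_left]
    refine ⟨fun h => ⟨h, ?_⟩, fun h => h.1⟩
    obtain ⟨i, hi⟩ := Set.mem_iUnion.1 (hs (Set.mem_image_of_mem c.pt h))
    exact ⟨i, hi⟩
  · intro i _ j _ hij
    change Disjoint (D ∩ c.pre (T i)) (D ∩ c.pre (T j))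
    rw [Set.disjoint_left]
    exact fun θ h h' => Set.disjoint_left.1 (hd hij) h.2 h'.2

theorem unique (h : HasClass μ G S q) (h' : HasClass μ G' S r) : q = r := by
  have hc := h.conSet_pre
  obtain ⟨ι, _, ch, C, h1, h2, h3, rfl, rfl⟩ := h
  obtain ⟨κ, _, ch', C', h1', h2', h3', h4', rfl⟩ := h'
  rw [Finset.sum_congr rfl fun i _ => chart_sum (h2 i)
      (T := fun j => (ch' j).pt '' C' j) (fun j => (Chart.matching μ _ _ (h2' j)).1) h3'
      (by rw [← h4']; exact Set.subset_iUnion_of_subset i le_rfl),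
    Finset.sum_congr rfl fun j _ => chart_sum (h2' j)
      (T := fun i => (ch i).pt '' C i) (fun i => (Chart.matching μ _ _ (h2 i)).1) h3
      (by rw [h4']; exact Set.subset_iUnion_of_subset j le_rfl), Finset.sum_comm]
  refine Finset.sum_congr rfl fun j _ => Finset.sum_congr rfl fun i _ => ?_
  refine nu_eq_of_image_eq ((h2' j).inter (Chart.matching μ _ _ (h2 i)).1) ?_
  ext P
  simp only [Set.mem_image, Set.mem_inter_iff, Chart.pre, Set.mem_ofPred_eq]
  constructor
  · rintro ⟨θ, ⟨hθ, η, hη, h⟩, rfl⟩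
    exact ⟨η, ⟨hη, θ, hθ, h.symm⟩, h⟩
  · rintro ⟨θ, ⟨hθ, η, hη, h⟩, rfl⟩
    exact ⟨η, ⟨hη, θ, hθ, h.symm⟩, h⟩

theorem diff (h : HasClass μ G S q) (hT : HasClass μ G' T r) (hTS : T ⊆ S) :
    HasClass μ G (S \ T) (q - r) := by
  obtain ⟨r₁, r₂, h1, h2, rfl⟩ := h.split hT.conSet_pre
  rw [Set.inter_eq_right.2 hTS] at h1
  rw [h1.unique hT, add_sub_cancel_left]
  exact h2

end HasClass

end

namespace LPt

variable {k K : Type u} [Field k] [Field K] [Algebra k K]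

/-- The maximal ideal of a local subring. -/
def mx (P : LPt k K k) : Ideal P.O := RingHom.ker P.res

/-- Membership in the powers of the maximal ideal. -/
def MP (P : LPt k K k) (n : ℕ) (x : K) : Prop := ∃ h : x ∈ P.O, (⟨x, h⟩ : P.O) ∈ P.mx ^ n

variable {P : LPt k K k} {x y : K} {n m : ℕ}

theorem MP.mem (h : P.MP n x) : x ∈ P.O := h.1

theorem MP.add (h : P.MP n x) (h' : P.MP n y) : P.MP n (x + y) :=
  ⟨add_mem h.1 h'.1, Ideal.add_mem _ h.2 h'.2⟩

theorem MP.neg (h : P.MP n x) : P.MP n (-x) :=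
  ⟨neg_mem h.1, (Ideal.neg_mem_iff _).2 h.2⟩

theorem MP.sub (h : P.MP n x) (h' : P.MP n y) : P.MP n (x - y) :=
  ⟨sub_mem h.1 h'.1, Ideal.sub_mem _ h.2 h'.2⟩

theorem MP.mul (h : P.MP n x) (h' : P.MP m y) : P.MP (n + m) (x * y) := by
  refine ⟨mul_mem h.1 h'.1, ?_⟩
  rw [pow_add]
  exact Ideal.mul_mem_mul h.2 h'.2

theorem MP.zero : P.MP n 0 := ⟨zero_mem _, Ideal.zero_mem _⟩

theorem mp_zero_iff : P.MP 0 x ↔ x ∈ P.O := by simp [MP]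

theorem mp_one_iff : P.MP 1 x ↔ P.At x 0 := by simp [MP, At, mx]

theorem MP.mul_mem (h : P.MP n x) (hy : y ∈ P.O) : P.MP n (y * x) := by
  simpa using (mp_zero_iff.2 hy).mul h

theorem MP.mono (h : P.MP n x) (hm : m ≤ n) : P.MP m x := ⟨h.1, Ideal.pow_le_pow_right hm h.2⟩

theorem MP.sum {ι : Type*} {s : Finset ι} {f : ι → K} (h : ∀ i ∈ s, P.MP n (f i)) :
    P.MP n (∑ i ∈ s, f i) := by
  classical
  induction s using Finset.induction_on with
  | empty => simpa using MP.zero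
  | insert a s ha ih =>
    rw [Finset.sum_insert ha]
    exact (h a (by simp)).add (ih fun i hi => h i (by simp [hi]))

theorem MP.pow (h : P.MP 1 x) (n : ℕ) : P.MP n (x ^ n) := by
  induction n with
  | zero => simpa using mp_zero_iff.2 P.O.one_mem
  | succ n ih => rw [pow_succ]; exact ih.mul h

theorem MP.induction {p : ∀ x, P.MP (n + 1) x → Prop}
    (h_mul : ∀ x y (hx : P.At x 0) (hy : P.MP n y), p (x * y)
      (by rw [add_comm]; exact (mp_one_iff.2 hx).mul hy))
    (h_add : ∀ x y hx hy, p x hx → p y hy → p (x + y) (MP.add hx hy)) (hx : P.MP (n + 1) x) : p x hx := by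
  obtain ⟨hx0, hx1⟩ := hx
  have : ∀ z : P.O, ∀ hz : z ∈ P.mx * P.mx ^ n, p z ⟨z.2, by rw [pow_succ']; exact hz⟩ := by
    intro z hz
    induction hz using Submodule.mul_induction_on' with
    | mem_mul_mem a ha b hb => exact h_mul a b (mp_one_iff.1 ⟨a.2, by simpa using ha⟩) ⟨b.2, hb⟩
    | add a ha b hb iha ihb => exact h_add _ _ _ _ iha ihb
  exact this ⟨x, hx0⟩ (by rw [← pow_succ']; exact hx1)

theorem MP.derivation {D : Derivation k K K} (hD : ∀ x ∈ P.O, D x ∈ P.O) :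
    ∀ {n : ℕ} {x : K}, P.MP (n + 1) x → P.MP n (D x) := by
  intro n
  induction n with
  | zero => exact fun h => mp_zero_iff.2 (hD _ h.1)
  | succ n ih =>
    intro x hx
    induction hx using MP.induction with
    | h_mul x y hx hy =>
      rw [D.leibniz, smul_eq_mul, smul_eq_mul, add_comm n 1]
      refine ((mp_one_iff.2 hx).mul (ih hy)).add ?_
      rw [add_comm 1 n]
      exact hy.mul_mem (hD _ hx.mem) |>.mono le_rfl |> fun h => by rwa [mul_comm] at h
    | h_add x y hx hy ihx ihy => rw [map_add]; exact ihx.add ihy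

theorem eq_zero_of_mp [IsNoetherianRing P.O] (h : ∀ n, P.MP n x) : x = 0 := by
  have hx := (h 0).1
  have : (⟨x, hx⟩ : P.O) ∈ (⨅ n : ℕ, P.mx ^ n) := by
    rw [Submodule.mem_iInf]
    exact fun n => (h n).2
  rw [Ideal.iInf_pow_eq_bot_of_isDomain P.mx (RingHom.ker_ne_top P.res)] at this
  exact congrArg Subtype.val ((Submodule.mem_bot _).1 this)

theorem exists_mp [IsNoetherianRing P.O] (hx : x ∈ P.O) (h0 : x ≠ 0) :
    ∃ n, P.MP n x ∧ ¬ P.MP (n + 1) x := by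
  by_contra! h
  refine h0 (eq_zero_of_mp (P := P) fun n => ?_)
  induction n with
  | zero => exact mp_zero_iff.2 hx
  | succ n ih => exact h n ih

end LPt

open LPt

/-- A regular two-dimensional local subring with parameters `u`, `v` and dual derivations. -/
structure RegPt {k K : Type u} [Field k] [Field K] [Algebra k K] (P : LPt k K k) (u v : K)
    (D₁ D₂ : Derivation k K K) : Prop where
  D₁_mem : ∀ x ∈ P.O, D₁ x ∈ P.O
  D₂_mem : ∀ x ∈ P.O, D₂ x ∈ P.O
  at_u : P.At u 0
  at_v : P.At v 0
  D₁_u : D₁ u = 1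
  D₁_v : D₁ v = 0
  D₂_u : D₂ u = 0
  D₂_v : D₂ v = 1
  gen : ∀ x, P.At x 0 → ∃ α ∈ P.O, ∃ β ∈ P.O, x = α * u + β * v
  noeth : IsNoetherianRing P.O
  frac : ∀ x : K, ∃ a ∈ P.O, ∃ b ∈ P.O, b ≠ 0 ∧ x = a / b

namespace RegPt

variable {k K : Type u} [Field k] [Field K] [Algebra k K] {P : LPt k K k} {u v : K}
  {D₁ D₂ : Derivation k K K}

theorem swap (h : RegPt P u v D₁ D₂) : RegPt P v u D₂ D₁ where
  D₁_mem := h.D₂_mem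
  D₂_mem := h.D₁_mem
  at_u := h.at_v
  at_v := h.at_u
  D₁_u := h.D₂_v
  D₁_v := h.D₂_u
  D₂_u := h.D₁_v
  D₂_v := h.D₁_u
  gen := fun x hx => by
    obtain ⟨α, hα, β, hβ, rfl⟩ := h.gen x hx
    exact ⟨β, hβ, α, hα, add_comm _ _⟩
  noeth := h.noeth
  frac := h.frac

theorem u_ne (h : RegPt P u v D₁ D₂) : u ≠ 0 := by
  rintro rfl
  simpa using h.D₁_u

variable (h : RegPt P u v D₁ D₂)
include h

theorem v_ne : v ≠ 0 := h.swap.u_ne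

theorem D_inv : D₁ u⁻¹ = - (u⁻¹ ^ 2) ∧ D₂ u⁻¹ = 0 := by
  have := h.u_ne
  rw [Derivation.leibniz_inv, Derivation.leibniz_inv, h.D₁_u, h.D₂_u]
  simp

theorem D₁_w : D₁ (v / u) = - (v / u) / u := by
  have := h.u_ne
  rw [div_eq_mul_inv, D₁.leibniz, h.D_inv.1, h.D₁_v, smul_eq_mul, smul_zero, add_zero]
  field_simp

theorem D₂_w : D₂ (v / u) = u⁻¹ := by
  rw [div_eq_mul_inv, D₂.leibniz, h.D_inv.2, h.D₂_v, smul_zero, zero_add, smul_eq_mul, mul_one]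

theorem exists_poly {n : ℕ} {x : K} (hx : P.MP n x) :
    ∃ F : Polynomial P.O, F.natDegree ≤ n ∧ x = u ^ n * P.evK (v / u) F := by
  have hu := h.u_ne
  induction n generalizing x with
  | zero => exact ⟨Polynomial.C ⟨x, hx.1⟩, by simp, by simp⟩
  | succ n ih =>
    induction hx using MP.induction with
    | h_mul x y hx hy =>
      obtain ⟨F, hF, rfl⟩ := ih hy
      obtain ⟨α, hα, β, hβ, rfl⟩ := h.gen x hx
      refine ⟨(Polynomial.C ⟨α, hα⟩ + Polynomial.C ⟨β, hβ⟩ * Polynomial.X) * F, ?_, ?_⟩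
      · refine Polynomial.natDegree_mul_le.trans ?_
        rw [add_comm]
        refine add_le_add hF ?_
        compute_degree
      · simp only [map_mul, map_add, evK_C, evK_X]
        rw [pow_succ]
        linear_combination (u ^ n * P.evK (v / u) F) * β * (- mul_div_cancel₀ v hu)
    | h_add x y hx hy ihx ihy =>
      obtain ⟨F, hF, rfl⟩ := ihx
      obtain ⟨G, hG, rfl⟩ := ihy
      exact ⟨F + G, Polynomial.natDegree_add_le_of_degree_le hF hG, by rw [map_add, mul_add]⟩

theorem mp_monomial {n i : ℕ} (hi : i ≤ n) : P.MP n (u ^ n * (v / u) ^ i) := by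
  have hu := h.u_ne
  have : u ^ n * (v / u) ^ i = u ^ (n - i) * v ^ i := by
    obtain ⟨j, rfl⟩ := Nat.exists_eq_add_of_le hi
    rw [Nat.add_sub_cancel_left, pow_add, div_pow,
      mul_right_comm, mul_div_cancel₀ _ (pow_ne_zero _ hu), mul_comm]
  rw [this]
  have := ((mp_one_iff.2 h.at_u).pow (n - i)).mul ((mp_one_iff.2 h.at_v).pow i)
  rwa [Nat.sub_add_cancel hi] at this

theorem mp_evK_add {n m : ℕ} {F : Polynomial P.O} (hF : F.natDegree ≤ n) (h0 : ∀ i, P.MP m (F.coeff i : K)) :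
    P.MP (n + m) (u ^ n * P.evK (v / u) F) := by
  rw [evK_eq_sum, Polynomial.sum_def, Finset.mul_sum]
  refine MP.sum fun i hi => ?_
  rw [mul_left_comm, add_comm]
  exact (h0 i).mul (h.mp_monomial ((Polynomial.le_natDegree_of_mem_supp _ hi).trans hF))

theorem mp_evK {n : ℕ} {F : Polynomial P.O} (hF : F.natDegree ≤ n) : P.MP n (u ^ n * P.evK (v / u) F) :=
  h.mp_evK_add (m := 0) hF fun i => mp_zero_iff.2 (F.coeff i).2

theorem mp_evK_succ {n : ℕ} {F : Polynomial P.O} (hF : F.natDegree ≤ n) (h0 : P.red F = 0) :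
    P.MP (n + 1) (u ^ n * P.evK (v / u) F) :=
  h.mp_evK_add (m := 1) hF fun i => mp_one_iff.2 (by
    have := at_coe (P := P) (F.coeff i)
    rwa [← red_coeff, h0, Polynomial.coeff_zero] at this)

theorem eq_zero_of_mp [CharZero k] {n : ℕ} : ∀ {F : Polynomial k}, F.natDegree ≤ n →
    P.MP (n + 1) (u ^ n * Polynomial.aeval (v / u) F) → F = 0 := by
  have hu := h.u_ne
  induction n with
  | zero =>
    intro F hF hm
    obtain ⟨a, rfl⟩ := Polynomial.natDegree_eq_zero.1 (Nat.le_zero.1 hF)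
    rw [pow_zero, one_mul, Polynomial.aeval_C, zero_add, mp_one_iff] at hm
    rw [Polynomial.C_eq_zero]
    exact ((hm.unique (at_algebraMap a)).symm : algebraMap k k a = 0)
  | succ n ih =>
    intro F hF hm
    have h1 := MP.derivation h.D₂_mem hm
    rw [D₂.leibniz, D₂.leibniz_pow, h.D₂_u, Derivation.map_aeval, h.D₂_w] at h1
    have h2 : P.MP (n + 1) (u ^ n * Polynomial.aeval (v / u) (Polynomial.derivative F)) := by
      convert h1 using 1
      simp only [smul_eq_mul, smul_zero, mul_zero, add_zero]
      rw [pow_succ]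
      linear_combination (- (u ^ n) * Polynomial.aeval (v / u) (Polynomial.derivative F)) *
        mul_inv_cancel₀ hu
    have h3 := ih (by
      have := Polynomial.natDegree_derivative_le F
      omega) h2
    obtain ⟨a, rfl⟩ := Polynomial.natDegree_eq_zero.1 (Polynomial.derivative_eq_zero.1 h3)
    have h4 := MP.derivation h.D₁_mem hm
    rw [Polynomial.aeval_C, D₁.leibniz, D₁.map_algebraMap, D₁.leibniz_pow, h.D₁_u] at h4
    have h5 := ih (F := Polynomial.C (((n : k) + 1) * a))
      ((Polynomial.natDegree_C _).trans_le n.zero_le) (by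
      convert h4 using 1
      simp only [Polynomial.aeval_C, smul_eq_mul, smul_zero, zero_add, nsmul_eq_mul, map_mul, map_add,
        map_natCast, map_one]
      simp only [Nat.add_sub_cancel, Nat.cast_add, Nat.cast_one]
      ring)
    rw [Polynomial.C_eq_zero, mul_eq_zero] at h5
    rw [h5.resolve_left (Nat.cast_add_one_ne_zero n), map_zero]

theorem red_eq_zero [CharZero k] {n : ℕ} {F : Polynomial P.O} (hF : F.natDegree ≤ n)
    (hm : P.MP (n + 1) (u ^ n * P.evK (v / u) F)) : P.red F = 0 := by
  set G : Polynomial P.O := (P.red F).map (algebraMap k P.O) with hG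
  have hdeg : (P.red F).natDegree ≤ n := Polynomial.natDegree_map_le.trans hF
  have h1 : P.red (F - G) = 0 := by
    ext i
    simp [red_coeff, hG]
  have h2 := h.mp_evK_succ (n := n) (F := F - G)
    ((Polynomial.natDegree_sub_le_of_le hF (Polynomial.natDegree_map_le.trans hdeg)).trans
      (max_self n).le) h1
  refine h.eq_zero_of_mp hdeg ?_
  convert hm.sub h2 using 1
  rw [map_sub, mul_sub, sub_sub_cancel, hG]
  simp [evK]

theorem evK_eq_zero [CharZero k] {F : Polynomial P.O} (hF : P.evK (v / u) F = 0) : P.red F = 0 :=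
  h.red_eq_zero le_rfl (by rw [hF, mul_zero]; exact MP.zero)

theorem exists_poly_ne {x : K} (hx : x ∈ P.O) (h0 : x ≠ 0) :
    ∃ n, ∃ F : Polynomial P.O, F.natDegree ≤ n ∧ P.red F ≠ 0 ∧ x = u ^ n * P.evK (v / u) F := by
  have := h.noeth
  obtain ⟨n, h1, h2⟩ := exists_mp hx h0
  obtain ⟨F, hF, rfl⟩ := h.exists_poly h1
  exact ⟨n, F, hF, fun hr => h2 (h.mp_evK_succ hF hr), rfl⟩

theorem evK_ne [CharZero k] {F : Polynomial P.O} (hF : P.red F ≠ 0) : P.evK (v / u) F ≠ 0 :=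
  fun h0 => hF (h.evK_eq_zero h0)

theorem exists_zpow [CharZero k] {x : K} (h0 : x ≠ 0) :
    ∃ n : ℤ, ∃ F G : Polynomial P.O, P.red F ≠ 0 ∧ P.red G ≠ 0 ∧
      x = u ^ n * P.evK (v / u) F / P.evK (v / u) G := by
  obtain ⟨a, ha, b, hb, hb0, rfl⟩ := h.frac x
  obtain ⟨n, F, -, hF, e1⟩ := h.exists_poly_ne ha (by rintro rfl; simp at h0)
  obtain ⟨m, G, -, hG, e2⟩ := h.exists_poly_ne hb hb0
  refine ⟨n - m, F, G, hF, hG, ?_⟩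
  have hu := h.u_ne
  have := h.evK_ne hG
  rw [e1, e2, zpow_sub₀ hu, zpow_natCast, zpow_natCast]
  field_simp

end RegPt

namespace LPt

variable {k K L : Type u} [Field k] [Field K] [Algebra k K] [Field L] [Algebra k L]

theorem isNoetherianRing_ofHoms {R : Type u} [CommRing R] [Algebra k R] [IsNoetherianRing R]
    {f : R →ₐ[k] K} {g : R →ₐ[k] L} {h : ∀ r, f r = 0 → g r = 0} :
    IsNoetherianRing (ofHoms f g h).O := by
  let φ : R →ₐ[k] (ofHoms f g h).O := f.codRestrict _ fun r => (at_ofHoms_self r).mem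
  have key : ∀ I J : Ideal (ofHoms f g h).O, I.comap φ ≤ J.comap φ → I ≤ J := by
    intro I J hIJ x hx
    obtain ⟨a, b, hb, e⟩ := mem_ofHoms.1 x.2
    have hbu : (f b)⁻¹ ∈ (ofHoms f g h).O := ((at_ofHoms_self (h := h) b).inv hb).mem
    have hfb : f b ≠ 0 := fun h0 => hb (h b h0)
    have h1 : φ a ∈ J := hIJ (show φ a ∈ I by
      have : φ a = φ b * x := Subtype.ext (by change f a = f b * x; rw [← e, mul_comm])
      rw [this]
      exact I.mul_mem_left _ hx)
    have : x = ⟨_, hbu⟩ * φ a := Subtype.ext (by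
      change (x : K) = (f b)⁻¹ * f a
      rw [← e]; field_simp)
    rw [this]
    exact J.mul_mem_left _ h1
  have hs : StrictMono fun I : Ideal (ofHoms f g h).O => I.comap φ := by
    intro I J hIJ
    refine lt_of_le_not_ge (Ideal.comap_mono hIJ.le) fun hle => ?_
    exact not_le_of_gt hIJ (key _ _ hle)
  have : WellFoundedGT (Ideal R) := inferInstance
  have := hs.wellFoundedGT
  exact isNoetherian_iff'.2 this

theorem derivation_evK {P P' : LPt k K k} (hP : ∀ x ∈ P.O, x ∈ P'.O) {D : Derivation k K K} {w : K}
    (hw : w ∈ P'.O) (hD : ∀ x ∈ P.O, D x ∈ P'.O) (hDw : D w ∈ P'.O) (F : Polynomial P.O) :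
    P.evK w F ∈ P'.O ∧ D (P.evK w F) ∈ P'.O := by
  induction F using Polynomial.induction_on' with
  | add p q hp hq =>
    rw [map_add, map_add]
    exact ⟨add_mem hp.1 hq.1, add_mem hp.2 hq.2⟩
  | monomial n a =>
    rw [← Polynomial.C_mul_X_pow_eq_monomial, map_mul, map_pow, evK_X, evK_C]
    refine ⟨mul_mem (hP _ a.2) (pow_mem hw n), ?_⟩
    rw [D.leibniz, D.leibniz_pow, smul_eq_mul, smul_eq_mul, smul_eq_mul, nsmul_eq_mul]
    exact add_mem (mul_mem (hP _ a.2) (mul_mem (natCast_mem _ n) (mul_mem (pow_mem hw _) hDw)))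
      (mul_mem (pow_mem hw _) (hD _ a.2))

end LPt

namespace RegPt

variable {k K : Type u} [Field k] [CharZero k] [Field K] [Algebra k K] {P : LPt k K k} {u v : K}
  {D₁ D₂ : Derivation k K K} (h : RegPt P u v D₁ D₂)

/-- The local ring of the blow-up of `P` at the point of the exceptional line where `v / u` has
value `c`. -/
def tr (c : k) : LPt k K k :=
  ofHoms (P.evK (v / u)) (P.evL c) fun F hF => by
    rw [evL_apply, h.evK_eq_zero hF, Polynomial.eval_zero]

/-- The local ring of the blow-up of `P` at the point of the exceptional line where `u / v`
vanishes. -/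
def inf : LPt k K k := h.swap.tr 0

theorem le_tr (c : k) : P ≤ h.tr c := by
  rintro x _ ⟨hx, rfl⟩
  have := at_ofHoms_self (f := P.evK (v / u)) (g := P.evL c)
    (h := fun F hF => by rw [evL_apply, h.evK_eq_zero hF, Polynomial.eval_zero]) (Polynomial.C ⟨x, hx⟩)
  rwa [evK_C, evL_C] at this

theorem tr_at (c : k) : (h.tr c).At (v / u) c := by
  have := at_ofHoms_self (f := P.evK (v / u)) (g := P.evL c)
    (h := fun F hF => by rw [evL_apply, h.evK_eq_zero hF, Polynomial.eval_zero]) Polynomial.X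
  rwa [evK_X, evL_X] at this

theorem le_inf : P ≤ h.inf := h.swap.le_tr 0

theorem inf_at : h.inf.At (u / v) 0 := h.swap.tr_at 0

theorem tr_le {c : k} {V : LPt k K k} (hV : P ≤ V) (hw : V.At (v / u) c) : h.tr c ≤ V :=
  ofHoms_le_iff.2 fun F => evK_at hV hw F

theorem inf_le {V : LPt k K k} (hV : P ≤ V) (hw : V.At (u / v) 0) : h.inf ≤ V :=
  h.swap.tr_le hV hw

theorem tr_at_evK (c : k) (F : Polynomial P.O) :
    (h.tr c).At (P.evK (v / u) F) ((P.red F).eval c) := by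
  rw [← evL_apply]
  exact at_ofHoms_self F

theorem mem_tr {c : k} {x : K} : (x ∈ (h.tr c).O) ↔ ∃ F G : Polynomial P.O, (P.red G).eval c ≠ 0 ∧
    x = P.evK (v / u) F / P.evK (v / u) G := by
  constructor
  · intro hx
    obtain ⟨F, G, hG, e⟩ := mem_ofHoms.1 hx
    rw [evL_apply] at hG
    exact ⟨F, G, hG, by rw [eq_div_iff ((h.tr_at_evK c G).ne_zero hG), e]⟩
  · rintro ⟨F, G, hG, rfl⟩
    exact ((h.tr_at_evK c F).div (h.tr_at_evK c G) hG).mem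

theorem regPt_tr (c : k) :
    RegPt (h.tr c) u (v / u - algebraMap k K c) (D₁ + (v / u) • D₂) (u • D₂) := by
  have hu := h.u_ne
  have hle : ∀ x ∈ P.O, x ∈ (h.tr c).O := fun x hx => mem_mono (h.le_tr c) hx
  have hD : ∀ D : Derivation k K K, (∀ x ∈ P.O, D x ∈ (h.tr c).O) → D (v / u) ∈ (h.tr c).O →
      ∀ x ∈ (h.tr c).O, D x ∈ (h.tr c).O := by
    intro D h1 h2 x hx
    obtain ⟨F, G, hG, rfl⟩ := h.mem_tr.1 hx
    obtain ⟨a1, a2⟩ := derivation_evK hle (h.tr_at c).mem h1 h2 F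
    obtain ⟨b1, b2⟩ := derivation_evK hle (h.tr_at c).mem h1 h2 G
    have b3 := ((h.tr_at_evK c G).inv hG).mem
    rw [div_eq_mul_inv, D.leibniz, Derivation.leibniz_inv, smul_eq_mul, smul_eq_mul, smul_eq_mul]
    exact add_mem (mul_mem a1 (mul_mem (neg_mem (pow_mem b3 2)) b2)) (mul_mem b3 a2)
  refine ⟨hD _ ?_ ?_, hD _ ?_ ?_, h.at_u.mono (h.le_tr c), ?_, ?_, ?_, ?_, ?_, ?_, ?_, ?_⟩
  · intro x hx
    simp only [Derivation.add_apply, Derivation.smul_apply, smul_eq_mul]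
    exact add_mem (hle _ (h.D₁_mem x hx)) (mul_mem (h.tr_at c).mem (hle _ (h.D₂_mem x hx)))
  · simp only [Derivation.add_apply, Derivation.smul_apply, smul_eq_mul, h.D₁_w, h.D₂_w]
    rw [show -(v / u) / u + v / u * u⁻¹ = 0 by field_simp; ring]
    exact zero_mem _
  · intro x hx
    simp only [Derivation.smul_apply, smul_eq_mul]
    exact mul_mem (hle _ h.at_u.mem) (hle _ (h.D₂_mem x hx))
  · simp only [Derivation.smul_apply, smul_eq_mul, h.D₂_w, mul_inv_cancel₀ hu]
    exact one_mem _
  · simpa using (h.tr_at c).sub (at_algebraMap c)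
  · simp [h.D₁_u, h.D₂_u]
  · simp only [Derivation.add_apply, Derivation.smul_apply, smul_eq_mul, map_sub, h.D₁_w, h.D₂_w,
      Derivation.map_algebraMap]
    field_simp
    ring
  · simp [h.D₂_u]
  · simp only [Derivation.smul_apply, smul_eq_mul, map_sub, h.D₂_w, Derivation.map_algebraMap]
    field_simp
    ring
  · intro x hx
    obtain ⟨F, G, hG, rfl⟩ := h.mem_tr.1 hx.mem
    have hGi := (h.tr_at_evK c G).inv hG
    have hF : P.res (F.eval (algebraMap k P.O c)) = 0 := by
      have e := hx.mul (h.tr_at_evK c G)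
      rw [div_mul_cancel₀ _ ((h.tr_at_evK c G).ne_zero hG), zero_mul] at e
      rw [e.unique (h.tr_at_evK c F)]
      have h1 := Polynomial.eval₂_at_apply (p := F) (P.res : P.O →+* k) (algebraMap k P.O c)
      rw [RingHom.coe_coe, P.res.commutes] at h1
      rw [← h1, Polynomial.eval₂_eq_eval_map]
      rfl
    obtain ⟨α, hα, β, hβ, e⟩ := h.gen _ ⟨(F.eval (algebraMap k P.O c)).2, hF⟩
    obtain ⟨F₁, hF₁⟩ := Polynomial.X_sub_C_dvd_sub_C_eval (a := algebraMap k P.O c) (p := F)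
    have e2 : P.evK (v / u) F = (α + β * (v / u)) * u + P.evK (v / u) F₁ * (v / u - algebraMap k K c) := by
      rw [sub_eq_iff_eq_add.1 hF₁, map_add, map_mul, map_sub, evK_X, evK_C, evK_C, e]
      have : ((algebraMap k P.O c : P.O) : K) = algebraMap k K c := rfl
      rw [this]
      field_simp
      ring
    refine ⟨(α + β * (v / u)) * (P.evK (v / u) G)⁻¹, ?_, P.evK (v / u) F₁ * (P.evK (v / u) G)⁻¹, ?_, ?_⟩
    · exact mul_mem (add_mem (hle _ hα) (mul_mem (hle _ hβ) (h.tr_at c).mem)) hGi.mem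
    · exact mul_mem (h.tr_at_evK c F₁).mem hGi.mem
    · rw [e2]; ring
  · have := h.noeth
    exact isNoetherianRing_ofHoms
  · intro x
    obtain ⟨a, ha, b, hb, hb0, rfl⟩ := h.frac x
    exact ⟨a, hle _ ha, b, hle _ hb, hb0, rfl⟩

theorem exists_tr_le {V : LPt k K k} (hV : P ≤ V) (hp : V.IsPlace) :
    (∃ c, h.tr c ≤ V ∧ V.At (v / u) c) ∨ (h.inf ≤ V ∧ V.At (u / v) 0) := by
  by_cases hw : v / u ∈ V.O
  · obtain ⟨c, hc⟩ := exists_at hw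
    exact Or.inl ⟨c, h.tr_le hV hc, hc⟩
  · have := hp.at_inv_zero hw
    rw [inv_div] at this
    exact Or.inr ⟨h.inf_le hV this, this⟩

end RegPt

/-- A pair of coordinates on the function field `K`, with dual derivations. -/
structure Frame (k K : Type u) [Field k] [Field K] [Algebra k K] where
  p : K
  q : K
  D₁ : Derivation k K K
  D₂ : Derivation k K K
  D₁_p : D₁ p = 1
  D₁_q : D₁ q = 0
  D₂_p : D₂ p = 0
  D₂_q : D₂ q = 1
  frac : ∀ x : K, ∃ a b : MvPolynomial (Fin 2) k, aeval ![p, q] b ≠ 0 ∧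
    x = aeval ![p, q] a / aeval ![p, q] b

namespace Frame

variable {k K : Type u} [Field k] [Field K] [Algebra k K] (F : Frame k K)

/-- The evaluation homomorphism of a frame. -/
def e : MvPolynomial (Fin 2) k →ₐ[k] K := aeval ![F.p, F.q]

@[simp] theorem e_X0 : F.e (X 0) = F.p := by simp [e]
@[simp] theorem e_X1 : F.e (X 1) = F.q := by simp [e]
theorem e_C (c : k) : F.e (C c) = algebraMap k K c := F.e.commutes c

theorem D₁_e (a : MvPolynomial (Fin 2) k) : F.D₁ (F.e a) = F.e (pderiv 0 a) := by
  induction a using MvPolynomial.induction_on with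
  | C c => rw [e_C, Derivation.map_algebraMap, pderiv_C, map_zero]
  | add a b ha hb => simp only [map_add, ha, hb]
  | mul_X a i ha =>
    rw [map_mul, F.D₁.leibniz, pderiv_mul, map_add, map_mul, map_mul, ha]
    fin_cases i
    · simp [F.D₁_p, pderiv_X]; ring
    · simp [F.D₁_q, pderiv_X]; ring

theorem D₂_e (a : MvPolynomial (Fin 2) k) : F.D₂ (F.e a) = F.e (pderiv 1 a) := by
  induction a using MvPolynomial.induction_on with
  | C c => rw [e_C, Derivation.map_algebraMap, pderiv_C, map_zero]
  | add a b ha hb => simp only [map_add, ha, hb]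
  | mul_X a i ha =>
    rw [map_mul, F.D₂.leibniz, pderiv_mul, map_add, map_mul, map_mul, ha]
    fin_cases i
    · simp [F.D₂_p, pderiv_X]; ring
    · simp [F.D₂_q, pderiv_X]; ring

theorem eq_zero_of_pderiv [CharZero k] {p : ℕ → MvPolynomial (Fin 2) k → Prop}
    (hd : ∀ N a i, p (N + 1) a → p N (pderiv i a)) (hC : ∀ N c, p (N + 1) (C c) → c = 0)
    {a : MvPolynomial (Fin 2) k} (h : p (a.totalDegree + 1) a) : a = 0 := by
  have main : ∀ (N : ℕ) (a : MvPolynomial (Fin 2) k),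
      (∀ m : Fin 2 →₀ ℕ, N ≤ m.degree → a.coeff m = 0) → p N a → a = 0 := by
    intro N
    induction N with
    | zero => intro a ha _; ext m; simpa using ha m (Nat.zero_le _)
    | succ N ih =>
      intro a ha h0
      have key : ∀ i, pderiv i a = 0 := by
        refine fun i => ih _ (fun m hm => ?_) (hd N a i h0)
        rw [coeff_pderiv, ha, zero_mul]
        rw [map_add, Finsupp.degree_single]
        omega
      have hc : a = C (a.coeff 0) := by
        ext m
        rw [coeff_C]
        split_ifs with hm
        · rw [hm]
        · obtain ⟨i, hi⟩ : ∃ i, m i ≠ 0 := by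
            by_contra! hcon
            exact hm (Finsupp.ext fun i => by simp [hcon i])
          have h1 : m = (m - Finsupp.single i 1) + Finsupp.single i 1 := by
            rw [tsub_add_cancel_of_le]
            simpa using Nat.one_le_iff_ne_zero.2 hi
          have h2 := congrArg (coeff (m - Finsupp.single i 1)) (key i)
          rw [coeff_pderiv, coeff_zero, ← h1, mul_eq_zero] at h2
          exact h2.resolve_right (Nat.cast_add_one_ne_zero _)
      rw [hc] at h0
      rw [hc, hC N _ h0, C_0]
  refine main _ a (fun m hm => ?_) h
  by_contra h
  have := le_totalDegree (mem_support_iff.2 h)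
  rw [Finsupp.degree_eq_sum] at hm
  rw [Finsupp.sum_fintype _ _ fun _ => rfl] at this
  omega

theorem e_injective [CharZero k] : Function.Injective F.e := by
  rw [injective_iff_map_eq_zero]
  refine fun a ha => eq_zero_of_pderiv (p := fun _ a => F.e a = 0) (fun _ a i h => ?_)
    (fun _ c h => by rwa [e_C, map_eq_zero] at h) ha
  fin_cases i
  · change F.e (pderiv 0 a) = 0
    rw [← D₁_e, h, map_zero]
  · change F.e (pderiv 1 a) = 0
    rw [← D₂_e, h, map_zero]

/-- The polynomial chart of a frame. -/
def toChart [CharZero k] : Chart k K := ⟨MvPolynomial (Fin 2) k, F.e, F.e_injective⟩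

/-- A point of the affine plane. -/
def pnt (α β : k) : MvPolynomial (Fin 2) k →ₐ[k] k := aeval ![α, β]

@[simp] theorem pnt_X0 (α β : k) : pnt α β (X 0) = α := by simp [pnt]
@[simp] theorem pnt_X1 (α β : k) : pnt α β (X 1) = β := by simp [pnt]

theorem eq_pnt (θ : MvPolynomial (Fin 2) k →ₐ[k] k) : θ = pnt (θ (X 0)) (θ (X 1)) := by
  ext i
  fin_cases i <;> simp

theorem exists_sub_C (α β : k) (a : MvPolynomial (Fin 2) k) :
    ∃ b c, a = C (pnt α β a) + b * (X 0 - C α) + c * (X 1 - C β) := by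
  induction a using MvPolynomial.induction_on with
  | C r => exact ⟨0, 0, by simp [pnt]⟩
  | add a a' ha ha' =>
    obtain ⟨b, c, e⟩ := ha
    obtain ⟨b', c', e'⟩ := ha'
    refine ⟨b + b', c + c', ?_⟩
    rw [map_add, C_add]
    linear_combination e + e'
  | mul_X a i ha =>
    obtain ⟨b, c, e⟩ := ha
    fin_cases i
    · refine ⟨C (pnt α β a) + b * X 0, c * X 0, ?_⟩
      simp only [Fin.zero_eta, map_mul, pnt_X0]
      linear_combination X 0 * e
    · refine ⟨b * X 1, C (pnt α β a) + c * X 1, ?_⟩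
      simp only [Fin.mk_one, map_mul, pnt_X1]
      linear_combination X 1 * e

variable [CharZero k]

/-- The local ring at a point of the plane of a frame. -/
def P (α β : k) : LPt k K k := F.toChart.pt (pnt α β)

theorem at_e (α β : k) (a : MvPolynomial (Fin 2) k) : (F.P α β).At (F.e a) (pnt α β a) :=
  Chart.pt_at (c := F.toChart) _ _

theorem at_p (α β : k) : (F.P α β).At F.p α := by simpa using F.at_e α β (X 0)
theorem at_q (α β : k) : (F.P α β).At F.q β := by simpa using F.at_e α β (X 1)

theorem P_le {α β : k} {V : LPt k K k} (hp : V.At F.p α) (hq : V.At F.q β) : F.P α β ≤ V := by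
  refine Chart.pt_le_iff.2 fun a => ?_
  change V.At (F.e a) (pnt α β a)
  induction a using MvPolynomial.induction_on with
  | C r =>
    have := at_algebraMap (P := V) r
    rw [← F.e_C] at this
    simpa [pnt] using this
  | add a b ha hb => rw [map_add, map_add]; exact ha.add hb
  | mul_X a i ha =>
    rw [map_mul, map_mul]
    refine ha.mul ?_
    fin_cases i
    · simpa using hp
    · simpa using hq

theorem mem_P {α β : k} {x : K} : x ∈ (F.P α β).O ↔ ∃ a b, pnt α β b ≠ 0 ∧ x = F.e a / F.e b := by
  constructor
  · intro hx
    obtain ⟨a, b, hb, e⟩ := Chart.mem_pt.1 hx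
    exact ⟨a, b, hb, (eq_div_iff ((F.at_e α β b).ne_zero hb)).2 e⟩
  · rintro ⟨a, b, hb, rfl⟩
    exact ((F.at_e α β a).div (F.at_e α β b) hb).mem

theorem regPt (α β : k) :
    RegPt (F.P α β) (F.p - algebraMap k K α) (F.q - algebraMap k K β) F.D₁ F.D₂ := by
  have hD : ∀ D : Derivation k K K, (∀ a, ∃ b, D (F.e a) = F.e b) →
      ∀ x ∈ (F.P α β).O, D x ∈ (F.P α β).O := by
    intro D h1 x hx
    obtain ⟨a, b, hb, rfl⟩ := F.mem_P.1 hx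
    obtain ⟨a', ha'⟩ := h1 a
    obtain ⟨b', hb'⟩ := h1 b
    have hbi := ((F.at_e α β b).inv hb).mem
    rw [div_eq_mul_inv, D.leibniz, Derivation.leibniz_inv, smul_eq_mul, smul_eq_mul, smul_eq_mul,
      ha', hb']
    exact add_mem (mul_mem (F.at_e α β a).mem (mul_mem (neg_mem (pow_mem hbi 2)) (F.at_e α β b').mem))
      (mul_mem hbi (F.at_e α β a').mem)
  refine ⟨hD _ fun a => ⟨_, F.D₁_e a⟩, hD _ fun a => ⟨_, F.D₂_e a⟩, ?_, ?_, ?_, ?_, ?_, ?_, ?_, ?_, ?_⟩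
  · simpa using (F.at_p α β).sub (at_algebraMap α)
  · simpa using (F.at_q α β).sub (at_algebraMap β)
  · simp [F.D₁_p]
  · simp [F.D₁_q]
  · simp [F.D₂_p]
  · simp [F.D₂_q]
  · intro x hx
    obtain ⟨a, b, hb, rfl⟩ := F.mem_P.1 hx.mem
    have ha : pnt α β a = 0 := by
      have h1 := hx.mul (F.at_e α β b)
      rw [div_mul_cancel₀ _ ((F.at_e α β b).ne_zero hb), zero_mul] at h1
      exact (F.at_e α β a).unique h1
    obtain ⟨c, d, e⟩ := exists_sub_C α β a
    have hbi := ((F.at_e α β b).inv hb).mem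
    refine ⟨F.e c * (F.e b)⁻¹, mul_mem (F.at_e α β c).mem hbi, F.e d * (F.e b)⁻¹,
      mul_mem (F.at_e α β d).mem hbi, ?_⟩
    rw [ha, C_0, zero_add] at e
    rw [e]
    simp only [map_add, map_mul, map_sub, e_X0, e_X1, e_C]
    ring
  · exact isNoetherianRing_ofHoms (R := MvPolynomial (Fin 2) k) (f := F.e) (g := pnt α β)
      (h := fun r hr => by rw [F.e_injective (hr.trans (map_zero _).symm), map_zero])
  · intro x
    obtain ⟨a, b, hb, e⟩ := F.frac x
    exact ⟨_, (F.at_e α β a).mem, _, (F.at_e α β b).mem, hb, e⟩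

/-- Exchanging the coordinates of a frame. -/
def swap : Frame k K where
  p := F.q
  q := F.p
  D₁ := F.D₂
  D₂ := F.D₁
  D₁_p := F.D₂_q
  D₁_q := F.D₂_p
  D₂_p := F.D₁_q
  D₂_q := F.D₁_p
  frac := fun x => by
    obtain ⟨a, b, hb, e⟩ := F.frac x
    have key : ∀ a : MvPolynomial (Fin 2) k, aeval ![F.q, F.p] (aeval ![(X 1 : MvPolynomial (Fin 2) k), X 0] a) =
        aeval ![F.p, F.q] a := by
      intro a
      rw [← AlgHom.comp_apply]
      congr 1
      ext i
      fin_cases i <;> simp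
    exact ⟨aeval ![X 1, X 0] a, aeval ![X 1, X 0] b, by rwa [key], by rw [key, key, e]⟩

theorem swap_P (α β : k) : F.swap.P β α = F.P α β :=
  le_antisymm (F.swap.P_le (F.at_q α β) (F.at_p α β)) (F.P_le (F.swap.at_q β α) (F.swap.at_p β α))

/-- The main chart of the blow-up of a frame at a point. -/
def blow (α β : k) : Frame k K where
  p := F.p - algebraMap k K α
  q := (F.q - algebraMap k K β) / (F.p - algebraMap k K α)
  D₁ := F.D₁ + ((F.q - algebraMap k K β) / (F.p - algebraMap k K α)) • F.D₂
  D₂ := (F.p - algebraMap k K α) • F.D₂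
  D₁_p := ((F.regPt α β).regPt_tr 0).D₁_u
  D₁_q := by simpa using ((F.regPt α β).regPt_tr 0).D₁_v
  D₂_p := ((F.regPt α β).regPt_tr 0).D₂_u
  D₂_q := by simpa using ((F.regPt α β).regPt_tr 0).D₂_v
  frac := fun x => by
    obtain ⟨a, b, hb, e⟩ := F.frac x
    have hu := (F.regPt α β).u_ne
    have key : ∀ a : MvPolynomial (Fin 2) k, aeval ![F.p - algebraMap k K α,
        (F.q - algebraMap k K β) / (F.p - algebraMap k K α)]
        (aeval ![(X 0 + C α : MvPolynomial (Fin 2) k), X 0 * X 1 + C β] a) =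
        aeval ![F.p, F.q] a := by
      intro a
      rw [← AlgHom.comp_apply]
      congr 1
      ext i
      fin_cases i
      · simp
      · simp [mul_div_cancel₀ _ hu]
    exact ⟨_, _, by rw [key b]; exact hb, by rw [key a, key b, e]⟩

theorem tr_eq (α β c : k) : (F.regPt α β).tr c = (F.blow α β).P 0 c := by
  have hu := (F.regPt α β).u_ne
  refine le_antisymm ((F.regPt α β).tr_le (F.P_le ?_ ?_) ((F.blow α β).at_q 0 c))
    ((F.blow α β).P_le ((F.regPt α β).at_u.mono ((F.regPt α β).le_tr c)) ((F.regPt α β).tr_at c))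
  · have := ((F.blow α β).at_p 0 c).add (at_algebraMap α)
    simpa [blow] using this
  · have := (((F.blow α β).at_p 0 c).mul ((F.blow α β).at_q 0 c)).add (at_algebraMap β)
    simpa [blow, mul_div_cancel₀ _ hu] using this

theorem inf_eq (α β : k) : (F.regPt α β).inf = (F.swap.blow β α).P 0 0 := by
  rw [← F.swap.tr_eq β α 0]
  have : ∀ (P P' : LPt k K k) (h : P = P') (u v : K) (D₁ D₂ : Derivation k K K)
    (h1 : RegPt P u v D₁ D₂) (h2 : RegPt P' u v D₁ D₂), h1.tr 0 = h2.tr 0 := by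
    rintro P _ rfl _ _ _ _ _ _; rfl
  exact this _ _ (F.swap_P α β).symm _ _ _ _ _ _

end Frame

namespace LPt

variable {k K : Type u} [Field k] [Field K] [Algebra k K]

/-- The `k`-subspace underlying a power of the maximal ideal. -/
def mpSubmodule (P : LPt k K k) (n : ℕ) : Submodule k K where
  carrier := {x | P.MP n x}
  add_mem' := MP.add
  zero_mem' := MP.zero
  smul_mem' := fun c x hx => by
    rw [Algebra.smul_def]
    exact hx.mul_mem (P.O.algebraMap_mem c)

/-- Membership in the ideal generated by two elements. -/
def In (P : LPt k K k) (a b x : K) : Prop := ∃ α ∈ P.O, ∃ β ∈ P.O, x = α * a + β * b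

variable {P P' : LPt k K k} {a b x y : K}

theorem In.add (hx : P.In a b x) (hy : P.In a b y) : P.In a b (x + y) := by
  obtain ⟨α, hα, β, hβ, rfl⟩ := hx
  obtain ⟨α', hα', β', hβ', rfl⟩ := hy
  exact ⟨α + α', add_mem hα hα', β + β', add_mem hβ hβ', by ring⟩

theorem In.mul_mem (hx : P.In a b x) (hy : y ∈ P.O) : P.In a b (y * x) := by
  obtain ⟨α, hα, β, hβ, rfl⟩ := hx
  exact ⟨y * α, P.O.mul_mem hy hα, y * β, P.O.mul_mem hy hβ, by ring⟩

theorem In.zero : P.In a b 0 := ⟨0, zero_mem _, 0, zero_mem _, by ring⟩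

theorem In.left : P.In a b a := ⟨1, one_mem _, 0, zero_mem _, by ring⟩

theorem In.sum {ι : Type*} {s : Finset ι} {f : ι → K} (h : ∀ i ∈ s, P.In a b (f i)) :
    P.In a b (∑ i ∈ s, f i) := by
  classical
  induction s using Finset.induction_on with
  | empty => simpa using In.zero
  | insert i s hi ih =>
    rw [Finset.sum_insert hi]
    exact (h i (by simp)).add (ih fun j hj => h j (by simp [hj]))

/-- The finite-dimensional space `S` surjects onto the quotient by the ideal `(a, b)`. -/
structure Spans (P : LPt k K k) (S : Submodule k K) (a b : K) : Prop where
  fin : FiniteDimensional k S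
  mem : ∀ s ∈ S, s ∈ P.O
  exists_sub : ∀ x ∈ P.O, ∃ s ∈ S, P.In a b (x - s)

theorem at_aeval {c : k} (hx : P.At x c) (F : Polynomial k) :
    P.At (Polynomial.aeval x F) (F.eval c) := by
  induction F using Polynomial.induction_on' with
  | add p q hp hq => rw [map_add, Polynomial.eval_add]; exact hp.add hq
  | monomial n r =>
    rw [Polynomial.aeval_monomial, Polynomial.eval_monomial]
    exact (at_algebraMap r).mul (hx.pow n)

theorem Spans.exists_pow {S : Submodule k K} (h : P.Spans S a b) {u : K} (hu : P.At u 0) :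
    ∃ M, P.In a b (u ^ M) := by
  have := h.fin
  choose s hs hI using fun j : ℕ => h.exists_sub (u ^ j) (hu.pow j).mem
  have hdep : ¬ LinearIndependent k (fun j : Fin (Module.finrank k S + 1) => (⟨s j, hs j⟩ : S)) := by
    intro hli
    have := hli.fintype_card_le_finrank
    simp at this
  obtain ⟨g, hg, i, hi⟩ := Fintype.not_linearIndependent_iff.1 hdep
  set F : Polynomial k := ∑ j : Fin (Module.finrank k S + 1), Polynomial.monomial (j : ℕ) (g j) with hF
  have hF0 : F ≠ 0 := by
    intro h0
    apply hi
    have := congrArg (fun p : Polynomial k => p.coeff (i : ℕ)) h0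
    simp only [hF, Polynomial.finsetSum_coeff, Polynomial.coeff_monomial, Polynomial.coeff_zero] at this
    rw [Finset.sum_eq_single i] at this
    · simpa using this
    · intro j _ hj
      rw [if_neg (fun h => hj (Fin.ext h))]
    · simp
  have hFI : P.In a b (Polynomial.aeval u F) := by
    have h1 : ∑ j : Fin (Module.finrank k S + 1), algebraMap k K (g j) * s j = 0 := by
      have := congrArg Subtype.val hg
      simpa [Algebra.smul_def] using this
    have h2 : Polynomial.aeval u F = ∑ j : Fin (Module.finrank k S + 1),
        algebraMap k K (g j) * (u ^ (j : ℕ) - s j) := by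
      simp only [mul_sub, Finset.sum_sub_distrib, h1, sub_zero, hF, map_sum, Polynomial.aeval_monomial]
    rw [h2]
    exact In.sum fun j _ => (hI j).mul_mem (P.O.algebraMap_mem _)
  obtain ⟨G, hG, hd⟩ := Polynomial.exists_eq_pow_rootMultiplicity_mul_and_not_dvd F hF0 0
  refine ⟨F.rootMultiplicity 0, ?_⟩
  have hG0 : G.eval 0 ≠ 0 := fun h0 => hd (Polynomial.dvd_iff_isRoot.2 h0)
  have hGu := at_aeval hu G
  have h3 := hFI.mul_mem (hGu.inv hG0).mem
  have h4 := hGu.ne_zero hG0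
  rw [hG] at h3
  simp only [map_zero, sub_zero, map_mul, map_pow, Polynomial.aeval_X] at h3
  rwa [mul_comm, mul_inv_cancel_right₀ h4] at h3

end LPt

namespace RegPt

variable {k K : Type u} [Field k] [CharZero k] [Field K] [Algebra k K] {P : LPt k K k} {u v : K}
  {D₁ D₂ : Derivation k K K} (h : RegPt P u v D₁ D₂)

theorem tr_inj {c c' : k} {Q : LPt k K k} (hc : h.tr c ≤ Q) (hc' : h.tr c' ≤ Q) : c = c' :=
  ((h.tr_at c).mono hc).unique ((h.tr_at c').mono hc')

theorem tr_inf {c : k} {Q : LPt k K k} (hc : h.tr c ≤ Q) (hc' : h.inf ≤ Q) : False := by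
  have h1 := ((h.tr_at c).mono hc).mul (h.inf_at.mono hc')
  rw [div_mul_div_cancel₀ h.u_ne, div_self h.v_ne, mul_zero] at h1
  exact one_ne_zero (at_one.unique h1)

theorem exists_mul_of_red (c : k) {H : Polynomial P.O} (hH : P.red H = 0) :
    ∃ z ∈ (h.tr c).O, P.evK (v / u) H = u * z := by
  have hu := h.u_ne
  rw [evK_eq_sum, Polynomial.sum_def]
  suffices ∀ i ∈ H.support, ∃ z ∈ (h.tr c).O, (H.coeff i : K) * (v / u) ^ i = u * z by
    choose! z hz e using this
    exact ⟨∑ i ∈ H.support, z i, sum_mem hz, by rw [Finset.mul_sum]; exact Finset.sum_congr rfl e⟩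
  intro i _
  have h0 : P.At (H.coeff i : K) 0 := by
    have := at_coe (P := P) (H.coeff i)
    rwa [← red_coeff, hH, Polynomial.coeff_zero] at this
  obtain ⟨α, hα, β, hβ, e⟩ := h.gen _ h0
  have hw := (h.tr_at c).mem
  refine ⟨(α + β * (v / u)) * (v / u) ^ i, mul_mem (add_mem (mem_mono (h.le_tr c) hα)
    (mul_mem (mem_mono (h.le_tr c) hβ) hw)) (pow_mem hw i), ?_⟩
  rw [e]
  field_simp

theorem exists_trunc (c : k) (i : ℕ) {x : K} (hx : x ∈ (h.tr c).O) :
    ∃ G : Polynomial P.O, G.natDegree ≤ i ∧ ∃ y ∈ (h.tr c).O, ∃ z ∈ (h.tr c).O,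
      x = P.evK (v / u) G + (v / u - algebraMap k K c) ^ i * y + u * z := by
  induction i with
  | zero => exact ⟨0, by simp, x, hx, 0, zero_mem _, by simp⟩
  | succ i ih =>
    obtain ⟨G, hG, y, hy, z, hz, e⟩ := ih
    obtain ⟨γ, hγ⟩ := exists_at hy
    have h0 := hγ.sub (at_algebraMap γ)
    rw [Algebra.algebraMap_self, RingHom.id_apply, sub_self] at h0
    obtain ⟨α, hα, β, hβ, e'⟩ := (h.regPt_tr c).gen _ h0
    rw [sub_eq_iff_eq_add] at e'
    have hwc := (h.regPt_tr c).at_v.mem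
    refine ⟨G + (Polynomial.X - Polynomial.C (algebraMap k P.O c)) ^ i *
      Polynomial.C (algebraMap k P.O γ), ?_, β, hβ, (v / u - algebraMap k K c) ^ i * α + z,
      add_mem (mul_mem (pow_mem hwc i) hα) hz, ?_⟩
    · refine Polynomial.natDegree_add_le_of_degree_le (hG.trans i.le_succ) ?_
      refine (Polynomial.natDegree_mul_C_le _ _).trans ?_
      refine (Polynomial.natDegree_pow_le_of_le i (Polynomial.natDegree_X_sub_C_le _)).trans ?_
      omega
    · have h1 : ∀ t, ((algebraMap k P.O t : P.O) : K) = algebraMap k K t := fun t => rfl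
      simp only [map_add, map_mul, map_pow, map_sub, evK_X, evK_C, h1]
      rw [e, e']
      ring

/-- The dimension of the quotient by `(a, b)` drops under blowing up, if `a` and `b` are not
both units or zero. -/
theorem spans_tr (c : k) {r : ℕ} {a b : K} (hr : 1 ≤ r) (ha : P.MP r a) (hb : P.MP r b)
    (ha' : ¬ P.MP (r + 1) a) {S : Submodule k K} (hS : P.Spans S a b) :
    ∃ S' : Submodule k K, Module.finrank k S' < Module.finrank k S ∧
      (h.tr c).Spans S' (a / u ^ r) (b / u ^ r) := by
  classical
  have hu := h.u_ne
  have hur := pow_ne_zero r hu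
  have := hS.fin
  have hle : ∀ {x}, x ∈ P.O → x ∈ (h.tr c).O := fun hx => mem_mono (h.le_tr c) hx
  have hdiv : ∀ {y}, P.MP r y → y / u ^ r ∈ (h.tr c).O := by
    intro y hy
    obtain ⟨F, -, rfl⟩ := h.exists_poly hy
    rw [mul_div_cancel_left₀ _ hur]
    exact (h.tr_at_evK c F).mem
  have hIn : ∀ {y}, P.In a b y → (h.tr c).In (a / u ^ r) (b / u ^ r) (y / u ^ r) := by
    rintro _ ⟨α, hα, β, hβ, rfl⟩
    exact ⟨α, hle hα, β, hle hβ, by ring⟩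
  have hlt : S ⊓ P.mpSubmodule r < S := by
    refine lt_of_le_of_ne inf_le_left fun he => ?_
    obtain ⟨s, hs, α, hα, β, hβ, e⟩ := hS.exists_sub 1 (one_mem _)
    have hs' : P.MP r s := by rw [← he] at hs; exact hs.2
    have h1 : P.MP r 1 := by
      rw [eq_add_of_sub_eq e]
      exact ((ha.mul_mem hα).add (hb.mul_mem hβ)).add hs'
    exact one_ne_zero (at_one.unique (mp_one_iff.1 (h1.mono hr)))
  refine ⟨(S ⊓ P.mpSubmodule r).map (LinearMap.mulLeft k (u ^ r)⁻¹),
    (Submodule.finrank_map_le _ _).trans_lt (Submodule.finrank_lt_finrank_of_lt hlt), ?_, ?_, ?_⟩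
  · infer_instance
  · rintro _ ⟨s, ⟨-, hs⟩, rfl⟩
    rw [LinearMap.mulLeft_apply, inv_mul_eq_div]
    exact hdiv hs
  -- it suffices to write elements using `m ^ r`
  suffices key : ∀ x ∈ (h.tr c).O, ∃ y, P.MP r y ∧ (h.tr c).In (a / u ^ r) (b / u ^ r) (x - y / u ^ r) by
    intro x hx
    obtain ⟨y, hy, hxy⟩ := key x hx
    obtain ⟨s, hs, hys⟩ := hS.exists_sub y hy.mem
    have hs' : P.MP r s := by
      obtain ⟨α, hα, β, hβ, e⟩ := hys
      rw [show s = y - (α * a + β * b) by rw [← e]; ring]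
      exact hy.sub ((ha.mul_mem hα).add (hb.mul_mem hβ))
    refine ⟨_, ⟨s, ⟨hs, hs'⟩, rfl⟩, ?_⟩
    rw [LinearMap.mulLeft_apply, inv_mul_eq_div]
    convert hxy.add (hIn hys) using 1
    ring
  obtain ⟨A, hA, hAe⟩ := h.exists_poly ha
  have hA0 : P.red A ≠ 0 := fun h0 => ha' (by rw [hAe]; exact h.mp_evK_succ hA h0)
  obtain ⟨A', hA', hd⟩ := Polynomial.exists_eq_pow_rootMultiplicity_mul_and_not_dvd _ hA0 c
  set e := (P.red A).rootMultiplicity c with he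
  have her : e ≤ r := by
    rw [he, ← Polynomial.count_roots]
    exact (Multiset.count_le_card _ _).trans ((Polynomial.card_roots' _).trans
      (Polynomial.natDegree_map_le.trans hA))
  obtain ⟨A₁, hA₁⟩ := P.red_surjective A'
  have hA₁c : (P.red A₁).eval c ≠ 0 := by
    rw [hA₁]; exact fun h0 => hd (Polynomial.dvd_iff_isRoot.2 h0)
  -- the power of the local parameter lies in the ideal modulo `u`
  obtain ⟨z, hz, hze⟩ : ∃ z ∈ (h.tr c).O, (h.tr c).In (a / u ^ r) (b / u ^ r)
      ((v / u - algebraMap k K c) ^ e - u * z) := by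
    obtain ⟨z, hz, hze⟩ := h.exists_mul_of_red c (H := A -
      (Polynomial.X - Polynomial.C (algebraMap k P.O c)) ^ e * A₁) (by
        rw [map_sub, map_mul, map_pow, map_sub, red_X, red_C, hA₁]
        conv_lhs => rw [hA']
        rw [show P.res (algebraMap k P.O c) = c from P.res.commutes c, sub_self])
    have hi := (h.tr_at_evK c A₁).inv hA₁c
    have h0 := (h.tr_at_evK c A₁).ne_zero hA₁c
    refine ⟨-((P.evK (v / u) A₁)⁻¹ * z), neg_mem (mul_mem hi.mem hz), ?_⟩
    convert (In.left (P := h.tr c) (a := a / u ^ r) (b := b / u ^ r)).mul_mem hi.mem using 1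
    rw [hAe, mul_div_cancel_left₀ _ hur]
    have h1 : ((algebraMap k P.O c : P.O) : K) = algebraMap k K c := rfl
    simp only [map_sub, map_mul, map_pow, evK_X, evK_C, h1] at hze
    rw [sub_eq_iff_eq_add] at hze
    rw [hze]
    field_simp
    ring
  have step : ∀ x ∈ (h.tr c).O, ∃ y, P.MP r y ∧ ∃ t ∈ (h.tr c).O,
      (h.tr c).In (a / u ^ r) (b / u ^ r) (x - y / u ^ r - u * t) := by
    intro x hx
    obtain ⟨G, hG, y, hy, z', hz', rfl⟩ := h.exists_trunc c e hx
    refine ⟨_, h.mp_evK (hG.trans her), z * y + z', add_mem (mul_mem hz hy) hz', ?_⟩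
    convert hze.mul_mem hy using 1
    rw [mul_div_cancel_left₀ _ hur]
    ring
  have iter : ∀ M : ℕ, ∀ x ∈ (h.tr c).O, ∃ y, P.MP r y ∧ ∃ t ∈ (h.tr c).O,
      (h.tr c).In (a / u ^ r) (b / u ^ r) (x - y / u ^ r - u ^ M * t) := by
    intro M
    induction M with
    | zero => exact fun x hx => ⟨0, MP.zero, x, hx, by simpa using In.zero⟩
    | succ M ih =>
      intro x hx
      obtain ⟨y, hy, t, ht, e1⟩ := ih x hx
      obtain ⟨y', hy', t', ht', e2⟩ := step t ht
      have huM := (h.at_u.pow M).mem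
      refine ⟨y + u ^ M * y', hy.add (hy'.mul_mem huM), t', ht', ?_⟩
      convert e1.add (e2.mul_mem (hle huM)) using 1
      ring
  intro x hx
  obtain ⟨M, hM⟩ := hS.exists_pow h.at_u
  obtain ⟨y, hy, t, ht, e1⟩ := iter M x hx
  refine ⟨y, hy, ?_⟩
  convert e1.add ((hIn hM).mul_mem (mul_mem ht (hle (h.at_u.pow r).mem))) using 1
  field_simp
  ring

end RegPt

section

variable {k K : Type u} [Field k] [Field K] [Algebra k K] {Q : Type u} [CommRing Q]

theorem HasClass.exists_pt {μ : AlgMeasure k Q} {G : Set (Chart k K)} {S : Set (LPt k K k)} {q : Q}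
    (h : HasClass μ G S q) {P : LPt k K k} (hP : P ∈ S) : ∃ c ∈ G, ∃ θ, P = Chart.pt c θ := by
  obtain ⟨ι, _, ch, C, h1, -, -, rfl, -⟩ := h
  obtain ⟨i, θ, -, rfl⟩ := Set.mem_iUnion.1 hP
  exact ⟨ch i, h1 i, θ, rfl⟩

theorem HasClass.finite [IsAlgClosed k] {μ : AlgMeasure k Q} {G : Set (Chart k K)} {S : Set (LPt k K k)} {q : Q}
    (h : HasClass μ G S q) (B : Finset (LPt k K k)) (hB : (B : Set (LPt k K k)) ⊆ S) :
    HasClass μ G (B : Set (LPt k K k)) B.card := by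
  have := HasClass.biUnion (μ := μ) (G := G) B (S := fun b => {b}) (q := fun _ => 1) (fun b hb => by
    obtain ⟨c, hc, θ, rfl⟩ := h.exists_pt (hB hb)
    exact HasClass.singleton hc θ) (by
      intro a _ b _ hab
      simpa using hab)
  have e : (⋃ b ∈ B, {b} : Set (LPt k K k)) = B := Set.biUnion_of_singleton (B : Set (LPt k K k))
  rw [e] at this
  simpa using this

/-- Every place is above at most one member of the family. -/
def Sep (E : Set (LPt k K k)) : Prop :=
  ∀ V : LPt k K k, V.IsPlace → ∀ e ∈ E, ∀ e' ∈ E, e ≤ V → e' ≤ V → e = e'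

/-- The family `E'` is proper over `E`. -/
def Dom (E E' : Set (LPt k K k)) : Prop := (∀ e' ∈ E', ∃ e ∈ E, e ≤ e') ∧
  ∀ V : LPt k K k, V.IsPlace → (∃ e ∈ E, e ≤ V) → ∃ e' ∈ E', e' ≤ V

theorem Dom.trans {E E' E'' : Set (LPt k K k)} (h : Dom E E') (h' : Dom E' E'') : Dom E E'' := by
  refine ⟨fun e'' he'' => ?_, fun V hV he => h'.2 V hV (h.2 V hV he)⟩
  obtain ⟨e', he', hle'⟩ := h'.1 e'' he''
  obtain ⟨e, he, hle⟩ := h.1 e' he'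
  exact ⟨e, he, hle.trans hle'⟩

theorem Dom.refl (E : Set (LPt k K k)) : Dom E E := ⟨fun e he => ⟨e, he, le_rfl⟩, fun _ _ h => h⟩

/-- The function `f` or its inverse is regular at `P`. -/
def LPt.Resolved (P : LPt k K k) (f : K) : Prop := f ∈ P.O ∨ f⁻¹ ∈ P.O

/-- The polynomial charts. -/
def frames (k K : Type u) [Field k] [Field K] [Algebra k K] [CharZero k] : Set (Chart k K) :=
  {c | ∃ F : Frame k K, F.toChart = c}

/-- There is a modification of the family `E`, of class `q`, resolving `f`. -/
def Refinable [CharZero k] (μ : AlgMeasure k Q) (E : Set (LPt k K k)) (q : Q) (f : K) : Prop :=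
  ∃ E', HasClass μ (frames k K) E' q ∧ Sep E' ∧ Dom E E' ∧ ∀ P ∈ E', P.Resolved f

theorem Refinable.inv [CharZero k] {μ : AlgMeasure k Q} {E : Set (LPt k K k)} {q : Q} {f : K}
    (h : Refinable μ E q f⁻¹) : Refinable μ E q f := by
  obtain ⟨E', h1, h2, h3, h4⟩ := h
  exact ⟨E', h1, h2, h3, fun P hP => by simpa [Resolved, or_comm] using h4 P hP⟩

theorem Refinable.dom [CharZero k] {μ : AlgMeasure k Q} {E E' : Set (LPt k K k)} {q : Q} {f : K}
    (h : Refinable μ E' q f) (hd : Dom E E') : Refinable μ E q f := by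
  obtain ⟨E'', h1, h2, h3, h4⟩ := h
  exact ⟨E'', h1, h2, hd.trans h3, h4⟩

theorem sep_singleton (P : LPt k K k) : Sep {P} := by
  rintro V - e rfl e' rfl - -
  rfl

theorem refinable_of_finite [IsAlgClosed k] [CharZero k] {μ : AlgMeasure k Q} {E : Set (LPt k K k)}
    {q : Q} {f : K} (hE : HasClass μ (frames k K) E q) (hs : Sep E)
    (B : Finset (LPt k K k)) (hB : (B : Set (LPt k K k)) ⊆ E)
    (hgood : ∀ e ∈ E, e ∉ B → e.Resolved f) (hbad : ∀ b ∈ B, Refinable μ {b} 1 f) :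
    Refinable μ E q f := by
  choose! R h1 h2 h3 h4 using hbad
  have hle : ∀ b ∈ B, ∀ e ∈ R b, b ≤ e := by
    intro b hb e he
    obtain ⟨_, rfl, h⟩ := (h3 b hb).1 e he
    exact h
  have hs' : ∀ P e e', e ∈ E → e' ∈ E → e ≤ P → e' ≤ P → e = e' := by
    intro P e e' he he' h h'
    obtain ⟨V, hPV, hV⟩ := exists_place_ge P
    exact hs V hV e he e' he' (h.trans hPV) (h'.trans hPV)
  refine ⟨(E \ B) ∪ ⋃ b ∈ B, R b, ?_, ?_, ⟨?_, ?_⟩, ?_⟩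
  · have e1 := hE.diff (hE.finite B hB) hB
    have e2 := HasClass.biUnion B (S := R) (q := fun _ => 1) h1 (by
      intro b hb b' hb' hne
      refine Set.disjoint_left.2 fun P hP hP' => hne ?_
      exact hs' P b b' (hB hb) (hB hb') (hle b hb P hP) (hle b' hb' P hP'))
    have := e1.union e2 (by
      refine Set.disjoint_left.2 fun P hP hP' => ?_
      simp only [Set.mem_iUnion] at hP'
      obtain ⟨b, hb, hPb⟩ := hP'
      refine hP.2 ?_
      rw [hs' P P b hP.1 (hB hb) le_rfl (hle b hb P hPb)]
      exact hb)
    simpa using this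
  · have key : ∀ e ∈ (E \ B) ∪ ⋃ b ∈ B, R b, (e ∈ E ∧ e ∉ B) ∨ ∃ b ∈ B, e ∈ R b := by
      rintro e (he | he)
      · exact Or.inl he
      · simp only [Set.mem_iUnion] at he
        obtain ⟨b, hb, h⟩ := he
        exact Or.inr ⟨b, hb, h⟩
    intro V hV e he e' he' hl hl'
    rcases key e he with ⟨m, n⟩ | ⟨b, hb, m⟩ <;> rcases key e' he' with ⟨m', n'⟩ | ⟨b', hb', m'⟩
    · exact hs V hV e m e' m' hl hl'
    · obtain rfl := hs V hV e m b' (hB hb') hl ((hle b' hb' e' m').trans hl')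
      exact absurd hb' n
    · obtain rfl := hs V hV b (hB hb) e' m' ((hle b hb e m).trans hl) hl'
      exact absurd hb n'
    · obtain rfl := hs V hV b (hB hb) b' (hB hb') ((hle b hb e m).trans hl) ((hle b' hb' e' m').trans hl')
      exact h2 b hb V hV e m e' m' hl hl'
  · rintro e (he | he)
    · exact ⟨e, he.1, le_rfl⟩
    · simp only [Set.mem_iUnion] at he
      obtain ⟨b, hb, h⟩ := he
      exact ⟨b, hB hb, hle b hb e h⟩
  · rintro V hV ⟨e, he, hl⟩
    by_cases heB : e ∈ B
    · obtain ⟨e', he', h⟩ := (h3 e heB).2 V hV ⟨e, rfl, hl⟩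
      exact ⟨e', Or.inr (by simp only [Set.mem_iUnion]; exact ⟨e, heB, he'⟩), h⟩
    · exact ⟨e, Or.inl ⟨he, heB⟩, hl⟩
  · rintro e (he | he)
    · exact hgood e he.1 he.2
    · simp only [Set.mem_iUnion] at he
      obtain ⟨b, hb, h⟩ := he
      exact h4 b hb e h

namespace Frame

variable [CharZero k] (F : Frame k K)

theorem mem_image {S : Set (MvPolynomial (Fin 2) k →ₐ[k] k)} {P : LPt k K k} :
    P ∈ F.toChart.pt '' S ↔ ∃ α β, pnt α β ∈ S ∧ F.P α β = P := by
  constructor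
  · rintro ⟨θ, hθ, rfl⟩
    have e := eq_pnt (k := k) θ
    exact ⟨_, _, e ▸ hθ, congrArg F.toChart.pt e.symm⟩
  · rintro ⟨α, β, h, rfl⟩
    exact ⟨pnt α β, h, rfl⟩

theorem exists_of_pt {c : Chart k K} (hc : c ∈ frames k K)
    (θ : c.A →ₐ[k] k) : ∃ (F : Frame k K) (α β : k), c.pt θ = F.P α β := by
  obtain ⟨F, rfl⟩ := hc
  have : (θ : MvPolynomial (Fin 2) k →ₐ[k] k) = pnt (θ (X 0 : MvPolynomial (Fin 2) k)) (θ (X 1 : MvPolynomial (Fin 2) k)) :=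
    eq_pnt θ
  exact ⟨F, _, _, congrArg F.toChart.pt this⟩

variable [IsAlgClosed k]

theorem hasClass_point (μ : AlgMeasure k Q) (α β : k) :
    HasClass μ (frames k K) {F.P α β} 1 :=
  HasClass.singleton (c := F.toChart) (show F.toChart ∈ frames k K from ⟨F, rfl⟩) (pnt α β)

theorem hasClass_axis (μ : AlgMeasure k Q) :
    HasClass μ (frames k K) (Set.range fun c => F.P 0 c) 0 := by
  have h := HasClass.of_chart (μ := μ) (G := frames k K) (c := F.toChart) ⟨F, rfl⟩
    (C := {θ : MvPolynomial (Fin 2) k →ₐ[k] k | θ (X 0) = 0}) (conSet_eq_zero _)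
  let g : MvPolynomial (Fin 2) k →ₐ[k] Polynomial k := aeval ![0, Polynomial.X]
  have hg : IsLCI g 1 := by
    refine ⟨by simp, fun y => ⟨Polynomial.aeval (X 1) y, 0, ?_⟩⟩
    rw [pow_zero, mul_one, ← Polynomial.aeval_algHom_apply]
    simp [g]
  have e1 : ∀ η : Polynomial k →ₐ[k] k, (η.comp g) (X 0) = 0 := fun η => by simp [g]
  have h0 := (hg.nu_eq μ (ψ := 1) (φ := ind {θ : MvPolynomial (Fin 2) k →ₐ[k] k | θ (X 0) = 0})
    isCon_one (fun η => ?_) (fun θ hθ => ?_)).2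
  · rw [μ.nu_one, μ.poly inferInstance] at h0
    have h' : HasClass μ (frames k K) (F.toChart.pt '' {θ : MvPolynomial (Fin 2) k →ₐ[k] k | θ (X 0) = 0}) 0 := h0 ▸ h
    convert h' using 1
    ext P
    refine Iff.trans ?_ (F.mem_image (P := P) (S := {θ : MvPolynomial (Fin 2) k →ₐ[k] k | θ (X 0) = 0})).symm
    constructor
    · rintro ⟨c, rfl⟩
      exact ⟨0, c, pnt_X0 _ _, rfl⟩
    · rintro ⟨α, β, h1, rfl⟩
      obtain rfl : α = 0 := (pnt_X0 α β).symm.trans h1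
      exact ⟨β, rfl⟩
  · exact Set.indicator_of_mem (show η.comp g ∈ {θ : MvPolynomial (Fin 2) k →ₐ[k] k | θ (X 0) = 0} from e1 η) _
  · refine Set.indicator_of_notMem (fun h0 => hθ ?_) _
    refine ⟨Polynomial.aeval (θ (X 1)), ?_⟩
    ext i
    fin_cases i
    · have : θ (X 0) = 0 := h0
      simp [g, this]
    · simp [g]

end Frame

end

section

variable {k K : Type u} [Field k] [Field K] [Algebra k K] {Q : Type u} [CommRing Q]

theorem LPt.Spans.symm {P : LPt k K k} {S : Submodule k K} {a b : K} (h : P.Spans S a b) : P.Spans S b a where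
  fin := h.fin
  mem := h.mem
  exists_sub x hx := by
    obtain ⟨s, hs, α, hα, β, hβ, e⟩ := h.exists_sub x hx
    exact ⟨s, hs, β, hβ, α, hα, by rw [e, add_comm]⟩

theorem LPt.Resolved.mono {P P' : LPt k K k} {f : K} (h : P.Resolved f) (hle : P ≤ P') : P'.Resolved f :=
  h.imp (mem_mono hle) (mem_mono hle)

variable [CharZero k]

theorem RegPt.mem_tr_div {P : LPt k K k} {u v : K} {D₁ D₂ : Derivation k K K} (h : RegPt P u v D₁ D₂) (c : k) {r : ℕ} {a : K}
    (ha : P.MP r a) : a / u ^ r ∈ (h.tr c).O := by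
  obtain ⟨F, -, rfl⟩ := h.exists_poly ha
  rw [mul_div_cancel_left₀ _ (pow_ne_zero _ h.u_ne)]
  exact (h.tr_at_evK c F).mem

variable [IsAlgClosed k]

/-- The points of the blow-up of a point. -/
def RegPt.blowUp {P : LPt k K k} {u v : K} {D₁ D₂ : Derivation k K K} (h : RegPt P u v D₁ D₂) : Set (LPt k K k) :=
  Set.range h.tr ∪ {h.inf}

namespace RegPt

variable {P : LPt k K k} {u v : K} {D₁ D₂ : Derivation k K K} (h : RegPt P u v D₁ D₂)

theorem dom_blowUp : Dom {P} h.blowUp := by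
  constructor
  · rintro _ (⟨c, rfl⟩ | rfl)
    · exact ⟨P, rfl, h.le_tr c⟩
    · exact ⟨P, rfl, h.le_inf⟩
  · rintro V hV ⟨_, rfl, hl⟩
    rcases h.exists_tr_le hl hV with ⟨c, hc, -⟩ | ⟨hc, -⟩
    · exact ⟨_, Or.inl ⟨c, rfl⟩, hc⟩
    · exact ⟨_, Or.inr rfl, hc⟩

theorem sep_blowUp : Sep h.blowUp := by
  rintro V - _ (⟨c, rfl⟩ | rfl) _ (⟨c', rfl⟩ | rfl) hl hl'
  · rw [h.tr_inj hl hl']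
  · exact (h.tr_inf hl hl').elim
  · exact (h.tr_inf hl' hl).elim
  · rfl

end RegPt

namespace Frame

variable (F : Frame k K)

theorem hasClass_blowUp (μ : AlgMeasure k Q) (α β : k) :
    HasClass μ (frames k K) (F.regPt α β).blowUp 1 := by
  have h1 := (F.blow α β).hasClass_axis μ
  have h2 := (F.swap.blow β α).hasClass_point μ 0 0
  rw [← F.inf_eq] at h2
  have e : (fun c => (F.blow α β).P 0 c) = (F.regPt α β).tr := funext fun c => (F.tr_eq α β c).symm
  rw [e] at h1
  have := h1.union h2 (by
    refine Set.disjoint_left.2 ?_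
    rintro _ ⟨c, rfl⟩ h0
    rw [Set.mem_singleton_iff] at h0
    exact (F.regPt α β).tr_inf (h0 ▸ le_rfl : (F.regPt α β).tr c ≤ (F.regPt α β).inf) le_rfl)
  rwa [zero_add] at this

theorem refinable_step (μ : AlgMeasure k Q) {n : ℕ}
    (ih : ∀ (F : Frame k K) (α β : k) (a b : K) (S : Submodule k K), a ∈ (F.P α β).O → b ∈ (F.P α β).O →
      (F.P α β).Spans S a b → Module.finrank k S < n → Refinable μ {F.P α β} 1 (a / b))
    {α β : k} {a b : K} {S : Submodule k K} {r : ℕ} (hr : 1 ≤ r) (ha : (F.P α β).MP r a)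
    (ha' : ¬ (F.P α β).MP (r + 1) a) (hb : (F.P α β).MP r b)
    (hS : (F.P α β).Spans S a b) (hn : Module.finrank k S < n + 1) : Refinable μ {F.P α β} 1 (a / b) := by
  classical
  set h := F.regPt α β with hh
  refine Refinable.dom ?_ h.dom_blowUp
  obtain ⟨A, hA, e⟩ := h.exists_poly ha
  obtain ⟨B, -, e'⟩ := h.exists_poly hb
  have hA0 : (F.P α β).red A ≠ 0 := fun h0 => ha' (e ▸ h.mp_evK_succ hA h0)
  have hu := h.u_ne
  refine refinable_of_finite (F.hasClass_blowUp μ α β) h.sep_blowUp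
    ((((F.P α β).red A).roots.toFinset.image h.tr) ∪ {h.inf}) ?_ ?_ ?_
  · intro P hP
    simp only [Finset.coe_union, Finset.coe_image, Finset.coe_singleton] at hP
    rcases hP with ⟨c, -, rfl⟩ | hP
    · exact Or.inl ⟨c, rfl⟩
    · exact Or.inr hP
  · rintro _ (⟨c, rfl⟩ | rfl) hP
    · right
      have hc : ((F.P α β).red A).eval c ≠ 0 := fun h0 => hP (by
        refine Finset.mem_union_left _ (Finset.mem_image_of_mem _ ?_)
        rw [Multiset.mem_toFinset, Polynomial.mem_roots hA0]
        exact h0)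
      have := ((h.tr_at_evK c B).div (h.tr_at_evK c A) hc).mem
      rw [inv_div, e, e', mul_div_mul_left _ _ (pow_ne_zero _ hu)]
      exact this
    · exact absurd (Finset.mem_union_right _ (Finset.mem_singleton_self _)) hP
  · intro P hP
    rcases Finset.mem_union.1 hP with hP | hP
    · obtain ⟨c, -, rfl⟩ := Finset.mem_image.1 hP
      obtain ⟨S', h1, h2⟩ := h.spans_tr c hr ha hb ha' hS
      have m1 := h.mem_tr_div c ha
      have m2 := h.mem_tr_div c hb
      rw [hh, F.tr_eq] at h2 m1 m2 ⊢
      have := ih _ _ _ _ _ S' m1 m2 h2 (by omega)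
      rwa [div_div_div_cancel_right₀ (pow_ne_zero _ hu)] at this
    · obtain rfl := Finset.mem_singleton.1 hP
      obtain ⟨S', h1, h2⟩ := h.swap.spans_tr 0 hr ha hb ha' hS
      have m1 := h.swap.mem_tr_div 0 ha
      have m2 := h.swap.mem_tr_div 0 hb
      change h.inf.Spans _ _ _ at h2
      change _ ∈ h.inf.O at m1 m2
      rw [hh, F.inf_eq] at h2 m1 m2 ⊢
      have := ih _ _ _ _ _ S' m1 m2 h2 (by omega)
      rwa [div_div_div_cancel_right₀ (pow_ne_zero _ h.v_ne)] at this

theorem refinable_of_resolved (μ : AlgMeasure k Q) {α β : k} {f : K} (h : (F.P α β).Resolved f) :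
    Refinable μ {F.P α β} 1 f :=
  ⟨_, F.hasClass_point μ α β, sep_singleton _, Dom.refl _, by rintro _ rfl; exact h⟩

theorem refinable_local (μ : AlgMeasure k Q) (n : ℕ) : ∀ (F : Frame k K) (α β : k) (a b : K)
    (S : Submodule k K), a ∈ (F.P α β).O → b ∈ (F.P α β).O →
    (F.P α β).Spans S a b → Module.finrank k S < n → Refinable μ {F.P α β} 1 (a / b) := by
  induction n with
  | zero => intros; omega
  | succ n ih =>
    intro F α β a b S ha hb hS hn
    have := (F.regPt α β).noeth
    by_cases ha0 : a = 0
    · exact F.refinable_of_resolved μ (Or.inl (by simp [ha0]))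
    by_cases hb0 : b = 0
    · exact F.refinable_of_resolved μ (Or.inl (by simp [hb0]))
    obtain ⟨r, hr, hr'⟩ := exists_mp ha ha0
    obtain ⟨s, hs, hs'⟩ := exists_mp hb hb0
    obtain ⟨c, hc⟩ := exists_at ha
    obtain ⟨d, hd⟩ := exists_at hb
    rcases Nat.eq_zero_or_pos r with rfl | hr0
    · refine F.refinable_of_resolved μ (Or.inr ?_)
      rw [inv_div]
      refine (hd.div hc ?_).mem
      rintro rfl
      exact hr' (mp_one_iff.2 hc)
    rcases Nat.eq_zero_or_pos s with rfl | hs0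
    · refine F.refinable_of_resolved μ (Or.inl (hc.div hd ?_).mem)
      rintro rfl
      exact hs' (mp_one_iff.2 hd)
    rcases le_total r s with hle | hle
    · exact F.refinable_step μ ih hr0 hr hr' (hs.mono hle) hS hn
    · refine Refinable.inv ?_
      rw [inv_div]
      exact F.refinable_step μ ih hs0 hs hs' (hr.mono hle) hS.symm hn

end Frame

end

section

section Plane

variable {k : Type u} [Field k] {a b : MvPolynomial (Fin 2) k}

theorem isMaximal_of_isRelPrime (hab : IsRelPrime a b) (ha : a ≠ 0) (P : Ideal (MvPolynomial (Fin 2) k)) [hP : P.IsPrime]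
    (haP : a ∈ P) (hbP : b ∈ P) : P.IsMaximal := by
  classical
  by_contra hmax
  obtain ⟨M, hM, hPM⟩ := Ideal.exists_le_maximal P hP.ne_top
  have hPM' : P < M := lt_of_le_of_ne hPM (by rintro rfl; exact hmax hM)
  obtain ⟨t, ht, hta⟩ : ∃ t, Prime t ∧ t ∈ P ∧ t ∣ a := by
    obtain ⟨s, hs, hass⟩ := UniqueFactorizationMonoid.exists_prime_factors a ha
    have : s.prod ∈ P := by
      obtain ⟨w, rfl⟩ := hass
      exact (hP.mem_or_mem haP).resolve_right fun hw => hP.ne_top (Ideal.eq_top_of_isUnit_mem _ hw w.isUnit)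
    obtain ⟨t, ht, htP⟩ := (Ideal.IsPrime.multiset_prod_mem_iff_exists_mem hP s).1 this
    exact ⟨t, hs t ht, htP, (Multiset.dvd_prod ht).trans hass.dvd⟩
  have htb : ¬ t ∣ b := fun h => ht.not_isUnit (hab hta.2 h)
  have hT : (Ideal.span {t}).IsPrime := (Ideal.span_singleton_prime ht.ne_zero).2 ht
  have h1 : (⊥ : Ideal (MvPolynomial (Fin 2) k)) < Ideal.span {t} :=
    bot_lt_iff_ne_bot.2 (by simpa using ht.ne_zero)
  have h2 : Ideal.span {t} < P :=
    lt_of_le_of_ne ((Ideal.span_singleton_le_iff_mem _).2 hta.1) fun h0 =>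
      htb (Ideal.mem_span_singleton.1 (h0 ▸ hbP))
  let p0 : PrimeSpectrum (MvPolynomial (Fin 2) k) := ⟨⊥, Ideal.isPrime_bot⟩
  let p1 : PrimeSpectrum (MvPolynomial (Fin 2) k) := ⟨_, hT⟩
  let p2 : PrimeSpectrum (MvPolynomial (Fin 2) k) := ⟨P, hP⟩
  let p3 : PrimeSpectrum (MvPolynomial (Fin 2) k) := ⟨M, hM.isPrime⟩
  have l1 : Order.height p0 + 1 ≤ Order.height p1 := Order.height_add_one_le h1
  have l2 : Order.height p1 + 1 ≤ Order.height p2 := Order.height_add_one_le h2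
  have l3 : Order.height p2 + 1 ≤ Order.height p3 := Order.height_add_one_le hPM'
  have l4 : (3 : ℕ∞) ≤ Order.height p3 := by
    refine le_trans ?_ ((add_le_add_left ((add_le_add_left l1 1).trans l2) 1).trans l3)
    calc (3 : ℕ∞) = 0 + 1 + 1 + 1 := by norm_num
      _ ≤ _ := by gcongr; exact zero_le
  have l5 := Order.height_le_krullDim p3
  have l6 := MvPolynomial.ringKrullDim_of_isNoetherianRing (R := k) (ι := Fin 2)
  rw [ringKrullDim_eq_zero_of_field, Nat.card_fin, zero_add] at l6
  have l7 : ((3 : ℕ∞) : WithBot ℕ∞) ≤ ((2 : ℕ) : WithBot ℕ∞) := (WithBot.coe_le_coe.2 l4).trans (l5.trans l6.le)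
  exact absurd (WithBot.coe_le_coe.1 l7) (by decide)

theorem finite_quotient (hab : IsRelPrime a b) (ha : a ≠ 0) :
    Module.Finite k (MvPolynomial (Fin 2) k ⧸ Ideal.span {a, b}) := by
  rw [Module.finite_iff_krullDimLE_zero, Ring.krullDimLE_zero_iff]
  intro I hI
  have := isMaximal_of_isRelPrime hab ha (I.comap (Ideal.Quotient.mk _))
    (by rw [Ideal.mem_comap, Ideal.Quotient.eq_zero_iff_mem.2 (Ideal.subset_span (by simp))]; exact zero_mem _)
    (by rw [Ideal.mem_comap, Ideal.Quotient.eq_zero_iff_mem.2 (Ideal.subset_span (by simp))]; exact zero_mem _)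
  have hs := Ideal.Quotient.mk_surjective (I := Ideal.span {a, b})
  have h2 := Ideal.map_eq_top_or_isMaximal_of_surjective _ hs this
  rw [Ideal.map_comap_of_surjective _ hs] at h2
  exact h2.resolve_left hI.ne_top

theorem finite_zeros (hab : IsRelPrime a b) (ha : a ≠ 0) :
    {θ : MvPolynomial (Fin 2) k →ₐ[k] k | θ a = 0 ∧ θ b = 0}.Finite := by
  have := finite_quotient hab ha
  have h1 : Finite ((MvPolynomial (Fin 2) k ⧸ Ideal.span {a, b}) →ₐ[k] k) :=
    (linearIndependent_algHom_toLinearMap k (MvPolynomial (Fin 2) k ⧸ Ideal.span {a, b}) k).finite_of_isNoetherian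
  refine Set.Finite.subset (Set.finite_range fun η : (MvPolynomial (Fin 2) k ⧸ Ideal.span {a, b}) →ₐ[k] k =>
    η.comp (Ideal.Quotient.mkₐ k _)) ?_
  rintro θ ⟨h1, h2⟩
  refine ⟨Ideal.Quotient.liftₐ _ θ fun x hx => ?_, ?_⟩
  · have : Ideal.span {a, b} ≤ RingHom.ker θ := Ideal.span_le.2 (by
      rintro y (rfl | rfl)
      exacts [h1, h2])
    exact this hx
  · refine MvPolynomial.algHom_ext fun i => ?_
    rfl

end Plane

variable {k K : Type u} [Field k] [Field K] [Algebra k K] {Q : Type u} [CommRing Q]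

namespace Frame

variable [CharZero k] (F : Frame k K) {a b : MvPolynomial (Fin 2) k}

theorem exists_coprime {f : K} (hf : f ≠ 0) : ∃ a b : MvPolynomial (Fin 2) k, IsRelPrime a b ∧ a ≠ 0 ∧ b ≠ 0 ∧
    f = F.e a / F.e b := by
  obtain ⟨a, b, hb, e⟩ := F.frac f
  change F.e b ≠ 0 at hb
  change f = F.e a / F.e b at e
  have ha0 : a ≠ 0 := by rintro rfl; simp [e] at hf
  obtain ⟨a', b', c, h, rfl, rfl⟩ := UniqueFactorizationMonoid.exists_reduced_factors a ha0 b
  rw [map_mul] at hb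
  refine ⟨a', b', h, right_ne_zero_of_mul ha0, ?_, ?_⟩
  · rintro rfl; simp at hb
  · rw [e, map_mul, map_mul, mul_div_mul_left _ _ (left_ne_zero_of_mul hb)]

theorem spans (hab : IsRelPrime a b) (ha : a ≠ 0) (α β : k) :
    ∃ S, (F.P α β).Spans S (F.e a) (F.e b) := by
  have hfin := finite_quotient hab ha
  have hmem : ∀ r, F.e r ∈ (F.P α β).O := fun r => (F.at_e α β r).mem
  let J : Ideal (MvPolynomial (Fin 2) k) :=
    { carrier := {r | (F.P α β).In (F.e a) (F.e b) (F.e r)}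
      add_mem' := fun hx hy => by
        change LPt.In _ _ _ _
        rw [map_add]; exact hx.add hy
      zero_mem' := by
        change LPt.In _ _ _ _
        rw [map_zero]; exact In.zero
      smul_mem' := fun c x hx => by
        change LPt.In _ _ _ _
        rw [smul_eq_mul, map_mul]; exact LPt.In.mul_mem hx (hmem c) }
  have hJ : Ideal.span {a, b} ≤ J := Ideal.span_le.2 (by
    rintro y (rfl | rfl)
    · exact In.left
    · exact ⟨0, zero_mem _, 1, one_mem _, by ring⟩)
  have : Module.Finite k (MvPolynomial (Fin 2) k ⧸ J) :=
    Module.Finite.of_surjective (Ideal.Quotient.factorₐ k hJ).toLinearMap (Ideal.Quotient.factor_surjective hJ)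
  obtain ⟨g, hg⟩ := (Ideal.Quotient.mkₐ k J).toLinearMap.exists_rightInverse_of_surjective
    (LinearMap.range_eq_top.2 Ideal.Quotient.mk_surjective)
  refine ⟨LinearMap.range (F.e.toLinearMap ∘ₗ g), inferInstance, ?_, ?_⟩
  · rintro _ ⟨x, rfl⟩
    exact hmem _
  · intro x hx
    obtain ⟨c, d, hd, rfl⟩ := F.mem_P.1 hx
    have hde : F.e d ≠ 0 := (F.at_e α β d).ne_zero hd
    have hdi : (F.e d)⁻¹ ∈ (F.P α β).O := ((F.at_e α β d).inv hd).mem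
    let m : (MvPolynomial (Fin 2) k ⧸ J) →ₗ[k] (MvPolynomial (Fin 2) k ⧸ J) :=
      LinearMap.mulLeft k (Ideal.Quotient.mk J d)
    have hm : Function.Injective m := by
      rw [injective_iff_map_eq_zero]
      intro y hy
      obtain ⟨y, rfl⟩ := Ideal.Quotient.mk_surjective y
      have hy' : Ideal.Quotient.mk J (d * y) = 0 := by rw [map_mul]; exact hy
      rw [Ideal.Quotient.eq_zero_iff_mem] at hy' ⊢
      have : LPt.In (F.P α β) (F.e a) (F.e b) (F.e (d * y)) := hy'
      have := this.mul_mem hdi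
      rwa [map_mul, inv_mul_cancel_left₀ hde] at this
    obtain ⟨y, hy⟩ := (LinearMap.injective_iff_surjective.1 hm) (Ideal.Quotient.mk J c)
    refine ⟨_, ⟨y, rfl⟩, ?_⟩
    have e1 : Ideal.Quotient.mk J (g y) = y := LinearMap.congr_fun hg y
    have e2 : Ideal.Quotient.mk J (c - d * g y) = 0 := by
      rw [map_sub, map_mul, e1, sub_eq_zero]
      exact hy.symm
    rw [Ideal.Quotient.eq_zero_iff_mem] at e2
    have : LPt.In (F.P α β) (F.e a) (F.e b) (F.e (c - d * g y)) := e2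
    have := this.mul_mem hdi
    convert this using 1
    rw [map_sub, map_mul]
    change F.e c / F.e d - F.e (g y) = _
    field_simp

variable [IsAlgClosed k]

theorem refinable_point (μ : AlgMeasure k Q) (α β : k) (f : K) : Refinable μ {F.P α β} 1 f := by
  by_cases hf : f = 0
  · exact F.refinable_of_resolved μ (Or.inl (by simp [hf]))
  obtain ⟨a, b, hab, ha, hb, rfl⟩ := F.exists_coprime hf
  obtain ⟨S, hS⟩ := F.spans hab ha α β
  exact F.refinable_local μ _ α β _ _ S (F.at_e _ _ _).mem (F.at_e _ _ _).mem hS (Nat.lt_succ_self _)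

theorem finite_unresolved (f : K) : {θ : MvPolynomial (Fin 2) k →ₐ[k] k | ¬ (F.toChart.pt θ).Resolved f}.Finite := by
  by_cases hf : f = 0
  · refine Set.finite_empty.subset fun θ hθ => hθ (Or.inl (by simp [hf]))
  obtain ⟨a, b, hab, ha, hb, rfl⟩ := F.exists_coprime hf
  refine (finite_zeros hab ha).subset fun θ hθ => ?_
  have h1 : ∀ r, (F.toChart.pt θ).At (F.e r) (θ r) := fun r => Chart.pt_at (c := F.toChart) θ r
  constructor
  · by_contra h
    refine hθ (Or.inr ?_)
    rw [inv_div]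
    exact ((h1 b).div (h1 a) h).mem
  · by_contra h
    exact hθ (Or.inl ((h1 a).div (h1 b) h).mem)

end Frame

variable [CharZero k] [IsAlgClosed k]

theorem refinable {μ : AlgMeasure k Q} {E : Set (LPt k K k)} {q : Q} (h : HasClass μ (frames k K) E q)
    (hs : Sep E) (f : K) : Refinable μ E q f := by
  classical
  have hfin : {P ∈ E | ¬ P.Resolved f}.Finite := by
    obtain ⟨ι, _, ch, C, h1, -, -, rfl, -⟩ := h
    refine Set.Finite.subset (s := ⋃ i, (ch i).pt '' {θ | ¬ ((ch i).pt θ).Resolved f})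
      (Set.finite_iUnion fun i => ?_) ?_
    · obtain ⟨F, hF⟩ := h1 i
      rw [← hF]
      exact (F.finite_unresolved f).image _
    · rintro P ⟨hP, hn⟩
      obtain ⟨i, θ, -, rfl⟩ := Set.mem_iUnion.1 hP
      exact Set.mem_iUnion.2 ⟨i, θ, hn, rfl⟩
  refine refinable_of_finite h hs hfin.toFinset ?_ ?_ ?_
  · rw [Set.Finite.coe_toFinset]
    exact fun P hP => hP.1
  · intro P hP hn
    by_contra h0
    exact hn (hfin.mem_toFinset.2 ⟨hP, h0⟩)
  · intro P hP
    obtain ⟨c, hc, θ, rfl⟩ := h.exists_pt (hfin.mem_toFinset.1 hP).1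
    obtain ⟨F, α, β, e⟩ := Frame.exists_of_pt hc θ
    rw [e]
    exact F.refinable_point μ α β f

/-- A modification resolving finitely many functions. -/
theorem exists_refinement {μ : AlgMeasure k Q} {E : Set (LPt k K k)} {q : Q} (h : HasClass μ (frames k K) E q)
    (hs : Sep E) (s : Finset K) : ∃ E', HasClass μ (frames k K) E' q ∧ Sep E' ∧ Dom E E' ∧
      ∀ f ∈ s, ∀ P ∈ E', P.Resolved f := by
  classical
  induction s using Finset.induction_on with
  | empty => exact ⟨E, h, hs, Dom.refl E, by simp⟩
  | insert f s hf ih =>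
    obtain ⟨E', h1, h2, h3, h4⟩ := ih
    obtain ⟨E'', h1', h2', h3', h4'⟩ := refinable h1 h2 f
    refine ⟨E'', h1', h2', h3.trans h3', fun g hg P hP => ?_⟩
    rcases Finset.mem_insert.1 hg with rfl | hg
    · exact h4' P hP
    · obtain ⟨e, he, hle⟩ := h3'.1 P hP
      exact (h4 g hg e he).mono hle

end

section

variable {k K : Type u} [Field k] [Field K] [Algebra k K] {Q : Type u} [CommRing Q]

namespace Frame

variable (F : Frame k K)

theorem q_ne : F.q ≠ 0 := by
  intro h
  have := F.D₂_q
  rw [h, map_zero] at this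
  exact zero_ne_one this

theorem exists_mul_inv_pow (a : MvPolynomial (Fin 2) k) : ∃ (N : ℕ) (a' : MvPolynomial (Fin 2) k),
    aeval ![F.p, F.q] a * F.q⁻¹ ^ N = aeval ![F.p, F.q⁻¹] a' := by
  have hq := F.q_ne
  have hX : ∀ n : ℕ, aeval ![F.p, F.q⁻¹] ((X 1 : MvPolynomial (Fin 2) k) ^ n) = F.q⁻¹ ^ n := fun n => by simp
  induction a using MvPolynomial.induction_on with
  | C r => exact ⟨0, C r, by simp⟩
  | add a b ha hb =>
    obtain ⟨N, a', ha⟩ := ha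
    obtain ⟨M, b', hb⟩ := hb
    refine ⟨N + M, a' * X 1 ^ M + b' * X 1 ^ N, ?_⟩
    rw [map_add, map_add, map_mul, map_mul, hX, hX, ← ha, ← hb]
    ring
  | mul_X a i ha =>
    obtain ⟨N, a', ha⟩ := ha
    fin_cases i
    · refine ⟨N, a' * X 0, ?_⟩
      rw [map_mul, map_mul, ← ha]
      simp
      ring
    · refine ⟨N + 1, a', ?_⟩
      rw [map_mul, ← ha]
      simp
      field_simp
      ring

/-- The frame obtained by inverting the second coordinate. -/
def invQ : Frame k K where
  p := F.p
  q := F.q⁻¹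
  D₁ := F.D₁
  D₂ := -(F.q ^ 2) • F.D₂
  D₁_p := F.D₁_p
  D₁_q := by rw [Derivation.leibniz_inv, F.D₁_q, smul_zero]
  D₂_p := by simp [F.D₂_p]
  D₂_q := by
    have hq := F.q_ne
    rw [Derivation.smul_apply, Derivation.leibniz_inv, F.D₂_q, smul_eq_mul, smul_eq_mul]
    field_simp
  frac := fun x => by
    obtain ⟨a, b, hb, e⟩ := F.frac x
    obtain ⟨N, a', ha'⟩ := F.exists_mul_inv_pow a
    obtain ⟨M, b', hb'⟩ := F.exists_mul_inv_pow b
    have hq := inv_ne_zero F.q_ne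
    have hX : ∀ n : ℕ, aeval ![F.p, F.q⁻¹] ((X 1 : MvPolynomial (Fin 2) k) ^ n) = F.q⁻¹ ^ n := fun n => by simp
    refine ⟨a' * X 1 ^ M, b' * X 1 ^ N, ?_, ?_⟩
    · rw [map_mul, hX, ← hb']
      exact mul_ne_zero (mul_ne_zero hb (pow_ne_zero _ hq)) (pow_ne_zero _ hq)
    · rw [map_mul, map_mul, hX, hX, ← ha', ← hb', e, mul_assoc, mul_assoc, mul_comm (F.q⁻¹ ^ M),
        mul_div_mul_right _ _ (mul_ne_zero (pow_ne_zero _ hq) (pow_ne_zero _ hq))]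

/-- The frame obtained by inverting the first coordinate. -/
def invP : Frame k K := F.swap.invQ.swap

theorem cl_plane (μ : AlgMeasure k Q) : μ.cl (MvPolynomial (Fin 2) k) = 0 := by
  rw [μ.iso inferInstance (finSuccEquiv k 1)]
  exact μ.poly inferInstance

variable [CharZero k] [IsAlgClosed k]

theorem hasClass_plane (μ : AlgMeasure k Q) :
    HasClass μ (frames k K) (Set.range fun c : k × k => F.P c.1 c.2) 0 := by
  have h := HasClass.of_chart (μ := μ) (G := frames k K) (c := F.toChart) ⟨F, rfl⟩
    (C := Set.univ) conSet_univ
  have h0 : μ.nu (ind (Set.univ : Set (MvPolynomial (Fin 2) k →ₐ[k] k))) = 0 := by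
    have : ind (Set.univ : Set (MvPolynomial (Fin 2) k →ₐ[k] k)) = 1 := by
      ext; simp [ind]
    rw [this, μ.nu_one, cl_plane]
  have h' : HasClass μ (frames k K) (F.toChart.pt '' (Set.univ : Set (MvPolynomial (Fin 2) k →ₐ[k] k))) 0 := h0 ▸ h
  convert h' using 1
  ext P
  refine Iff.trans ?_ (F.mem_image (P := P) (S := Set.univ)).symm
  constructor
  · rintro ⟨⟨α, β⟩, rfl⟩
    exact ⟨α, β, trivial, rfl⟩
  · rintro ⟨α, β, -, rfl⟩
    exact ⟨(α, β), rfl⟩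

/-- The points of the product of two projective lines with the given coordinates. -/
def quadric : Set (LPt k K k) :=
  (Set.range fun c : k × k => F.P c.1 c.2) ∪ ((Set.range fun c => F.invQ.swap.P 0 c) ∪
    ((Set.range fun c => F.invP.P 0 c) ∪ {F.invP.invQ.P 0 0}))

theorem at_zero_ne {V : LPt k K k} {x : K} {c : k} (hx : x ≠ 0) (h : V.At x c) (h' : V.At x⁻¹ 0) : False := by
  have := h.mul h'
  rw [mul_inv_cancel₀ hx, mul_zero] at this
  exact one_ne_zero (at_one.unique this)

theorem p_ne : F.p ≠ 0 := F.swap.q_ne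

theorem quadric_cases {P V : LPt k K k} (hP : P ∈ F.quadric) (hV : P ≤ V) :
    (∃ α β, V.At F.p α ∧ V.At F.q β ∧ P = F.P α β) ∨
    (∃ α, V.At F.p α ∧ V.At F.q⁻¹ 0 ∧ P = F.invQ.swap.P 0 α) ∨
    (∃ β, V.At F.p⁻¹ 0 ∧ V.At F.q β ∧ P = F.invP.P 0 β) ∨
    (V.At F.p⁻¹ 0 ∧ V.At F.q⁻¹ 0 ∧ P = F.invP.invQ.P 0 0) := by
  rcases hP with ⟨⟨α, β⟩, rfl⟩ | ⟨α, rfl⟩ | ⟨β, rfl⟩ | hP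
  · exact Or.inl ⟨α, β, (F.at_p α β).mono hV, (F.at_q α β).mono hV, rfl⟩
  · exact Or.inr (Or.inl ⟨α, (F.invQ.swap.at_q 0 α).mono hV, (F.invQ.swap.at_p 0 α).mono hV, rfl⟩)
  · exact Or.inr (Or.inr (Or.inl ⟨β, (F.invP.at_p 0 β).mono hV, (F.invP.at_q 0 β).mono hV, rfl⟩))
  · obtain rfl : P = _ := hP
    exact Or.inr (Or.inr (Or.inr ⟨(F.invP.invQ.at_p 0 0).mono hV, (F.invP.invQ.at_q 0 0).mono hV, rfl⟩))

theorem sep_quadric' {P P' V : LPt k K k} (hP : P ∈ F.quadric) (hP' : P' ∈ F.quadric) (hV : P ≤ V) (hV' : P' ≤ V) :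
    P = P' := by
  have hp := F.p_ne
  have hq := F.q_ne
  rcases F.quadric_cases hP hV with ⟨α, β, h1, h2, rfl⟩ | ⟨α, h1, h2, rfl⟩ | ⟨β, h1, h2, rfl⟩ | ⟨h1, h2, rfl⟩ <;>
  rcases F.quadric_cases hP' hV' with ⟨α', β', h1', h2', rfl⟩ | ⟨α', h1', h2', rfl⟩ | ⟨β', h1', h2', rfl⟩ | ⟨h1', h2', rfl⟩
  all_goals try first
    | exact (at_zero_ne hp h1 h1').elim
    | exact (at_zero_ne hp h1' h1).elim
    | exact (at_zero_ne hq h2 h2').elim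
    | exact (at_zero_ne hq h2' h2).elim
  · rw [h1.unique h1', h2.unique h2']
  · rw [h1.unique h1']
  · rw [h2.unique h2']
  · rfl

theorem sep_quadric : Sep F.quadric := fun _ _ _ he _ he' hl hl' => F.sep_quadric' he he' hl hl'

theorem exists_quadric_le {V : LPt k K k} (hV : V.IsPlace) : ∃ P ∈ F.quadric, P ≤ V := by
  by_cases hp : F.p ∈ V.O <;> by_cases hq : F.q ∈ V.O
  · obtain ⟨α, hα⟩ := exists_at hp
    obtain ⟨β, hβ⟩ := exists_at hq
    exact ⟨_, Or.inl ⟨(α, β), rfl⟩, F.P_le hα hβ⟩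
  · obtain ⟨α, hα⟩ := exists_at hp
    exact ⟨_, Or.inr (Or.inl ⟨α, rfl⟩), F.invQ.swap.P_le (hV.at_inv_zero hq) hα⟩
  · obtain ⟨β, hβ⟩ := exists_at hq
    exact ⟨_, Or.inr (Or.inr (Or.inl ⟨β, rfl⟩)), F.invP.P_le (hV.at_inv_zero hp) hβ⟩
  · exact ⟨_, Or.inr (Or.inr (Or.inr rfl)), F.invP.invQ.P_le (hV.at_inv_zero hp) (hV.at_inv_zero hq)⟩

theorem hasClass_quadric (μ : AlgMeasure k Q) : HasClass μ (frames k K) F.quadric 1 := by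
  have hp := F.p_ne
  have hq := F.q_ne
  have h := (F.hasClass_plane μ).union ((F.invQ.swap.hasClass_axis μ).union
    ((F.invP.hasClass_axis μ).union (F.invP.invQ.hasClass_point μ 0 0) ?_) ?_) ?_
  · rwa [zero_add, zero_add, zero_add] at h
  · refine Set.disjoint_left.2 ?_
    rintro _ ⟨β, rfl⟩ h0
    have h0 : F.invP.P 0 β = F.invP.invQ.P 0 0 := h0
    exact at_zero_ne hq (F.invP.at_q 0 β) (h0 ▸ F.invP.invQ.at_q 0 0)
  · refine Set.disjoint_left.2 ?_
    rintro _ ⟨α, rfl⟩ (⟨β, h0⟩ | h0)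
    · have h0 : F.invP.P 0 β = F.invQ.swap.P 0 α := h0
      exact at_zero_ne hq (F.invP.at_q 0 β) (h0 ▸ F.invQ.swap.at_p 0 α)
    · have h0 : F.invQ.swap.P 0 α = F.invP.invQ.P 0 0 := h0
      exact at_zero_ne hp (F.invQ.swap.at_q 0 α) (h0 ▸ F.invP.invQ.at_p 0 0)
  · refine Set.disjoint_left.2 ?_
    rintro _ ⟨⟨α, β⟩, rfl⟩ (⟨γ, h0⟩ | ⟨γ, h0⟩ | h0)
    · have h0 : F.invQ.swap.P 0 γ = F.P α β := h0
      exact at_zero_ne hq (F.at_q α β) (h0 ▸ F.invQ.swap.at_p 0 γ)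
    · have h0 : F.invP.P 0 γ = F.P α β := h0
      exact at_zero_ne hp (F.at_p α β) (h0 ▸ F.invP.at_p 0 γ)
    · have h0 : F.P α β = F.invP.invQ.P 0 0 := h0
      exact at_zero_ne hp (F.at_p α β) (h0 ▸ F.invP.invQ.at_p 0 0)

/-- There is a complete smooth model, of class one, on which given functions are resolved. -/
theorem exists_model (F : Frame k K) (μ : AlgMeasure k Q) (s : Finset K) : ∃ E, HasClass μ (frames k K) E 1 ∧ Sep E ∧
    (∀ V : LPt k K k, V.IsPlace → ∃ P ∈ E, P ≤ V) ∧ ∀ f ∈ s, ∀ P ∈ E, P.Resolved f := by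
  obtain ⟨E, h1, h2, h3, h4⟩ := exists_refinement (F.hasClass_quadric μ) F.sep_quadric s
  exact ⟨E, h1, h2, fun V hV => h3.2 V hV (F.exists_quadric_le hV), h4⟩

end Frame

end

section

variable {k K : Type u} [Field k] [Field K] [Algebra k K]

theorem LPt.isLocalRing (P : LPt k K k) : IsLocalRing P.O := by
  have hu : ∀ x : P.O, P.res x ≠ 0 → IsUnit x := fun x hx => by
    have h0 : (x : K) ≠ 0 := (at_coe x).ne_zero hx
    exact IsUnit.of_mul_eq_one ⟨(x : K)⁻¹, P.inv x hx⟩ (Subtype.ext (mul_inv_cancel₀ h0))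
  refine IsLocalRing.of_isUnit_or_isUnit_one_sub_self fun x => ?_
  by_cases hx : P.res x = 0
  · exact Or.inr (hu _ (by simp [hx]))
  · exact Or.inl (hu _ hx)

theorem dvd_of_forall_pow {R : Type u} [CommRing R] [IsNoetherianRing R] [IsLocalRing R] {I : Ideal R}
    (hI : I ≠ ⊤) {a b : R} (h : ∀ n, ∃ c, a - b * c ∈ I ^ n) : b ∣ a := by
  have h1 := Ideal.iInf_pow_smul_eq_bot_of_isLocalRing (M := R ⧸ Ideal.span {b}) I hI
  have h2 : Ideal.Quotient.mk (Ideal.span {b}) a ∈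
      ⨅ i : ℕ, I ^ i • (⊤ : Submodule R (R ⧸ Ideal.span {b})) := by
    rw [Submodule.mem_iInf]
    intro n
    obtain ⟨c, hm⟩ := h n
    have e : Ideal.Quotient.mk (Ideal.span {b}) a = (a - b * c) • (1 : R ⧸ Ideal.span {b}) := by
      rw [Algebra.smul_def, mul_one, Ideal.Quotient.algebraMap_eq]
      exact Ideal.Quotient.eq.2 (Ideal.mem_span_singleton.2 ⟨c, by ring⟩)
    rw [e]
    exact Submodule.smul_mem_smul hm trivial
  rwa [h1, Submodule.mem_bot, Ideal.Quotient.eq_zero_iff_mem, Ideal.mem_span_singleton] at h2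

theorem LPt.mem_of_mp {P : LPt k K k} [IsNoetherianRing P.O] {a b : K} (ha : a ∈ P.O) (hb : b ∈ P.O)
    (hb0 : b ≠ 0) (h : ∀ n, ∃ c ∈ P.O, P.MP n (a - b * c)) : a / b ∈ P.O := by
  have := P.isLocalRing
  obtain ⟨c, hc⟩ := dvd_of_forall_pow (I := P.mx) (a := ⟨a, ha⟩) (b := ⟨b, hb⟩)
    (RingHom.ker_ne_top P.res) fun n => by
      obtain ⟨c, hc, hm, hm'⟩ := h n
      exact ⟨⟨c, hc⟩, hm'⟩
  have : a = b * c := congrArg Subtype.val hc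
  rw [this, mul_div_cancel_left₀ _ hb0]
  exact c.2

theorem Frame.derivation_eq (F : Frame k K) (D : Derivation k K K) (x : K) :
    D x = D F.p * F.D₁ x + D F.q * F.D₂ x := by
  have h1 : ∀ a, D (F.e a) = D F.p * F.D₁ (F.e a) + D F.q * F.D₂ (F.e a) := by
    intro a
    induction a using MvPolynomial.induction_on with
    | C c => simp [F.e_C]
    | add a b ha hb => simp only [map_add, ha, hb]; ring
    | mul_X a i ha =>
      rw [map_mul]
      simp only [Derivation.leibniz, ha, smul_eq_mul]
      fin_cases i
      · simp [F.D₁_p, F.D₂_p]; ring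
      · simp [F.D₁_q, F.D₂_q]; ring
  obtain ⟨a, b, hb, rfl⟩ := F.frac x
  have hb' : F.e b ≠ 0 := hb
  change D (F.e a / F.e b) = D F.p * F.D₁ (F.e a / F.e b) + D F.q * F.D₂ (F.e a / F.e b)
  simp only [Derivation.leibniz_div, h1, smul_eq_mul]
  ring

variable [CharZero k] 

/-- A regular local ring `P` dominated by a regular local ring `z`, whose parameters generate the
maximal ideal of `z` and whose dual derivations preserve `z`, is equal to `z`. -/
theorem RegPt.eq_of_le {P z : LPt k K k} {u v : K} {D₁ D₂ : Derivation k K K}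
    (h : RegPt P u v D₁ D₂) (hz : RegPt z u v D₁ D₂) (hle : P ≤ z) : P = z := by
  have hu := h.u_ne
  have key1 : ∀ n x, x ∈ z.O → ∃ a ∈ P.O, z.MP n (x - a) := by
    intro n
    induction n with
    | zero => exact fun x hx => ⟨0, P.O.zero_mem, mp_zero_iff.2 (by simpa using hx)⟩
    | succ n ih =>
      intro x hx
      obtain ⟨a, ha, hm⟩ := ih x hx
      obtain ⟨F, hF, e⟩ := hz.exists_poly hm
      let G : Polynomial z.O := (z.red F).map (algebraMap k z.O)
      let G' : Polynomial P.O := (z.red F).map (algebraMap k P.O)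
      have hd : (z.red F).natDegree ≤ n := Polynomial.natDegree_map_le.trans hF
      have hG : z.evK (v / u) G = P.evK (v / u) G' := by
        simp only [G, G', evK_eq_sum]
        rw [Polynomial.sum_over_range' _ (by simp) (n + 1)
          (Nat.lt_succ_of_le (Polynomial.natDegree_map_le.trans hd)),
          Polynomial.sum_over_range' _ (by simp) (n + 1)
          (Nat.lt_succ_of_le (Polynomial.natDegree_map_le.trans hd))]
        simp
      refine ⟨a + u ^ n * P.evK (v / u) G', add_mem ha
        (h.mp_evK (Polynomial.natDegree_map_le.trans hd)).1, ?_⟩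
      rw [← sub_sub, e, ← hG, ← mul_sub, ← map_sub]
      refine hz.mp_evK_succ ((Polynomial.natDegree_sub_le _ _).trans
        (max_le hF (Polynomial.natDegree_map_le.trans hd))) ?_
      ext i
      simp [G, red_coeff]
  have key2 : ∀ n x, x ∈ P.O → z.MP n x → P.MP n x := by
    intro n
    induction n with
    | zero => exact fun x hx _ => mp_zero_iff.2 hx
    | succ n ih =>
      intro x hx hm
      obtain ⟨F, hF, e⟩ := h.exists_poly (ih x hx (hm.mono n.le_succ))
      let ι : P.O →+* z.O := (Subalgebra.inclusion (fun y hy => mem_mono hle hy)).toRingHom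
      let F' : Polynomial z.O := F.map ι
      have hd : F'.natDegree ≤ n := Polynomial.natDegree_map_le.trans hF
      have e1 : z.evK (v / u) F' = P.evK (v / u) F := by
        simp only [F', evK_eq_sum]
        rw [Polynomial.sum_over_range' _ (by simp) (n + 1) (Nat.lt_succ_of_le hd),
          Polynomial.sum_over_range' _ (by simp) (n + 1) (Nat.lt_succ_of_le hF)]
        refine Finset.sum_congr rfl fun i _ => ?_
        rw [Polynomial.coeff_map]
        rfl
      have e2 : z.red F' = P.red F := by
        ext i
        rw [red_coeff, red_coeff, Polynomial.coeff_map]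
        exact (at_coe (P := z) (ι (F.coeff i))).unique ((at_coe (F.coeff i)).mono hle)
      rw [e, ← e1] at hm
      rw [e]
      exact h.mp_evK_succ hF (e2 ▸ hz.red_eq_zero hd hm)
  refine le_antisymm hle fun x c hx => ?_
  have hmem : x ∈ P.O := by
    obtain ⟨a, ha, b, hb, hb0, rfl⟩ := h.frac x
    have := h.noeth
    refine mem_of_mp ha hb hb0 fun n => ?_
    obtain ⟨c, hc, hm⟩ := key1 n _ hx.1
    refine ⟨c, hc, key2 n _ (sub_mem ha (mul_mem hb hc)) ?_⟩
    have e : a - b * c = b * (a / b - c) := by field_simp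
    rw [e]
    exact hm.mul_mem (mem_mono hle hb)
  obtain ⟨d, hd⟩ := exists_at hmem
  rwa [hx.unique (hd.mono hle)]

/-- A regular local ring dominated by the local ring `z` of a point of a frame, whose parameters
generate the maximal ideal of `z`, is equal to `z`. -/
theorem RegPt.eq_frame {P : LPt k K k} {u v : K} {D₁ D₂ : Derivation k K K}
    (h : RegPt P u v D₁ D₂) (F : Frame k K) {α β : k} (hle : P ≤ F.P α β)
    (hgen : ∀ x, (F.P α β).At x 0 → ∃ a ∈ (F.P α β).O, ∃ b ∈ (F.P α β).O, x = a * u + b * v) :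
    P = F.P α β := by
  set z := F.P α β with hzdef
  have hF := F.regPt α β
  have hu := h.at_u.mono hle
  have hv := h.at_v.mono hle
  obtain ⟨c11, h11⟩ := exists_at (hF.D₁_mem u hu.1)
  obtain ⟨c12, h12⟩ := exists_at (hF.D₂_mem u hu.1)
  obtain ⟨c21, h21⟩ := exists_at (hF.D₁_mem v hv.1)
  obtain ⟨c22, h22⟩ := exists_at (hF.D₂_mem v hv.1)
  have hval : ∀ D : Derivation k K K, (∀ x ∈ z.O, D x ∈ z.O) → ∀ x a b c1 c2 a0 b0,
      z.At (D u) c1 → z.At (D v) c2 → z.At a a0 → z.At b b0 → x = a * u + b * v →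
      z.At (D x) (a0 * c1 + b0 * c2) := by
    rintro D hD _ a b c1 c2 a0 b0 h1 h2 ha hb rfl
    obtain ⟨a', ha'⟩ := exists_at (hD a ha.1)
    obtain ⟨b', hb'⟩ := exists_at (hD b hb.1)
    have := ((ha.mul h1).add (hu.mul ha')).add ((hb.mul h2).add (hv.mul hb'))
    simpa [Derivation.leibniz] using this
  obtain ⟨a, ha, b, hb, e1⟩ := hgen _ hF.at_u
  obtain ⟨c, hc, d, hd, e2⟩ := hgen _ hF.at_v
  obtain ⟨a0, ha⟩ := exists_at ha
  obtain ⟨b0, hb⟩ := exists_at hb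
  obtain ⟨c0, hc⟩ := exists_at hc
  obtain ⟨d0, hd⟩ := exists_at hd
  have r1 := (hval F.D₁ hF.D₁_mem _ a b c11 c21 a0 b0 h11 h21 ha hb e1).unique (by rw [hF.D₁_u]; exact at_one)
  have r2 := (hval F.D₂ hF.D₂_mem _ a b c12 c22 a0 b0 h12 h22 ha hb e1).unique (by rw [hF.D₂_u]; exact at_zero)
  have r3 := (hval F.D₁ hF.D₁_mem _ c d c11 c21 c0 d0 h11 h21 hc hd e2).unique (by rw [hF.D₁_v]; exact at_zero)
  have r4 := (hval F.D₂ hF.D₂_mem _ c d c12 c22 c0 d0 h12 h22 hc hd e2).unique (by rw [hF.D₂_v]; exact at_one)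
  have hJ0 : c11 * c22 - c12 * c21 ≠ 0 := by
    intro h0
    have : (a0 * d0 - b0 * c0) * (c11 * c22 - c12 * c21) = 1 := by
      linear_combination (c0 * c12 + d0 * c22) * r1 + r4 - (c0 * c11 + d0 * c21) * r2
    rw [h0, mul_zero] at this
    exact zero_ne_one this
  have hJ : z.At (F.D₁ u * F.D₂ v - F.D₂ u * F.D₁ v) (c11 * c22 - c12 * c21) :=
    (h11.mul h22).sub (h12.mul h21)
  have hJn := hJ.ne_zero hJ0
  have hJi := (hJ.inv hJ0).1
  have hD : ∀ D : Derivation k K K, ∀ s t, D u = s → D v = t → s ∈ z.O → t ∈ z.O → ∀ x ∈ z.O, D x ∈ z.O := by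
    intro D s t hs ht hs' ht' x hx
    have q1 := F.derivation_eq D u
    have q2 := F.derivation_eq D v
    rw [hs] at q1
    rw [ht] at q2
    have ep : D F.p = (s * F.D₂ v - t * F.D₂ u) * (F.D₁ u * F.D₂ v - F.D₂ u * F.D₁ v)⁻¹ := by
      rw [eq_mul_inv_iff_mul_eq₀ hJn, q1, q2]; ring
    have eq : D F.q = (t * F.D₁ u - s * F.D₁ v) * (F.D₁ u * F.D₂ v - F.D₂ u * F.D₁ v)⁻¹ := by
      rw [eq_mul_inv_iff_mul_eq₀ hJn, q1, q2]; ring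
    rw [F.derivation_eq D x, ep, eq]
    exact add_mem (mul_mem (mul_mem (sub_mem (mul_mem hs' h22.1) (mul_mem ht' h12.1)) hJi) (hF.D₁_mem x hx))
      (mul_mem (mul_mem (sub_mem (mul_mem ht' h11.1) (mul_mem hs' h21.1)) hJi) (hF.D₂_mem x hx))
  refine h.eq_of_le (z := z) ⟨hD D₁ 1 0 h.D₁_u h.D₁_v z.O.one_mem z.O.zero_mem, 
    hD D₂ 0 1 h.D₂_u h.D₂_v z.O.zero_mem z.O.one_mem, hu, hv, h.D₁_u, h.D₁_v, h.D₂_u, h.D₂_v, hgen,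
    hF.noeth, hF.frac⟩ hle

end

section

variable {k K : Type u} [Field k] [Field K] [Algebra k K] [CharZero k]

namespace Frame

variable (F : Frame k K)

theorem coeff_eq_zero_of_eval {a b : MvPolynomial (Fin 2) k} (hab : IsRelPrime a b) (hb : b ≠ 0) {α β : k}
    (ha0 : pnt α β a = 0) (hb0 : pnt α β b = 0) :
    ∀ (n : ℕ) (G : Polynomial (MvPolynomial (Fin 2) k)), G.natDegree ≤ n →
      G.eval₂ (F.e : MvPolynomial (Fin 2) k →+* K) (F.e a / F.e b) = 0 → ∀ i, pnt α β (G.coeff i) = 0 := by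
  have hinj : Function.Injective (F.e : MvPolynomial (Fin 2) k →+* K) := F.e_injective
  have heb : F.e b ≠ 0 := fun h => hb (F.e_injective (by rw [h, map_zero]))
  intro n
  induction n with
  | zero =>
    intro G hG h0 i
    obtain ⟨g, rfl⟩ : ∃ g, G = Polynomial.C g := ⟨_, Polynomial.eq_C_of_natDegree_le_zero hG⟩
    rw [Polynomial.eval₂_C] at h0
    have : g = 0 := hinj (by rw [h0, map_zero])
    simp [this]
  | succ n ih =>
    intro G hG h0 i
    have hdvd : b ∣ G.coeff (n + 1) := by
      rcases Nat.lt_or_ge G.natDegree (n + 1) with hlt | hge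
      · rw [Polynomial.coeff_eq_zero_of_natDegree_lt hlt]; exact dvd_zero b
      have hd : G.natDegree = n + 1 := le_antisymm hG hge
      have h1 : (G.scaleRoots b).IsRoot a := by
        have := Polynomial.scaleRoots_eval₂_eq_zero_of_eval₂_div_eq_zero hinj (r := a) (s := b) h0
          (mem_nonZeroDivisors_of_ne_zero hb)
        rw [Polynomial.eval₂_at_apply] at this
        exact hinj (by rw [this, map_zero])
      have h2 := Polynomial.dvd_term_of_isRoot_of_dvd_terms (p := b) (n + 1) h1 (fun j hj => by
        rw [Polynomial.coeff_scaleRoots]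
        rcases Nat.lt_or_ge j (n + 1) with hjl | hjl
        · refine Dvd.dvd.mul_right (Dvd.dvd.mul_left (dvd_pow_self b ?_) _) _
          omega
        · rw [Polynomial.coeff_eq_zero_of_natDegree_lt (by omega)]
          simp)
      rw [Polynomial.coeff_scaleRoots, hd, Nat.sub_self, pow_zero, mul_one] at h2
      exact (hab.symm.pow_right (n := n + 1)).dvd_of_dvd_mul_right h2
    obtain ⟨g, hg⟩ := hdvd
    have h1 := ih (G - Polynomial.C g * Polynomial.X ^ n * (Polynomial.C b * Polynomial.X - Polynomial.C a)) (by
      rw [Polynomial.natDegree_le_iff_coeff_eq_zero]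
      intro N hN
      have e : Polynomial.C g * Polynomial.X ^ n * (Polynomial.C b * Polynomial.X - Polynomial.C a) =
        Polynomial.C (b * g) * Polynomial.X ^ (n + 1) - Polynomial.C (a * g) * Polynomial.X ^ n := by
        simp only [map_mul]; ring
      rw [e, Polynomial.coeff_sub, Polynomial.coeff_sub, Polynomial.coeff_C_mul_X_pow,
        Polynomial.coeff_C_mul_X_pow, if_neg (by omega : ¬ N = n)]
      split_ifs with hN'
      · rw [hN', hg]; ring
      · rw [Polynomial.coeff_eq_zero_of_natDegree_lt (by omega)]; ring) (by
      simp only [Polynomial.eval₂_sub, Polynomial.eval₂_mul, Polynomial.eval₂_C, Polynomial.eval₂_X, h0]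
      simp only [RingHom.coe_coe]
      field_simp
      ring) i
    rw [Polynomial.coeff_sub, map_sub] at h1
    have h2 : pnt α β ((Polynomial.C g * Polynomial.X ^ n * (Polynomial.C b * Polynomial.X - Polynomial.C a)).coeff i) = 0 := by
      have e : Polynomial.C g * Polynomial.X ^ n * (Polynomial.C b * Polynomial.X - Polynomial.C a) =
        Polynomial.C (b * g) * Polynomial.X ^ (n + 1) - Polynomial.C (a * g) * Polynomial.X ^ n := by
        simp only [map_mul]; ring
      rw [e, Polynomial.coeff_sub, Polynomial.coeff_C_mul_X_pow, Polynomial.coeff_C_mul_X_pow, map_sub]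
      split_ifs <;> simp [ha0, hb0]
    rwa [h2, sub_zero] at h1

/-- If neither `w` nor `w⁻¹` is regular at a point of the plane, then the local ring of the point is
dominated by local rings at which `w` takes any given value. -/
theorem exists_ge_at {w : K} {α β : k} (h1 : w ∉ (F.P α β).O) (h2 : w⁻¹ ∉ (F.P α β).O) (c : k) :
    ∃ V : LPt k K k, F.P α β ≤ V ∧ V.At w c := by
  have hw : w ≠ 0 := by rintro rfl; exact h1 (zero_mem _)
  obtain ⟨a, b, hab, ha, hb, e⟩ := F.exists_coprime hw
  have heb : F.e b ≠ 0 := fun h => hb (F.e_injective (by rw [h, map_zero]))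
  have hb0 : pnt α β b = 0 := by
    by_contra hb0
    exact h1 (F.mem_P.2 ⟨a, b, hb0, e⟩)
  have ha0 : pnt α β a = 0 := by
    by_contra ha0
    exact h2 (F.mem_P.2 ⟨b, a, ha0, by rw [e, inv_div]⟩)
  let f : Polynomial (MvPolynomial (Fin 2) k) →ₐ[k] K := Polynomial.eval₂AlgHom F.e w fun _ => Commute.all _ _
  let g : Polynomial (MvPolynomial (Fin 2) k) →ₐ[k] k := Polynomial.eval₂AlgHom (pnt α β) c fun _ => Commute.all _ _
  have hfg : ∀ G, f G = 0 → g G = 0 := by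
    intro G hG
    have := F.coeff_eq_zero_of_eval hab hb ha0 hb0 _ G le_rfl (by rw [← e]; exact hG)
    change G.eval₂ (pnt α β : MvPolynomial (Fin 2) k →+* k) c = 0
    rw [Polynomial.eval₂_eq_sum]
    exact Finset.sum_eq_zero fun i _ => by simp [this i]
  refine ⟨ofHoms f g hfg, F.P_le ?_ ?_, ?_⟩
  · have := at_ofHoms_self (h := hfg) (Polynomial.C (X 0))
    simpa [f, g] using this
  · have := at_ofHoms_self (h := hfg) (Polynomial.C (X 1))
    simpa [f, g] using this
  · have := at_ofHoms_self (h := hfg) Polynomial.X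
    simpa [f, g] using this

end Frame

namespace RegPt

variable {P : LPt k K k} {u v : K} {D₁ D₂ : Derivation k K K}

theorem exists_eval_ne {p q : Polynomial k} (hp : p ≠ 0) (hq : q ≠ 0) : ∃ c, p.eval c ≠ 0 ∧ q.eval c ≠ 0 := by
  classical
  obtain ⟨c, hc⟩ := Infinite.exists_notMem_finset (p * q).roots.toFinset
  simp only [Multiset.mem_toFinset, Polynomial.mem_roots (mul_ne_zero hp hq), Polynomial.IsRoot,
    Polynomial.eval_mul, mul_eq_zero, not_or] at hc
  exact ⟨c, hc⟩

theorem eq_frame_or (h : RegPt P u v D₁ D₂) (F : Frame k K) {α β : k} (hle : P ≤ F.P α β) :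
    P = F.P α β ∨ v / u ∈ (F.P α β).O ∨ u / v ∈ (F.P α β).O := by
  by_contra! hcon
  obtain ⟨hne, h1, h2⟩ := hcon
  refine hne (h.eq_frame F hle ?_)
  have hu := h.u_ne
  have hF := F.regPt α β
  set z := F.P α β with hz
  set s := F.p - algebraMap k K α
  set t := F.q - algebraMap k K β
  let W : ℕ → K → Prop := fun n x => ∃ A G : Polynomial P.O, P.red G ≠ 0 ∧
    x = u ^ n * (P.evK (v / u) A / P.evK (v / u) G)
  have hW1 : ∀ x, z.At x 0 → W 1 x := by
    intro x hx
    by_cases hx0 : x = 0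
    · exact ⟨0, 1, by simp, by simp [hx0]⟩
    obtain ⟨n, A, G, hA, hG, e⟩ := h.exists_zpow hx0
    obtain ⟨c, hcA, hcG⟩ := exists_eval_ne hA hG
    obtain ⟨V, hzV, hV⟩ := F.exists_ge_at h1 (by rwa [inv_div]) c
    have htV := h.tr_le (hle.trans hzV) hV
    have hr := (((h.tr_at_evK c A).div (h.tr_at_evK c G) hcG).mono htV)
    have hn : 0 < n := by
      by_contra! hn
      obtain ⟨m, rfl⟩ := Int.exists_eq_neg_ofNat hn
      have h3 : V.At (x * u ^ m) (0 * 0 ^ m) := (hx.mono hzV).mul ((h.at_u.mono (hle.trans hzV)).pow m)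
      have h4 : x * u ^ m = P.evK (v / u) A / P.evK (v / u) G := by
        rw [e, zpow_neg, zpow_natCast]; field_simp
      rw [h4, zero_mul] at h3
      exact div_ne_zero hcA hcG (hr.unique h3)
    obtain ⟨m, rfl⟩ := Int.eq_ofNat_of_zero_le hn.le
    refine ⟨Polynomial.C ⟨u, h.at_u.1⟩ ^ (m - 1) * A, G, hG, ?_⟩
    have : m = 1 + (m - 1) := by omega
    rw [e, map_mul, map_pow, evK_C, zpow_natCast]
    conv_lhs => rw [this, pow_add]
    ring
  have hWmul : ∀ x y, W 1 x → W 1 y → W 2 (x * y) := by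
    rintro _ _ ⟨A, G, hG, rfl⟩ ⟨B, H, hH, rfl⟩
    exact ⟨A * B, G * H, by rw [map_mul]; exact mul_ne_zero hG hH, by
      rw [map_mul, map_mul, mul_div_mul_comm]; ring⟩
  have hWadd : ∀ x y, W 2 x → W 2 y → W 2 (x + y) := by
    rintro _ _ ⟨A, G, hG, rfl⟩ ⟨B, H, hH, rfl⟩
    have := h.evK_ne hG
    have := h.evK_ne hH
    exact ⟨A * H + G * B, G * H, by rw [map_mul]; exact mul_ne_zero hG hH, by
      rw [map_add, map_mul, map_mul, map_mul]; field_simp⟩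
  have hW2 : ∀ x, z.MP 2 x → W 2 x := by
    intro x hx
    induction hx using MP.induction with
    | h_mul x y hx hy => exact hWmul _ _ (hW1 x hx) (hW1 y (mp_one_iff.1 hy))
    | h_add x y hx hy ihx ihy => exact hWadd _ _ ihx ihy
  have hind : ∀ a b : k, z.MP 2 (algebraMap k K a * u + algebraMap k K b * v) → a = 0 ∧ b = 0 := by
    intro a b hab
    obtain ⟨A, G, hG, e⟩ := hW2 _ hab
    have hGn := h.evK_ne hG
    have h3 : P.evK (v / u) ((Polynomial.C (algebraMap k P.O a) + Polynomial.C (algebraMap k P.O b) * Polynomial.X) * G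
        - Polynomial.C ⟨u, h.at_u.1⟩ * A) = 0 := by
      simp only [map_sub, map_mul, map_add, evK_C, evK_X]
      have ea : ((algebraMap k P.O a : P.O) : K) = algebraMap k K a := rfl
      have eb : ((algebraMap k P.O b : P.O) : K) = algebraMap k K b := rfl
      rw [ea, eb]
      field_simp at e ⊢
      linear_combination e
    have h4 := h.evK_eq_zero h3
    have hru : P.res ⟨u, h.at_u.1⟩ = 0 := (at_coe (P := P) ⟨u, h.at_u.1⟩).unique h.at_u
    simp only [map_sub, map_mul, map_add, red_C, red_X, hru, map_zero, zero_mul, sub_zero, AlgHom.commutes] at h4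
    rcases mul_eq_zero.1 h4 with h5 | h5
    · have c0 := congrArg (Polynomial.coeff · 0) h5
      have c1 := congrArg (Polynomial.coeff · 1) h5
      simp at c0 c1
      exact ⟨c0, c1⟩
    · exact absurd h5 hG
  have h_u := h.at_u.mono hle
  have h_v := h.at_v.mono hle
  obtain ⟨a, ha, b, hb, e1⟩ := hF.gen _ h_u
  obtain ⟨c, hc, d, hd, e2⟩ := hF.gen _ h_v
  obtain ⟨a0, ha⟩ := exists_at ha
  obtain ⟨b0, hb⟩ := exists_at hb
  obtain ⟨c0, hc⟩ := exists_at hc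
  obtain ⟨d0, hd⟩ := exists_at hd
  have hcomb : ∀ x y : k, x * a0 + y * c0 = 0 → x * b0 + y * d0 = 0 → x = 0 ∧ y = 0 := by
    intro x y hx hy
    refine hind x y ?_
    have e : algebraMap k K x * u + algebraMap k K y * v =
        (algebraMap k K x * a + algebraMap k K y * c) * s + (algebraMap k K x * b + algebraMap k K y * d) * t := by
      rw [e1, e2]; ring
    rw [e]
    have m1 := ((at_algebraMap x).mul ha).add ((at_algebraMap y).mul hc)
    have m2 := ((at_algebraMap x).mul hb).add ((at_algebraMap y).mul hd)
    simp only [Algebra.algebraMap_self, RingHom.id_apply, hx, hy] at m1 m2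
    exact ((mp_one_iff.2 m1).mul (mp_one_iff.2 hF.at_u)).add ((mp_one_iff.2 m2).mul (mp_one_iff.2 hF.at_v))
  have hdet : a0 * d0 - b0 * c0 ≠ 0 := by
    intro h0
    obtain ⟨hd0, hb0⟩ := hcomb d0 (-b0) (by linear_combination h0) (by ring)
    obtain ⟨hc0, ha0⟩ := hcomb c0 (-a0) (by ring) (by linear_combination -h0)
    have := hcomb 1 0 (by simp [neg_eq_zero.1 ha0]) (by simp [neg_eq_zero.1 hb0])
    exact one_ne_zero this.1
  have hdA := (ha.mul hd).sub (hb.mul hc)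
  have hdn := hdA.ne_zero hdet
  have hdi := (hdA.inv hdet).1
  intro x hx
  obtain ⟨x1, hx1, x2, hx2, ex⟩ := hF.gen _ hx
  refine ⟨(x1 * d - x2 * c) * (a * d - b * c)⁻¹, mul_mem (sub_mem (mul_mem hx1 hd.1) (mul_mem hx2 hc.1)) hdi,
    (x2 * a - x1 * b) * (a * d - b * c)⁻¹, mul_mem (sub_mem (mul_mem hx2 ha.1) (mul_mem hx1 hb.1)) hdi, ?_⟩
  have : x = ((x1 * d - x2 * c) * u + (x2 * a - x1 * b) * v) * (a * d - b * c)⁻¹ := by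
    rw [eq_mul_inv_iff_mul_eq₀ hdn, ex, e1, e2]; ring
  rw [this]; ring

end RegPt

end

section

variable {k K : Type u} [Field k] [Field K] [Algebra k K]

namespace Frame

variable (F : Frame k K)

/-- The Jacobian determinant of two functions with respect to a frame. -/
def J (u v : K) : K := F.D₁ u * F.D₂ v - F.D₂ u * F.D₁ v

theorem J_swap (u v : K) : F.J u v = - F.J v u := by
  unfold J; ring

theorem J_tr {u v : K} (hu : u ≠ 0) (c : k) : F.J u v = u * F.J u (v / u - algebraMap k K c) := by
  obtain ⟨w, rfl⟩ : ∃ w, v = u * w := ⟨v / u, by field_simp⟩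
  rw [mul_div_cancel_left₀ _ hu]
  simp only [J, Derivation.leibniz, map_sub, Derivation.map_algebraMap, smul_eq_mul]
  ring

theorem J_ne {P : LPt k K k} {u v : K} {D₁ D₂ : Derivation k K K} (h : RegPt P u v D₁ D₂) : F.J u v ≠ 0 := by
  intro h0
  have q1 := F.derivation_eq D₁ u
  have q2 := F.derivation_eq D₁ v
  have q3 := F.derivation_eq D₂ u
  have q4 := F.derivation_eq D₂ v
  rw [h.D₁_u] at q1
  rw [h.D₁_v] at q2
  rw [h.D₂_u] at q3
  rw [h.D₂_v] at q4
  have : (D₁ F.p * D₂ F.q - D₁ F.q * D₂ F.p) * F.J u v = 1 := by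
    unfold J
    have e : (1 : K) = 1 * 1 - 0 * 0 := by ring
    rw [e]
    nth_rewrite 1 [q1]
    nth_rewrite 1 [q4]
    nth_rewrite 1 [q2]
    nth_rewrite 1 [q3]
    ring
  rw [h0, mul_zero] at this
  exact zero_ne_one this

variable [CharZero k]

theorem eq_zero_of_mp {α β : k} {a : MvPolynomial (Fin 2) k}
    (h : (F.P α β).MP (a.totalDegree + 1) (F.e a)) : a = 0 := by
  refine eq_zero_of_pderiv (p := fun N a => (F.P α β).MP N (F.e a)) (fun N a i h0 => ?_) (fun N c h0 => ?_) h
  · fin_cases i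
    · change (F.P α β).MP N (F.e (pderiv 0 a))
      rw [← D₁_e]
      exact MP.derivation (F.regPt α β).D₁_mem h0
    · change (F.P α β).MP N (F.e (pderiv 1 a))
      rw [← D₂_e]
      exact MP.derivation (F.regPt α β).D₂_mem h0
  · rw [e_C] at h0
    exact ((mp_one_iff.1 (h0.mono (Nat.le_add_left 1 N))).unique (at_algebraMap (P := F.P α β) c)).symm

theorem exists_not_mp {f : K} (hf : f ≠ 0) : ∃ n, ∀ α β, ¬ (F.P α β).MP n f := by
  obtain ⟨a, b, hb, e⟩ := F.frac f
  change F.e b ≠ 0 at hb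
  change f = F.e a / F.e b at e
  refine ⟨a.totalDegree + 1, fun α β hm => ?_⟩
  have e1 : F.e a = F.e b * f := by rw [e]; field_simp
  have h1 : (F.P α β).MP (a.totalDegree + 1) (F.e a) := e1 ▸ hm.mul_mem (F.at_e α β b).1
  have : a = 0 := F.eq_zero_of_mp h1
  rw [this, map_zero, zero_div] at e
  exact hf e

end Frame

variable [CharZero k]

/-- The points of `Z` dominating `P`. -/
def fib (Z : Set (LPt k K k)) (P : LPt k K k) : Set (LPt k K k) := {z | z ∈ Z ∧ P ≤ z}

/-- Every point of `Z` which is the centre of a place centred at `P` dominates `P`. -/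
def ZDef (Z : Set (LPt k K k)) (P : LPt k K k) : Prop :=
  ∀ V : LPt k K k, V.IsPlace → P ≤ V → ∀ z ∈ Z, z ≤ V → P ≤ z

/-- The Jacobian of `u` and `v` vanishes to order less than `n` at the points of `Z` above `P`. -/
def JBound {ι : Type*} (F : ι → Frame k K) (Z : Set (LPt k K k)) (P : LPt k K k) (u v : K) (n : ℕ) : Prop :=
  ∀ i α β, (F i).P α β ∈ fib Z P → ¬ ((F i).P α β).MP n ((F i).J u v)

variable {Z : Set (LPt k K k)} {P : LPt k K k} {u v : K} {D₁ D₂ : Derivation k K K}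

theorem fib_nonempty [IsAlgClosed k] (hc : ∀ V : LPt k K k, V.IsPlace → ∃ z ∈ Z, z ≤ V) (hP : ZDef Z P) :
    (fib Z P).Nonempty := by
  obtain ⟨V, hV, hVp⟩ := exists_place_ge P
  obtain ⟨z, hz, hzV⟩ := hc V hVp
  exact ⟨z, hz, hP V hVp hV z hz hzV⟩

namespace RegPt

theorem exists_jBound {ι : Type*} [Finite ι] (F : ι → Frame k K) (h : RegPt P u v D₁ D₂) :
    ∃ n, JBound F Z P u v n := by
  have := Fintype.ofFinite ι
  choose n hn using fun i => (F i).exists_not_mp ((F i).J_ne h)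
  refine ⟨∑ i, n i, fun i α β _ hm => hn i α β (hm.mono ?_)⟩
  exact Finset.single_le_sum (f := n) (fun _ _ => Nat.zero_le _) (Finset.mem_univ i)

theorem fib_subset_tr (h : RegPt P u v D₁ D₂) (c : k) : fib Z (h.tr c) ⊆ fib Z P :=
  fun _ hz => ⟨hz.1, (h.le_tr c).trans hz.2⟩

theorem fib_subset_inf (h : RegPt P u v D₁ D₂) : fib Z h.inf ⊆ fib Z P :=
  h.swap.fib_subset_tr 0

theorem jBound_tr {ι : Type*} {F : ι → Frame k K} (h : RegPt P u v D₁ D₂) {n : ℕ}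
    (hJ : JBound F Z P u v (n + 1)) (c : k) : JBound F Z (h.tr c) u (v / u - algebraMap k K c) n := by
  intro i α β hz hm
  refine hJ i α β (h.fib_subset_tr c hz) ?_
  rw [(F i).J_tr h.u_ne c, add_comm]
  exact (mp_one_iff.2 (h.at_u.mono ((h.le_tr c).trans hz.2))).mul hm

theorem jBound_swap {ι : Type*} {F : ι → Frame k K} {n : ℕ} (hJ : JBound F Z P u v n) : JBound F Z P v u n := by
  intro i α β hz hm
  refine hJ i α β hz ?_
  rw [(F i).J_swap]
  exact hm.neg

theorem not_jBound_zero [IsAlgClosed k] {ι : Type*} {F : ι → Frame k K} (h : RegPt P u v D₁ D₂)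
    (hF : ∀ z ∈ Z, ∃ i α β, z = (F i).P α β)
    (hc : ∀ V : LPt k K k, V.IsPlace → ∃ z ∈ Z, z ≤ V) (hP : ZDef Z P) (hJ : JBound F Z P u v 0) : False := by
  obtain ⟨z, hz⟩ := fib_nonempty hc hP
  obtain ⟨i, α, β, rfl⟩ := hF z hz.1
  refine hJ i α β hz (mp_zero_iff.2 ?_)
  have hr := (F i).regPt α β
  have hu := (h.at_u.mono hz.2).1
  have hv := (h.at_v.mono hz.2).1
  exact sub_mem (mul_mem (hr.D₁_mem _ hu) (hr.D₂_mem _ hv)) (mul_mem (hr.D₂_mem _ hu) (hr.D₁_mem _ hv))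

theorem exists_at_or {ι : Type*} {F : ι → Frame k K} (h : RegPt P u v D₁ D₂)
    (hF : ∀ z ∈ Z, ∃ i α β, z = (F i).P α β) (hPZ : P ∉ Z) {z : LPt k K k} (hz : z ∈ fib Z P) :
    (∃ c, z.At (v / u) c) ∨ z.At (u / v) 0 := by
  obtain ⟨i, α, β, rfl⟩ := hF z hz.1
  rcases h.eq_frame_or (F i) hz.2 with e | hw | hw
  · exact absurd (e ▸ hz.1) hPZ
  · exact Or.inl (exists_at hw)
  · obtain ⟨c, hc⟩ := exists_at hw
    by_cases h0 : c = 0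
    · exact Or.inr (h0 ▸ hc)
    · have := hc.inv h0
      rw [inv_div] at this
      exact Or.inl ⟨_, this⟩

theorem w_ne (h : RegPt P u v D₁ D₂) : v / u ≠ 0 := div_ne_zero h.v_ne h.u_ne

theorem zdef_tr [IsAlgClosed k] {ι : Type*} {F : ι → Frame k K} (h : RegPt P u v D₁ D₂)
    (hF : ∀ z ∈ Z, ∃ i α β, z = (F i).P α β) (hPZ : P ∉ Z) (hP : ZDef Z P) (c : k) : ZDef Z (h.tr c) := by
  intro V hV hcV z hz hzV
  have hPz := hP V hV ((h.le_tr c).trans hcV) z hz hzV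
  have hVc := (h.tr_at c).mono hcV
  rcases h.exists_at_or hF hPZ ⟨hz, hPz⟩ with ⟨d, hd⟩ | h0
  · refine h.tr_le hPz ?_
    rwa [hVc.unique (hd.mono hzV)]
  · refine (Frame.at_zero_ne h.w_ne hVc ?_).elim
    rw [inv_div]
    exact h0.mono hzV

theorem fib_eq {ι : Type*} {F : ι → Frame k K} (h : RegPt P u v D₁ D₂)
    (hF : ∀ z ∈ Z, ∃ i α β, z = (F i).P α β) (hPZ : P ∉ Z) :
    fib Z P = fib Z h.inf ∪ ⋃ c, fib Z (h.tr c) := by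
  refine subset_antisymm (fun z hz => ?_)
    (Set.union_subset h.fib_subset_inf (Set.iUnion_subset h.fib_subset_tr))
  rcases h.exists_at_or hF hPZ hz with ⟨d, hd⟩ | h0
  · exact Or.inr (Set.mem_iUnion.2 ⟨d, hz.1, h.tr_le hz.2 hd⟩)
  · exact Or.inl ⟨hz.1, h.inf_le hz.2 h0⟩

theorem disjoint_tr (h : RegPt P u v D₁ D₂) {c d : k} (hcd : c ≠ d) :
    Disjoint (fib Z (h.tr c)) (fib Z (h.tr d)) :=
  Set.disjoint_left.2 fun _ hz hz' =>
    hcd (((h.tr_at c).mono hz.2).unique ((h.tr_at d).mono hz'.2))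

theorem disjoint_inf [IsAlgClosed k] (h : RegPt P u v D₁ D₂) (c : k) :
    Disjoint (fib Z h.inf) (fib Z (h.tr c)) :=
  Set.disjoint_left.2 fun _ hz hz' => Frame.at_zero_ne h.w_ne ((h.tr_at c).mono hz'.2)
    (by rw [inv_div]; exact h.inf_at.mono hz.2)

end RegPt

end

section PuncturedLine

variable {k : Type u} [Field k] {H : Polynomial k}

/-- The coordinate of a point of a punctured line. -/
def coord (φ : Localization.Away H →ₐ[k] k) : k :=
  φ (algebraMap (Polynomial k) (Localization.Away H) Polynomial.X)

theorem apply_algebraMap_eval (φ : Localization.Away H →ₐ[k] k) (N : Polynomial k) :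
    φ (algebraMap (Polynomial k) (Localization.Away H) N) = N.eval (coord φ) := by
  have : φ.comp (IsScalarTower.toAlgHom k (Polynomial k) (Localization.Away H)) = Polynomial.aeval (coord φ) := by
    ext; simp [coord]
  have := DFunLike.congr_fun this N
  simpa [Polynomial.aeval_def, Polynomial.eval₂_eq_eval_map] using this

theorem eval_coord_ne (φ : Localization.Away H →ₐ[k] k) : H.eval (coord φ) ≠ 0 := by
  rw [← apply_algebraMap_eval]
  exact ((IsLocalization.Away.algebraMap_isUnit H).map φ).ne_zero

theorem exists_coord {c : k} (hc : H.eval c ≠ 0) : ∃ φ : Localization.Away H →ₐ[k] k, coord φ = c := by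
  refine ⟨IsLocalization.liftAlgHom (M := Submonoid.powers H) (f := Polynomial.aeval c) ?_, ?_⟩
  · rintro ⟨_, n, rfl⟩
    simpa [Polynomial.aeval_def, Polynomial.eval₂_eq_eval_map] using fun h => absurd h hc
  · simp [coord]

theorem isLCI_puncturedLine : IsLCI (IsScalarTower.toAlgHom k (Polynomial k) (Localization.Away H)) H where
  unit := IsLocalization.Away.algebraMap_isUnit H
  surj y := by
    obtain ⟨⟨a, ⟨_, n, rfl⟩⟩, h⟩ := IsLocalization.surj (Submonoid.powers H) y
    exact ⟨a, n, by simpa using h⟩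

theorem finiteType_puncturedLine : Algebra.FiniteType k (Localization.Away H) := by
  have := IsLocalization.finiteType_of_monoid_fg (Submonoid.powers H) (Localization.Away H)
  exact Algebra.FiniteType.trans (S := Polynomial k) inferInstance this

theorem eq_zero_of_forall [Infinite k] (hH : H ≠ 0) {y : Localization.Away H}
    (hy : ∀ φ : Localization.Away H →ₐ[k] k, φ y = 0) : y = 0 := by
  obtain ⟨N, n, h⟩ := (isLCI_puncturedLine (H := H)).surj y
  change y * _ = algebraMap (Polynomial k) (Localization.Away H) N at h
  have hN : N * H = 0 := by
    refine Polynomial.funext fun c => ?_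
    rw [Polynomial.eval_mul, Polynomial.eval_zero]
    by_cases hc : H.eval c = 0
    · rw [hc, mul_zero]
    · obtain ⟨φ, rfl⟩ := exists_coord hc
      rw [← apply_algebraMap_eval φ N, ← h, map_mul, hy, zero_mul, zero_mul]
  have hN0 : N = 0 := (mul_eq_zero.1 hN).resolve_right hH
  rw [hN0, map_zero] at h
  exact ((isLCI_puncturedLine.unit.pow n).mul_left_eq_zero).1 h

theorem AlgMeasure.cl_puncturedLine [IsAlgClosed k] [DecidableEq k] {Q : Type u} [CommRing Q] (μ : AlgMeasure k Q) (hH : H ≠ 0) :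
    μ.cl (Localization.Away H) = - (H.roots.toFinset.card : Q) := by
  classical
  have := finiteType_puncturedLine (H := H)
  obtain ⟨h1, h2⟩ := (isLCI_puncturedLine (H := H)).nu_eq μ (φ := ind {θ | θ H ≠ 0}) (ψ := 1) isCon_one
    (fun η => by
      rw [ind, Set.indicator_of_mem]
      · rfl
      · exact ((IsLocalization.Away.algebraMap_isUnit H).map η).ne_zero)
    (fun θ hθ => by
      rw [ind, Set.indicator_of_notMem]
      intro h0
      obtain ⟨φ, hφ⟩ := exists_coord (H := H) (c := θ Polynomial.X) (by
        have e : θ = Polynomial.aeval (θ Polynomial.X) := by ext; simp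
        have h0 : θ H ≠ 0 := h0
        rw [e] at h0
        simpa [Polynomial.aeval_def, Polynomial.eval₂_eq_eval_map] using h0)
      exact hθ ⟨φ, by ext; exact hφ⟩)
  rw [μ.nu_one] at h2
  have h3 : ({θ | θ H = 0} : Set (Polynomial k →ₐ[k] k)) = (H.roots.toFinset.image
      (fun c => (Polynomial.aeval c : Polynomial k →ₐ[k] k)) : Finset _) := by
    ext θ
    have e : θ = Polynomial.aeval (θ Polynomial.X) := by ext; simp
    simp only [Set.mem_ofPred_eq, Finset.coe_image, Set.mem_image, Finset.mem_coe, Multiset.mem_toFinset,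
      Polynomial.mem_roots hH, Polynomial.IsRoot]
    constructor
    · intro h0
      refine ⟨θ Polynomial.X, ?_, e.symm⟩
      rw [e] at h0
      simpa [Polynomial.aeval_def, Polynomial.eval₂_eq_eval_map] using h0
    · rintro ⟨c, hc, rfl⟩
      simpa [Polynomial.aeval_def, Polynomial.eval₂_eq_eval_map] using hc
  have h4 := μ.nu_union (conSet_ne_zero H) (conSet_eq_zero (k := k) H)
    (Set.disjoint_left.2 fun θ h h' => h h')
  rw [h3, μ.nu_finset, Finset.card_image_of_injective _ (fun c d h => by
      simpa using DFunLike.congr_fun h Polynomial.X), h2, ← h3] at h4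
  have h5 : ({θ | θ H ≠ 0} ∪ {θ | θ H = 0} : Set (Polynomial k →ₐ[k] k)) = Set.univ := by
    ext θ; simpa using (em _).symm
  rw [h5, ind, Set.indicator_univ] at h4
  have h6 := μ.nu_one (A := Polynomial k)
  rw [μ.poly inferInstance] at h6
  rw [eq_neg_iff_add_eq_zero, ← h4]
  exact h6

variable (H) in
/-- A rational parametrization of a plane curve. -/
theorem exists_param (N₁ N₂ : Polynomial k) {H₀ : Polynomial k} (hd : H₀ ∣ H) :
    ∃ g : MvPolynomial (Fin 2) k →ₐ[k] Localization.Away H, ∀ φ : Localization.Away H →ₐ[k] k,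
      φ.comp g = Frame.pnt (N₁.eval (coord φ) / H₀.eval (coord φ)) (N₂.eval (coord φ) / H₀.eval (coord φ)) := by
  have hu : IsUnit (algebraMap (Polynomial k) (Localization.Away H) H₀) :=
    isUnit_of_dvd_unit (map_dvd _ hd) (IsLocalization.Away.algebraMap_isUnit H)
  obtain ⟨i, hi⟩ := hu.exists_right_inv
  refine ⟨aeval ![algebraMap _ _ N₁ * i, algebraMap _ _ N₂ * i], fun φ => ?_⟩
  have h1 := congrArg φ hi
  rw [map_mul, map_one, apply_algebraMap_eval] at h1
  have h0 : H₀.eval (coord φ) ≠ 0 := left_ne_zero_of_mul_eq_one h1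
  have h2 : φ i = (H₀.eval (coord φ))⁻¹ := eq_inv_of_mul_eq_one_right h1
  ext j
  fin_cases j <;> simp [h2, apply_algebraMap_eval, div_eq_mul_inv]

theorem exists_forall_mem [IsAlgClosed k] {N₁ N₂ H₀ : Polynomial k} (hH₀ : H₀ ≠ 0)
    {S : Set (MvPolynomial (Fin 2) k →ₐ[k] k)} (hS : ConSet S)
    (hinf : {c | H₀.eval c ≠ 0 ∧ Frame.pnt (N₁.eval c / H₀.eval c) (N₂.eval c / H₀.eval c) ∈ S}.Infinite) :
    ∃ m : Polynomial k, m ≠ 0 ∧ ∀ c, m.eval c ≠ 0 → H₀.eval c ≠ 0 →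
      Frame.pnt (N₁.eval c / H₀.eval c) (N₂.eval c / H₀.eval c) ∈ S := by
  obtain ⟨g, hg⟩ := exists_param H₀ N₁ N₂ dvd_rfl
  have hT := hS.preimage g
  have hdom : IsDomain (Localization.Away H₀) := IsLocalization.isDomain_localization
    (powers_le_nonZeroDivisors_of_noZeroDivisors hH₀)
  obtain ⟨h, hh, r, hr⟩ := hT.exists_const (⊥ : Ideal (Localization.Away H₀))
  obtain ⟨m, n, hm⟩ := (isLCI_puncturedLine (H := H₀)).surj h
  change h * _ = algebraMap (Polynomial k) (Localization.Away H₀) m at hm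
  have hm0 : m ≠ 0 := by
    rintro rfl
    rw [map_zero] at hm
    exact hh ((Submodule.mem_bot _).2 (((isLCI_puncturedLine.unit.pow n).mul_left_eq_zero).1 hm))
  have hmφ : ∀ φ : Localization.Away H₀ →ₐ[k] k, m.eval (coord φ) ≠ 0 → φ h ≠ 0 := by
    intro φ hφ h0
    rw [← apply_algebraMap_eval, ← hm, map_mul, h0, zero_mul] at hφ
    exact hφ rfl
  have hr' : ∀ φ : Localization.Away H₀ →ₐ[k] k, m.eval (coord φ) ≠ 0 →
      ind {η : Localization.Away H₀ →ₐ[k] k | η.comp g ∈ S} φ = r := fun φ hφ =>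
    hr φ (fun x hx => by rw [(Submodule.mem_bot _).1 hx, map_zero]) (hmφ φ hφ)
  obtain ⟨c₀, ⟨hc0, hc1⟩, hc2⟩ : ∃ c ∈ {c | H₀.eval c ≠ 0 ∧ Frame.pnt (N₁.eval c / H₀.eval c) (N₂.eval c / H₀.eval c) ∈ S},
      m.eval c ≠ 0 := by
    by_contra! hcon
    refine hinf ((Polynomial.finite_setOfPred_isRoot hm0).subset fun c hc => hcon c hc)
  obtain ⟨φ₀, rfl⟩ := exists_coord hc0
  have hr0 := hr' φ₀ hc2
  rw [ind, Set.indicator_of_mem (show φ₀ ∈ {η : Localization.Away H₀ →ₐ[k] k | η.comp g ∈ S} by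
    change φ₀.comp g ∈ S; rw [hg]; exact hc1)] at hr0
  refine ⟨m, hm0, fun c hc hc' => ?_⟩
  obtain ⟨φ, rfl⟩ := exists_coord hc'
  by_contra hcon
  have := hr' φ hc
  rw [ind, Set.indicator_of_notMem (show φ ∉ {η : Localization.Away H₀ →ₐ[k] k | η.comp g ∈ S} by
    change φ.comp g ∉ S; rw [hg]; exact hcon), ← hr0] at this
  exact zero_ne_one this

end PuncturedLine

section

section Curve

variable {k : Type u} [Field k] {H : Polynomial k}

theorem isLCI_of_coord [IsAlgClosed k] (hH : H ≠ 0) {A : Type u} [CommRing A] [Algebra k A]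
    (g : A →ₐ[k] Localization.Away H) {a b : A}
    (hg : ∀ φ : Localization.Away H →ₐ[k] k, φ (g b) ≠ 0 ∧ φ (g a) = coord φ * φ (g b)) :
    ∃ h : A, IsLCI g (b * h) := by
  have := finiteType_puncturedLine (H := H)
  have hub : IsUnit (g b) := by
    by_contra hcon
    obtain ⟨M, hM, hbM⟩ := exists_max_ideal_of_mem_nonunits (mem_nonunits_iff.2 hcon)
    obtain ⟨θ, h1, -⟩ := exists_point_prime (k := k) M (h := 1) (fun h => hM.ne_top ((Ideal.eq_top_iff_one _).2 h))
    exact (hg θ).1 (h1 _ hbM)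
  set X' := algebraMap (Polynomial k) (Localization.Away H) Polynomial.X with hX'
  have ha : g a = X' * g b := by
    refine sub_eq_zero.1 (eq_zero_of_forall hH fun φ => ?_)
    rw [map_sub, map_mul, (hg φ).2]
    exact sub_self _
  have key : ∀ N : Polynomial k, ∃ (a' : A) (n : ℕ), algebraMap (Polynomial k) (Localization.Away H) N * g b ^ n = g a' := by
    intro N
    induction N using Polynomial.induction_on' with
    | add p q hp hq =>
      obtain ⟨a₁, n, h1⟩ := hp
      obtain ⟨a₂, m, h2⟩ := hq
      refine ⟨a₁ * b ^ m + a₂ * b ^ n, n + m, ?_⟩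
      simp only [map_add, map_mul, map_pow, ← h1, ← h2]
      ring
    | monomial n c =>
      refine ⟨algebraMap k A c * a ^ n, n, ?_⟩
      rw [map_mul, map_pow, ha, ← Polynomial.C_mul_X_pow_eq_monomial, map_mul, map_pow, AlgHom.commutes,
        IsScalarTower.algebraMap_apply k (Polynomial k) (Localization.Away H)]
      simp only [Polynomial.algebraMap_eq]
      rw [← hX']; ring
  obtain ⟨h, d, hh⟩ := key H
  refine ⟨h, ?_, fun y => ?_⟩
  · rw [map_mul, ← hh]
    exact hub.mul ((IsLocalization.Away.algebraMap_isUnit H).mul (hub.pow d))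
  · obtain ⟨N, n, hN⟩ := (isLCI_puncturedLine (H := H)).surj y
    change y * (algebraMap (Polynomial k) (Localization.Away H) H) ^ n = algebraMap (Polynomial k) (Localization.Away H) N at hN
    obtain ⟨a', m, hm⟩ := key N
    refine ⟨a' * (b ^ n * h ^ m * b ^ (d * n)), n + m, ?_⟩
    simp only [map_mul, map_pow, ← hh, ← hm, ← hN]
    ring

end Curve

variable {k K : Type u} [Field k] [Field K] [Algebra k K] {Q : Type u} [CommRing Q]

theorem Frame.hasClass_curve [IsAlgClosed k] [CharZero k] [DecidableEq k] (F : Frame k K) (μ : AlgMeasure k Q)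
    {H N₁ N₂ H₀ : Polynomial k} (hH : H ≠ 0) (hd : H₀ ∣ H) {a b : MvPolynomial (Fin 2) k}
    (hab : ∀ c, H.eval c ≠ 0 → pnt (N₁.eval c / H₀.eval c) (N₂.eval c / H₀.eval c) b ≠ 0 ∧
      pnt (N₁.eval c / H₀.eval c) (N₂.eval c / H₀.eval c) a =
        c * pnt (N₁.eval c / H₀.eval c) (N₂.eval c / H₀.eval c) b) :
    HasClass μ (frames k K)
      ((fun c => F.P (N₁.eval c / H₀.eval c) (N₂.eval c / H₀.eval c)) '' {c | H.eval c ≠ 0})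
      (-(H.roots.toFinset.card : Q)) := by
  have := finiteType_puncturedLine (H := H)
  obtain ⟨g, hg⟩ := exists_param H N₁ N₂ hd
  obtain ⟨h, hh⟩ := isLCI_of_coord hH g (a := a) (b := b) (fun φ => by
    have e : ∀ x, φ (g x) = pnt (N₁.eval (coord φ) / H₀.eval (coord φ)) (N₂.eval (coord φ) / H₀.eval (coord φ)) x :=
      fun x => by rw [← hg]; rfl
    rw [e, e]
    exact hab _ (eval_coord_ne φ))
  obtain ⟨h1, h2⟩ := hh.nu_eq μ (φ := ind (Set.range fun η : Localization.Away H →ₐ[k] k => η.comp g)) (ψ := 1) isCon_one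
    (fun η => by
      rw [ind, Set.indicator_of_mem (Set.mem_range_self η)]
      rfl)
    (fun θ hθ => by
      rw [ind, Set.indicator_of_notMem]
      exact hθ)
  rw [μ.nu_one, μ.cl_puncturedLine hH] at h2
  rw [← h2]
  have hc := HasClass.of_chart (μ := μ) (G := frames k K) (c := F.toChart) ⟨F, rfl⟩ (C := Set.range fun η : Localization.Away H →ₐ[k] k => η.comp g) h1
  have hs : (fun c => F.P (N₁.eval c / H₀.eval c) (N₂.eval c / H₀.eval c)) '' {c | H.eval c ≠ 0} =
      F.toChart.pt '' (Set.range fun η : Localization.Away H →ₐ[k] k => η.comp g) := by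
    ext z
    refine Iff.trans ?_ F.mem_image.symm
    constructor
    · rintro ⟨c, hc, rfl⟩
      obtain ⟨φ, rfl⟩ := exists_coord hc
      exact ⟨_, _, ⟨φ, hg φ⟩, rfl⟩
    · rintro ⟨α, β, ⟨φ, hφ⟩, rfl⟩
      have e := (hg φ).symm.trans hφ
      have e0 := DFunLike.congr_fun e (X 0)
      have e1 := DFunLike.congr_fun e (X 1)
      simp only [pnt_X0, pnt_X1] at e0 e1
      exact ⟨coord φ, eval_coord_ne φ, by rw [← e0, ← e1]⟩
  rw [hs]
  exact hc

end

section

variable {k K : Type u} [Field k] [Field K] [Algebra k K] {Q : Type u} [CommRing Q]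
variable {Z : Set (LPt k K k)} {P : LPt k K k} {u v : K} {D₁ D₂ : Derivation k K K}

namespace RegPt

theorem exists_eq_div [CharZero k] (h : RegPt P u v D₁ D₂) {x : K} {T : Set k} (hT : T.Infinite)
    (hx : ∀ c ∈ T, ∃ z : LPt k K k, h.tr c ≤ z ∧ x ∈ z.O) :
    ∃ A G : Polynomial P.O, P.red G ≠ 0 ∧ x = P.evK (v / u) A / P.evK (v / u) G := by
  by_cases h0 : x = 0
  · exact ⟨0, 1, by simp, by simp [h0]⟩
  obtain ⟨n, F, G, hF, hG, e⟩ := h.exists_zpow h0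
  have hu := h.u_ne
  rcases le_or_gt 0 n with hn | hn
  · lift n to ℕ using hn
    refine ⟨Polynomial.C ⟨u, h.at_u.mem⟩ ^ n * F, G, hG, ?_⟩
    rw [e, zpow_natCast, map_mul, map_pow, evK_C]
  · exfalso
    obtain ⟨m, rfl⟩ : ∃ m : ℕ, n = -(m + 1 : ℕ) := ⟨n.natAbs - 1, by omega⟩
    have hFG : P.red F * P.red G ≠ 0 := mul_ne_zero hF hG
    obtain ⟨c, hc, hc'⟩ : ∃ c ∈ T, (P.red F * P.red G).eval c ≠ 0 := by
      by_contra! hcon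
      exact hT ((Polynomial.finite_setOfPred_isRoot hFG).subset fun c hc => hcon c hc)
    rw [Polynomial.eval_mul] at hc'
    obtain ⟨z, hz, hxz⟩ := hx c hc
    obtain ⟨d, hd⟩ := exists_at hxz
    have h1 := (h.tr_at_evK c F).mono hz
    have h2 := (h.tr_at_evK c G).mono hz
    have h3 := (hd.mul ((h.at_u.mono ((h.le_tr c).trans hz)).pow (m + 1))).mul h2
    have e' : x * u ^ (m + 1) * P.evK (v / u) G = P.evK (v / u) F := by
      have := h.evK_ne hG
      rw [e, zpow_neg, zpow_natCast]
      field_simp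
    rw [e', zero_pow (Nat.succ_ne_zero m), mul_zero, zero_mul] at h3
    exact left_ne_zero_of_mul hc' (h1.unique h3)

theorem exists_curve [CharZero k] (h : RegPt P u v D₁ D₂) (F : Frame k K) {T : Set k} (hT : T.Infinite)
    (hx : ∀ c ∈ T, ∃ α β, F.P α β ∈ fib Z (h.tr c)) :
    ∃ N₁ N₂ H₀ : Polynomial k, H₀ ≠ 0 ∧
      (∀ c, H₀.eval c ≠ 0 → F.P (N₁.eval c / H₀.eval c) (N₂.eval c / H₀.eval c) ≤ h.tr c) ∧
      {c | H₀.eval c ≠ 0 ∧ F.P (N₁.eval c / H₀.eval c) (N₂.eval c / H₀.eval c) ∈ Z}.Infinite := by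
  obtain ⟨A, G, hG, hp⟩ := h.exists_eq_div (x := F.p) hT fun c hc => by
    obtain ⟨α, β, hz⟩ := hx c hc
    exact ⟨_, hz.2, (F.at_p α β).mem⟩
  obtain ⟨B, G', hG', hq⟩ := h.exists_eq_div (x := F.q) hT fun c hc => by
    obtain ⟨α, β, hz⟩ := hx c hc
    exact ⟨_, hz.2, (F.at_q α β).mem⟩
  have h0 : P.red G * P.red G' ≠ 0 := mul_ne_zero hG hG'
  have hP : ∀ c, (P.red G * P.red G').eval c ≠ 0 →
      (h.tr c).At F.p ((P.red A * P.red G').eval c / (P.red G * P.red G').eval c) ∧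
      (h.tr c).At F.q ((P.red G * P.red B).eval c / (P.red G * P.red G').eval c) := by
    intro c hc
    rw [Polynomial.eval_mul] at hc
    have h1 := left_ne_zero_of_mul hc
    have h2 := right_ne_zero_of_mul hc
    rw [Polynomial.eval_mul, Polynomial.eval_mul, Polynomial.eval_mul, mul_div_mul_right _ _ h2,
      mul_div_mul_left _ _ h1, hp, hq]
    exact ⟨(h.tr_at_evK c A).div (h.tr_at_evK c G) h1, (h.tr_at_evK c B).div (h.tr_at_evK c G') h2⟩
  refine ⟨P.red A * P.red G', P.red G * P.red B, P.red G * P.red G', h0,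
    fun c hc => F.P_le (hP c hc).1 (hP c hc).2, ?_⟩
  refine (hT.sdiff (Polynomial.finite_setOfPred_isRoot h0)).mono fun c hc => ?_
  have hc0 : (P.red G * P.red G').eval c ≠ 0 := hc.2
  obtain ⟨α, β, hz⟩ := hx c hc.1
  refine ⟨hc0, ?_⟩
  rw [((hP c hc0).1.mono hz.2).unique (F.at_p α β), ((hP c hc0).2.mono hz.2).unique (F.at_q α β)]
  exact hz.1

end RegPt

end

section

variable {k K : Type u} [Field k] [Field K] [Algebra k K] {Q : Type u} [CommRing Q]
variable {Z : Set (LPt k K k)} {P : LPt k K k} {u v : K} {D₁ D₂ : Derivation k K K}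
variable [CharZero k] [IsAlgClosed k] {μ : AlgMeasure k Q} {G : Set (Chart k K)} {q : Q}

theorem Frame.exists_numerator {N₁ N₂ H₀ : Polynomial k} (hH₀ : H₀ ≠ 0) (b : MvPolynomial (Fin 2) k) :
    ∃ (N : Polynomial k) (n : ℕ), ∀ c, H₀.eval c ≠ 0 →
      pnt (N₁.eval c / H₀.eval c) (N₂.eval c / H₀.eval c) b * H₀.eval c ^ n = N.eval c := by
  obtain ⟨g, hg⟩ := exists_param H₀ N₁ N₂ dvd_rfl
  obtain ⟨N, n, h⟩ := (isLCI_puncturedLine (H := H₀)).surj (g b)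
  change g b * (algebraMap (Polynomial k) (Localization.Away H₀) H₀) ^ n = algebraMap (Polynomial k) (Localization.Away H₀) N at h
  refine ⟨N, n, fun c hc => ?_⟩
  obtain ⟨φ, rfl⟩ := exists_coord hc
  have := congrArg φ h
  rw [map_mul, map_pow, apply_algebraMap_eval, apply_algebraMap_eval] at this
  rw [← this, ← hg]
  rfl

namespace RegPt

theorem exists_class_iUnion_tr [DecidableEq k] {ι : Type*} [Finite ι] {F : ι → Frame k K} (h : RegPt P u v D₁ D₂)
    (hF : ∀ z ∈ Z, ∃ i α β, z = (F i).P α β)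
    (hc : ∀ V : LPt k K k, V.IsPlace → ∃ z ∈ Z, z ≤ V) (hZ : HasClass μ G Z q) (hsep : Sep Z)
    (hPZ : P ∉ Z) (hP : ZDef Z P) :
    ∃ H : Polynomial k, H ≠ 0 ∧
      HasClass μ (frames k K) (⋃ c ∈ {c | H.eval c ≠ 0}, fib Z (h.tr c)) (-(H.roots.toFinset.card : Q)) ∧
      (⋃ c ∈ {c | H.eval c ≠ 0}, fib Z (h.tr c)).Infinite := by
  have hdef := h.zdef_tr hF hPZ hP
  choose z hz using fun c => fib_nonempty hc (hdef c)
  choose i α β hi using fun c => hF _ (hz c).1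
  obtain ⟨i₀, hinf⟩ := Finite.exists_infinite_fiber i
  obtain ⟨N₁, N₂, H₀, hH₀, hle, hinf'⟩ := h.exists_curve (Z := Z) (F i₀) (T := i ⁻¹' {i₀})
    (Set.infinite_coe_iff.1 hinf) (fun c hc => by
      have e : i c = i₀ := hc
      exact ⟨α c, β c, by rw [← e, ← hi]; exact hz c⟩)
  obtain ⟨m, hm, hmem⟩ := exists_forall_mem (N₁ := N₁) (N₂ := N₂) hH₀ (hZ.conSet_pre (F i₀).toChart) hinf'
  have hmem' : ∀ c, m.eval c ≠ 0 → H₀.eval c ≠ 0 →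
      (F i₀).P (N₁.eval c / H₀.eval c) (N₂.eval c / H₀.eval c) ∈ Z := hmem
  have heq : ∀ c, m.eval c ≠ 0 → H₀.eval c ≠ 0 →
      (F i₀).P (N₁.eval c / H₀.eval c) (N₂.eval c / H₀.eval c) = h.tr c := by
    intro c h1 h2
    refine le_antisymm (hle c h2) ?_
    obtain ⟨V, hV, hVp⟩ := exists_place_ge (h.tr c)
    exact hdef c V hVp hV _ (hmem' c h1 h2) ((hle c h2).trans hV)
  have hfib : ∀ c, m.eval c ≠ 0 → H₀.eval c ≠ 0 →
      fib Z (h.tr c) = {(F i₀).P (N₁.eval c / H₀.eval c) (N₂.eval c / H₀.eval c)} := by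
    intro c h1 h2
    refine subset_antisymm (fun y hy => ?_) (Set.singleton_subset_iff.2 ⟨hmem' c h1 h2, (heq c h1 h2).ge⟩)
    obtain ⟨V, hV, hVp⟩ := exists_place_ge y
    exact hsep V hVp _ hy.1 _ (hmem' c h1 h2) hV (((heq c h1 h2).le.trans hy.2).trans hV)
  obtain ⟨c₀, h1, h2⟩ := exists_eval_ne hm hH₀
  have hw := (h.tr_at c₀).mem
  rw [← heq c₀ h1 h2] at hw
  obtain ⟨a, b, hb, hab⟩ := (F i₀).mem_P.1 hw
  obtain ⟨N, n, hN⟩ := Frame.exists_numerator (N₁ := N₁) (N₂ := N₂) hH₀ b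
  have hN0 : N ≠ 0 := by
    rintro rfl
    have := hN c₀ h2
    rw [Polynomial.eval_zero] at this
    exact mul_ne_zero hb (pow_ne_zero _ h2) this
  have hH : H₀ * m * N ≠ 0 := mul_ne_zero (mul_ne_zero hH₀ hm) hN0
  have hsplit : ∀ c, (H₀ * m * N).eval c ≠ 0 → H₀.eval c ≠ 0 ∧ m.eval c ≠ 0 ∧ N.eval c ≠ 0 := by
    intro c hc
    simp only [Polynomial.eval_mul, mul_ne_zero_iff] at hc
    exact ⟨hc.1.1, hc.1.2, hc.2⟩
  have heb : (F i₀).e b ≠ 0 := fun h0 => hb (by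
    have h0' : b = 0 := (F i₀).e_injective (by rw [h0, map_zero])
    rw [h0', map_zero])
  have hcl := (F i₀).hasClass_curve μ hH (N₁ := N₁) (N₂ := N₂) (H₀ := H₀) ⟨m * N, by ring⟩ (a := a) (b := b) (by
    intro c hc
    obtain ⟨q1, q2, q3⟩ := hsplit c hc
    refine ⟨fun h0 => q3 (by rw [← hN c q1, h0, zero_mul]), ?_⟩
    have e1 := h.tr_at c
    rw [← heq c q2 q1] at e1
    have e2 := e1.mul ((F i₀).at_e (N₁.eval c / H₀.eval c) (N₂.eval c / H₀.eval c) b)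
    rw [hab, div_mul_cancel₀ _ heb] at e2
    exact ((F i₀).at_e _ _ a).unique e2)
  have hset : (⋃ c ∈ {c | (H₀ * m * N).eval c ≠ 0}, fib Z (h.tr c)) =
      ((fun c => (F i₀).P (N₁.eval c / H₀.eval c) (N₂.eval c / H₀.eval c)) '' {c | (H₀ * m * N).eval c ≠ 0}) := by
    rw [Set.image_eq_iUnion]
    refine Set.iUnion₂_congr fun c hc => ?_
    obtain ⟨q1, q2, q3⟩ := hsplit c hc
    exact hfib c q2 q1
  refine ⟨_, hH, hset ▸ hcl, ?_⟩
  rw [hset]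
  refine Set.Infinite.image (fun c hc d hd hcd => ?_) ?_
  · obtain ⟨q1, q2, -⟩ := hsplit c hc
    obtain ⟨r1, r2, -⟩ := hsplit d hd
    have hcd : (F i₀).P (N₁.eval c / H₀.eval c) (N₂.eval c / H₀.eval c) =
      (F i₀).P (N₁.eval d / H₀.eval d) (N₂.eval d / H₀.eval d) := hcd
    rw [heq c q2 q1, heq d r2 r1] at hcd
    have := h.tr_at c
    rw [hcd] at this
    exact this.unique (h.tr_at d)
  · exact (Polynomial.finite_setOfPred_isRoot hH).infinite_compl

theorem hasClass_fib {ι : Type*} [Finite ι] {F : ι → Frame k K}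
    (hF : ∀ z ∈ Z, ∃ i α β, z = (F i).P α β)
    (hc : ∀ V : LPt k K k, V.IsPlace → ∃ z ∈ Z, z ≤ V) (hZ : HasClass μ G Z q) (hsep : Sep Z) (n : ℕ) :
    ∀ {P : LPt k K k} {u v : K} {D₁ D₂ : Derivation k K K}, RegPt P u v D₁ D₂ → ZDef Z P → JBound F Z P u v n →
      HasClass μ (frames k K) (fib Z P) 1 ∧ ((fib Z P).Infinite ∨ P ∈ Z) := by
  classical
  induction n with
  | zero => exact fun h hP hJ => (h.not_jBound_zero hF hc hP hJ).elim
  | succ n ih =>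
    intro P u v D₁ D₂ h hP hJ
    by_cases hPZ : P ∈ Z
    · refine ⟨?_, Or.inr hPZ⟩
      obtain ⟨i, α, β, rfl⟩ := hF P hPZ
      have e : fib Z ((F i).P α β) = {(F i).P α β} := by
        refine subset_antisymm (fun y hy => ?_) (Set.singleton_subset_iff.2 ⟨hPZ, le_rfl⟩)
        obtain ⟨V, hV, hVp⟩ := exists_place_ge y
        exact hsep V hVp _ hy.1 _ hPZ hV (hy.2.trans hV)
      rw [e]
      exact Frame.hasClass_point (F i) μ α β
    · obtain ⟨H, hH, hcl, hinf⟩ := h.exists_class_iUnion_tr hF hc hZ hsep hPZ hP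
      have h1 := (ih (h.swap.regPt_tr 0) (h.swap.zdef_tr hF hPZ hP 0) (h.swap.jBound_tr (jBound_swap hJ) 0)).1
      have h2 : HasClass μ (frames k K) (⋃ c ∈ H.roots.toFinset, fib Z (h.tr c)) (∑ c ∈ H.roots.toFinset, (1 : Q)) :=
        HasClass.biUnion _ (fun c _ => (ih (h.regPt_tr c) (h.zdef_tr hF hPZ hP c) (h.jBound_tr hJ c)).1)
          (fun c _ d _ hcd => h.disjoint_tr hcd)
      have h3 := (HasClass.union (S := fib Z h.inf) h1 hcl (by
          simp only [Set.disjoint_iUnion_right]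
          exact fun c _ => h.disjoint_inf c)).union h2 (by
        simp only [Set.disjoint_iUnion_right, Set.disjoint_union_left, Set.disjoint_iUnion_left]
        refine fun c hc => ⟨h.disjoint_inf c, fun d hd => h.disjoint_tr ?_⟩
        rintro rfl
        exact hd (Polynomial.isRoot_of_mem_roots (Multiset.mem_toFinset.1 hc)))
      have hset : fib Z P = fib Z h.inf ∪ (⋃ c ∈ {c | H.eval c ≠ 0}, fib Z (h.tr c)) ∪
          ⋃ c ∈ H.roots.toFinset, fib Z (h.tr c) := by
        rw [h.fib_eq hF hPZ, Set.union_assoc]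
        congr 1
        ext y
        simp only [Set.mem_iUnion, Set.mem_union, Multiset.mem_toFinset, Polynomial.mem_roots hH, Polynomial.IsRoot,
          Set.mem_ofPred_eq]
        constructor
        · rintro ⟨c, hy⟩
          by_cases h0 : H.eval c = 0
          · exact Or.inr ⟨c, Multiset.mem_toFinset.2 ((Polynomial.mem_roots hH).2 h0), hy⟩
          · exact Or.inl ⟨c, h0, hy⟩
        · rintro (⟨c, -, hy⟩ | ⟨c, -, hy⟩) <;> exact ⟨c, hy⟩
      have hq : (1 : Q) + -(H.roots.toFinset.card : Q) + ∑ c ∈ H.roots.toFinset, (1 : Q) = 1 := by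
        rw [Finset.sum_const, nsmul_eq_mul, mul_one]; ring
      rw [hq, ← hset] at h3
      refine ⟨h3, Or.inl ?_⟩
      rw [hset]
      exact hinf.mono (Set.subset_union_right.trans Set.subset_union_left)

end RegPt

end

section

variable {k K : Type u} [Field k] [Field K] [Algebra k K] {Q : Type u} [CommRing Q]

theorem Chart.exists_pt_le (c : Chart k K) {s : Set c.A} (hs : Algebra.adjoin k s = ⊤) {z : LPt k K k}
    (h : ∀ f ∈ s, c.e f ∈ z.O) : ∃ θ, c.pt θ ≤ z := by
  have hz : ∀ a, c.e a ∈ z.O := by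
    intro a
    have : a ∈ Algebra.adjoin k s := hs ▸ Algebra.mem_top
    have h2 : Algebra.adjoin k s ≤ z.O.comap c.e := Algebra.adjoin_le h
    exact h2 this
  refine ⟨z.res.comp (c.e.codRestrict z.O hz), Chart.pt_le_iff.2 fun a => ?_⟩
  exact at_of_mem (hz a)

theorem Chart.pt_le_of_resolved [CharZero k] [IsAlgClosed k] (c : Chart k K) {s : Set c.A} (hs : Algebra.adjoin k s = ⊤) {z V : LPt k K k}
    (h : ∀ f ∈ s, z.Resolved (c.e f)) {θ : c.A →ₐ[k] k} (hV : c.pt θ ≤ V) (hzV : z ≤ V) : c.pt θ ≤ z := by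
  obtain ⟨θ', hθ'⟩ := c.exists_pt_le hs (z := z) fun f hf => by
    by_contra h0
    have hne : c.e f ≠ 0 := fun h => h0 (h ▸ zero_mem _)
    obtain ⟨d, hd⟩ := exists_at ((h f hf).resolve_left h0)
    by_cases hd0 : d = 0
    · exact Frame.at_zero_ne hne ((c.pt_at θ f).mono hV) ((hd0 ▸ hd).mono hzV)
    · have := (hd.inv hd0).mem
      rw [inv_inv] at this
      exact h0 this
  have : θ = θ' := by
    ext a
    exact ((c.pt_at θ a).mono hV).unique ((c.pt_at θ' a).mono (hθ'.trans hzV))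
  rwa [this]

namespace Frame

variable [CharZero k]

theorem exists_common_denom (F : Frame k K) (T : Finset K) : ∃ a : MvPolynomial (Fin 2) k, a ≠ 0 ∧
    ∀ α β, pnt α β a ≠ 0 → ∀ x ∈ T, x ∈ (F.P α β).O := by
  classical
  induction T using Finset.induction_on with
  | empty => exact ⟨1, one_ne_zero, by simp⟩
  | insert x T hx ih =>
    obtain ⟨a, ha, h⟩ := ih
    obtain ⟨n, d, hd, e⟩ := F.frac x
    refine ⟨a * d, mul_ne_zero ha (by rintro rfl; simp at hd), fun α β h0 => ?_⟩
    rw [map_mul] at h0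
    intro y hy
    rcases Finset.mem_insert.1 hy with rfl | hy
    · exact F.mem_P.2 ⟨n, d, right_ne_zero_of_mul h0, e⟩
    · exact h α β (left_ne_zero_of_mul h0) y hy

theorem exists_eq_pt (F : Frame k K) (c : Chart k K) (hfrac : ∀ x : K, ∃ a b : c.A, b ≠ 0 ∧ x = c.e a / c.e b) :
    ∃ a : MvPolynomial (Fin 2) k, a ≠ 0 ∧ ∀ α β, pnt α β a ≠ 0 → ∃ θ, F.P α β = c.pt θ := by
  classical
  obtain ⟨s, hs⟩ := (inferInstance : Algebra.FiniteType k c.A).out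
  obtain ⟨b₁, b₂, hb₂, hp⟩ := hfrac F.p
  obtain ⟨b₃, b₄, hb₄, hq⟩ := hfrac F.q
  obtain ⟨a, ha, h⟩ := F.exists_common_denom (insert (c.e b₂)⁻¹ (insert (c.e b₄)⁻¹ (s.image c.e)))
  refine ⟨a, ha, fun α β h0 => ?_⟩
  have hmem := h α β h0
  obtain ⟨θ, hθ⟩ := c.exists_pt_le (s := (s : Set c.A)) hs (z := F.P α β) fun f hf =>
    hmem _ (by simp only [Finset.mem_insert, Finset.mem_image]; exact Or.inr (Or.inr ⟨f, hf, rfl⟩))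
  refine ⟨θ, le_antisymm ?_ hθ⟩
  have hunit : ∀ b, b ≠ 0 → (c.e b)⁻¹ ∈ (F.P α β).O → θ b ≠ 0 := by
    intro b hb hm h0
    have hne : c.e b ≠ 0 := fun h => hb (c.inj (by rw [h, map_zero]))
    obtain ⟨d, hd⟩ := exists_at hm
    have := hd.mul ((c.pt_at θ b).mono hθ)
    rw [inv_mul_cancel₀ hne, h0, mul_zero] at this
    exact one_ne_zero (at_one.unique this)
  have h2 := hunit b₂ hb₂ (hmem _ (by simp))
  have h4 := hunit b₄ hb₄ (hmem _ (by simp))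
  have hp' := (c.pt_at θ b₁).div (c.pt_at θ b₂) h2
  have hq' := (c.pt_at θ b₃).div (c.pt_at θ b₄) h4
  rw [← hp] at hp'
  rw [← hq] at hq'
  refine F.P_le ?_ ?_
  · rwa [(hp'.mono hθ).unique (F.at_p α β)] at hp'
  · rwa [(hq'.mono hθ).unique (F.at_q α β)] at hq'

theorem finite_or_of_prime [IsAlgClosed k] {S S' : Set (MvPolynomial (Fin 2) k →ₐ[k] k)} (hS : ConSet S) (hS' : ConSet S')
    (hd : Disjoint S S') {π : MvPolynomial (Fin 2) k} (hπ : Prime π) :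
    (S ∩ {θ | θ π = 0}).Finite ∨ (S' ∩ {θ | θ π = 0}).Finite := by
  have hP : (Ideal.span {π}).IsPrime := (Ideal.span_singleton_prime hπ.ne_zero).2 hπ
  have hz : ∀ θ : MvPolynomial (Fin 2) k →ₐ[k] k, θ π = 0 → ∀ x ∈ Ideal.span {π}, θ x = 0 := by
    intro θ h0 x hx
    obtain ⟨y, rfl⟩ := Ideal.mem_span_singleton'.1 hx
    rw [map_mul, h0, mul_zero]
  have key : ∀ {S : Set (MvPolynomial (Fin 2) k →ₐ[k] k)}, ConSet S → ¬ (S ∩ {θ | θ π = 0}).Finite →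
      ∃ h ∉ Ideal.span {π}, ∀ θ : MvPolynomial (Fin 2) k →ₐ[k] k, θ π = 0 → θ h ≠ 0 → θ ∈ S := by
    intro S hS hinf
    obtain ⟨h, hh, r, hr⟩ := hS.exists_const (Ideal.span {π})
    refine ⟨h, hh, ?_⟩
    have hrel : IsRelPrime π h := by
      refine (hπ.irreducible.isRelPrime_iff_not_dvd).2 fun hdv => hh (Ideal.mem_span_singleton.2 hdv)
    obtain ⟨θ₀, ⟨h1, h2⟩, h3⟩ := Set.not_subset.1 fun hsub =>
      hinf ((finite_zeros hrel hπ.ne_zero).subset hsub)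
    have h2 : θ₀ π = 0 := h2
    have h3 : θ₀ h ≠ 0 := fun h0 => h3 ⟨h2, h0⟩
    have hr0 := hr θ₀ (hz _ h2) h3
    rw [ind, Set.indicator_of_mem h1] at hr0
    intro θ h4 h5
    by_contra h6
    have := hr θ (hz _ h4) h5
    rw [ind, Set.indicator_of_notMem h6, ← hr0] at this
    exact zero_ne_one this
  by_contra! hcon
  obtain ⟨h, hh, h1⟩ := key hS hcon.1
  obtain ⟨h', hh', h1'⟩ := key hS' hcon.2
  obtain ⟨θ, h2, h3⟩ := exists_point_prime (k := k) (Ideal.span {π}) (h := h * h') (fun hm =>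
    (hP.mem_or_mem hm).elim hh hh')
  rw [map_mul] at h3
  have h4 := h2 π (Ideal.mem_span_singleton_self π)
  exact Set.disjoint_left.1 hd (h1 θ h4 (left_ne_zero_of_mul h3)) (h1' θ h4 (right_ne_zero_of_mul h3))

end Frame

end

section

variable {k K : Type u} [Field k] [Field K] [Algebra k K] {Q : Type u} [CommRing Q]
variable [CharZero k] [IsAlgClosed k] {μ : AlgMeasure k Q} {G : Set (Chart k K)} {q : Q}

theorem HasClass.exists_frames {Z : Set (LPt k K k)} (h : HasClass μ (frames k K) Z q) :
    ∃ (ι : Type) (_ : Finite ι) (F : ι → Frame k K), ∀ z ∈ Z, ∃ i α β, z = (F i).P α β := by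
  obtain ⟨ι, hι, ch, C, h1, -, -, rfl, -⟩ := h
  choose F hF using h1
  obtain rfl : (fun i => (F i).toChart) = ch := funext hF
  refine ⟨ι, inferInstance, F, fun z hz => ?_⟩
  obtain ⟨i, hi⟩ := Set.mem_iUnion.1 hz
  obtain ⟨α, β, -, e⟩ := (F i).mem_image.1 hi
  exact ⟨i, α, β, e.symm⟩

/-- Only finitely many regular points of a complete model are not points of `Z`. -/
theorem finite_diff {X Z : Set (LPt k K k)} (F₀ : Frame k K) {ι J : Type*} [Finite ι] {F : ι → Frame k K}
    (hF : ∀ z ∈ Z, ∃ i α β, z = (F i).P α β) {ch : J → Chart k K} (hX : X = ⋃ j, Set.range (ch j).pt)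
    (hreg : ∀ x ∈ X, ∃ u v D₁ D₂, RegPt x u v D₁ D₂) (hsep : Sep X)
    (hcomp : ∀ V : LPt k K k, V.IsPlace → ∃ x ∈ X, x ≤ V)
    (hcl : ∀ x ∈ X, HasClass μ (frames k K) (fib Z x) 1) (hinf : ∀ x ∈ X, x ∉ Z → (fib Z x).Infinite) :
    (X \ Z).Finite := by
  classical
  obtain ⟨V₀, -, hV₀⟩ := exists_place_ge (F₀.P 0 0)
  obtain ⟨x₀, hx₀, -⟩ := hcomp V₀ hV₀
  obtain ⟨u, v, D₁, D₂, hr⟩ := hreg x₀ hx₀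
  rw [hX] at hx₀
  obtain ⟨j, θ₀, rfl⟩ := Set.mem_iUnion.1 hx₀
  have hfr : ∀ x : K, ∃ a b : (ch j).A, b ≠ 0 ∧ x = (ch j).e a / (ch j).e b := by
    intro x
    obtain ⟨y, hy, z, hz, hz0, rfl⟩ := hr.frac x
    obtain ⟨a, b, hb, h1⟩ := Chart.mem_pt.1 hy
    obtain ⟨a', b', hb', h2⟩ := Chart.mem_pt.1 hz
    have hne : ∀ b, θ₀ b ≠ 0 → (ch j).e b ≠ 0 := fun b hb => ((ch j).pt_at θ₀ b).ne_zero hb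
    have hb0 := hne b hb
    have hb0' := hne b' hb'
    have ha' : (ch j).e a' ≠ 0 := by rw [← h2]; exact mul_ne_zero hz0 hb0'
    refine ⟨a * b', b * a', fun h0 => ?_, ?_⟩
    · have := congrArg (ch j).e h0
      rw [map_mul, map_zero] at this
      exact mul_ne_zero hb0 ha' this
    · rw [map_mul, map_mul, ← h1, ← h2]
      field_simp
  choose a ha0 ha using fun i => (F i).exists_eq_pt (ch j) hfr
  by_contra hbad
  have key : ∀ x : ↥(X \ Z), ∃ p : Σ i, ↥((UniqueFactorizationMonoid.factors (a i)).toFinset : Set (MvPolynomial (Fin 2) k)),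
      ¬ ((F p.1).toChart.pre (fib Z x.1) ∩ {θ | θ (p.2 : MvPolynomial (Fin 2) k) = 0}).Finite := by
    rintro ⟨x, hx, hxZ⟩
    by_contra! hcon
    refine hinf x hx hxZ ?_
    refine Set.Finite.subset (Set.finite_iUnion fun p => (hcon p).image (F p.1).toChart.pt) fun z hz => ?_
    obtain ⟨i, α, β, rfl⟩ := hF z hz.1
    have h0 : Frame.pnt α β (a i) = 0 := by
      by_contra h0
      obtain ⟨θ, hθ⟩ := ha i α β h0
      have hzX : (F i).P α β ∈ X := by
        rw [hX, hθ]
        exact Set.mem_iUnion.2 ⟨j, θ, rfl⟩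
      obtain ⟨V, hV, hVp⟩ := exists_place_ge ((F i).P α β)
      have := hsep V hVp _ hx _ hzX (hz.2.trans hV) hV
      exact hxZ (this ▸ hz.1)
    have h1 : Frame.pnt α β (UniqueFactorizationMonoid.factors (a i)).prod = 0 := by
      obtain ⟨w, hw⟩ := UniqueFactorizationMonoid.factors_prod (ha0 i)
      rw [← hw, map_mul] at h0
      exact (mul_eq_zero.1 h0).resolve_right (w.isUnit.map (Frame.pnt α β)).ne_zero
    rw [map_multiset_prod, Multiset.prod_eq_zero_iff, Multiset.mem_map] at h1
    obtain ⟨π, hπ, h2⟩ := h1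
    exact Set.mem_iUnion.2 ⟨⟨i, π, Finset.mem_coe.2 (Multiset.mem_toFinset.2 hπ)⟩, Frame.pnt α β, ⟨hz, h2⟩, rfl⟩
  choose p hp using key
  have : Infinite ↥(X \ Z) := Set.infinite_coe_iff.2 hbad
  obtain ⟨x, y, hxy, he⟩ := Finite.exists_ne_map_eq_of_infinite p
  have hpx := hp x
  have hpy := hp y
  rw [he] at hpx
  have hπ : Prime ((p y).2 : MvPolynomial (Fin 2) k) :=
    UniqueFactorizationMonoid.prime_of_factor _ (Multiset.mem_toFinset.1 (Finset.mem_coe.1 (p y).2.2))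
  have hd : Disjoint ((F (p y).1).toChart.pre (fib Z x.1)) ((F (p y).1).toChart.pre (fib Z y.1)) := by
    refine Set.disjoint_left.2 fun θ h1 h2 => hxy (Subtype.ext ?_)
    obtain ⟨V, hV, hVp⟩ := exists_place_ge ((F (p y).1).toChart.pt θ)
    exact hsep V hVp _ x.2.1 _ y.2.1 (h1.2.trans hV) (h2.2.trans hV)
  exact (Frame.finite_or_of_prime ((hcl _ x.2.1).conSet_pre (F (p y).1).toChart)
    ((hcl _ y.2.1).conSet_pre (F (p y).1).toChart) hd hπ).elim hpx hpy

/-- A complete nonsingular model of a rational function field in two variables has class one. -/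
theorem class_eq_one {X : Set (LPt k K k)} (F₀ : Frame k K) {J : Type*} [Finite J]
    {ch : J → Chart k K} (hX : X = ⋃ j, Set.range (ch j).pt) (hq : HasClass μ G X q)
    (hreg : ∀ x ∈ X, ∃ u v D₁ D₂, RegPt x u v D₁ D₂) (hsep : Sep X)
    (hcomp : ∀ V : LPt k K k, V.IsPlace → ∃ x ∈ X, x ≤ V) : q = 1 := by
  classical
  have := Fintype.ofFinite J
  choose s hs using fun j => (inferInstance : Algebra.FiniteType k (ch j).A).out
  obtain ⟨Z, hZ, hZsep, hZc, hres⟩ := F₀.exists_model μ (Finset.univ.biUnion fun j => (s j).image (ch j).e)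
  obtain ⟨ι, _, F, hF⟩ := hZ.exists_frames
  have hdef' : ∀ x ∈ X, ∀ V : LPt k K k, x ≤ V → ∀ z ∈ Z, z ≤ V → x ≤ z := by
    intro x hx V hxV z hz hzV
    rw [hX] at hx
    obtain ⟨j, θ, rfl⟩ := Set.mem_iUnion.1 hx
    refine (ch j).pt_le_of_resolved (s := (s j : Set (ch j).A)) (hs j) (fun f hf => hres _ ?_ z hz) hxV hzV
    exact Finset.mem_biUnion.2 ⟨j, Finset.mem_univ _, Finset.mem_image_of_mem _ hf⟩
  have hdef : ∀ x ∈ X, ZDef Z x := fun x hx V _ hxV => hdef' x hx V hxV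
  have hmain : ∀ x ∈ X, HasClass μ (frames k K) (fib Z x) 1 ∧ ((fib Z x).Infinite ∨ x ∈ Z) := by
    intro x hx
    obtain ⟨u, v, D₁, D₂, hr⟩ := hreg x hx
    obtain ⟨n, hn⟩ := hr.exists_jBound F (Z := Z)
    exact RegPt.hasClass_fib hF hZc hZ hZsep n hr (hdef x hx) hn
  have hfin := finite_diff (μ := μ) F₀ hF hX hreg hsep hcomp (fun x hx => (hmain x hx).1)
    (fun x hx hxZ => (hmain x hx).2.resolve_right hxZ)
  obtain ⟨r, r', h1, h2, hr⟩ := hq.split hZ.conSet_pre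
  have hB := h2.finite hfin.toFinset (by rw [hfin.coe_toFinset])
  rw [hfin.coe_toFinset] at hB
  have hr' := h2.unique hB
  have h3 : HasClass μ (frames k K) (⋃ x ∈ hfin.toFinset, fib Z x) (∑ x ∈ hfin.toFinset, (1 : Q)) :=
    HasClass.biUnion _ (fun x hx => (hmain x ((hfin.mem_toFinset.1 hx).1)).1) (by
      intro x hx y hy hxy
      refine Set.disjoint_left.2 fun z h4 h5 => hxy ?_
      obtain ⟨V, hV, hVp⟩ := exists_place_ge z
      exact hsep V hVp _ (hfin.mem_toFinset.1 hx).1 _ (hfin.mem_toFinset.1 hy).1 (h4.2.trans hV) (h5.2.trans hV))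
  have h4 := (h1.mono (Set.subset_univ _)).union (h3.mono (Set.subset_univ _)) (by
    simp only [Set.disjoint_iUnion_right]
    intro x hx
    refine Set.disjoint_left.2 fun z h4 h5 => (hfin.mem_toFinset.1 hx).2 ?_
    obtain ⟨V, hV, hVp⟩ := exists_place_ge z
    rw [hsep V hVp _ (hfin.mem_toFinset.1 hx).1 _ h4.1 (h5.2.trans hV) hV]
    exact h4.2)
  have hset : X ∩ Z ∪ ⋃ x ∈ hfin.toFinset, fib Z x = Z := by
    ext z
    constructor
    · rintro (h | h)
      · exact h.2
      · simp only [Set.mem_iUnion] at h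
        obtain ⟨x, hx, h⟩ := h
        exact h.1
    · intro hz
      by_cases hzX : z ∈ X
      · exact Or.inl ⟨hzX, hz⟩
      · right
        obtain ⟨V, hV, hVp⟩ := exists_place_ge z
        obtain ⟨x, hx, hxV⟩ := hcomp V hVp
        have hxz := hdef' x hx V hxV z hz hV
        refine Set.mem_iUnion₂.2 ⟨x, hfin.mem_toFinset.2 ⟨hx, fun hxZ => hzX ?_⟩, hz, hxz⟩
        rwa [← hZsep V hVp _ hxZ _ hz hxV hV]
  rw [hset] at h4
  rw [hr, hr', ← h4.unique hZ, Finset.sum_const, nsmul_eq_mul, mul_one]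

end

section

open KaehlerDifferential
section Kaehler

variable {k A : Type u} [Field k] [CommRing A] [Algebra k A] (θ : A →ₐ[k] k)

/-- The derivation `a => a - θ a` modulo the square of the kernel of `θ`. -/
def cotDer : Derivation k A (A ⧸ (RingHom.ker θ) ^ 2) :=
  Derivation.mk' (((Ideal.Quotient.mkₐ k (RingHom.ker θ ^ 2)).toLinearMap).comp
    (LinearMap.id - (Algebra.linearMap k A).comp θ.toLinearMap)) (by
    intro a b
    have h : ∀ x y : A, x - y ∈ RingHom.ker θ ^ 2 → (Ideal.Quotient.mk (RingHom.ker θ ^ 2)) x =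
      Ideal.Quotient.mk _ y := fun x y => Ideal.Quotient.eq.2
    have hm : ∀ x, x - algebraMap k A (θ x) ∈ RingHom.ker θ := fun x => by
      rw [RingHom.mem_ker, map_sub, AlgHom.commutes]; simp
    change Ideal.Quotient.mk (RingHom.ker θ ^ 2) (a * b - algebraMap k A (θ (a * b))) =
      a • Ideal.Quotient.mk (RingHom.ker θ ^ 2) (b - algebraMap k A (θ b)) +
      b • Ideal.Quotient.mk (RingHom.ker θ ^ 2) (a - algebraMap k A (θ a))
    rw [Algebra.smul_def, Algebra.smul_def]
    change _ = Ideal.Quotient.mk (RingHom.ker θ ^ 2) a * _ + Ideal.Quotient.mk (RingHom.ker θ ^ 2) b * _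
    rw [← map_mul, ← map_mul, ← map_add]
    refine h _ _ ?_
    have := Ideal.mul_mem_mul (hm a) (hm b)
    rw [← pow_two] at this
    convert (RingHom.ker θ ^ 2).neg_mem this using 1
    rw [map_mul, map_mul]
    ring)

theorem cotDer_apply (a : A) : cotDer θ a = Ideal.Quotient.mk _ (a - algebraMap k A (θ a)) := rfl

theorem mem_ker_sq {ι : Type*} [Finite ι] (b : Module.Basis ι A Ω[A⁄k]) {x : A} (hx : θ x = 0)
    (h : ∀ i, θ (b.coord i (D k A x)) = 0) : x ∈ RingHom.ker θ ^ 2 := by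
  have := Fintype.ofFinite ι
  have hr : ∀ ω : Ω[A⁄k], ∃ m ∈ RingHom.ker θ, (cotDer θ).liftKaehlerDifferential ω = Ideal.Quotient.mk _ m := by
    intro ω
    have hω : ω ∈ Submodule.span A (Set.range (D k A)) := by rw [span_range_derivation]; trivial
    induction hω using Submodule.span_induction with
    | mem x h =>
      obtain ⟨a, rfl⟩ := h
      refine ⟨a - algebraMap k A (θ a), ?_, ?_⟩
      · rw [RingHom.mem_ker, map_sub, AlgHom.commutes]; simp
      · rw [Derivation.liftKaehlerDifferential_comp_D, cotDer_apply]
    | zero => exact ⟨0, zero_mem _, by simp⟩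
    | add x y _ _ hx hy =>
      obtain ⟨m, hm, e⟩ := hx
      obtain ⟨m', hm', e'⟩ := hy
      exact ⟨m + m', add_mem hm hm', by rw [map_add, map_add, e, e']⟩
    | smul a x _ hx =>
      obtain ⟨m, hm, e⟩ := hx
      exact ⟨a * m, Ideal.mul_mem_left _ _ hm, by rw [map_smul, e, map_mul]; rfl⟩
  rw [← Ideal.Quotient.eq_zero_iff_mem]
  have h1 : cotDer θ x = Ideal.Quotient.mk _ x := by rw [cotDer_apply, hx, map_zero, sub_zero]
  rw [← h1, ← Derivation.liftKaehlerDifferential_comp_D, ← b.sum_repr (D k A x), map_sum]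
  refine Finset.sum_eq_zero fun i _ => ?_
  obtain ⟨m, hm, e⟩ := hr (b i)
  rw [map_smul, e]
  change Ideal.Quotient.mk _ (_ * m) = 0
  rw [Ideal.Quotient.eq_zero_iff_mem, pow_two]
  exact Ideal.mul_mem_mul (h i) hm

theorem exists_kaehler_param {ι : Type*} [DecidableEq ι] (b : Module.Basis ι A Ω[A⁄k]) (i : ι) :
    ∃ x, θ x = 0 ∧ ∀ j, θ (b.coord j (D k A x)) = if i = j then 1 else 0 := by
  have hr : ∀ ω : Ω[A⁄k], ∃ x, θ x = 0 ∧ ∀ j, θ (b.coord j (D k A x)) = θ (b.coord j ω) := by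
    intro ω
    have hω : ω ∈ Submodule.span A (Set.range (D k A)) := by rw [span_range_derivation]; trivial
    induction hω using Submodule.span_induction with
    | mem x h =>
      obtain ⟨a, rfl⟩ := h
      refine ⟨a - algebraMap k A (θ a), ?_, fun j => ?_⟩
      · rw [map_sub, AlgHom.commutes]; simp
      · rw [map_sub, Derivation.map_algebraMap, sub_zero]
    | zero => exact ⟨0, map_zero _, by simp⟩
    | add x y _ _ hx hy =>
      obtain ⟨m, hm, e⟩ := hx
      obtain ⟨m', hm', e'⟩ := hy
      exact ⟨m + m', by rw [map_add, hm, hm', add_zero], fun j => by simp only [map_add, e j, e' j]⟩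
    | smul a x _ hx =>
      obtain ⟨m, hm, e⟩ := hx
      refine ⟨algebraMap k A (θ a) * m, by rw [map_mul, hm, mul_zero], fun j => ?_⟩
      rw [← Algebra.smul_def, Derivation.map_smul_of_tower]
      rw [← algebraMap_smul A (θ a) (D k A m), map_smul, smul_eq_mul, map_mul, AlgHom.commutes, e j, map_smul,
        smul_eq_mul, map_mul]
      rfl
  obtain ⟨x, hx, h⟩ := hr (b i)
  refine ⟨x, hx, fun j => (h j).trans ?_⟩
  rw [Module.Basis.coord_apply, Module.Basis.repr_self, Finsupp.single_apply]
  split_ifs <;> simp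

end Kaehler

section Extend

variable {k K : Type u} [Field k] [Field K] [Algebra k K]

theorem Chart.isFractionRing {c : Chart k K} (hfr : ∀ x : K, ∃ a b : c.A, b ≠ 0 ∧ x = c.e a / c.e b) :
    @IsFractionRing c.A _ K _ c.e.toRingHom.toAlgebra := by
  let _ := c.e.toRingHom.toAlgebra
  have hi : Function.Injective (algebraMap c.A K) := c.inj
  have : IsDomain c.A := hi.isDomain (algebraMap c.A K)
  have := (faithfulSMul_iff_algebraMap_injective c.A K).2 hi
  refine IsFractionRing.of_field c.A K fun x => ?_
  obtain ⟨a, b, -, h⟩ := hfr x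
  exact ⟨a, b, h⟩

theorem Chart.exists_derivation {c : Chart k K} (hfr : ∀ x : K, ∃ a b : c.A, b ≠ 0 ∧ x = c.e a / c.e b)
    (φ : Ω[c.A⁄k] →ₗ[c.A] c.A) : ∃ E : Derivation k K K, ∀ a, E (c.e a) = c.e (φ (D k c.A a)) := by
  have hfrac := Chart.isFractionRing hfr
  let _ := c.e.toRingHom.toAlgebra
  have : IsScalarTower k c.A K := IsScalarTower.of_algebraMap_eq fun r => (c.e.commutes r).symm
  have : Algebra.FormallyEtale c.A K := Algebra.FormallyEtale.of_isLocalization (nonZeroDivisors c.A)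
  refine ⟨((TensorProduct.AlgebraTensorModule.rid c.A K K).toLinearMap ∘ₗ
    (TensorProduct.AlgebraTensorModule.lTensor K K φ) ∘ₗ
    (tensorKaehlerEquivOfFormallyEtale k c.A K).symm.toLinearMap).compDer (D k K), fun a => ?_⟩
  have h := tensorKaehlerEquivOfFormallyEtale_symm_D_algebraMap k c.A K a
  change (TensorProduct.AlgebraTensorModule.rid c.A K K) ((TensorProduct.AlgebraTensorModule.lTensor K K φ)
    ((tensorKaehlerEquivOfFormallyEtale k c.A K).symm (D k K (algebraMap c.A K a)))) = _
  rw [h]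
  simp [Algebra.smul_def]
  rfl

theorem Chart.finrank_kaehler {c : Chart k K} (hfr : ∀ x : K, ∃ a b : c.A, b ≠ 0 ∧ x = c.e a / c.e b)
    {ι : Type*} [Fintype ι] (b : Module.Basis ι c.A Ω[c.A⁄k]) : Module.finrank K Ω[K⁄k] = Fintype.card ι := by
  have hfrac := Chart.isFractionRing hfr
  let _ := c.e.toRingHom.toAlgebra
  have : IsScalarTower k c.A K := IsScalarTower.of_algebraMap_eq fun r => (c.e.commutes r).symm
  have : Algebra.FormallyEtale c.A K := Algebra.FormallyEtale.of_isLocalization (nonZeroDivisors c.A)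
  exact Module.finrank_eq_card_basis ((b.baseChange K).map (tensorKaehlerEquivOfFormallyEtale k c.A K))

end Extend

end

section

open KaehlerDifferential
variable {k K : Type u} [Field k] [Field K] [Algebra k K]

theorem LPt.mx_le_jacobson (P : LPt k K k) : P.mx ≤ (⊥ : Ideal P.O).jacobson := by
  intro x hx
  rw [Ideal.mem_jacobson_bot]
  intro y
  have h1 : P.res (x * y + 1) = 1 := by
    rw [map_add, map_mul, show P.res x = 0 from hx, zero_mul, zero_add, map_one]
  have h2 : P.At ((x * y + 1 : P.O) : K) 1 := by rw [← h1]; exact P.at_coe _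
  have h3 := h2.inv one_ne_zero
  exact IsUnit.of_mul_eq_one ⟨_, h3.mem⟩ (Subtype.ext (mul_inv_cancel₀ (h2.ne_zero one_ne_zero)))

theorem Chart.mp_of_mem {c : Chart k K} {θ : c.A →ₐ[k] k} {n : ℕ} {x : c.A} (h : x ∈ RingHom.ker θ ^ n) :
    (c.pt θ).MP n (c.e x) := by
  let φ : c.A →ₐ[k] (c.pt θ).O := c.e.codRestrict _ fun r => (c.pt_at θ r).mem
  have h1 : (RingHom.ker θ).map φ ≤ (c.pt θ).mx := by
    rw [Ideal.map_le_iff_le_comap]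
    intro r hr
    have := c.pt_at θ r
    rw [show θ r = 0 from hr] at this
    obtain ⟨_, h⟩ := this
    exact h
  refine ⟨(c.pt_at θ x).mem, ?_⟩
  have h2 := Ideal.mem_map_of_mem φ h
  rw [Ideal.map_pow] at h2
  exact Ideal.pow_right_mono h1 n h2

theorem Chart.exists_regPt {c : Chart k K} (hfr : ∀ x : K, ∃ a b : c.A, b ≠ 0 ∧ x = c.e a / c.e b)
    (b : Module.Basis (Fin 2) c.A Ω[c.A⁄k]) (θ : c.A →ₐ[k] k) :
    ∃ u v D₁ D₂, RegPt (c.pt θ) u v D₁ D₂ := by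
  obtain ⟨u, hu, hu'⟩ := exists_kaehler_param θ b 0
  obtain ⟨v, hv, hv'⟩ := exists_kaehler_param θ b 1
  obtain ⟨E₁, h₁⟩ := Chart.exists_derivation hfr (b.coord 0)
  obtain ⟨E₂, h₂⟩ := Chart.exists_derivation hfr (b.coord 1)
  set P := c.pt θ with hP
  have a1 : P.At (E₁ (c.e u)) 1 := by rw [h₁]; have h := c.pt_at θ (b.coord 0 (D k c.A u)); rw [hu'] at h; exact h
  have a2 : P.At (E₁ (c.e v)) 0 := by rw [h₁]; have h := c.pt_at θ (b.coord 0 (D k c.A v)); rw [hv'] at h; exact h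
  have a3 : P.At (E₂ (c.e u)) 0 := by rw [h₂]; have h := c.pt_at θ (b.coord 1 (D k c.A u)); rw [hu'] at h; exact h
  have a4 : P.At (E₂ (c.e v)) 1 := by rw [h₂]; have h := c.pt_at θ (b.coord 1 (D k c.A v)); rw [hv'] at h; exact h
  have hmem : ∀ E : Derivation k K K, (∀ a, ∃ a', E (c.e a) = c.e a') → ∀ x ∈ P.O, E x ∈ P.O := by
    intro E hE x hx
    obtain ⟨r, s, hs, e⟩ := Chart.mem_pt.1 hx
    have hs0 := (c.pt_at θ s).ne_zero hs
    have hsi := ((c.pt_at θ s).inv hs).mem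
    obtain ⟨r', hr'⟩ := hE r
    obtain ⟨s', hs'⟩ := hE s
    have h := congrArg E e
    rw [E.leibniz, smul_eq_mul, smul_eq_mul, hr', hs'] at h
    have : E x = (c.e r' - x * c.e s') * (c.e s)⁻¹ := by
      rw [← h]; field_simp; ring
    rw [this]
    exact mul_mem (sub_mem (c.pt_at θ r').mem (mul_mem hx (c.pt_at θ s').mem)) hsi
  have hE₁ := hmem E₁ fun a => ⟨_, h₁ a⟩
  have hE₂ := hmem E₂ fun a => ⟨_, h₂ a⟩
  set δ := E₁ (c.e u) * E₂ (c.e v) - E₁ (c.e v) * E₂ (c.e u) with hδ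
  have aδ : P.At δ 1 := by simpa using (a1.mul a4).sub (a2.mul a3)
  have hδ0 : δ ≠ 0 := aδ.ne_zero one_ne_zero
  have hδi : δ⁻¹ ∈ P.O := (aδ.inv one_ne_zero).mem
  have hnoe : IsNoetherianRing c.A := Algebra.FiniteType.isNoetherianRing k c.A
  have noeth : IsNoetherianRing P.O := isNoetherianRing_ofHoms
  have hpu : P.At (c.e u) 0 := by simpa [hu] using c.pt_at θ u
  have hpv : P.At (c.e v) 0 := by simpa [hv] using c.pt_at θ v
  refine ⟨c.e u, c.e v, (E₂ (c.e v) * δ⁻¹) • E₁ - (E₁ (c.e v) * δ⁻¹) • E₂,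
    (E₁ (c.e u) * δ⁻¹) • E₂ - (E₂ (c.e u) * δ⁻¹) • E₁, ?_, ?_, hpu, hpv, ?_, ?_, ?_, ?_, ?_, noeth, ?_⟩
  · intro x hx
    exact sub_mem (mul_mem (mul_mem a4.mem hδi) (hE₁ x hx)) (mul_mem (mul_mem a2.mem hδi) (hE₂ x hx))
  · intro x hx
    exact sub_mem (mul_mem (mul_mem a1.mem hδi) (hE₂ x hx)) (mul_mem (mul_mem a3.mem hδi) (hE₁ x hx))
  · simp only [Derivation.sub_apply, Derivation.smul_apply, smul_eq_mul]
    have : (E₂ (c.e v) * δ⁻¹) * E₁ (c.e u) - (E₁ (c.e v) * δ⁻¹) * E₂ (c.e u) = δ * δ⁻¹ := by rw [hδ]; ring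
    rw [this, mul_inv_cancel₀ hδ0]
  · simp only [Derivation.sub_apply, Derivation.smul_apply, smul_eq_mul]; ring
  · simp only [Derivation.sub_apply, Derivation.smul_apply, smul_eq_mul]; ring
  · simp only [Derivation.sub_apply, Derivation.smul_apply, smul_eq_mul]
    have : (E₁ (c.e u) * δ⁻¹) * E₂ (c.e v) - (E₂ (c.e u) * δ⁻¹) * E₁ (c.e v) = δ * δ⁻¹ := by rw [hδ]; ring
    rw [this, mul_inv_cancel₀ hδ0]
  · let u' : P.O := ⟨c.e u, hpu.mem⟩
    let v' : P.O := ⟨c.e v, hpv.mem⟩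
    have hle : P.mx ≤ Ideal.span {u', v'} := by
      refine Submodule.le_of_le_smul_of_le_jacobson_bot (I := P.mx) (IsNoetherian.noetherian _) P.mx_le_jacobson ?_
      intro x hx
      obtain ⟨r, s, hs, e⟩ := Chart.mem_pt.1 x.2
      have hs0 := (c.pt_at θ s).ne_zero hs
      have hr : θ r = 0 := by
        have h1 : P.At (x * c.e s) (0 * θ s) := At.mul ⟨x.2, hx⟩ (c.pt_at θ s)
        rw [e, zero_mul] at h1
        exact (c.pt_at θ r).unique h1
      let r' := r - algebraMap k c.A (θ (b.coord 0 (D k c.A r))) * u - algebraMap k c.A (θ (b.coord 1 (D k c.A r))) * v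
      have hr' : r' ∈ RingHom.ker θ ^ 2 := by
        refine mem_ker_sq θ b ?_ fun i => ?_
        · simp only [r', map_sub, map_mul, hr, hu, hv]; ring
        · simp only [r', map_sub, ← Algebra.smul_def, Derivation.map_smul]
          rw [← algebraMap_smul c.A (θ (b.coord 0 (D k c.A r))) (D k c.A u),
            ← algebraMap_smul c.A (θ (b.coord 1 (D k c.A r))) (D k c.A v)]
          simp only [map_smul, smul_eq_mul, map_mul, AlgHom.commutes, hu', hv']
          fin_cases i <;> simp
      obtain ⟨hm1, hm2⟩ := Chart.mp_of_mem hr'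
      have hsi : (c.e s)⁻¹ ∈ P.O := ((c.pt_at θ s).inv hs).mem
      let α : P.O := algebraMap k _ (θ (b.coord 0 (D k c.A r)))
      let β : P.O := algebraMap k _ (θ (b.coord 1 (D k c.A r)))
      have hx' : x = ⟨_, hsi⟩ * (α * u' + β * v') + ⟨_, hsi⟩ * ⟨c.e r', hm1⟩ := by
        refine Subtype.ext ?_
        change (x : K) = (c.e s)⁻¹ * (algebraMap k K (θ (b.coord 0 (D k c.A r))) * c.e u +
          algebraMap k K (θ (b.coord 1 (D k c.A r))) * c.e v) + (c.e s)⁻¹ * c.e r'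
        simp only [r', map_sub, map_mul, AlgHom.commutes]
        rw [← e]
        field_simp
        ring
      rw [hx']
      refine Submodule.add_mem_sup (Ideal.mul_mem_left _ _ (add_mem ?_ ?_)) (Ideal.mul_mem_left _ _ ?_)
      · exact Ideal.mul_mem_left _ _ (Ideal.subset_span (by simp))
      · exact Ideal.mul_mem_left _ _ (Ideal.subset_span (by simp))
      · rw [smul_eq_mul, ← pow_two]; exact hm2
    rintro x ⟨hx, hx0⟩
    obtain ⟨α, β, h⟩ := Ideal.mem_span_pair.1 (hle (x := ⟨x, hx⟩) hx0)
    exact ⟨α, α.2, β, β.2, (congrArg Subtype.val h).symm⟩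
  · intro x
    obtain ⟨r, s, hs, rfl⟩ := hfr x
    exact ⟨_, (c.pt_at θ r).mem, _, (c.pt_at θ s).mem, fun h => hs (c.inj (h.trans (map_zero _).symm)), rfl⟩

end

section

open KaehlerDifferential

variable {k A : Type u} [Field k] [CommRing A] [Algebra k A]

theorem derivation_nilpotent [CharZero k] (E : Derivation k A A) {a : A} (ha : IsNilpotent a) :
    IsNilpotent (E a) := by
  obtain ⟨n, hn⟩ := ha
  have key : ∀ j ≤ n, a ^ (n - j) * (E a) ^ (2 * j) = 0 := by
    intro j
    induction j with
    | zero => intro _; simpa using hn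
    | succ j ih =>
      intro hj
      obtain ⟨m, rfl⟩ : ∃ m, n = j + 1 + m := ⟨_, (Nat.add_sub_cancel' hj).symm⟩
      have h := ih (by omega)
      rw [show j + 1 + m - j = m + 1 by omega] at h
      rw [show j + 1 + m - (j + 1) = m by omega]
      have h1 := congrArg E h
      have e1 : E (a ^ (m + 1)) = ((m : A) + 1) * a ^ m * E a := by
        rw [E.leibniz_pow]; simp [mul_assoc]
      have e2 : ∃ z, E ((E a) ^ (2 * j)) * E a = z * (E a) ^ (2 * j) := by
        rcases Nat.eq_zero_or_pos j with rfl | hj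
        · exact ⟨0, by simp⟩
        · refine ⟨(2 * j : ℕ) * E (E a), ?_⟩
          rw [E.leibniz_pow]
          simp only [nsmul_eq_mul, smul_eq_mul]
          obtain ⟨i, hi⟩ : ∃ i, 2 * j = i + 1 := ⟨2 * j - 1, by omega⟩
          rw [hi, Nat.add_sub_cancel, pow_succ]
          ring
      obtain ⟨z, hz⟩ := e2
      rw [E.leibniz, smul_eq_mul, smul_eq_mul, e1, map_zero] at h1
      have h2 : ((m : A) + 1) * (a ^ m * E a ^ (2 * (j + 1))) = 0 := by
        have : ((m : A) + 1) * (a ^ m * E a ^ (2 * (j + 1))) =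
            (a ^ (m + 1) * E (E a ^ (2 * j)) + E a ^ (2 * j) * (((m : A) + 1) * a ^ m * E a)) * E a
              - a ^ (m + 1) * (E (E a ^ (2 * j)) * E a) := by ring
        rw [this, h1, hz, zero_mul, zero_sub, neg_eq_zero]
        calc _ = z * (a ^ (m + 1) * E a ^ (2 * j)) := by ring
          _ = 0 := by rw [h, mul_zero]
      have hu : IsUnit ((m : A) + 1) := by
        have : IsUnit ((m : k) + 1) := (Nat.cast_add_one_ne_zero m).isUnit
        simpa using this.map (algebraMap k A)
      exact hu.mul_right_eq_zero.1 h2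
  exact ⟨2 * n, by simpa using key n le_rfl⟩

theorem isReduced_of_kaehler_basis [CharZero k] [IsAlgClosed k] [Algebra.FiniteType k A] {ι : Type*} [Finite ι]
    (b : Module.Basis ι A Ω[A⁄k]) : IsReduced A := by
  classical
  have := Fintype.ofFinite ι
  have hnoe : IsNoetherianRing A := Algebra.FiniteType.isNoetherianRing k A
  refine ⟨fun x hx => ?_⟩
  have hθ : ∀ θ : A →ₐ[k] k, ∃ r, θ r = 0 ∧ r * x = x := by
    intro θ
    choose u hu hu' using fun i => exists_kaehler_param θ b i
    let m := RingHom.ker θ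
    let T : Derivation k A A := ∑ i, u i • (b.coord i).compDer (D k A)
    have hT : ∀ y, T y = ∑ i, u i * b.coord i (D k A y) := by
      intro y
      simp only [T]
      rw [← Derivation.coeFnAddMonoidHom_apply, map_sum, Finset.sum_apply]
      rfl
    have h1 : ∀ y ∈ m, T y - y ∈ m ^ 2 := by
      intro y hy
      have h2 : y - ∑ i, algebraMap k A (θ (b.coord i (D k A y))) * u i ∈ m ^ 2 := by
        refine mem_ker_sq θ b ?_ fun j => ?_
        · simp only [map_sub, map_sum, map_mul, hu, mul_zero, Finset.sum_const_zero, sub_zero]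
          exact hy
        · simp only [map_sub, map_sum, ← Algebra.smul_def, Derivation.map_smul]
          simp only [← algebraMap_smul A (θ _) (D k A (u _))]
          simp only [map_smul, smul_eq_mul, map_mul, AlgHom.commutes, hu']
          simp
      have h3 : T y - ∑ i, algebraMap k A (θ (b.coord i (D k A y))) * u i ∈ m ^ 2 := by
        rw [hT, ← Finset.sum_sub_distrib]
        refine Ideal.sum_mem _ fun i _ => ?_
        rw [mul_comm, ← sub_mul, pow_two]
        refine Ideal.mul_mem_mul ?_ (hu i)
        rw [RingHom.mem_ker, map_sub, AlgHom.commutes]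
        simp
      simpa using (m ^ 2).sub_mem h3 h2
    have h2 : ∀ n : ℕ, ∀ y ∈ m ^ n, T y - n * y ∈ m ^ (n + 1) := by
      intro n
      induction n with
      | zero =>
        intro y _
        rw [hT, Nat.cast_zero, zero_mul, sub_zero, zero_add, pow_one]
        exact Ideal.sum_mem _ fun i _ => Ideal.mul_mem_right _ _ (hu i)
      | succ n ih =>
        intro y hy
        rw [pow_succ'] at hy
        induction hy using Submodule.mul_induction_on' with
        | mem_mul_mem p hp q hq =>
          have e : T (p * q) - ((n + 1 : ℕ) : A) * (p * q) = p * (T q - n * q) + q * (T p - p) := by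
            rw [T.leibniz, smul_eq_mul, smul_eq_mul]; push_cast; ring
          rw [e]
          refine add_mem ?_ ?_
          · rw [pow_succ' m (n + 1)]; exact Ideal.mul_mem_mul hp (ih q hq)
          · rw [show n + 1 + 1 = n + 2 from rfl, pow_add]; exact Ideal.mul_mem_mul hq (h1 p hp)
        | add p _ q _ hp hq =>
          have e : T (p + q) - ((n + 1 : ℕ) : A) * (p + q) = (T p - ((n + 1 : ℕ) : A) * p) +
            (T q - ((n + 1 : ℕ) : A) * q) := by rw [map_add]; ring
          rw [e]
          exact add_mem hp hq
    have h3 : ∀ n : ℕ, ∀ y : A, IsNilpotent y → y ∈ m ^ (n + 1) := by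
      intro n
      induction n with
      | zero =>
        intro y hy
        rw [zero_add, pow_one]
        exact (hy.map θ).eq_zero
      | succ n ih =>
        intro y hy
        have h4 := h2 (n + 1) y (ih y hy)
        have h5 : T y ∈ m ^ (n + 1 + 1) := by
          rw [hT]
          refine Ideal.sum_mem _ fun i _ => ?_
          rw [pow_succ' m (n + 1)]
          exact Ideal.mul_mem_mul (hu i) (ih _ (derivation_nilpotent ((b.coord i).compDer (D k A)) hy))
        have h6 := (m ^ (n + 1 + 1)).sub_mem h5 h4
        rw [sub_sub_cancel] at h6
        have hu : IsUnit (((n + 1 : ℕ)) : A) := by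
          have : IsUnit (((n + 1 : ℕ)) : k) := (Nat.cast_ne_zero.2 n.succ_ne_zero).isUnit
          simpa using this.map (algebraMap k A)
        exact (Ideal.unit_mul_mem_iff_mem _ hu).1 h6
    have h4 : x ∈ (⨅ i : ℕ, m ^ i • (⊤ : Submodule A A)) := by
      rw [Submodule.mem_iInf]
      intro i
      rw [smul_eq_mul, Ideal.mul_top]
      exact Ideal.pow_le_pow_right (Nat.le_succ i) (h3 i x hx)
    obtain ⟨r, hr⟩ := (Ideal.mem_iInf_smul_pow_eq_bot_iff m x).1 h4
    exact ⟨r, r.2, hr⟩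
  by_contra hx0
  have hne : Ideal.torsionOf A A x ≠ ⊤ := by
    intro h
    rw [Ideal.eq_top_iff_one, Ideal.mem_torsionOf_iff, one_smul] at h
    exact hx0 h
  have : Nontrivial (A ⧸ Ideal.torsionOf A A x) := Ideal.Quotient.nontrivial_iff.2 hne
  obtain ⟨η⟩ := exists_point (k := k) (A ⧸ Ideal.torsionOf A A x)
  obtain ⟨r, hr, h⟩ := hθ (η.comp (Ideal.Quotient.mkₐ k _))
  have h1 : (1 - r) ∈ Ideal.torsionOf A A x := by
    rw [Ideal.mem_torsionOf_iff, smul_eq_mul, sub_mul, h, one_mul, sub_self]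
  have h2 : (η.comp (Ideal.Quotient.mkₐ k (Ideal.torsionOf A A x))) (1 - r) = 0 := by
    change η (Ideal.Quotient.mk _ (1 - r)) = 0
    rw [Ideal.Quotient.eq_zero_iff_mem.2 h1, map_zero]
  rw [map_sub, hr, map_one, sub_zero] at h2
  exact one_ne_zero h2

end

/-- `s : X ⟶ Spec k` is separated and of finite type. -/
structure Var {k : Type u} [Field k] {X : Scheme.{u}} (s : X ⟶ SpecBase k) : Prop where
  ft : LocallyOfFiniteType s
  qc : QuasiCompact s
  sep : IsSeparated s

section Var

variable {k : Type u} [Field k] {X Y : Scheme.{u}} {s : X ⟶ SpecBase k}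

theorem Var.isNoetherian (h : Var s) : IsNoetherian X := by
  have := h.ft
  have := h.qc
  have : IsLocallyNoetherian X := LocallyOfFiniteType.isLocallyNoetherian s
  have : CompactSpace X := QuasiCompact.compactSpace_of_compactSpace s
  constructor

theorem Var.comp_open (h : Var s) (f : Y ⟶ X) [IsOpenImmersion f] : Var (f ≫ s) := by
  have := h.isNoetherian
  obtain ⟨_, _, _⟩ := h
  exact ⟨inferInstance, inferInstance, inferInstance⟩

theorem Var.comp_closed (h : Var s) (f : Y ⟶ X) [IsClosedImmersion f] : Var (f ≫ s) := by
  obtain ⟨_, _, _⟩ := h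
  exact ⟨inferInstance, inferInstance, inferInstance⟩

theorem Var.of_isProper [IsProper s] : Var s :=
  ⟨inferInstance, inferInstance, inferInstance⟩

theorem Var.of_affine {A : Type u} [CommRing A] [Algebra k A] (h : Algebra.FiniteType k A) :
    Var (Spec.map (CommRingCat.ofHom (algebraMap k A))) :=
  ⟨(HasRingHomProperty.Spec_iff (P := @LocallyOfFiniteType)).2
    (RingHom.finiteType_algebraMap.2 h), inferInstance, inferInstance⟩

theorem Var.of_iso {Y : Scheme.{u}} {t : Y ⟶ SpecBase k} (h : Var s) (e : Y ⟶ X) [IsIso e]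
    (he : e ≫ s = t) : Var t := he ▸ h.comp_open e

end Var

end

end MotivicSurface

noncomputable section

open MotivicSurface

namespace MotivicMeasure

variable {k : Type u} [Field k] {R : Type v} [CommRing R] (μ : MotivicMeasure k R)
variable {X Y Z U U' : Scheme.{u}} {s : X ⟶ SpecBase k}

theorem cl_congr {t : Y ⟶ SpecBase k} (h : Var s) (e : X ⟶ Y) [IsIso e] (he : e ≫ t = s) :
    μ.cl X s = μ.cl Y t :=
  μ.cl_iso s t (asIso e) h.ft h.qc h.sep he

theorem cl_eq_of_range (h : Var s) (f : U ⟶ X) (g : U' ⟶ X) [IsOpenImmersion f]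
    [IsOpenImmersion g] (hr : Set.range f = Set.range g) : μ.cl U (f ≫ s) = μ.cl U' (g ≫ s) :=
  μ.cl_congr (h.comp_open f) (IsOpenImmersion.isoOfRangeEq f g hr).hom (by
    rw [← Category.assoc, IsOpenImmersion.isoOfRangeEq_hom_fac])

theorem scissor (h : Var s) (i : Z ⟶ X) [IsClosedImmersion i] (j : U ⟶ X) [IsOpenImmersion j]
    (hr : Set.range j = (Set.range i)ᶜ) :
    μ.cl X s = μ.cl U (j ≫ s) + μ.cl Z (i ≫ s) := by
  rw [μ.cl_scissor s i h.ft h.qc h.sep ‹_› j.opensRange hr,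
    μ.cl_eq_of_range h j.opensRange.ι j (by simp)]

/-- The class of an open subscheme. -/
def clO (s : X ⟶ SpecBase k) (U : X.Opens) : R := μ.cl U.toScheme (U.ι ≫ s)

theorem clO_top (h : Var s) : μ.clO s ⊤ = μ.cl X s := by
  rw [clO, μ.cl_eq_of_range h (⊤ : X.Opens).ι (𝟙 X) (by simp), Category.id_comp]

theorem clO_range (h : Var s) (f : U ⟶ X) [IsOpenImmersion f] :
    μ.clO s f.opensRange = μ.cl U (f ≫ s) :=
  μ.cl_eq_of_range h _ _ (by simp)

/-- Removing a closed subscheme from an open subscheme. -/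
theorem clO_eq (h : Var s) (i : Z ⟶ X) [IsClosedImmersion i] (U W : X.Opens)
    (hW : ∀ x, x ∈ W ↔ x ∈ U ∧ x ∉ Set.range i) :
    μ.clO s U = μ.clO s W + μ.clO (i ≫ s) (i ⁻¹ᵁ U) := by
  have hWU : W ≤ U := fun x hx => ((hW x).1 hx).1
  have : IsClosedImmersion (i ∣_ U) := IsZariskiLocalAtTarget.restrict ‹_› U
  rw [clO, μ.scissor (h.comp_open U.ι) (i ∣_ U) (X.homOfLE hWU)]
  · simp [clO]
  · ext x
    have h1 : x ∈ Set.range (X.homOfLE hWU) ↔ x.1 ∈ W :=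
      ⟨fun ⟨y, hy⟩ => hy ▸ (Scheme.homOfLE_apply hWU y).symm ▸ y.2,
        fun hx => ⟨⟨x.1, hx⟩, Scheme.homOfLE_apply' _ _ _⟩⟩
    have h2 : x ∈ Set.range (i ∣_ U) ↔ x.1 ∈ Set.range i := by
      constructor
      · rintro ⟨y, rfl⟩
        exact ⟨y.1, (morphismRestrict_base_coe i U y).symm⟩
      · rintro ⟨y, hy⟩
        exact ⟨⟨y, show i y ∈ U from hy ▸ x.2⟩, Subtype.ext
          ((morphismRestrict_base_coe i U _).trans hy)⟩
    rw [h1, hW, Set.mem_compl_iff, h2]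
    exact and_iff_right x.2

theorem clO_point (h : Var s) (p : SpecBase k ⟶ X) (hp : p ≫ s = 𝟙 _) (U W : X.Opens)
    (hpU : Set.range p ⊆ U) (hW : ∀ x, x ∈ W ↔ x ∈ U ∧ x ∉ Set.range p) :
    μ.clO s U = μ.clO s W + 1 := by
  have := h.sep
  have := isClosedImmersion_of_comp_eq_id _ _ hp
  have hv : Var (p ≫ s) := h.comp_closed p
  have e : p ⁻¹ᵁ U = ⊤ := by
    ext y
    simpa using hpU ⟨y, rfl⟩
  rw [μ.clO_eq h p U W hW, e, μ.clO_top hv, hp, μ.cl_point]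

theorem clO_sup (h : Var s) (U W : X.Opens) :
    μ.clO s (U ⊔ W) + μ.clO s (U ⊓ W) = μ.clO s U + μ.clO s W := by
  let I := Scheme.IdealSheafData.vanishingIdeal ⟨(U : Set X)ᶜ, U.2.isClosed_compl⟩
  have hI : Set.range I.subschemeι = (U : Set X)ᶜ := by
    simp [I]
  have h1 := μ.clO_eq h I.subschemeι (U ⊔ W) U (by
    intro x; rw [hI]; simp; tauto)
  have h2 := μ.clO_eq h I.subschemeι W (U ⊓ W) (by
    intro x; rw [hI]; simp; tauto)
  have e : I.subschemeι ⁻¹ᵁ (U ⊔ W) = I.subschemeι ⁻¹ᵁ W := by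
    ext y
    have : I.subschemeι y ∉ U := (hI.le ⟨y, rfl⟩ : _ ∈ (U : Set X)ᶜ)
    simp [this]
  rw [h1, h2, e]
  ring

end MotivicMeasure

end

namespace MotivicSurface

noncomputable section

section

open scoped TensorProduct

variable {k : Type u} [Field k] {R : Type u} [CommRing R]

/-- `Spec A` over `Spec k`. -/
def specStr (k A : Type u) [Field k] [CommRing A] [Algebra k A] :
    Spec (.of A) ⟶ SpecBase k :=
  Spec.map (CommRingCat.ofHom (algebraMap k A))

theorem specStr_comp {A B : Type u} [CommRing A] [Algebra k A] [CommRing B] [Algebra k B]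
    (f : A →ₐ[k] B) : Spec.map (CommRingCat.ofHom f.toRingHom) ≫ specStr k A = specStr k B := by
  rw [specStr, specStr, ← Spec.map_comp, ← CommRingCat.ofHom_comp]
  congr 2
  exact f.comp_algebraMap

section

variable {A B : Type u} [CommRing A] [Algebra k A] [CommRing B] [Algebra k B]

theorem var_specStr (h : Algebra.FiniteType k A) : Var (specStr k A) := Var.of_affine h

theorem isIso_specMap (e : A ≃ₐ[k] B) :
    IsIso (Spec.map (CommRingCat.ofHom e.toAlgHom.toRingHom)) :=
  inferInstanceAs (IsIso (Spec.map e.toRingEquiv.toCommRingCatIso.hom))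

variable (μ : MotivicMeasure k R)

theorem cl_specStr_congr (hA : Algebra.FiniteType k A) (e : A ≃ₐ[k] B) :
    μ.cl (Spec (.of A)) (specStr k A) = μ.cl (Spec (.of B)) (specStr k B) := by
  have := isIso_specMap e.symm
  exact μ.cl_congr (var_specStr hA)
    (Spec.map (CommRingCat.ofHom e.symm.toAlgHom.toRingHom)) (specStr_comp _)

theorem cl_specStr_scissor (hA : Algebra.FiniteType k A) (f : A) :
    μ.cl (Spec (.of A)) (specStr k A) =
      μ.cl (Spec (.of (Localization.Away f))) (specStr k (Localization.Away f)) +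
      μ.cl (Spec (.of (A ⧸ Ideal.span {f}))) (specStr k (A ⧸ Ideal.span {f})) := by
  rw [← specStr_comp (IsScalarTower.toAlgHom k A (Localization.Away f)),
    ← specStr_comp (Ideal.Quotient.mkₐ k (Ideal.span {f}))]
  have : IsClosedImmersion (Spec.map (CommRingCat.ofHom
      (Ideal.Quotient.mkₐ k (Ideal.span {f})).toRingHom)) :=
    IsClosedImmersion.spec_of_surjective _ Ideal.Quotient.mk_surjective
  have : IsOpenImmersion (Spec.map (CommRingCat.ofHom
      (IsScalarTower.toAlgHom k A (Localization.Away f)).toRingHom)) :=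
    Scheme.isOpenImmersion_SpecMap_localizationAway (R := .of A) f
  refine μ.scissor (var_specStr hA) _ _ ?_
  refine (PrimeSpectrum.localization_away_comap_range (Localization.Away f) f).trans ?_
  refine Eq.trans ?_ (congrArg compl
    (range_comap_of_surjective _ (Ideal.Quotient.mk (Ideal.span {f}))
    Ideal.Quotient.mk_surjective).symm)
  rw [Ideal.mk_ker, PrimeSpectrum.zeroLocus_span]
  exact PrimeSpectrum.basicOpen_eq_zeroLocus_compl f

theorem cl_specStr_tensor (hA : Algebra.FiniteType k A) (hB : Algebra.FiniteType k B) :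
    μ.cl (Spec (.of (A ⊗[k] B))) (specStr k (A ⊗[k] B)) =
      μ.cl (Spec (.of A)) (specStr k A) * μ.cl (Spec (.of B)) (specStr k B) := by
  have h := var_specStr hA
  have h' := var_specStr hB
  rw [← μ.cl_prod _ _ h.ft h.qc h.sep h'.ft h'.qc h'.sep]
  have hT : Algebra.FiniteType k (A ⊗[k] B) := .trans hA inferInstance
  let e : Spec (.of (A ⊗[k] B)) ≅ pullback (specStr k A) (specStr k B) :=
    (pullbackSpecIso k A B).symm
  have h1 : e.hom ≫ pullback.fst _ _ = Spec.map (CommRingCat.ofHom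
      (Algebra.TensorProduct.includeLeft (S := k) : A →ₐ[k] A ⊗[k] B).toRingHom) :=
    pullbackSpecIso_inv_fst k A B
  exact μ.cl_congr (var_specStr hT) e.hom (by rw [reassoc_of% h1, specStr_comp])

theorem cl_specStr_poly (hA : Algebra.FiniteType k A) :
    μ.cl (Spec (.of (Polynomial A))) (specStr k (Polynomial A)) ∈ Ideal.span {μ.lef} := by
  rw [cl_specStr_congr μ (.trans hA inferInstance) (polyEquivTensor k A),
    cl_specStr_tensor μ hA inferInstance]
  exact Ideal.mul_mem_left _ _ (Ideal.subset_span rfl)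

end

/-- The measure on finitely generated algebras modulo the class of the line. -/
def ofMotivic (μ : MotivicMeasure k R) : AlgMeasure k (R ⧸ Ideal.span {μ.lef}) where
  cl A _ _ := Ideal.Quotient.mk _ (μ.cl (Spec (.of A)) (specStr k A))
  iso hA e := congrArg _ (cl_specStr_congr μ hA e)
  scissor hA f := (congrArg _ (cl_specStr_scissor μ hA f)).trans (map_add _ _ _)
  point := by
    rw [← map_one (Ideal.Quotient.mk _), ← μ.cl_point]
    congr 2
    exact Spec.map_id _
  poly hA := Ideal.Quotient.eq_zero_iff_mem.2 (cl_specStr_poly μ hA)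

end

section

variable {k : Type u} [Field k] {X : Scheme.{u}} (s : X ⟶ SpecBase k)

/-- Sections over an open subset, as a `k`-algebra. -/
def Sec (_ : X ⟶ SpecBase k) (U : X.Opens) : Type u := Γ(X, U)

instance (U : X.Opens) : CommRing (Sec s U) := inferInstanceAs (CommRing Γ(X, U))

/-- The structure homomorphism of `Sec s U`. -/
def Sec.str (U : X.Opens) : CommRingCat.of k ⟶ Γ(X, U) :=
  (Scheme.ΓSpecIso (.of k)).inv ≫ s.appLE ⊤ U fun _ _ => trivial

theorem Sec.str_res {U V : X.Opens} (h : V ≤ U) :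
    Sec.str s U ≫ X.presheaf.map (homOfLE h).op = Sec.str s V := by
  rw [Sec.str, Sec.str, Category.assoc]
  exact congrArg _ (s.appLE_map _ _)

instance (U : X.Opens) : Algebra k (Sec s U) :=
  RingHom.toAlgebra (S := Sec s U) (Sec.str s U).hom

/-- The inclusion of an affine open subset. -/
def secMor {U : X.Opens} (hU : IsAffineOpen U) : Spec (.of (Sec s U)) ⟶ X :=
  hU.fromSpec

instance {U : X.Opens} (hU : IsAffineOpen U) : IsOpenImmersion (secMor s hU) :=
  inferInstanceAs (IsOpenImmersion hU.fromSpec)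

theorem range_secMor {U : X.Opens} (hU : IsAffineOpen U) : Set.range (secMor s hU) = U :=
  hU.range_fromSpec

theorem secMor_comp {U : X.Opens} (hU : IsAffineOpen U) :
    secMor s hU ≫ s = specStr k (Sec s U) := by
  have h := IsAffineOpen.SpecMap_appLE_fromSpec s (isAffineOpen_top (SpecBase k)) hU
    (fun _ _ => trivial)
  refine h.symm.trans ?_
  rw [IsAffineOpen.fromSpec_top, Scheme.isoSpec_Spec_inv, ← Spec.map_comp]
  rfl

variable {s}

/-- Restriction of sections. -/
def Sec.res {U V : X.Opens} (h : V ≤ U) : Sec s U →ₐ[k] Sec s V :=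
  { (X.presheaf.map (homOfLE h).op).hom with
    commutes' r := congrArg (fun f : CommRingCat.of k ⟶ Γ(X, V) => f.hom r) (Sec.str_res s h) }

theorem secMor_res {U V : X.Opens} (hU : IsAffineOpen U) (hV : IsAffineOpen V) (h : V ≤ U) :
    Spec.map (CommRingCat.ofHom (Sec.res (s := s) h).toRingHom) ≫ secMor s hU = secMor s hV :=
  hU.map_fromSpec hV (homOfLE h).op

theorem Sec.finiteType [LocallyOfFiniteType s] {U : X.Opens} (hU : IsAffineOpen U) :
    Algebra.FiniteType k (Sec s U) := by
  have h := s.finiteType_appLE (isAffineOpen_top (SpecBase k)) hU fun _ _ => trivial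
  refine RingHom.finiteType_algebraMap.1 ?_
  have h2 : (Sec.str s U).hom.FiniteType := by
    rw [Sec.str, CommRingCat.hom_comp]
    refine RingHom.FiniteType.comp h (RingHom.FiniteType.of_surjective _ ?_)
    exact (Scheme.ΓSpecIso (.of k)).commRingCatIsoToRingEquiv.symm.surjective
  exact h2

section Points

theorem exists_specMap {A B : Type u} [CommRing A] [Algebra k A] [CommRing B] [Algebra k B]
    (q : Spec (.of B) ⟶ Spec (.of A)) (hq : q ≫ specStr k A = specStr k B) :
    ∃ f : A →ₐ[k] B, Spec.map (CommRingCat.ofHom f.toRingHom) = q := by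
  obtain ⟨φ, rfl⟩ := Spec.map_surjective q
  rw [specStr, specStr, ← Spec.map_comp] at hq
  have h2 := Spec.map_injective hq
  exact ⟨{ φ.hom with commutes' r := congrArg (fun f => f.hom r) h2 }, rfl⟩

/-- The morphism from an affine scheme attached to a homomorphism from the sections over an
affine open subset. -/
def ptMor {U : X.Opens} (hU : IsAffineOpen U) {B : Type u} [CommRing B]
    [Algebra k B] (θ : Sec s U →ₐ[k] B) : Spec (.of B) ⟶ X :=
  Spec.map (CommRingCat.ofHom θ.toRingHom) ≫ secMor s hU

variable {U V : X.Opens} (hU : IsAffineOpen U) (hV : IsAffineOpen V)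
variable {B C : Type u} [CommRing B] [Algebra k B] [CommRing C] [Algebra k C]

theorem ptMor_comp (θ : Sec s U →ₐ[k] B) : ptMor hU θ ≫ s = specStr k B := by
  rw [ptMor, Category.assoc, secMor_comp, specStr_comp]

theorem specMap_ptMor (θ : Sec s U →ₐ[k] B) (f : B →ₐ[k] C) :
    Spec.map (CommRingCat.ofHom f.toRingHom) ≫ ptMor hU θ = ptMor hU (f.comp θ) := by
  rw [ptMor, ptMor, ← Category.assoc, ← Spec.map_comp]
  rfl

theorem ptMor_res (h : V ≤ U) (θ : Sec s V →ₐ[k] B) :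
    ptMor hU (θ.comp (Sec.res h)) = ptMor hV θ := by
  rw [← specMap_ptMor, ptMor, secMor_res hU hV, ptMor]

theorem ptMor_injective : Function.Injective (ptMor (s := s) (B := B) hU) := by
  intro θ η h
  have h1 := Spec.map_injective ((cancel_mono _).1 h)
  ext a
  exact congrArg (fun f : CommRingCat.of (Sec s U) ⟶ CommRingCat.of B => f.hom a) h1

theorem range_ptMor_subset (θ : Sec s U →ₐ[k] B) : Set.range (ptMor hU θ) ⊆ U := by
  rw [← range_secMor s hU]
  rintro _ ⟨y, rfl⟩
  exact ⟨Spec.map (CommRingCat.ofHom θ.toRingHom) y, (Scheme.Hom.comp_apply _ _ _).symm⟩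

theorem exists_ptMor (p : Spec (.of B) ⟶ X) (hp : p ≫ s = specStr k B)
    (hpU : Set.range p ⊆ U) : ∃ θ : Sec s U →ₐ[k] B, ptMor hU θ = p := by
  obtain ⟨θ, hθ⟩ := exists_specMap
    (IsOpenImmersion.lift (secMor s hU) p (by rw [range_secMor]; exact hpU))
    (by rw [← secMor_comp s hU, IsOpenImmersion.lift_fac_assoc, hp])
  exact ⟨θ, by rw [ptMor, hθ, IsOpenImmersion.lift_fac]⟩

end Points

section FunctionField

variable [IsIntegral X] (s)

/-- The function field as an extension of `k`. -/
def FF (_ : X ⟶ SpecBase k) : Type u := X.functionField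

instance : Field (FF s) := inferInstanceAs (Field X.functionField)

instance : Nonempty (⊤ : X.Opens) := ⟨⟨genericPoint X, trivial⟩⟩

instance : Algebra k (FF s) :=
  RingHom.toAlgebra (S := FF s) (Sec.str s ⊤ ≫ X.germToFunctionField ⊤).hom

/-- Sections as rational functions. -/
def Sec.toFF (U : X.Opens) [Nonempty U] : Sec s U →ₐ[k] FF s :=
  { (X.germToFunctionField U).hom with
    commutes' r := by
      have h1 : Sec.str s U ≫ X.germToFunctionField U =
          Sec.str s ⊤ ≫ X.germToFunctionField ⊤ := by
        rw [← Sec.str_res s (le_top : U ≤ ⊤), Category.assoc]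
        congr 1
        exact X.presheaf.germ_res _ _ _
      exact congrArg (fun f : CommRingCat.of k ⟶ X.functionField => f.hom r) h1 }

theorem Sec.toFF_injective (U : X.Opens) [Nonempty U] : Function.Injective (Sec.toFF s U) :=
  Scheme.germToFunctionField_injective X U

theorem Sec.toFF_res {U V : X.Opens} [Nonempty U] [Nonempty V] (h : V ≤ U) (a : Sec s U) :
    Sec.toFF s V (Sec.res h a) = Sec.toFF s U a :=
  X.presheaf.germ_res_apply (homOfLE h) _ _ a

theorem Sec.exists_frac {U : X.Opens} (hU : IsAffineOpen U) [Nonempty U] (x : FF s) :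
    ∃ a b : Sec s U, b ≠ 0 ∧ x = Sec.toFF s U a / Sec.toFF s U b := by
  have := functionField_isFractionRing_of_isAffineOpen X U hU
  obtain ⟨a, b, hb, h⟩ := IsFractionRing.div_surjective Γ(X, U) (K := X.functionField) x
  exact ⟨a, b, nonZeroDivisors.ne_zero (M₀ := Γ(X, U)) hb, h.symm⟩

/-- The generic point. -/
def genMor : Spec (.of (FF s)) ⟶ X := X.fromSpecStalk (genericPoint X)

theorem genMor_eq {U : X.Opens} (hU : IsAffineOpen U) [Nonempty U] :
    ptMor hU (Sec.toFF s U) = genMor s :=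
  hU.fromSpecStalk_eq_fromSpecStalk _

end FunctionField

end

section

variable {k : Type u} [Field k] {X : Scheme.{u}} {s : X ⟶ SpecBase k} [IsIntegral X]

theorem genMor_comp : genMor s ≫ s = specStr k (FF s) := by
  obtain ⟨U, hU, hx, -⟩ := exists_isAffineOpen_mem_and_subset (X := X) (x := genericPoint X) (U := ⊤)
    trivial
  have : Nonempty U := ⟨⟨_, hx⟩⟩
  rw [← genMor_eq s hU, ptMor_comp]

theorem range_eq_singleton (f : SpecBase k ⟶ X) (x : SpecBase k) : Set.range f = {f x} := by
  have : Subsingleton (SpecBase k) := inferInstanceAs (Subsingleton (PrimeSpectrum k))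
  exact Set.range_eq_singleton_iff.2 fun y => congrArg f (Subsingleton.elim y x)

theorem isLCI_res {U : X.Opens} (hU : IsAffineOpen U) (f : Γ(X, U)) :
    IsLCI (Sec.res (s := s) (X.basicOpen_le f)) f := by
  have := hU.isLocalization_basicOpen f
  refine ⟨IsLocalization.Away.algebraMap_isUnit (S := Γ(X, X.basicOpen f)) f, fun y => ?_⟩
  obtain ⟨n, a, h⟩ := IsLocalization.Away.surj (S := Γ(X, X.basicOpen f)) f y
  exact ⟨a, n, h⟩

variable [LocallyOfFiniteType s]

variable (s) in
/-- The sections over an affine open subset, inside the function field. -/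
def chartOf {U : X.Opens} (hU : IsAffineOpen U) [Nonempty U] : Chart k (FF s) :=
  have := Sec.finiteType (s := s) hU
  { A := Sec s U, e := Sec.toFF s U, inj := Sec.toFF_injective s U }

/-- The point of the function field attached to a point of an affine open subset. -/
def ptOf {U : X.Opens} (hU : IsAffineOpen U) [Nonempty U] (θ : Sec s U →ₐ[k] k) :
    LPt k (FF s) k := (chartOf s hU).pt θ

theorem ptOf_res {U V : X.Opens} (hU : IsAffineOpen U) (hV : IsAffineOpen V) [Nonempty U]
    [Nonempty V] (f : Γ(X, U)) (h : V = X.basicOpen f) (hVU : V ≤ U) (ζ : Sec s V →ₐ[k] k) :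
    ptOf hU (ζ.comp (Sec.res hVU)) = ptOf hV ζ := by
  subst h
  exact Chart.pt_comp (c := chartOf s hU) (b := chartOf s hV) (Sec.toFF_res s hVU)
    (isLCI_res hU f) ζ

/-- `P` is the local ring of the rational point `p`. -/
def Rep (p : SpecBase k ⟶ X) (P : LPt k (FF s) k) : Prop :=
  ∃ (U : X.Opens) (hU : IsAffineOpen U) (_ : Nonempty U) (θ : Sec s U →ₐ[k] k),
    ptMor hU θ = p ∧ ptOf hU θ = P

variable {p p' : SpecBase k ⟶ X} {P P' : LPt k (FF s) k}

theorem Rep.exists_eq (h : Rep p P) {U : X.Opens} (hU : IsAffineOpen U) [Nonempty U]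
    (hp : Set.range p ⊆ U) : ∃ θ : Sec s U →ₐ[k] k, ptMor hU θ = p ∧ ptOf hU θ = P := by
  obtain ⟨W, hW, _, η, rfl, rfl⟩ := h
  have hηW := range_ptMor_subset hW η
  let x₀ : SpecBase k := (⊥ : PrimeSpectrum k)
  rw [range_eq_singleton _ x₀, Set.singleton_subset_iff] at hp hηW
  obtain ⟨f, g, hfg, hx⟩ := exists_basicOpen_le_affine_inter hU hW _ ⟨hp, hηW⟩
  have hV := hU.basicOpen f
  have : Nonempty (X.basicOpen f) := ⟨⟨_, hx⟩⟩
  obtain ⟨ζ, hζ⟩ := exists_ptMor (s := s) hV (ptMor hW η) ((ptMor_comp hW η).trans rfl) (by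
    rw [range_eq_singleton _ x₀, Set.singleton_subset_iff]; exact hx)
  have hVW : X.basicOpen f ≤ W := hfg ▸ X.basicOpen_le g
  have h1 : ζ.comp (Sec.res hVW) = η :=
    ptMor_injective hW ((ptMor_res hW hV hVW ζ).trans hζ)
  refine ⟨ζ.comp (Sec.res (X.basicOpen_le f)), (ptMor_res hU hV _ ζ).trans hζ, ?_⟩
  rw [ptOf_res hU hV f rfl, ← h1, ptOf_res hW hV g hfg]

theorem Rep.unique (h : Rep p P) (h' : Rep p P') : P = P' := by
  obtain ⟨W, hW, _, η, rfl, rfl⟩ := h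
  obtain ⟨θ, h1, h2⟩ := h'.exists_eq hW (range_ptMor_subset hW η)
  rw [← h2, ptMor_injective hW h1]

theorem exists_lift {U : X.Opens} (hU : IsAffineOpen U) [Nonempty U] {θ : Sec s U →ₐ[k] k}
    {V : LPt k (FF s) k} (h : ptOf hU θ ≤ V) : ∃ φ : Sec s U →ₐ[k] V.O,
      V.res.comp φ = θ ∧ V.O.val.comp φ = Sec.toFF s U := by
  have h1 : ∀ r, V.At (Sec.toFF s U r) (θ r) := Chart.pt_le_iff.1 h
  refine ⟨(Sec.toFF s U).codRestrict V.O fun r => (h1 r).mem, ?_, rfl⟩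
  ext r
  exact (h1 r).2

theorem valuationRing_of_isPlace {K : Type u} [Field K] [Algebra k K] {V : LPt k K k}
    (hV : V.IsPlace) : ValuationRing V.O ∧ IsFractionRing V.O K :=
  have h : V.O.toSubring = (ValuationSubring.mk V.O.toSubring hV).toSubring := rfl
  ⟨inferInstanceAs (ValuationRing (ValuationSubring.mk V.O.toSubring hV)),
    inferInstanceAs (IsFractionRing (ValuationSubring.mk V.O.toSubring hV) K)⟩

theorem Rep.eq_of_le [IsSeparated s] {V : LPt k (FF s) k} (hV : V.IsPlace) (h : Rep p P)
    (h' : Rep p' P') (hP : P ≤ V) (hP' : P' ≤ V) : p = p' := by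
  obtain ⟨U, hU, _, θ, rfl, rfl⟩ := h
  obtain ⟨W, hW, _, η, rfl, rfl⟩ := h'
  obtain ⟨φ, rfl, hφ⟩ := exists_lift hU hP
  obtain ⟨ψ, rfl, hψ⟩ := exists_lift hW hP'
  rw [← specMap_ptMor, ← specMap_ptMor]
  obtain ⟨_, _⟩ := valuationRing_of_isPlace hV
  have h1 : Spec.map (CommRingCat.ofHom (algebraMap V.O (FF s))) ≫ ptMor hU φ = genMor s := by
    rw [← genMor_eq s hU, ← hφ, ← specMap_ptMor]; rfl
  have h2 : Spec.map (CommRingCat.ofHom (algebraMap V.O (FF s))) ≫ ptMor hW ψ = genMor s := by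
    rw [← genMor_eq s hW, ← hψ, ← specMap_ptMor]; rfl
  have hu : ValuativeCriterion.Uniqueness s :=
    (IsSeparated.eq_valuativeCriterion.le _ _ s ‹_›).1
  let S : ValuativeCommSq s :=
    { R := V.O, K := FF s, i₁ := genMor s, i₂ := specStr k V.O
      commSq := ⟨by rw [← h1, Category.assoc, ptMor_comp]⟩ }
  have := hu S
  have h3 := Subsingleton.elim (α := S.commSq.LiftStruct) ⟨ptMor hU φ, h1, ptMor_comp hU φ⟩
    ⟨ptMor hW ψ, h2, ptMor_comp hW ψ⟩
  exact congrArg _ (congrArg CommSq.LiftStruct.l h3)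

theorem exists_rep_le [UniversallyClosed s] {V : LPt k (FF s) k} (hV : V.IsPlace) :
    ∃ p P, Rep p P ∧ P ≤ V := by
  obtain ⟨_, _⟩ := valuationRing_of_isPlace hV
  have he : ValuativeCriterion.Existence s :=
    (UniversallyClosed.eq_valuativeCriterion.le _ _ s ‹_›).1
  let S : ValuativeCommSq s :=
    { R := V.O, K := FF s, i₁ := genMor s, i₂ := specStr k V.O
      commSq := ⟨by rw [genMor_comp]; exact (specStr_comp V.O.val).symm⟩ }
  obtain ⟨F, hF₁, hF₂⟩ := (he S).exists_lift
  obtain ⟨U, hU, hx, -⟩ := exists_isAffineOpen_mem_and_subset (X := X)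
    (x := F (IsLocalRing.closedPoint V.O)) (U := ⊤) trivial
  have : Nonempty U := ⟨⟨_, hx⟩⟩
  obtain ⟨φ, rfl⟩ := exists_ptMor (s := s) hU F hF₂ (by
    rintro _ ⟨y, rfl⟩
    exact ((IsLocalRing.specializes_closedPoint y).map F.continuous).mem_open U.2 hx)
  have h1 : V.O.val.comp φ = Sec.toFF s U := by
    apply ptMor_injective hU
    rw [← specMap_ptMor, genMor_eq]
    exact hF₁
  refine ⟨_, _, ⟨U, hU, ‹_›, V.res.comp φ, rfl, rfl⟩, Chart.pt_le_iff.2 fun r => ?_⟩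
  rw [show (chartOf s hU).e = V.O.val.comp φ from h1.symm]
  exact LPt.at_coe (φ r)

end

section

variable {k : Type u} [Field k] {X : Scheme.{u}} {s : X ⟶ SpecBase k} [IsIntegral X]

variable [IsAlgClosed k] [IsProper s]

variable (s) in
/-- The local rings of the rational points of an open subset. -/
def ptSet (U : X.Opens) : Set (LPt k (FF s) k) := {P | ∃ p, Rep p P ∧ Set.range p ⊆ U}

theorem ptSet_affine {U : X.Opens} (hU : IsAffineOpen U) [Nonempty U] :
    ptSet s U = Set.range (chartOf s hU).pt := by
  ext P
  constructor
  · rintro ⟨p, hp, hpU⟩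
    obtain ⟨θ, -, h⟩ := hp.exists_eq hU hpU
    exact ⟨θ, h⟩
  · rintro ⟨θ, rfl⟩
    exact ⟨_, ⟨U, hU, ‹_›, θ, rfl, rfl⟩, range_ptMor_subset hU θ⟩

theorem ptSet_bot : ptSet s (⊥ : X.Opens) = ∅ := by
  refine Set.eq_empty_of_forall_notMem fun P ⟨p, _, hp⟩ => ?_
  exact hp ⟨(⊥ : PrimeSpectrum k), rfl⟩

theorem ptSet_sup (U W : X.Opens) : ptSet s (U ⊔ W) = ptSet s U ∪ ptSet s W := by
  ext P
  simp only [ptSet, range_eq_singleton _ (⊥ : PrimeSpectrum k), Set.singleton_subset_iff,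
    SetLike.mem_coe, TopologicalSpace.Opens.mem_sup, and_or_left, exists_or]
  rfl

theorem ptSet_inf (U W : X.Opens) : ptSet s (U ⊓ W) = ptSet s U ∩ ptSet s W := by
  apply subset_antisymm
  · rintro P ⟨p, h, hp⟩
    exact ⟨⟨p, h, hp.trans fun _ hx => hx.1⟩, ⟨p, h, hp.trans fun _ hx => hx.2⟩⟩
  · rintro P ⟨⟨p, h, hp⟩, ⟨p', h', hp'⟩⟩
    obtain ⟨V, hPV, hV⟩ := P.exists_place_ge
    obtain rfl := h.eq_of_le hV h' hPV hPV
    exact ⟨p, h, Set.subset_inter hp hp'⟩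

variable {R : Type u} [CommRing R] (μ : MotivicMeasure k R)

theorem clO_bot : μ.clO s (⊥ : X.Opens) = 0 := by
  have h := μ.clO_eq (Var.of_isProper (s := s)) (𝟙 X) ⊤ ⊥ (by simp)
  rw [Category.id_comp] at h
  exact right_eq_add.1 h |>.symm ▸ rfl

theorem hasClass_affine {U : X.Opens} (hU : IsAffineOpen U) :
    HasClass (ofMotivic μ) Set.univ (ptSet s U) (Ideal.Quotient.mk _ (μ.clO s U)) := by
  obtain rfl | hne := eq_or_ne U ⊥
  · rw [ptSet_bot, clO_bot, map_zero]
    exact .empty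
  have : Nonempty U := by
    obtain ⟨x, hx⟩ := (TopologicalSpace.Opens.ne_bot_iff_nonempty U).1 hne
    exact ⟨⟨x, hx⟩⟩
  have h := HasClass.of_chart (μ := ofMotivic μ) (Set.mem_univ (chartOf s hU)) conSet_univ
  have h1 : ind (Set.univ : Set ((chartOf s hU).A →ₐ[k] k)) = 1 := Set.indicator_univ _
  rw [Set.image_univ, ← ptSet_affine, h1, AlgMeasure.nu_one] at h
  have h2 : U = (secMor s hU).opensRange := TopologicalSpace.Opens.ext (range_secMor s hU).symm
  have h3 : μ.clO s U = μ.cl (Spec (.of (Sec s U))) (specStr k (Sec s U)) := by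
    rw [← secMor_comp s hU, ← μ.clO_range Var.of_isProper, ← h2]
  rw [h3]
  exact h

theorem isAffineOpen_inf {U W : X.Opens} (s : X ⟶ SpecBase k) [IsSeparated s]
    (hU : IsAffineOpen U) (hW : IsAffineOpen W) : IsAffineOpen (U ⊓ W) :=
  isAffineHom_diagonal_iff.mp (inferInstance : IsAffineHom (pullback.diagonal s)) ⊤
    (isAffineOpen_top _) U (fun _ _ => trivial) W (fun _ _ => trivial) hU hW

theorem HasClass.ptSet_sup {U W : X.Opens}
    (hU : HasClass (ofMotivic μ) Set.univ (ptSet s U) (Ideal.Quotient.mk _ (μ.clO s U)))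
    (hW : HasClass (ofMotivic μ) Set.univ (ptSet s W) (Ideal.Quotient.mk _ (μ.clO s W)))
    (h : HasClass (ofMotivic μ) Set.univ (ptSet s (W ⊓ U))
      (Ideal.Quotient.mk _ (μ.clO s (W ⊓ U)))) :
    HasClass (ofMotivic μ) Set.univ (ptSet s (U ⊔ W)) (Ideal.Quotient.mk _ (μ.clO s (U ⊔ W))) := by
  have h1 : ptSet s (W ⊓ U) = ptSet s W ∩ ptSet s U := ptSet_inf W U
  have h2 := hU.union (hW.diff h (h1 ▸ Set.inter_subset_left)) (by
    rw [h1, Set.sdiff_self_inter]; exact Set.disjoint_sdiff_right)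
  rw [h1, Set.sdiff_self_inter, Set.union_sdiff_self,
    ← MotivicSurface.ptSet_sup] at h2
  convert h2 using 1
  rw [inf_comm, ← map_sub, ← map_add, ← add_sub_assoc, ← μ.clO_sup Var.of_isProper,
    add_sub_cancel_right]

theorem hasClass_ptSet (U : X.Opens) :
    HasClass (ofMotivic μ) Set.univ (ptSet s U) (Ideal.Quotient.mk _ (μ.clO s U)) := by
  have := (Var.of_isProper (s := s)).isNoetherian
  refine (compact_open_induction_on (P := fun U => HasClass (ofMotivic μ) Set.univ (ptSet s U)
    (Ideal.Quotient.mk _ (μ.clO s U)) ∧ ∀ C : X.Opens, IsAffineOpen C → HasClass (ofMotivic μ)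
      Set.univ (ptSet s (C ⊓ U)) (Ideal.Quotient.mk _ (μ.clO s (C ⊓ U)))) U
    (TopologicalSpace.NoetherianSpace.isCompact _) ?_ ?_).1
  · have h : HasClass (ofMotivic μ) Set.univ (ptSet s (⊥ : X.Opens))
        (Ideal.Quotient.mk _ (μ.clO s (⊥ : X.Opens))) := by
      rw [ptSet_bot, clO_bot, map_zero]
      exact .empty
    exact ⟨h, fun C _ => by rwa [inf_bot_eq]⟩
  · intro S _ U ⟨h1, h2⟩
    refine ⟨h1.ptSet_sup μ (hasClass_affine μ U.2) (h2 U U.2), fun C hC => ?_⟩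
    rw [inf_sup_left]
    have hCU := isAffineOpen_inf s hC U.2
    refine (h2 C hC).ptSet_sup μ (hasClass_affine μ hCU) ?_
    rw [show C ⊓ U.1 ⊓ (C ⊓ S) = (C ⊓ U.1) ⊓ S by
      rw [← inf_assoc, inf_right_comm C, inf_idem]]
    exact h2 _ hCU

/-- A complete nonsingular rational surface has class one modulo the class of the line. -/
theorem cl_sub_one_mem [CharZero k] (F₀ : Frame k (FF s))
    (hΩ : ∀ x : X, ∃ W : X.Opens, IsAffineOpen W ∧ x ∈ W ∧
      Nonempty (Module.Basis (Fin 2) (Sec s W) Ω[Sec s W⁄k])) :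
    μ.cl X s - 1 ∈ Ideal.span {μ.lef} := by
  have := (Var.of_isProper (s := s)).isNoetherian
  rw [← Ideal.Quotient.eq_zero_iff_mem, map_sub, map_one, sub_eq_zero,
    ← μ.clO_top Var.of_isProper]
  choose W hW hx b using hΩ
  have hne (x : X) : Nonempty (W x) := ⟨⟨x, hx x⟩⟩
  obtain ⟨t, ht⟩ := isCompact_univ.elim_finite_subcover (fun x => (W x : Set X))
    (fun x => (W x).2) fun x _ => Set.mem_iUnion.2 ⟨x, hx x⟩
  have hcov : ptSet s (⊤ : X.Opens) = ⋃ x : t, Set.range (chartOf s (hW x)).pt := by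
    ext P
    constructor
    · rintro ⟨p, hp, -⟩
      obtain ⟨x, hxt, h⟩ := Set.mem_iUnion₂.1 (ht (Set.mem_univ (p (⊥ : PrimeSpectrum k))))
      refine Set.mem_iUnion.2 ⟨⟨x, hxt⟩, ?_⟩
      rw [← ptSet_affine]
      exact ⟨p, hp, by rwa [range_eq_singleton p (⊥ : PrimeSpectrum k),
        Set.singleton_subset_iff]⟩
    · rintro h
      obtain ⟨x, h⟩ := Set.mem_iUnion.1 h
      rw [← ptSet_affine] at h
      obtain ⟨p, hp, -⟩ := h
      exact ⟨p, hp, fun _ _ => trivial⟩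
  refine class_eq_one F₀ hcov (hasClass_ptSet μ ⊤) ?_ ?_ ?_
  · intro P hP
    rw [hcov] at hP
    obtain ⟨x, θ, rfl⟩ := Set.mem_iUnion.1 hP
    obtain ⟨b⟩ := b x
    exact Chart.exists_regPt (c := chartOf s (hW x)) (Sec.exists_frac s (hW x)) b θ
  · rintro V hV P ⟨p, hp, -⟩ P' ⟨p', hp', -⟩ h h'
    obtain rfl := hp.eq_of_le hV hp' h h'
    exact hp.unique hp'
  · intro V hV
    obtain ⟨p, P, hp, h⟩ := exists_rep_le (s := s) hV
    exact ⟨P, ⟨p, hp, fun _ _ => trivial⟩, h⟩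

end

attribute [local instance] MvPolynomial.gradedAlgebra

section Homogeneous

variable {k : Type u} [Field k] {n : ℕ}

theorem aeval_mul_of_isHomogeneous {L : Type*} [CommRing L] [Algebra k L] {x : MvPolynomial (Fin n) k}
    {d : ℕ} (hx : x.IsHomogeneous d) (c : L) (v : Fin n → L) :
    aeval (fun i => c * v i) x = c ^ d * aeval v x := by
  rw [aeval_def, aeval_def, eval₂_eq', eval₂_eq', Finset.mul_sum]
  refine Finset.sum_congr rfl fun m hm => ?_
  have h := hx (mem_support_iff.1 hm)
  rw [Finsupp.weight_apply, Finsupp.sum_fintype _ _ (by simp)] at h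
  simp only [Pi.one_apply, smul_eq_mul, mul_one] at h
  rw [Finset.prod_congr rfl fun i _ => mul_pow c (v i) (m i), Finset.prod_mul_distrib,
    Finset.prod_pow_eq_pow_sum, h]
  ring

end Homogeneous

section Away

variable (k : Type u) [Field k] (n : ℕ)

theorem X_zero_mem : (X 0 : MvPolynomial (Fin (n + 1)) k) ∈ homogeneousSubmodule (Fin (n + 1)) k 1 :=
  isHomogeneous_X k 0

/-- The ring of the standard affine chart of projective space. -/
abbrev PAway : Type u :=
  HomogeneousLocalization.Away (homogeneousSubmodule (Fin (n + 1)) k) (X 0)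

/-- The constants of the standard affine chart. -/
def PAway.const : k →+* PAway k n :=
  (HomogeneousLocalization.fromZeroRingHom (homogeneousSubmodule (Fin (n + 1)) k) _).comp
    (algebraMap k (homogeneousSubmodule (Fin (n + 1)) k 0))

/-- The affine coordinates identify the polynomial ring with the standard chart. -/
def PAway.coord : MvPolynomial (Fin n) k →+* PAway k n :=
  eval₂Hom (PAway.const k n) fun i =>
    HomogeneousLocalization.Away.mk _ (X_zero_mem k n) 1 (X i.succ) (isHomogeneous_X k i.succ)

/-- The first homogeneous coordinate as a denominator. -/
abbrev PAway.den : Submonoid.powers (X 0 : MvPolynomial (Fin (n + 1)) k) :=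
  ⟨X 0 ^ 1, ⟨1, rfl⟩⟩

theorem PAway.val_coord (p : MvPolynomial (Fin n) k) :
    (PAway.coord k n p).val = aeval (fun i : Fin n => (Localization.mk (X i.succ)
      (den k n) : Localization.Away (X 0 : MvPolynomial (Fin (n + 1)) k))) p := by
  induction p using MvPolynomial.induction_on with
  | C a => 
    simp only [coord, coe_eval₂Hom, eval₂_C, algHom_C]
    rfl
  | add p q hp hq => simp only [map_add, HomogeneousLocalization.val_add, hp, hq]
  | mul_X p i hp =>
    rw [map_mul, HomogeneousLocalization.val_mul, hp, map_mul, aeval_X]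
    congr 1
    rw [coord, coe_eval₂Hom, eval₂_X]
    rfl

/-- Dehomogenization. -/
def PAway.dehom : PAway k n →+* MvPolynomial (Fin n) k :=
  (Localization.awayLift (aeval (R := k) (Fin.cons 1 X : Fin (n + 1) → MvPolynomial (Fin n) k)).toRingHom
    (X 0) (by simp)).comp (algebraMap (PAway k n)
      (Localization.Away (X 0 : MvPolynomial (Fin (n + 1)) k)))

theorem PAway.dehom_coord : (PAway.dehom k n).comp (PAway.coord k n) = RingHom.id _ := by
  have hw : IsUnit ((aeval (R := k) (Fin.cons 1 X : Fin (n + 1) → MvPolynomial (Fin n) k)).toRingHom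
    (X 0)) := by simp
  refine MvPolynomial.ringHom_ext (fun r => ?_) fun i => ?_
  · have e : PAway.coord k n (C r) = PAway.const k n r := by simp [coord]
    rw [RingHom.comp_apply, e]
    refine (IsLocalization.Away.lift_eq (S := Localization.Away
      (X 0 : MvPolynomial (Fin (n + 1)) k)) _ hw (C r)).trans ?_
    simp
  · have e : (PAway.coord k n (X i)).val = Localization.mk (X i.succ) (den k n) := by
      rw [val_coord, aeval_X]
    rw [RingHom.comp_apply, RingHom.id_apply, dehom, RingHom.comp_apply,
      HomogeneousLocalization.algebraMap_apply, e, Localization.mk_eq_mk']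
    refine (IsLocalization.lift_mk'_spec (S := Localization.Away
      (X 0 : MvPolynomial (Fin (n + 1)) k)) _ _ _ _).2 ?_
    simp

theorem PAway.coord_surjective : Function.Surjective (PAway.coord k n) := by
  intro a
  obtain ⟨m, x, hx, rfl⟩ := HomogeneousLocalization.Away.mk_surjective _ (X_zero_mem k n) a
  refine ⟨aeval (Fin.cons 1 X : Fin (n + 1) → MvPolynomial (Fin n) k) x,
    HomogeneousLocalization.val_injective _ ?_⟩
  rw [PAway.val_coord, HomogeneousLocalization.Away.val_mk]
  have h2 {L : Type u} [CommRing L] [Algebra k L] (v : Fin n → L) :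
      (aeval v (aeval (Fin.cons 1 X : Fin (n + 1) → MvPolynomial (Fin n) k) x) : L) =
        aeval (Fin.cons 1 v : Fin (n + 1) → L) x := by
    rw [← AlgHom.comp_apply, comp_aeval]
    congr 2
    funext i
    refine Fin.cases ?_ (fun i => ?_) i <;> simp
  rw [h2]
  have h3 {L : Type u} [CommRing L] [Algebra k L] [Algebra (MvPolynomial (Fin (n + 1)) k) L]
      [IsScalarTower k (MvPolynomial (Fin (n + 1)) k) L] (D : L)
      (hD : algebraMap (MvPolynomial (Fin (n + 1)) k) L (X 0) * D = 1) (v : Fin n → L)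
      (hv : ∀ i, v i = D * algebraMap (MvPolynomial (Fin (n + 1)) k) L (X i.succ)) :
      aeval (Fin.cons 1 v : Fin (n + 1) → L) x = D ^ m * algebraMap _ L x := by
    rw [← aeval_X_left_apply x, ← aeval_algebraMap_apply, ← aeval_mul_of_isHomogeneous
      (d := m) (by simpa using hx), aeval_X_left_apply]
    congr 2
    funext i
    refine Fin.cases ?_ (fun i => ?_) i
    · rw [Fin.cons_zero, Function.comp_apply, mul_comm, hD]
    · rw [Fin.cons_succ, hv, Function.comp_apply]
  rw [h3 (Localization.mk 1 (den k n)), Localization.mk_pow,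
    ← Localization.mk_one_eq_algebraMap, Localization.mk_mul, one_pow, one_mul, mul_one]
  · congr 1
    exact Subtype.ext (by simp)
  · rw [← Localization.mk_one_eq_algebraMap, Localization.mk_mul]
    simpa [den] using Localization.mk_self (den k n)
  · intro i
    rw [← Localization.mk_one_eq_algebraMap, Localization.mk_mul]
    simp

theorem PAway.coord_bijective : Function.Bijective (PAway.coord k n) :=
  ⟨Function.LeftInverse.injective (g := PAway.dehom k n) fun p =>
    DFunLike.congr_fun (dehom_coord k n) p, coord_surjective k n⟩

end Away

section Chart

variable (k : Type u) [Field k] (n : ℕ)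

/-- The standard chart `𝔸ⁿ ⟶ ℙⁿ`. -/
def projChart : Spec (.of (MvPolynomial (Fin n) k)) ⟶
    Proj (homogeneousSubmodule (Fin (n + 1)) k) :=
  Spec.map (RingEquiv.ofBijective _ (PAway.coord_bijective k n)).symm.toCommRingCatIso.hom ≫
    Proj.awayι (homogeneousSubmodule (Fin (n + 1)) k) (X 0) (X_zero_mem k n) one_pos

instance : IsOpenImmersion (projChart k n) :=
  IsOpenImmersion.comp _ _

theorem range_projChart : Set.range (projChart k n) =
    (Proj.basicOpen (homogeneousSubmodule (Fin (n + 1)) k) (X 0) : Set _) := by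
  rw [← Proj.opensRange_awayι _ _ (X_zero_mem k n) one_pos]
  exact congrArg (fun U : (Proj (homogeneousSubmodule (Fin (n + 1)) k)).Opens =>
    (U : Set (Proj (homogeneousSubmodule (Fin (n + 1)) k))))
    (Scheme.Hom.opensRange_comp_of_isIso _ _)

/-- The standard chart, as a morphism to `ProjSpace`. -/
def stdChart : Spec (.of (MvPolynomial (Fin n) k)) ⟶ ProjSpace k n := projChart k n

instance : IsOpenImmersion (stdChart k n) := inferInstanceAs (IsOpenImmersion (projChart k n))

theorem projChart_comp : projChart k n ≫ Proj.toSpecZero _ ≫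
    Spec.map (CommRingCat.ofHom (algebraMap k (homogeneousSubmodule (Fin (n + 1)) k 0))) =
      specStr k (MvPolynomial (Fin n) k) := by
  rw [projChart, Category.assoc, Proj.awayι_toSpecZero_assoc, ← Spec.map_comp, ← Spec.map_comp]
  refine congrArg Spec.map (CommRingCat.hom_ext (RingHom.ext fun r => ?_))
  change (RingEquiv.ofBijective _ (PAway.coord_bijective k n)).symm (PAway.const k n r) = C r
  rw [RingEquiv.symm_apply_eq]
  simp [PAway.coord]

theorem stdChart_comp : stdChart k n ≫ ProjSpace.toSpec k n =
    specStr k (MvPolynomial (Fin n) k) :=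
  projChart_comp k n

end Chart

attribute [local instance] MvPolynomial.gradedAlgebra

section Proj

variable (k : Type u) [Field k] (n : ℕ)

theorem X_mem_irrelevant (i : Fin (n + 1)) :
    X i ∈ HomogeneousIdeal.irrelevant (homogeneousSubmodule (Fin (n + 1)) k) := by
  rw [HomogeneousIdeal.mem_irrelevant_iff, GradedRing.proj_apply]
  exact DirectSum.decompose_of_mem_ne (homogeneousSubmodule (Fin (n + 1)) k)
    (i := 1) (j := 0) (isHomogeneous_X k i) one_ne_zero

variable {k n}

theorem irrelevant_le {I : HomogeneousIdeal (homogeneousSubmodule (Fin (n + 1)) k)}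
    (h : ∀ i, X i ∈ I) :
    HomogeneousIdeal.irrelevant (homogeneousSubmodule (Fin (n + 1)) k) ≤ I := by
  intro f hf
  rw [HomogeneousIdeal.mem_irrelevant_iff, GradedRing.proj_apply] at hf
  have h0 : coeff 0 f = 0 := by
    have : homogeneousComponent 0 f = 0 := by
      rw [← hf]
      exact (decomposition.decompose'_apply f 0).symm
    rwa [homogeneousComponent_zero, C_eq_zero] at this
  have h1 : f ∈ Ideal.span ((X : Fin (n + 1) → MvPolynomial (Fin (n + 1)) k) '' Set.univ) := by
    refine mem_ideal_span_X_image.2 fun m hm => ?_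
    by_contra! hc
    refine mem_support_iff.1 hm ?_
    rwa [show m = 0 from Finsupp.ext fun i => hc i trivial]
  exact (Ideal.span_le (I := I.toIdeal)).2 (by rintro _ ⟨i, -, rfl⟩; exact h i) h1

variable (k n)

/-- The generic point of projective space. -/
def projGen : ProjectiveSpectrum (homogeneousSubmodule (Fin (n + 1)) k) where
  asHomogeneousIdeal := ⊥
  isPrime := Ideal.isPrime_bot
  not_irrelevant_le h := X_ne_zero (R := k) (0 : Fin (n + 1)) (h (X_mem_irrelevant k n 0))

theorem irreducibleSpace_proj :
    IrreducibleSpace (Proj (homogeneousSubmodule (Fin (n + 1)) k)) := by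
  have h : closure {projGen k n} = (Set.univ : Set (Proj (homogeneousSubmodule (Fin (n + 1)) k))) :=
    Set.eq_univ_of_forall fun y => (ProjectiveSpectrum.le_iff_mem_closure _ _ y).1
      (bot_le (a := y.asHomogeneousIdeal))
  have : PreirreducibleSpace (Proj (homogeneousSubmodule (Fin (n + 1)) k)) :=
    ⟨h ▸ (isIrreducible_singleton.closure).2⟩
  exact { toNonempty := ⟨projGen k n⟩ }

/-- The point at infinity of the projective line. -/
def projInf : ProjectiveSpectrum (homogeneousSubmodule (Fin 2) k) where
  asHomogeneousIdeal := ⟨Ideal.span {X 0}, Ideal.homogeneous_span _ _ (by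
    rintro _ rfl
    exact ⟨1, isHomogeneous_X k 0⟩)⟩
  isPrime := (Ideal.span_singleton_prime (X_ne_zero _)).2 X_prime
  not_irrelevant_le h := by
    have := Ideal.mem_span_singleton.1 (h (X_mem_irrelevant k 1 1))
    rw [X_dvd_X] at this
    simp at this

theorem eq_projInf (y : ProjectiveSpectrum (homogeneousSubmodule (Fin 2) k))
    (hy : X 0 ∈ y.asHomogeneousIdeal) : y = projInf k := by
  refine ProjectiveSpectrum.ext (HomogeneousIdeal.ext' fun d f hf => ⟨fun h => ?_, fun h => ?_⟩)
  · have h1 : X 1 ∉ y.asHomogeneousIdeal := fun h1 =>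
      y.not_irrelevant_le (irrelevant_le (n := 1) (Fin.forall_fin_two.2 ⟨hy, h1⟩))
    have key : f - C (coeff (Finsupp.single 1 d) f) * X 1 ^ d ∈
        Ideal.span ((X : Fin 2 → MvPolynomial (Fin 2) k) '' {0}) := by
      refine mem_ideal_span_X_image.2 fun m hm => ⟨0, rfl, fun h0 => ?_⟩
      rw [mem_support_iff, coeff_sub, coeff_C_mul, coeff_X_pow] at hm
      have hm' : m = Finsupp.single 1 (m 1) := by
        ext i
        fin_cases i <;> simp [h0]
      by_cases hc : coeff m f = 0
      · rw [hc] at hm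
        split_ifs at hm with h2
        · rw [h2, hc] at hm
          simp at hm
        · simp at hm
      · have := hf hc
        rw [hm', Finsupp.weight_single] at this
        simp at this
        rw [← this, ← hm'] at hm
        simp at hm
    rw [Set.image_singleton] at key
    have key' : f - C (coeff (Finsupp.single 1 d) f) * X 1 ^ d ∈ y.asHomogeneousIdeal.toIdeal :=
      Ideal.span_le.2 (Set.singleton_subset_iff.2 hy) key
    have h2 : C (coeff (Finsupp.single 1 d) f) * X 1 ^ d ∈ y.asHomogeneousIdeal.toIdeal := by
      simpa using sub_mem (show f ∈ y.asHomogeneousIdeal.toIdeal from h) key'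
    have h3 : coeff (Finsupp.single 1 d) f = 0 := by
      by_contra hc
      have hu : IsUnit (C (coeff (Finsupp.single 1 d) f) : MvPolynomial (Fin 2) k) :=
        (IsUnit.mk0 _ hc).map C
      rw [Ideal.unit_mul_mem_iff_mem _ hu] at h2
      exact h1 (y.isPrime.mem_of_pow_mem _ h2)
    rw [h3, C_0, zero_mul, sub_zero] at key
    exact key
  · exact Ideal.span_le.2 (Set.singleton_subset_iff.2 hy)
      (show f ∈ Ideal.span {X 0} from h)

theorem exists_compl_range_stdChart : ∃ x, (Set.range (stdChart k 1))ᶜ = {x} := by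
  refine ⟨(projInf k : Proj (homogeneousSubmodule (Fin 2) k)), ?_⟩
  change (Set.range (projChart k 1))ᶜ = _
  rw [range_projChart]
  ext y
  exact not_not.trans ⟨fun h => eq_projInf k y h, fun h => h ▸ Ideal.subset_span rfl⟩

variable {k}

theorem exists_point_of_isClosed [IsAlgClosed k] {X : Scheme.{u}} {s : X ⟶ SpecBase k}
    (h : Var s) {x : X} (hx : IsClosed {x}) :
    ∃ p : SpecBase k ⟶ X, p ≫ s = 𝟙 _ ∧ Set.range p = {x} := by
  have := h.ft
  refine ⟨pointOfClosedPoint s x hx, pointOfClosedPoint_comp s x hx, ?_⟩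
  ext y
  constructor
  · rintro ⟨z, rfl⟩
    exact pointOfClosedPoint_apply s x hx z
  · rintro rfl
    exact ⟨(⊥ : PrimeSpectrum k), pointOfClosedPoint_apply s _ hx _⟩

theorem cl_projLine [IsAlgClosed k] {R : Type u} [CommRing R] (μ : MotivicMeasure k R)
    (h : Var (ProjSpace.toSpec k 1)) : μ.cl _ (ProjSpace.toSpec k 1) = μ.lef + 1 := by
  obtain ⟨x, hx⟩ := exists_compl_range_stdChart k
  have hc : IsClosed {x} := by
    rw [← hx]
    exact (stdChart k 1).isOpenEmbedding.isOpen_range.isClosed_compl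
  obtain ⟨p, hp, hr⟩ := exists_point_of_isClosed h hc
  have hW (y) : y ∈ (stdChart k 1).opensRange ↔ y ∈ (⊤ : (ProjSpace k 1).Opens) ∧
      y ∉ Set.range p := by
    rw [hr, ← hx, Set.mem_compl_iff, not_not]
    exact (and_iff_right trivial).symm
  rw [← μ.clO_top h, μ.clO_point h p hp ⊤ (stdChart k 1).opensRange (fun _ _ => trivial) hW,
    μ.clO_range h, stdChart_comp]
  exact congrArg (· + 1) (cl_specStr_congr μ inferInstance (uniqueAlgEquiv k (Fin 1)))

end Proj

section

variable {k : Type u} [Field k] [IsAlgClosed k] {X Xt : Scheme.{u}} {s : X ⟶ SpecBase k}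
  {R : Type u} [CommRing R] (μ : MotivicMeasure k R)

theorem clO_closedPoint (h : Var s) {q : X} (hq : IsClosed {q}) (U W : X.Opens) (hU : q ∈ U)
    (hW : ∀ x, x ∈ W ↔ x ∈ U ∧ x ≠ q) : μ.clO s U = μ.clO s W + 1 := by
  obtain ⟨p, hp, hr⟩ := exists_point_of_isClosed h hq
  refine μ.clO_point h p hp U W ?_ ?_ <;> rw [hr]
  · exact Set.singleton_subset_iff.2 hU
  · exact hW

/-- Removing closed curves with a common point. -/
theorem exists_preimage_eq {Y Z : Scheme.{u}} (f : Y ⟶ X) (g : Z ⟶ X) [IsClosedImmersion f]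
    [IsClosedImmersion g] {p : X} (h : Set.range f ∩ Set.range g = {p}) :
    ∃ q : Z, g q = p ∧ IsClosed {q} ∧ ∀ z, g z ∈ Set.range f ↔ z = q := by
  obtain ⟨-, q, hq⟩ := h.ge rfl
  have key (z) : g z ∈ Set.range f ↔ z = q := by
    constructor
    · intro hz
      have : g z = p := h.le ⟨hz, z, rfl⟩
      exact g.isClosedEmbedding.injective (this.trans hq.symm)
    · rintro rfl
      rw [hq]
      exact (h.ge rfl).1
  refine ⟨q, hq, ?_, key⟩
  have : {q} = g ⁻¹' Set.range f := Set.ext fun z => (key z).symm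
  rw [this]
  exact f.isClosedEmbedding.isClosed_range.preimage g.continuous

/-- The class of a surface with a resolution whose exceptional curve is a triangle of lines. -/
theorem cl_sub_two_mem (hs : Var s) (x : X) (π : Xt ⟶ X) (ht : Var (π ≫ s))
    (V : X.Opens) (hV : (V : Set X) = {x}ᶜ) (hiso : IsIso (π ∣_ V))
    (ℓ : Fin 3 → (ProjSpace k 1 ⟶ Xt)) (hci : ∀ i, IsClosedImmersion (ℓ i))
    (hk : ∀ i, ℓ i ≫ π ≫ s = ProjSpace.toSpec k 1)
    (hE : (⋃ i, Set.range (ℓ i)) = π ⁻¹' {x})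
    (hpair : ∀ i j, i ≠ j → ∃ p : Xt, Set.range (ℓ i) ∩ Set.range (ℓ j) = {p})
    (htriple : Set.range (ℓ 0) ∩ Set.range (ℓ 1) ∩ Set.range (ℓ 2) = ∅)
    (h1 : μ.cl Xt (π ≫ s) - 1 ∈ Ideal.span {μ.lef}) :
    μ.cl X s - 2 ∈ Ideal.span {μ.lef} := by
  have hP : Var (ProjSpace.toSpec k 1) := hk 0 ▸ ht.comp_closed (ℓ 0)
  have hl := cl_projLine μ hP
  have hx : IsClosed {x} := by
    rw [← compl_compl ({x} : Set X), ← hV]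
    exact V.2.isClosed_compl
  have memV (y : X) : y ∈ V ↔ y ≠ x := by
    rw [← SetLike.mem_coe, hV]
    rfl
  have e1 : μ.cl X s = μ.clO s V + 1 := by
    rw [← μ.clO_top hs]
    exact clO_closedPoint μ hs hx ⊤ V trivial fun y => by
      rw [memV]
      exact (and_iff_right trivial).symm
  have e2 : μ.clO (π ≫ s) (π ⁻¹ᵁ V) = μ.clO s V := by
    refine μ.cl_congr (ht.comp_open _) (π ∣_ V) ?_
    rw [morphismRestrict_ι_assoc]
  have hcl (i : Fin 3) : IsClosed (Set.range (ℓ i)) := (ℓ i).isClosedEmbedding.isClosed_range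
  let W₀ : Xt.Opens := ⟨(Set.range (ℓ 0))ᶜ, (hcl 0).isOpen_compl⟩
  let W₁ : Xt.Opens := W₀ ⊓ ⟨(Set.range (ℓ 1))ᶜ, (hcl 1).isOpen_compl⟩
  have memW (y : Xt) : y ∈ π ⁻¹ᵁ V ↔ y ∈ W₁ ∧ y ∉ Set.range (ℓ 2) := by
    have h : y ∈ ⋃ i, Set.range (ℓ i) ↔ π y = x := by
      rw [hE]
      rfl
    rw [Set.mem_iUnion, Fin.exists_fin_succ, Fin.exists_fin_two] at h
    change π y ∈ V ↔ (y ∉ Set.range (ℓ 0) ∧ y ∉ Set.range (ℓ 1)) ∧ y ∉ Set.range (ℓ 2)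
    rw [memV, Ne, ← h]
    change ¬ (y ∈ Set.range (ℓ 0) ∨ y ∈ Set.range (ℓ 1) ∨ y ∈ Set.range (ℓ 2)) ↔ _
    tauto
  have f0 := μ.clO_eq ht (ℓ 0) ⊤ W₀ fun y => (and_iff_right trivial).symm
  have f1 := μ.clO_eq ht (ℓ 1) W₀ W₁ fun y => Iff.rfl
  have f2 := μ.clO_eq ht (ℓ 2) W₁ (π ⁻¹ᵁ V) memW
  obtain ⟨p₀, hp₀⟩ := hpair 0 1 (by decide)
  obtain ⟨p₁, hp₁⟩ := hpair 0 2 (by decide)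
  obtain ⟨p₂, hp₂⟩ := hpair 1 2 (by decide)
  obtain ⟨q₀, -, hc₀, hq₀⟩ := exists_preimage_eq _ _ hp₀
  obtain ⟨q₁, -, hc₁, hq₁⟩ := exists_preimage_eq _ _ hp₁
  obtain ⟨q₂, -, hc₂, hq₂⟩ := exists_preimage_eq _ _ hp₂
  have hne : q₂ ≠ q₁ := by
    rintro rfl
    exact htriple.le ⟨⟨(hq₁ _).2 rfl, (hq₂ _).2 rfl⟩, q₂, rfl⟩
  have g1 := clO_closedPoint μ hP hc₀ ⊤ (ℓ 1 ⁻¹ᵁ W₀) trivial fun y =>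
    (not_congr (hq₀ y)).trans (and_iff_right trivial).symm
  have g2 := clO_closedPoint μ hP hc₁ ⊤ (ℓ 2 ⁻¹ᵁ W₀) trivial fun y =>
    (not_congr (hq₁ y)).trans (and_iff_right trivial).symm
  have g3 := clO_closedPoint μ hP hc₂ (ℓ 2 ⁻¹ᵁ W₀) (ℓ 2 ⁻¹ᵁ W₁)
    ((not_congr (hq₁ q₂)).2 hne) fun y => and_congr Iff.rfl (not_congr (hq₂ y))
  have e0 : ℓ 0 ⁻¹ᵁ (⊤ : Xt.Opens) = ⊤ := rfl
  rw [hk, e0, μ.clO_top ht, μ.clO_top hP, hl] at f0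
  rw [hk] at f1 f2
  rw [μ.clO_top hP, hl] at g1 g2
  have : μ.cl X s - 2 = (μ.cl Xt (π ≫ s) - 1) - 3 * μ.lef := by
    rw [e1, f0, f1, f2, e2]
    linear_combination g1 + g2 + g3
  rw [this]
  exact sub_mem h1 (Ideal.mul_mem_left _ _ (Ideal.mem_span_singleton_self _))

end

section

variable {k : Type u} [Field k] {X : Scheme.{u}} {s : X ⟶ SpecBase k} {m : ℕ}

instance : IrreducibleSpace (ProjSpace k m) := irreducibleSpace_proj k m

theorem irreducibleSpace_of_birational
    (hb : BirationalOver k X (ProjSpace k m) s (ProjSpace.toSpec k m)) : IrreducibleSpace X := by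
  obtain ⟨U, V, e, hU, hV, -⟩ := hb
  have hI : IsIrreducible (Set.range (e.inv ≫ U.ι)) := by
    have : Nonempty V := hV.nonempty.to_subtype
    have : IrreducibleSpace V := V.ι.isOpenEmbedding.irreducibleSpace
    exact Set.image_univ ▸ (IrreducibleSpace.isIrreducible_univ V).image _
      (e.inv ≫ U.ι).continuous.continuousOn
  have hr : Set.range (e.inv ≫ U.ι) = U := by
    have := Scheme.Hom.opensRange_comp_of_isIso e.inv U.ι
    rw [Scheme.Opens.opensRange_ι] at this
    exact congrArg (fun O : X.Opens => (O : Set X)) this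
  rw [hr] at hI
  have hc := hI.closure
  rw [hU.closure_eq] at hc
  have : PreirreducibleSpace X := ⟨hc.2⟩
  exact { toNonempty := ⟨hc.1.some⟩ }

theorem exists_mor_of_birational [IrreducibleSpace X]
    (hb : BirationalOver k X (ProjSpace k m) s (ProjSpace.toSpec k m)) (W : X.Opens)
    (hW : (W : Set X).Nonempty) :
    ∃ f : MvPolynomial (Fin m) k, f ≠ 0 ∧ ∃ j : Spec (.of (Localization.Away f)) ⟶ X,
      IsOpenImmersion j ∧ j ≫ s = specStr k (Localization.Away f) ∧ Set.range j ⊆ W := by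
  obtain ⟨U, V, e, hU, hV, he⟩ := hb
  let h := e.hom ≫ V.ι
  let O := h ''ᵁ (U.ι ⁻¹ᵁ W)
  obtain ⟨x, hxW, hxU⟩ := hU.inter_open_nonempty W W.2 hW
  obtain ⟨y, hyO, z, rfl⟩ := nonempty_preirreducible_inter O.2
    (stdChart k m).isOpenEmbedding.isOpen_range ⟨h ⟨x, hxU⟩, ⟨x, hxU⟩, hxW, rfl⟩
    ⟨_, (⟨⊥, Ideal.isPrime_bot⟩ : PrimeSpectrum (MvPolynomial (Fin m) k)), rfl⟩
  obtain ⟨_, ⟨f, rfl⟩, hzf, hf⟩ :=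
    PrimeSpectrum.isTopologicalBasis_basic_opens.exists_subset_of_mem_open
    (show z ∈ ((stdChart k m ⁻¹ᵁ O : TopologicalSpace.Opens _) : Set _) from hyO)
    (stdChart k m ⁻¹ᵁ O).2
  refine ⟨f, fun h0 => hzf (h0 ▸ z.asIdeal.zero_mem), ?_⟩
  let a : Spec (.of (Localization.Away f)) ⟶ Spec (.of (MvPolynomial (Fin m) k)) :=
    Spec.map (CommRingCat.ofHom (algebraMap _ (Localization.Away f)))
  have ha : IsOpenImmersion a := inferInstance
  have har : Set.range a = (PrimeSpectrum.basicOpen f : Set (PrimeSpectrum _)) :=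
    PrimeSpectrum.localization_away_comap_range (Localization.Away f) f
  let g := a ≫ stdChart k m
  have hgO : Set.range g ⊆ O := by
    rintro _ ⟨t, rfl⟩
    exact hf (har.subset ⟨t, rfl⟩)
  have hgh : Set.range g ⊆ Set.range h := fun t ht => by
    obtain ⟨w, -, rfl⟩ := hgO ht
    exact ⟨w, rfl⟩
  let l := IsOpenImmersion.lift h g hgh
  have hl : l ≫ h = g := IsOpenImmersion.lift_fac h g hgh
  have : IsOpenImmersion (l ≫ h) := hl ▸ inferInstance
  have : IsOpenImmersion l := IsOpenImmersion.of_comp l h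
  refine ⟨l ≫ U.ι, inferInstance, ?_, ?_⟩
  · have hs : h ≫ ProjSpace.toSpec k m = U.ι ≫ s := by simpa [h] using he
    rw [Category.assoc, ← hs, ← Category.assoc, hl]
    change (a ≫ stdChart k m) ≫ _ = _
    rw [Category.assoc, stdChart_comp]
    exact specStr_comp (IsScalarTower.toAlgHom k (MvPolynomial (Fin m) k) (Localization.Away f))
  · rintro _ ⟨t, rfl⟩
    obtain ⟨w, hw, hwt⟩ := hgO ⟨t, rfl⟩
    rw [← hl] at hwt
    have : w = l t := h.isOpenEmbedding.injective hwt
    subst this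
    exact hw

end

section

variable {R S : Type*} [CommRing R] [CommRing S] [Algebra R S] [Algebra.IsIntegral R S]

theorem exists_le_height (hi : Function.Injective (algebraMap R S)) (n : ℕ) :
    ∀ p : PrimeSpectrum R, (n : ℕ∞) ≤ Order.height p →
      ∃ q : PrimeSpectrum S, q.comap (algebraMap R S) = p ∧ (n : ℕ∞) ≤ Order.height q := by
  induction n with
  | zero =>
    intro p _
    obtain ⟨Q, -, hQ, h⟩ := Ideal.exists_ideal_over_prime_of_isIntegral p.asIdeal (⊥ : Ideal S)
      (by rw [← RingHom.ker_eq_comap_bot, (RingHom.injective_iff_ker_eq_bot _).1 hi]; exact bot_le)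
    exact ⟨⟨Q, hQ⟩, PrimeSpectrum.ext h, by simp⟩
  | succ n ih =>
    intro p hp
    obtain ⟨l, hl, hn⟩ := Order.exists_series_of_le_height p hp
    have hlt : l.eraseLast.last < p := by
      rw [← hl]
      exact l.eraseLast_last_rel_last (by omega)
    obtain ⟨q, hq, hqn⟩ := ih l.eraseLast.last <|
      le_trans (by simp [hn]) (Order.length_le_height_last (p := l.eraseLast))
    obtain ⟨Q, hqQ, hQ, h⟩ := Ideal.exists_ideal_over_prime_of_isIntegral p.asIdeal q.asIdeal
      (by rw [← PrimeSpectrum.comap_asIdeal, hq]; exact hlt.le)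
    refine ⟨⟨Q, hQ⟩, PrimeSpectrum.ext h, ?_⟩
    have hlt' : q < ⟨Q, hQ⟩ := lt_of_le_of_ne hqQ fun e => hlt.ne <| by
      rw [← hq, e]
      exact PrimeSpectrum.ext h
    exact le_trans (by push_cast; gcongr) (Order.height_add_one_le hlt')

theorem ringKrullDim_eq_of_isIntegral (hi : Function.Injective (algebraMap R S)) :
    ringKrullDim S = ringKrullDim R := by
  refine le_antisymm (Order.krullDim_le_of_strictMono (PrimeSpectrum.comap (algebraMap R S))
    fun p q h => Ideal.IsIntegral.comap_lt_comap h) ?_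
  refine iSup_le fun l => ?_
  obtain ⟨q, -, hq⟩ := exists_le_height hi l.length _ (Order.length_le_height_last (p := l))
  exact le_trans (WithBot.coe_le_coe.2 hq) (Order.height_le_krullDim q)

end

section

variable {k K : Type u} [Field k] [Field K] [Algebra k K]

theorem natCast_eq_trdeg {c : Chart k K}
    (hfr : ∀ x : K, ∃ a b : c.A, b ≠ 0 ∧ x = c.e a / c.e b) {n : ℕ}
    (g : MvPolynomial (Fin n) k →ₐ[k] c.A) (hg : Function.Injective g) (hg' : g.IsIntegral) :
    (n : Cardinal.{u}) = Algebra.trdeg k K := by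
  have hfrac := Chart.isFractionRing hfr
  let _ := c.e.toRingHom.toAlgebra
  let _ := g.toRingHom.toAlgebra
  have : IsScalarTower k c.A K := IsScalarTower.of_algebraMap_eq fun r => (c.e.commutes r).symm
  have : IsScalarTower k (MvPolynomial (Fin n) k) c.A :=
    IsScalarTower.of_algebraMap_eq fun r => (g.commutes r).symm
  have hi : Function.Injective (algebraMap c.A K) := c.inj
  have : IsDomain c.A := hi.isDomain (algebraMap c.A K)
  have := (faithfulSMul_iff_algebraMap_injective c.A K).2 hi
  have := (faithfulSMul_iff_algebraMap_injective (MvPolynomial (Fin n) k) c.A).2 hg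
  have : Algebra.IsIntegral (MvPolynomial (Fin n) k) c.A := ⟨hg'⟩
  have : Algebra.IsAlgebraic c.A K := IsLocalization.isAlgebraic (R := c.A) (S := K) (nonZeroDivisors c.A)
  have h := (((IsTranscendenceBasis.mvPolynomial (Fin n) k).algebraMap_comp (A := c.A)).algebraMap_comp
    (A := K)).lift_cardinalMk_eq_trdeg
  simpa using h

theorem ringKrullDim_chart {m : ℕ} (y : MvPolynomial (Fin m) k →ₐ[k] K)
    (hy : Function.Injective y)
    (hyfr : ∀ x : K, ∃ a b : MvPolynomial (Fin m) k, b ≠ 0 ∧ x = y a / y b) {c : Chart k K}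
    (hfr : ∀ x : K, ∃ a b : c.A, b ≠ 0 ∧ x = c.e a / c.e b) : ringKrullDim c.A = m := by
  have : IsDomain c.A := c.inj.isDomain c.e
  obtain ⟨n, g, hg, hg'⟩ := exists_integral_inj_algHom_of_fg k c.A
  have h1 := natCast_eq_trdeg hfr g hg hg'
  have h2 := natCast_eq_trdeg (c := ⟨MvPolynomial (Fin m) k, y, hy⟩) hyfr (AlgHom.id k _)
    Function.injective_id (RingHom.isIntegral_of_surjective _ Function.surjective_id)
  obtain rfl : n = m := Nat.cast_injective (h1.trans h2.symm)
  let _ := g.toRingHom.toAlgebra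
  have : Algebra.IsIntegral (MvPolynomial (Fin n) k) c.A := ⟨hg'⟩
  rw [ringKrullDim_eq_of_isIntegral (R := MvPolynomial (Fin n) k) hg,
    MvPolynomial.ringKrullDim_of_isNoetherianRing, ringKrullDim_eq_zero_of_field]
  simp

end

section

attribute [local instance] specializationOrder in
theorem topologicalKrullDim_le_of_forall {X : Scheme.{u}} {d : WithBot ℕ∞}
    (h : ∀ x : X, ∃ (Y : Scheme.{u}) (f : Y ⟶ X), IsOpenImmersion f ∧ x ∈ Set.range f ∧
      topologicalKrullDim Y ≤ d) : topologicalKrullDim X ≤ d := by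
  rw [topologicalKrullDim, Order.krullDim_eq_of_orderIso (irreducibleSetEquivPoints (α := X)),
    Order.krullDim_eq_iSup_coheight]
  refine iSup_le fun x => ?_
  obtain ⟨Y, f, hf, ⟨z, rfl⟩, hd⟩ := h x
  rw [topologicalKrullDim, Order.krullDim_eq_of_orderIso (irreducibleSetEquivPoints (α := Y))] at hd
  rw [f.isOpenEmbedding.coheight_eq]
  exact (Order.coheight_le_krullDim z).trans hd

variable {k : Type u} [Field k] {X : Scheme.{u}} (s : X ⟶ SpecBase k) [IsIntegral X]
  [LocallyOfFiniteType s]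

theorem topologicalKrullDim_eq {m : ℕ} (y : MvPolynomial (Fin m) k →ₐ[k] FF s)
    (hy : Function.Injective y)
    (hyfr : ∀ x : FF s, ∃ a b : MvPolynomial (Fin m) k, b ≠ 0 ∧ x = y a / y b) :
    topologicalKrullDim X = m := by
  have hU : ∀ x : X, ∃ (U : X.Opens) (hU : IsAffineOpen U), x ∈ U ∧
      topologicalKrullDim (Spec (.of (Sec s U))) = m := fun x => by
    obtain ⟨U, hU, hx, -⟩ := exists_isAffineOpen_mem_and_subset (X := X) (x := x) (U := ⊤) trivial
    have : Nonempty U := ⟨⟨x, hx⟩⟩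
    exact ⟨U, hU, hx, (PrimeSpectrum.topologicalKrullDim_eq_ringKrullDim (Sec s U)).trans
      (ringKrullDim_chart y hy hyfr (c := chartOf s hU) (Sec.exists_frac s hU))⟩
  refine le_antisymm (topologicalKrullDim_le_of_forall fun x => ?_) ?_
  · obtain ⟨U, h, hx, hd⟩ := hU x
    exact ⟨_, secMor s h, inferInstance, (range_secMor s h).symm ▸ hx, hd.le⟩
  · obtain ⟨U, h, hx, hd⟩ := hU (genericPoint X)
    rw [← hd]
    exact (secMor s h).isOpenEmbedding.isInducing.topologicalKrullDim_le

end

section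

variable {k : Type u} [Field k] {X : Scheme.{u}} (s : X ⟶ SpecBase k)

theorem exists_sec_equiv {B : Type u} [CommRing B] [Algebra k B] [Nontrivial B]
    (j : Spec (.of B) ⟶ X) [IsOpenImmersion j] (hj : j ≫ s = specStr k B) :
    ∃ (U : X.Opens) (_ : IsAffineOpen U) (_ : Nonempty U), Nonempty (Sec s U ≃ₐ[k] B) := by
  have hU : IsAffineOpen j.opensRange := isAffineOpen_opensRange j
  let q := (IsOpenImmersion.isoOfRangeEq j (secMor s hU) (range_secMor s hU).symm)
  have hq : q.hom ≫ secMor s hU = j := IsOpenImmersion.lift_fac _ _ _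
  obtain ⟨φ, hφ⟩ := exists_specMap q.hom (by rw [← secMor_comp s hU, ← Category.assoc, hq, hj])
  obtain ⟨z⟩ : Nonempty (PrimeSpectrum B) := inferInstance
  refine ⟨_, hU, ⟨⟨j z, z, rfl⟩⟩, ⟨AlgEquiv.ofBijective φ ?_⟩⟩
  have : IsIso (Spec.map (CommRingCat.ofHom φ.toRingHom)) := hφ ▸ inferInstance
  exact isIso_SpecMap_iff.1 this

theorem exists_coordinates [IsIntegral X] {m : ℕ} {f : MvPolynomial (Fin m) k} (hf : f ≠ 0)
    (j : Spec (.of (Localization.Away f)) ⟶ X) [IsOpenImmersion j]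
    (hj : j ≫ s = specStr k (Localization.Away f)) :
    ∃ y : MvPolynomial (Fin m) k →ₐ[k] FF s, Function.Injective y ∧
      ∀ x : FF s, ∃ a b : MvPolynomial (Fin m) k, b ≠ 0 ∧ x = y a / y b := by
  have hle : Submonoid.powers f ≤ nonZeroDivisors (MvPolynomial (Fin m) k) :=
    powers_le_nonZeroDivisors_of_noZeroDivisors hf
  have hinj := IsLocalization.injective (Localization.Away f) hle
  have : Nontrivial (Localization.Away f) := hinj.nontrivial
  obtain ⟨U, hU, _, ⟨φ⟩⟩ := exists_sec_equiv s j hj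
  let ψ : Localization.Away f →ₐ[k] FF s := (Sec.toFF s U).comp φ.symm.toAlgHom
  have hψ : Function.Injective ψ := (Sec.toFF_injective s U).comp φ.symm.injective
  let y := ψ.comp (IsScalarTower.toAlgHom k (MvPolynomial (Fin m) k) (Localization.Away f))
  have hy : Function.Injective y := hψ.comp hinj
  refine ⟨y, hy, fun x => ?_⟩
  have hfr : ∀ a : Sec s U, ∃ p q, q ≠ 0 ∧ Sec.toFF s U a * y q = y p := fun a => by
    obtain ⟨n, p, hp⟩ := IsLocalization.Away.surj f (φ a)
    refine ⟨p, f ^ n, pow_ne_zero n hf, ?_⟩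
    have := congrArg ψ hp
    rw [map_mul] at this
    have h1 : ψ (φ a) = Sec.toFF s U a := congrArg (Sec.toFF s U) (φ.symm_apply_apply a)
    rw [h1, ← map_pow] at this
    exact this
  obtain ⟨a, b, hb, rfl⟩ := Sec.exists_frac s hU x
  obtain ⟨p, q, hq, h⟩ := hfr a
  obtain ⟨p', q', hq', h'⟩ := hfr b
  have hy0 : ∀ {z}, z ≠ 0 → y z ≠ 0 := fun hz => (map_ne_zero_iff y hy).2 hz
  have hb' : Sec.toFF s U b ≠ 0 := (map_ne_zero_iff _ (Sec.toFF_injective s U)).2 hb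
  have hp' : p' ≠ 0 := by
    rintro rfl
    rw [map_zero] at h'
    exact mul_ne_zero hb' (hy0 hq') h'
  refine ⟨p * q', q * p', mul_ne_zero hq hp', ?_⟩
  rw [map_mul, map_mul, ← h, ← h']
  have := hy0 hq
  have := hy0 hq'
  field_simp

theorem exists_frame {K : Type u} [Field K] [Algebra k K]
    (y : MvPolynomial (Fin 2) k →ₐ[k] K) (hy : Function.Injective y)
    (hfr : ∀ x : K, ∃ a b : MvPolynomial (Fin 2) k, b ≠ 0 ∧ x = y a / y b) :
    Nonempty (Frame k K) := by
  have hE := fun i => Chart.exists_derivation (c := ⟨MvPolynomial (Fin 2) k, y, hy⟩) hfr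
    ((KaehlerDifferential.mvPolynomialBasis k (Fin 2)).coord i)
  choose E hE using hE
  have hX : ∀ i j, E i (y (.X j)) = if j = i then 1 else 0 := fun i j => by
    rw [hE]
    simp [Finsupp.single_apply, apply_ite]
  have hy' : y = aeval ![y (.X 0), y (.X 1)] := by
    ext i
    fin_cases i <;> simp
  refine ⟨⟨y (.X 0), y (.X 1), E 0, E 1, by simp [hX], by simp [hX], by simp [hX], by simp [hX],
    fun x => ?_⟩⟩
  rw [← hy']
  obtain ⟨a, b, hb, h⟩ := hfr x
  exact ⟨a, b, (map_ne_zero_iff y hy).2 hb, h⟩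

theorem exists_kaehler_basis [Smooth s] (x : X) : ∃ W : X.Opens, IsAffineOpen W ∧ x ∈ W ∧
    ∃ n, Nonempty (Module.Basis (Fin n) (Sec s W) Ω[Sec s W⁄k]) := by
  obtain ⟨U, hU, W, hW, hx, e, h⟩ := Smooth.exists_isStandardSmooth s x
  have hUt : U = ⊤ := by
    have : Subsingleton (SpecBase k) := inferInstanceAs (Subsingleton (PrimeSpectrum k))
    exact top_le_iff.1 fun z _ => Subsingleton.elim (s x) z ▸ e hx
  subst hUt
  refine ⟨W, hW, hx, ?_⟩
  have h2 : (algebraMap k (Sec s W)).IsStandardSmooth := by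
    refine RingHom.IsStandardSmooth.comp h ?_
    exact (RingHom.IsStandardSmoothOfRelativeDimension.equiv
      (Scheme.ΓSpecIso (.of k)).commRingCatIsoToRingEquiv.symm).isStandardSmooth
  have : Algebra.IsStandardSmooth k (Sec s W) := RingHom.isStandardSmooth_algebraMap.1 h2
  have : Nontrivial (Sec s W) := by
    have : Nonempty W := ⟨⟨x, hx⟩⟩
    exact inferInstanceAs (Nontrivial Γ(X, W))
  exact ⟨_, ⟨Module.finBasis (Sec s W) Ω[Sec s W⁄k]⟩⟩

theorem isReduced_of_smooth [IsAlgClosed k] [CharZero k] [Smooth s] : IsReduced X := by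
  have (x : X) : _root_.IsReduced (X.presheaf.stalk x) := by
    obtain ⟨W, hW, hx, n, ⟨b⟩⟩ := exists_kaehler_basis s x
    have := Sec.finiteType (s := s) hW
    have : _root_.IsReduced Γ(X, W) := isReduced_of_kaehler_basis (A := Sec s W) b
    let _ := (X.presheaf.germ W x hx).hom.toAlgebra
    have := hW.isLocalization_stalk ⟨x, hx⟩
    exact isReduced_localizationPreserves (hW.primeIdealOf ⟨x, hx⟩).asIdeal.primeCompl _ ‹_›
  exact isReduced_of_isReduced_stalk X

end

section

variable {k : Type u} [Field k]

theorem exists_mor_resolution {X Xt : Scheme.{u}} {s : X ⟶ SpecBase k} {m : ℕ} [IrreducibleSpace X]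
    (hb : BirationalOver k X (ProjSpace k m) s (ProjSpace.toSpec k m)) (V : X.Opens)
    (hV : (V : Set X).Nonempty) (π : Xt ⟶ X) (hiso : IsIso (π ∣_ V)) :
    ∃ f : MvPolynomial (Fin m) k, f ≠ 0 ∧ ∃ j : Spec (.of (Localization.Away f)) ⟶ Xt,
      IsOpenImmersion j ∧ j ≫ π ≫ s = specStr k (Localization.Away f) := by
  obtain ⟨f, hf, j, hj, hjs, hjV⟩ := exists_mor_of_birational hb V hV
  let l := IsOpenImmersion.lift V.ι j (by rwa [Scheme.Opens.range_ι])
  have hl : l ≫ V.ι = j := IsOpenImmersion.lift_fac _ _ _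
  have : IsOpenImmersion (l ≫ V.ι) := hl ▸ hj
  have : IsOpenImmersion l := IsOpenImmersion.of_comp l V.ι
  refine ⟨f, hf, l ≫ inv (π ∣_ V) ≫ (π ⁻¹ᵁ V).ι, inferInstance, ?_⟩
  rw [← hjs, ← hl]
  simp only [Category.assoc]
  rw [← morphismRestrict_ι_assoc, IsIso.inv_hom_id_assoc]

theorem cl_sub_one_mem_of_smooth [IsAlgClosed k] [CharZero k] {X : Scheme.{u}}
    (s : X ⟶ SpecBase k) [IrreducibleSpace X] [Smooth s] [IsProper s]
    {f : MvPolynomial (Fin 2) k} (hf : f ≠ 0) (j : Spec (.of (Localization.Away f)) ⟶ X)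
    [IsOpenImmersion j] (hj : j ≫ s = specStr k (Localization.Away f))
    {R : Type u} [CommRing R] (μ : MotivicMeasure k R) : μ.cl X s - 1 ∈ Ideal.span {μ.lef} := by
  have := isReduced_of_smooth s
  have : IsIntegral X := isIntegral_of_irreducibleSpace_of_isReduced X
  obtain ⟨y, hy, hfr⟩ := exists_coordinates s hf j hj
  obtain ⟨F⟩ := exists_frame y hy hfr
  refine cl_sub_one_mem μ F fun x => ?_
  obtain ⟨W, hW, hx, n, ⟨b⟩⟩ := exists_kaehler_basis s x
  refine ⟨W, hW, hx, ?_⟩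
  have : Nonempty W := ⟨⟨x, hx⟩⟩
  have h1 := Chart.finrank_kaehler (c := chartOf s hW) (Sec.exists_frac s hW) b
  have h2 := Chart.finrank_kaehler (c := ⟨MvPolynomial (Fin 2) k, y, hy⟩) hfr
    (KaehlerDifferential.mvPolynomialBasis k (Fin 2))
  obtain rfl : n = 2 := by simpa using h1.symm.trans h2
  exact ⟨b⟩

theorem nonempty_of_compl_singleton {X : Scheme.{u}} (hdim : topologicalKrullDim X = 2) {x : X}
    {V : Set X} (hV : V = {x}ᶜ) : V.Nonempty := by
  rw [hV, Set.nonempty_compl]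
  intro h
  have : Subsingleton X := Set.subsingleton_univ_iff.1 (h ▸ Set.subsingleton_singleton)
  have h0 := topologicalKrullDim_zero_of_discreteTopology X
  rw [hdim] at h0
  exact absurd h0 (by decide)

theorem eq_two_of_birational {X : Scheme.{u}} {s : X ⟶ SpecBase k} [IsIntegral X]
    [LocallyOfFiniteType s] (hdim : topologicalKrullDim X = 2) {m : ℕ}
    (hb : BirationalOver k X (ProjSpace k m) s (ProjSpace.toSpec k m)) : m = 2 := by
  obtain ⟨f, hf, j, _, hj, -⟩ := exists_mor_of_birational hb ⊤ Set.univ_nonempty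
  obtain ⟨y, hy, hfr⟩ := exists_coordinates s hf j hj
  have h := topologicalKrullDim_eq s y hy hfr
  rw [hdim] at h
  exact_mod_cast h.symm

end

section

/-- An extension `F` of `k` presented as an ultraproduct of finite fields. -/
structure Ultra (k : Type u) [Field k] where ofData ::
  I : Type u
  U : Ultrafilter I
  E : I → Type u
  [field : ∀ i, Field (E i)]
  [finite : ∀ i, Finite (E i)]
  F : Type u
  [fieldF : Field F]
  [algF : Algebra k F]
  mk : (∀ i, E i) →+* F
  surj : Function.Surjective mk
  mk_eq_zero : ∀ x, mk x = 0 ↔ ∀ᶠ i in U, x i = 0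

attribute [instance] Ultra.field Ultra.finite Ultra.fieldF Ultra.algF

variable {k : Type u} [Field k] (Λ : Ultra k)

namespace Ultra

variable {Λ}

theorem mk_eq {x y : ∀ i, Λ.E i} : Λ.mk x = Λ.mk y ↔ ∀ᶠ i in Λ.U, x i = y i := by
  rw [← sub_eq_zero, ← map_sub, Λ.mk_eq_zero]
  simp [sub_eq_zero]

/-- The point of affine space over the ultraproduct with given coordinates. -/
def pt {σ : Type} (x : ∀ i, σ → Λ.E i) (j : σ) : Λ.F := Λ.mk fun i => x i j

theorem pt_eq {σ : Type} [Finite σ] {x y : ∀ i, σ → Λ.E i} :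
    pt x = pt y ↔ ∀ᶠ i in Λ.U, x i = y i := by
  simp only [funext_iff, pt, mk_eq, Filter.eventually_all]

theorem pt_surjective {σ : Type} (z : σ → Λ.F) : ∃ x : ∀ i, σ → Λ.E i, pt x = z := by
  choose w hw using fun j => Λ.surj (z j)
  exact ⟨fun i j => w j i, funext hw⟩

theorem mk_eval {σ : Type} (G : MvPolynomial σ (∀ i, Λ.E i)) (x : ∀ i, σ → Λ.E i) :
    Λ.mk (fun i => eval (x i) (map (Pi.evalRingHom _ i) G)) = eval (pt x) (map Λ.mk G) := by
  have h : (fun i => eval (x i) (map (Pi.evalRingHom _ i) G)) = eval (fun j i => x i j) G := by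
    funext i
    rw [MvPolynomial.eval_map]
    exact (eval₂_comp_left (Pi.evalRingHom Λ.E i) (RingHom.id _) (fun j i => x i j) G).symm
  rw [h, MvPolynomial.eval_map]
  exact eval₂_comp_left Λ.mk (RingHom.id _) _ G

/-- A polynomial over `k` is evaluated coordinatewise in the ultraproduct. -/
theorem exists_eval {σ : Type} (g : MvPolynomial σ k) : ∃ f : ∀ i, (σ → Λ.E i) → Λ.E i,
    ∀ x, aeval (pt x) g = Λ.mk fun i => f i (x i) := by
  obtain ⟨G, hG⟩ := map_surjective Λ.mk Λ.surj (map (algebraMap k Λ.F) g)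
  refine ⟨fun i x => eval x (map (Pi.evalRingHom _ i) G), fun x => ?_⟩
  rw [mk_eval, hG, MvPolynomial.eval_map]
  rfl

theorem eventually_forall {α : Λ.I → Type*} [∀ i, Nonempty (α i)] {p : ∀ i, α i → Prop}
    (h : ∀ y : ∀ i, α i, ∀ᶠ i in Λ.U, p i (y i)) : ∀ᶠ i in Λ.U, ∀ y, p i y := by
  by_contra hc
  rw [← Ultrafilter.eventually_not] at hc
  push Not at hc
  obtain ⟨y, hy⟩ := Filter.skolem.1 hc
  obtain ⟨i, hi, hi'⟩ := (hy.and (h y)).exists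
  exact hi hi'

end Ultra

open Ultra

/-- Generators of a `k`-algebra together with a description of its points in an ultraproduct as
an ultraproduct of sets. -/
structure Pres (C : Type u) [CommRing C] [Algebra k C] where
  σ : Type
  [finite : Finite σ]
  c : σ → C
  surj : Function.Surjective (aeval c : MvPolynomial σ k →ₐ[k] C)
  Z : ∀ i, Set (σ → Λ.E i)
  mem : ∀ x : ∀ i, σ → Λ.E i, (∀ᶠ i in Λ.U, x i ∈ Z i) ↔ ∃ θ : C →ₐ[k] Λ.F, ∀ j, θ (c j) = pt x j

attribute [instance] Pres.finite

namespace Pres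

variable {Λ} {C D : Type u} [CommRing C] [Algebra k C] [CommRing D] [Algebra k D]

/-- The number of points, as an ultraproduct of integers. -/
def count (P : Pres Λ C) : (Λ.U : Filter Λ.I).Germ ℤ :=
  ((fun i => ((P.Z i).ncard : ℤ)) : Λ.I → ℤ)

theorem hom_ext (P : Pres Λ C) {B : Type*} [CommRing B] [Algebra k B] {θ η : C →ₐ[k] B}
    (h : ∀ j, θ (P.c j) = η (P.c j)) : θ = η := by
  have h1 : θ.comp (aeval P.c) = η.comp (aeval P.c) := by
    ext j
    simpa using h j
  ext a
  obtain ⟨p, rfl⟩ := P.surj a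
  exact DFunLike.congr_fun h1 p

theorem exists_pres (Λ : Ultra k) (C : Type u) [CommRing C] [Algebra k C]
    [Algebra.FiniteType k C] : Nonempty (Pres Λ C) := by
  obtain ⟨n, f, hf, S, hS⟩ := (Algebra.FinitePresentation.of_finiteType (R := k)).1
    (inferInstance : Algebra.FiniteType k C)
  have hf' : aeval (fun j => f (X j)) = f := by
    ext j
    simp
  choose e he using fun p : MvPolynomial (Fin n) k => Ultra.exists_eval (Λ := Λ) p
  refine ⟨⟨Fin n, fun j => f (X j), by rwa [hf'], fun i => {x | ∀ p ∈ S, e p i x = 0},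
    fun x => ?_⟩⟩
  have h1 : (∀ᶠ i in Λ.U, x i ∈ {x | ∀ p ∈ S, e p i x = 0}) ↔ ∀ p ∈ S, aeval (pt x) p = 0 := by
    simp only [he, Λ.mk_eq_zero, Set.mem_ofPred_eq]
    exact Filter.eventually_all_finset S
  rw [h1]
  constructor
  · intro h
    have hle : RingHom.ker f ≤ RingHom.ker (aeval (pt x) : MvPolynomial (Fin n) k →ₐ[k] Λ.F) :=
      hS ▸ Ideal.span_le.2 h
    exact ⟨Ideal.Quotient.liftₐ _ _ hle |>.comp
      (Ideal.quotientKerAlgEquivOfSurjective hf).symm.toAlgHom, fun j => by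
        have : (Ideal.quotientKerAlgEquivOfSurjective hf).symm (f (X j)) =
          Ideal.Quotient.mk _ (X j) := by
            rw [AlgEquiv.symm_apply_eq]
            rfl
        rw [AlgHom.comp_apply]
        exact (congrArg _ this).trans (aeval_X _ _)⟩
  · rintro ⟨θ, hθ⟩ p hp
    have h2 : θ.comp f = aeval (pt x) := by
      ext j
      simpa using hθ j
    rw [← h2]
    exact (congrArg θ (hS ▸ Ideal.subset_span hp : p ∈ RingHom.ker f)).trans (map_zero θ)

theorem exists_map (P : Pres Λ C) (Q : Pres Λ D) (φ : C →ₐ[k] D) :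
    ∃ f : ∀ i, (Q.σ → Λ.E i) → (P.σ → Λ.E i), ∀ (θ : D →ₐ[k] Λ.F) (y : ∀ i, Q.σ → Λ.E i),
      (∀ j, θ (Q.c j) = pt y j) → ∀ j, θ (φ (P.c j)) = pt (fun i => f i (y i)) j := by
  choose g hg using fun j => Q.surj (φ (P.c j))
  choose e he using fun j => Ultra.exists_eval (Λ := Λ) (g j)
  refine ⟨fun i y j => e j i y, fun θ y h j => ?_⟩
  have h2 : θ.comp (aeval Q.c) = aeval (pt y) := by
    ext t
    simpa using h t
  rw [← hg, ← AlgHom.comp_apply, h2, he]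
  rfl

theorem exists_mem (P : Pres Λ C) (θ : C →ₐ[k] Λ.F) : ∃ x : ∀ i, P.σ → Λ.E i,
    (∀ᶠ i in Λ.U, x i ∈ P.Z i) ∧ ∀ j, θ (P.c j) = pt x j := by
  obtain ⟨x, hx⟩ := pt_surjective fun j => θ (P.c j)
  exact ⟨x, (P.mem x).2 ⟨θ, fun j => (congrFun hx j).symm⟩, fun j => (congrFun hx j).symm⟩

/-- Algebras whose points partition the points of `C` have counts adding up to that of `C`. -/
theorem count_eq_sum {ι : Type} [Fintype ι] {D : ι → Type u} [∀ b, CommRing (D b)]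
    [∀ b, Algebra k (D b)] (P : Pres Λ C) (Q : ∀ b, Pres Λ (D b)) (φ : ∀ b, C →ₐ[k] D b)
    (h : ∀ θ : C →ₐ[k] Λ.F, ∃! p : Σ b, D b →ₐ[k] Λ.F, p.2.comp (φ p.1) = θ) :
    P.count = ∑ b, (Q b).count := by
  choose f hf using fun b => P.exists_map (Q b) (φ b)
  have key : ∀ᶠ i in Λ.U, (P.Z i).ncard = ∑ b, ((Q b).Z i).ncard := by
    have h1 : ∀ᶠ i in Λ.U, ∀ b, ∀ y, y ∈ (Q b).Z i → f b i y ∈ P.Z i := by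
      refine Filter.eventually_all.2 fun b => eventually_forall fun y =>
        Ultrafilter.eventually_imp.2 fun hy => ?_
      obtain ⟨η, hη⟩ := ((Q b).mem y).1 hy
      exact (P.mem _).2 ⟨η.comp (φ b), hf b η y hη⟩
    have h2 : ∀ᶠ i in Λ.U, ∀ b b', ∀ y : ((Q b).σ → Λ.E i) × ((Q b').σ → Λ.E i),
        y.1 ∈ (Q b).Z i ∧ y.2 ∈ (Q b').Z i ∧ f b i y.1 = f b' i y.2 →
        (⟨b, y.1⟩ : Σ b, (Q b).σ → Λ.E i) = ⟨b', y.2⟩ := by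
      refine Filter.eventually_all.2 fun b => Filter.eventually_all.2 fun b' =>
        eventually_forall fun y => Ultrafilter.eventually_imp.2 fun hy => ?_
      rw [Filter.eventually_and, Filter.eventually_and] at hy
      obtain ⟨η, hη⟩ := ((Q b).mem _).1 hy.1
      obtain ⟨η', hη'⟩ := ((Q b').mem _).1 hy.2.1
      have h3 : (⟨b, η⟩ : Σ b, D b →ₐ[k] Λ.F) = ⟨b', η'⟩ :=
        (h (η'.comp (φ b'))).unique (P.hom_ext fun j => (hf b η _ hη j).trans
          ((congrFun (pt_eq.2 hy.2.2) j).trans (hf b' η' _ hη' j).symm)) rfl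
      cases h3
      filter_upwards [pt_eq.1 (funext fun j => (hη j).symm.trans (hη' j))] with i hi
      rw [hi]
    have h3 : ∀ᶠ i in Λ.U, ∀ x, x ∈ P.Z i → ∃ b, ∃ y ∈ (Q b).Z i, f b i y = x := by
      refine eventually_forall fun x => Ultrafilter.eventually_imp.2 fun hx => ?_
      obtain ⟨θ, hθ⟩ := (P.mem x).1 hx
      obtain ⟨⟨b, η⟩, rfl, -⟩ := h θ
      obtain ⟨y, hy, hy'⟩ := (Q b).exists_mem η
      filter_upwards [hy, pt_eq.1 (funext fun j => (hf b η y hy' j).symm.trans (hθ j))] with i h h'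
      exact ⟨b, y i, h, h'⟩
    filter_upwards [h1, h2, h3] with i h1 h2 h3
    have h4 := Nat.card_congr (Equiv.ofBijective (fun p : Σ b, (Q b).Z i =>
      (⟨f p.1 i p.2, h1 _ _ p.2.2⟩ : P.Z i)) ⟨fun p q hpq => ?_, fun x => ?_⟩)
    · rw [Nat.card_sigma] at h4
      exact h4.symm
    · obtain ⟨b, y, hy⟩ := p
      obtain ⟨b', y', hy'⟩ := q
      cases h2 b b' (y, y') ⟨hy, hy', congrArg Subtype.val hpq⟩
      rfl
    · obtain ⟨b, y, hy, hx⟩ := h3 x x.2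
      exact ⟨⟨b, y, hy⟩, Subtype.ext hx⟩
  have h5 : ∑ b, (Q b).count = ((∑ b, fun i => (((Q b).Z i).ncard : ℤ) : Λ.I → ℤ) :
      (Λ.U : Filter Λ.I).Germ ℤ) :=
    (map_sum (Filter.Germ.coeRingHom (Λ.U : Filter Λ.I)) _ _).symm
  rw [h5]
  refine Filter.Germ.coe_eq.2 ?_
  filter_upwards [key] with i hi
  simp [hi]

end Pres

end

section

open Ultra TensorProduct

variable {k : Type u} [Field k] {Λ : Ultra k}

namespace Pres

variable {C D : Type u} [CommRing C] [Algebra k C] [CommRing D] [Algebra k D]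

/-- Generators of a tensor product. -/
def tensor (P : Pres Λ C) (Q : Pres Λ D) : Pres Λ (C ⊗[k] D) where
  σ := P.σ ⊕ Q.σ
  c := Sum.elim (fun j => P.c j ⊗ₜ 1) (fun j => 1 ⊗ₜ Q.c j)
  surj := by
    intro z
    induction z with
    | zero => exact ⟨0, map_zero _⟩
    | add x y hx hy =>
      obtain ⟨⟨a, rfl⟩, b, rfl⟩ := hx, hy
      exact ⟨a + b, map_add _ _ _⟩
    | tmul x y =>
      obtain ⟨⟨a, rfl⟩, b, rfl⟩ := P.surj x, Q.surj y
      refine ⟨rename Sum.inl a * rename Sum.inr b, ?_⟩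
      have h1 := (comp_aeval_apply P.c Algebra.TensorProduct.includeLeft (B := C ⊗[k] D) a).symm
      have h2 := (comp_aeval_apply Q.c Algebra.TensorProduct.includeRight (B := C ⊗[k] D) b).symm
      rw [map_mul, aeval_rename, aeval_rename]
      refine (congrArg₂ _ h1 h2).trans ?_
      simp
  Z i := {x | x ∘ Sum.inl ∈ P.Z i ∧ x ∘ Sum.inr ∈ Q.Z i}
  mem x := by
    have h1 := P.mem fun i => x i ∘ Sum.inl
    have h2 := Q.mem fun i => x i ∘ Sum.inr
    simp only [Set.mem_ofPred_eq, Filter.eventually_and]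
    rw [h1, h2]
    constructor
    · rintro ⟨⟨θ, hθ⟩, η, hη⟩
      refine ⟨Algebra.TensorProduct.lift θ η fun _ _ => Commute.all _ _, ?_⟩
      rintro (j | j)
      · exact (by simp : _ = θ (P.c j)).trans (hθ j)
      · exact (by simp : _ = η (Q.c j)).trans (hη j)
    · rintro ⟨θ, hθ⟩
      exact ⟨⟨θ.comp Algebra.TensorProduct.includeLeft, fun j => hθ (.inl j)⟩,
        θ.comp Algebra.TensorProduct.includeRight, fun j => hθ (.inr j)⟩

theorem count_tensor (P : Pres Λ C) (Q : Pres Λ D) :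
    (P.tensor Q).count = P.count * Q.count := by
  refine Filter.Germ.coe_eq.2 (.of_forall fun i => ?_)
  have h : ((P.tensor Q).Z i).ncard = (P.Z i ×ˢ Q.Z i).ncard :=
    Nat.card_congr ((Equiv.sumArrowEquivProdArrow _ _ _).subtypeEquiv fun _ => Iff.rfl)
  simp [h, Set.ncard_prod]

variable (Λ) in
/-- The one-point algebra. -/
def base : Pres Λ k where
  σ := Empty
  c := Empty.elim
  surj r := ⟨MvPolynomial.C r, aeval_C _ r⟩
  Z _ := Set.univ
  mem _ := by simpa using ⟨Algebra.ofId k Λ.F⟩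

theorem count_base : (base Λ).count = 1 :=
  Filter.Germ.coe_eq.2 (.of_forall fun i => by simp [base])

variable (Λ) in
/-- The affine line. -/
def line : Pres Λ (Polynomial k) where
  σ := Unit
  c _ := Polynomial.X
  surj p := ⟨p.aeval (X ()), by
    rw [← Polynomial.aeval_algHom_apply, aeval_X, Polynomial.aeval_X_left_apply]⟩
  Z _ := Set.univ
  mem x := by simpa using ⟨Polynomial.aeval (pt x ()), by simp⟩

theorem count_line : (line Λ).count = ((fun i => (Nat.card (Λ.E i) : ℤ)) : Λ.I → ℤ) :=
  Filter.Germ.coe_eq.2 (.of_forall fun i => by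
    simp [line, Nat.card_congr (Equiv.funUnique Unit (Λ.E i))])

theorem not_isUnit_count_line : ¬ IsUnit (line Λ).count := by
  rw [count_line]
  intro h
  obtain ⟨r, hr⟩ := h.exists_right_inv
  induction r using Filter.Germ.inductionOn with | _ r
  rw [← Filter.Germ.coe_mul, ← Filter.Germ.coe_one, Filter.Germ.coe_eq] at hr
  obtain ⟨i, hi⟩ := hr.exists
  have h1 : (1 : ℤ) < Nat.card (Λ.E i) := by exact_mod_cast Finite.one_lt_card
  rcases Int.eq_one_or_neg_one_of_mul_eq_one hi with h2 | h2 <;> dsimp only at h2 <;> omega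

end Pres

theorem specMap_injective {A B : Type u} [CommRing A] [Algebra k A] [CommRing B] [Algebra k B]
    {f g : A →ₐ[k] B} (h : Spec.map (CommRingCat.ofHom f.toRingHom) =
      Spec.map (CommRingCat.ofHom g.toRingHom)) : f = g :=
  AlgHom.ext fun x => congrArg (fun f => f.hom x) (Spec.map_injective h)

theorem specMap_comp {A B C : Type u} [CommRing A] [Algebra k A] [CommRing B] [Algebra k B]
    [CommRing C] [Algebra k C] (f : A →ₐ[k] B) (g : B →ₐ[k] C) :
    Spec.map (CommRingCat.ofHom (g.comp f).toRingHom) =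
      Spec.map (CommRingCat.ofHom g.toRingHom) ≫ Spec.map (CommRingCat.ofHom f.toRingHom) :=
  Spec.map_comp (CommRingCat.ofHom f.toRingHom) (CommRingCat.ofHom g.toRingHom)

variable {X Y Z : Scheme.{u}}

/-- A morphism from an affine scheme of finite type over `k`. -/
structure Piece (Λ : Ultra k) (s : X ⟶ SpecBase k) where
  C : Type u
  [ring : CommRing C]
  [alg : Algebra k C]
  P : Pres Λ C
  g : Spec (.of C) ⟶ X
  hg : g ≫ s = specStr k C

attribute [instance] Piece.ring Piece.alg

namespace Piece

variable {s : X ⟶ SpecBase k}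

/-- The point attached to a homomorphism. -/
def toPt (p : Piece Λ s) (θ : p.C →ₐ[k] Λ.F) : Spec (.of Λ.F) ⟶ X :=
  Spec.map (CommRingCat.ofHom θ.toRingHom) ≫ p.g

theorem toPt_comp (p : Piece Λ s) (θ : p.C →ₐ[k] Λ.F) : p.toPt θ ≫ s = specStr k Λ.F := by
  rw [Piece.toPt, Category.assoc, p.hg, specStr_comp]

/-- Composition with a morphism. -/
def map {t : Y ⟶ SpecBase k} (f : X ⟶ Y) (hf : f ≫ t = s) (p : Piece Λ s) : Piece Λ t :=
  ⟨p.C, p.P, p.g ≫ f, by rw [Category.assoc, hf, p.hg]⟩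

/-- An affine fibre product of two pieces. -/
structure Fiber (p q : Piece Λ s) where
  E : Type u
  [ring : CommRing E]
  [alg : Algebra k E]
  P : Pres Λ E
  φ : p.C →ₐ[k] E
  ψ : q.C →ₐ[k] E
  comm : ∀ ζ : E →ₐ[k] Λ.F, p.toPt (ζ.comp φ) = q.toPt (ζ.comp ψ)
  existsUnique : ∀ θ η, p.toPt θ = q.toPt η → ∃! ζ : E →ₐ[k] Λ.F, ζ.comp φ = θ ∧ ζ.comp ψ = η

attribute [instance] Fiber.ring Fiber.alg

/-- The fibre product with the factors exchanged. -/
def Fiber.symm {p q : Piece Λ s} (E : Fiber p q) : Fiber q p :=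
  ⟨E.E, E.P, E.ψ, E.φ, fun ζ => (E.comm ζ).symm, fun θ η h => by
    simpa only [and_comm] using E.existsUnique η θ h.symm⟩

/-- Every point over the ultraproduct lies on exactly one member of a family of pieces. -/
def Complete {ι : Type} (L : ι → Piece Λ s) : Prop :=
  ∀ p : Spec (.of Λ.F) ⟶ X, p ≫ s = specStr k Λ.F →
    ∃! q : Σ a, (L a).C →ₐ[k] Λ.F, (L q.1).toPt q.2 = p

theorem count_eq_sum {ι : Type} [Fintype ι] {L : ι → Piece Λ s} (hL : Complete L)
    (p : Piece Λ s) (E : ∀ a, Fiber p (L a)) : p.P.count = ∑ a, (E a).P.count := by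
  refine p.P.count_eq_sum _ (fun a => (E a).φ) fun θ => ?_
  obtain ⟨⟨a, η⟩, h, hu⟩ := hL _ (p.toPt_comp θ)
  obtain ⟨ζ, hζ, hu'⟩ := (E a).existsUnique θ η h.symm
  refine ⟨⟨a, ζ⟩, hζ.1, ?_⟩
  rintro ⟨a', ζ'⟩ rfl
  cases hu ⟨a', ζ'.comp (E a').ψ⟩ ((E a').comm ζ').symm
  rw [hu' ζ' ⟨rfl, rfl⟩]

theorem finiteType (p : Piece Λ s) : Algebra.FiniteType k p.C :=
  .of_surjective _ p.P.surj

instance (t : X ⟶ SpecBase k) [IsAffine X] : IsIso (secMor t (isAffineOpen_top X)) := by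
  have : IsIso (isAffineOpen_top X).fromSpec := by
    rw [IsAffineOpen.fromSpec_top]
    infer_instance
  exact this

theorem exists_fiber [IsSeparated s] (p q : Piece Λ s) : Nonempty (Fiber p q) := by
  have hp (p : Piece Λ s) : LocallyOfFiniteType (p.g ≫ s) ∧ IsAffineHom (p.g ≫ s) := by
    rw [p.hg]
    exact ⟨(var_specStr p.finiteType).ft, inferInstanceAs (IsAffineHom (Spec.map _))⟩
  obtain ⟨_, _⟩ := hp p
  obtain ⟨_, _⟩ := hp q
  have := IsAffineHom.of_comp p.g s
  have := locallyOfFiniteType_of_comp p.g s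
  have := isAffine_of_isAffineHom (pullback.snd p.g q.g)
  let t := pullback.snd p.g q.g ≫ q.g ≫ s
  let m := secMor t (isAffineOpen_top _)
  have := Sec.finiteType (s := t) (isAffineOpen_top _)
  obtain ⟨P⟩ := Pres.exists_pres Λ (Sec t ⊤)
  obtain ⟨φ, hφ⟩ := exists_specMap (m ≫ pullback.fst p.g q.g) (by
    rw [← secMor_comp t (isAffineOpen_top _), ← p.hg, Category.assoc, pullback.condition_assoc])
  obtain ⟨ψ, hψ⟩ := exists_specMap (m ≫ pullback.snd p.g q.g) (by
    rw [← secMor_comp t (isAffineOpen_top _), ← q.hg, Category.assoc])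
  refine ⟨⟨_, P, φ, ψ, fun ζ => ?_, fun θ η h => ?_⟩⟩
  · simp only [toPt, specMap_comp, hφ, hψ, Category.assoc, pullback.condition]
  · let l := pullback.lift _ _ h
    have hl : l ≫ pullback.fst _ _ = _ := pullback.lift_fst _ _ _
    have hl' : l ≫ pullback.snd _ _ = _ := pullback.lift_snd _ _ _
    obtain ⟨ζ, hζ⟩ := exists_specMap (l ≫ inv m) (by
      rw [← secMor_comp t (isAffineOpen_top _), Category.assoc, IsIso.inv_hom_id_assoc]
      exact (pullback.lift_snd_assoc _ _ _ _).trans (by rw [q.hg, specStr_comp]))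
    refine ⟨ζ, ⟨specMap_injective ?_, specMap_injective ?_⟩, fun ζ' ⟨h2, h3⟩ =>
      specMap_injective ?_⟩
    · rw [specMap_comp, hζ, hφ, Category.assoc, IsIso.inv_hom_id_assoc, hl]
    · rw [specMap_comp, hζ, hψ, Category.assoc, IsIso.inv_hom_id_assoc, hl']
    · rw [hζ, ← cancel_mono m, Category.assoc, IsIso.inv_hom_id, Category.comp_id]
      apply pullback.hom_ext
      · rw [Category.assoc, ← hφ, ← specMap_comp, h2, hl]
      · rw [Category.assoc, ← hψ, ← specMap_comp, h3, hl']

end Piece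

/-- `r` counts the points of a scheme over `k` in an ultraproduct of finite fields. -/
def HasCount (Λ : Ultra k) (s : X ⟶ SpecBase k) (r : (Λ.U : Filter Λ.I).Germ ℤ) : Prop :=
  ∃ (ι : Type) (_ : Fintype ι) (L : ι → Piece Λ s), Piece.Complete L ∧ r = ∑ a, (L a).P.count

namespace HasCount

variable {s : X ⟶ SpecBase k} {t : Y ⟶ SpecBase k} {r r' : (Λ.U : Filter Λ.I).Germ ℤ}

theorem unique [IsSeparated s] (h : HasCount Λ s r) (h' : HasCount Λ s r') : r = r' := by
  obtain ⟨ι, _, L, hL, rfl⟩ := h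
  obtain ⟨κ, _, M, hM, rfl⟩ := h'
  let E a b := Classical.choice ((L a).exists_fiber (M b))
  rw [Finset.sum_congr rfl fun a _ => (L a).count_eq_sum hM (E a), Finset.sum_comm]
  exact Finset.sum_congr rfl fun b _ => ((M b).count_eq_sum hL fun a => (E a b).symm).symm

theorem of_isIso {C : Type u} [CommRing C] [Algebra k C] (P : Pres Λ C)
    (g : Spec (.of C) ⟶ X) [IsIso g] (hg : g ≫ s = specStr k C) : HasCount Λ s P.count := by
  refine ⟨Unit, inferInstance, fun _ => ⟨C, P, g, hg⟩, fun p hp => ?_, by simp⟩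
  obtain ⟨θ, hθ⟩ := exists_specMap (p ≫ inv g) (by rw [← hg]; simpa)
  have hp' : Spec.map (CommRingCat.ofHom θ.toRingHom) ≫ g = p := by
    rw [hθ, Category.assoc, IsIso.inv_hom_id, Category.comp_id]
  refine ⟨⟨(), θ⟩, hp', ?_⟩
  rintro ⟨⟨⟩, η⟩ h
  cases specMap_injective ((cancel_mono g).1 (h.trans hp'.symm))
  rfl

theorem exists_of_isAffine [IsAffine X] [LocallyOfFiniteType s] : ∃ r, HasCount Λ s r := by
  have := Sec.finiteType (s := s) (isAffineOpen_top X)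
  obtain ⟨P⟩ := Pres.exists_pres Λ (Sec s (⊤ : X.Opens))
  exact ⟨_, of_isIso P _ (secMor_comp s (isAffineOpen_top X))⟩

theorem add (f : Y ⟶ X) (i : Z ⟶ X) [Mono f] [Mono i] (hd : ∀ (p : Spec (.of Λ.F) ⟶ Y) q, p ≫ f ≠ q ≫ i)
    (hl : ∀ p : Spec (.of Λ.F) ⟶ X, (∃ q, q ≫ f = p) ∨ ∃ q, q ≫ i = p)
    (h : HasCount Λ (f ≫ s) r) (h' : HasCount Λ (i ≫ s) r') : HasCount Λ s (r + r') := by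
  obtain ⟨ι, _, L, hL, rfl⟩ := h
  obtain ⟨κ, _, M, hM, rfl⟩ := h'
  refine ⟨ι ⊕ κ, inferInstance,
    Sum.elim (fun a => (L a).map f rfl) (fun b => (M b).map i rfl), fun p hp => ?_, by
      rw [Fintype.sum_sum_type]; rfl⟩
  obtain ⟨q, rfl⟩ | ⟨q, rfl⟩ := hl p
  · obtain ⟨⟨a, η⟩, rfl, hu⟩ := hL q (by rw [← hp, Category.assoc])
    refine ⟨⟨.inl a, η⟩, (Category.assoc _ _ _).symm, ?_⟩
    rintro ⟨a' | b, η'⟩ h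
    · cases hu ⟨a', η'⟩ ((cancel_mono f).1 ((Category.assoc _ _ _).trans h))
      rfl
    · exact (hd _ _ ((Category.assoc _ _ _).trans h).symm).elim
  · obtain ⟨⟨a, η⟩, rfl, hu⟩ := hM q (by rw [← hp, Category.assoc])
    refine ⟨⟨.inr a, η⟩, (Category.assoc _ _ _).symm, ?_⟩
    rintro ⟨b | a', η'⟩ h
    · exact (hd _ _ ((Category.assoc _ _ _).trans h)).elim
    · cases hu ⟨a', η'⟩ ((cancel_mono i).1 ((Category.assoc _ _ _).trans h))
      rfl

theorem scissor (i : Z ⟶ X) [IsClosedImmersion i] (j : Y ⟶ X) [IsOpenImmersion j]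
    (hr : Set.range j = (Set.range i)ᶜ) (h : HasCount Λ (j ≫ s) r)
    (h' : HasCount Λ (i ≫ s) r') : HasCount Λ s (r + r') := by
  refine add j i (fun p q h => ?_) (fun p => ?_) h h'
  · let z : Spec (.of Λ.F) := default
    have h1 : j (p z) ∈ (Set.range i)ᶜ := hr ▸ ⟨_, rfl⟩
    exact h1 ⟨q z, by rw [← Scheme.Hom.comp_apply, ← h, Scheme.Hom.comp_apply]⟩
  · have : Subsingleton (Spec (.of Λ.F)) := inferInstanceAs (Subsingleton (PrimeSpectrum Λ.F))
    by_cases hp : p default ∈ Set.range i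
    · right
      have : Surjective (pullback.snd i p) := ⟨fun z => by
        rw [← Set.mem_range, Scheme.Pullback.range_snd, Subsingleton.elim z default]
        exact hp⟩
      have := isIso_of_isClosedImmersion_of_surjective (pullback.snd i p)
      exact ⟨inv (pullback.snd i p) ≫ pullback.fst i p, by simp [pullback.condition]⟩
    · left
      refine ⟨IsOpenImmersion.lift j p ?_, IsOpenImmersion.lift_fac _ _ _⟩
      rintro _ ⟨z, rfl⟩
      rw [hr, Subsingleton.elim z default]
      exact hp

end HasCount

end

section

open TensorProduct

variable {k : Type u} [Field k] {Λ : Ultra k} {X Y : Scheme.{u}} {s : X ⟶ SpecBase k}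
  {t : Y ⟶ SpecBase k} {r r' : (Λ.U : Filter Λ.I).Germ ℤ}

theorem HasCount.map_iso (h : HasCount Λ s r) (e : X ⟶ Y) [IsIso e] (he : e ≫ t = s) :
    HasCount Λ t r := by
  obtain ⟨ι, _, L, hL, rfl⟩ := h
  refine ⟨ι, _, fun a => (L a).map e he, fun p hp => ?_, rfl⟩
  obtain ⟨⟨a, θ⟩, h, hu⟩ := hL (p ≫ inv e) (by rw [← he]; simpa)
  refine ⟨⟨a, θ⟩, (Category.assoc _ _ _).symm.trans ((IsIso.eq_comp_inv e).1 h), fun q hq => ?_⟩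
  exact hu q ((IsIso.eq_comp_inv e).2 ((Category.assoc _ _ _).trans hq))

theorem Var.exists_hasCount (Λ : Ultra k) (hs : Var s) : ∃ r, HasCount Λ s r := by
  have := hs.isNoetherian
  suffices ∀ (T : TopologicalSpace.Closeds X) (Y : Scheme.{u}) (i : Y ⟶ X) [IsClosedImmersion i],
      Set.range i = T → ∃ r, HasCount Λ (i ≫ s) r by
    simpa using this ⊤ X (𝟙 X) (by simp)
  intro T
  induction T using WellFoundedLT.induction with | _ T ih
  intro Y i _ hT
  have := (hs.comp_closed i).ft
  rcases isEmpty_or_nonempty Y with hY | ⟨⟨y⟩⟩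
  · exact HasCount.exists_of_isAffine
  obtain ⟨U, hU, hyU, -⟩ := exists_isAffineOpen_mem_and_subset (x := y) (U := ⊤) trivial
  let J := Scheme.IdealSheafData.vanishingIdeal ⟨(U : Set Y)ᶜ, U.2.isClosed_compl⟩
  have hJ : Set.range J.subschemeι = (U : Set Y)ᶜ := by simp [J]
  have : IsAffine U.toScheme := hU
  have := ((hs.comp_closed i).comp_open U.ι).ft
  obtain ⟨r, hr⟩ := HasCount.exists_of_isAffine (Λ := Λ) (s := U.ι ≫ i ≫ s)
  obtain ⟨r', hr'⟩ := ih ⟨_, (J.subschemeι ≫ i).isClosedEmbedding.isClosed_range⟩ (by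
    refine lt_of_le_of_ne ?_ fun h => ?_
    · rintro _ ⟨z, rfl⟩
      exact hT.le ⟨J.subschemeι z, (Scheme.Hom.comp_apply _ _ _).symm⟩
    · have h1 : i y ∈ T := hT.le ⟨y, rfl⟩
      rw [← h] at h1
      obtain ⟨z, hz⟩ := h1
      rw [Scheme.Hom.comp_apply] at hz
      exact (i.isClosedEmbedding.injective hz ▸ hJ.le ⟨z, rfl⟩ : y ∈ (U : Set Y)ᶜ) hyU)
    _ (J.subschemeι ≫ i) rfl
  exact ⟨_, HasCount.scissor J.subschemeι U.ι (by simp [hJ]) hr (by simpa using hr')⟩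

theorem eq_lift_comp {C D F : Type*} [CommRing C] [Algebra k C] [CommRing D] [Algebra k D]
    [CommRing F] [Algebra k F] (ζ : C ⊗[k] D →ₐ[k] F) :
    ζ = Algebra.TensorProduct.lift (ζ.comp Algebra.TensorProduct.includeLeft)
      (ζ.comp Algebra.TensorProduct.includeRight) fun _ _ => .all _ _ :=
  Algebra.TensorProduct.ext (by ext; simp) (by ext; simp)

theorem HasCount.prod (h : HasCount Λ s r) (h' : HasCount Λ t r') :
    HasCount Λ (pullback.fst s t ≫ s) (r * r') := by
  obtain ⟨ι, _, L, hL, rfl⟩ := h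
  obtain ⟨κ, _, M, hM, rfl⟩ := h'
  let N (c : ι × κ) : Piece Λ (pullback.fst s t ≫ s) :=
    ⟨(L c.1).C ⊗[k] (M c.2).C, (L c.1).P.tensor (M c.2).P, pullback.lift
      (Spec.map (CommRingCat.ofHom Algebra.TensorProduct.includeLeft.toRingHom) ≫ (L c.1).g)
      (Spec.map (CommRingCat.ofHom Algebra.TensorProduct.includeRight.toRingHom) ≫ (M c.2).g)
      (by rw [Category.assoc, Category.assoc, (L c.1).hg, (M c.2).hg, specStr_comp, specStr_comp]),
      by rw [pullback.lift_fst_assoc, Category.assoc, (L c.1).hg, specStr_comp]⟩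
  have hl (c) (ζ : (N c).C →ₐ[k] Λ.F) : (N c).toPt ζ ≫ pullback.fst s t =
      (L c.1).toPt (ζ.comp Algebra.TensorProduct.includeLeft) := by
    rw [Piece.toPt, Piece.toPt, specMap_comp, Category.assoc, pullback.lift_fst, Category.assoc]
  have hr (c) (ζ : (N c).C →ₐ[k] Λ.F) : (N c).toPt ζ ≫ pullback.snd s t =
      (M c.2).toPt (ζ.comp Algebra.TensorProduct.includeRight) := by
    rw [Piece.toPt, Piece.toPt, specMap_comp, Category.assoc, pullback.lift_snd, Category.assoc]
  refine ⟨ι × κ, inferInstance, N, fun p hp => ?_, ?_⟩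
  · obtain ⟨⟨a, θ⟩, h, hu⟩ := hL (p ≫ pullback.fst s t) (by rw [Category.assoc, hp])
    obtain ⟨⟨b, η⟩, h', hu'⟩ := hM (p ≫ pullback.snd s t) (by
      rw [Category.assoc, ← pullback.condition, hp])
    refine ⟨⟨(a, b), Algebra.TensorProduct.lift θ η fun _ _ => Commute.all _ _⟩, ?_, ?_⟩
    · apply pullback.hom_ext
      · exact (hl _ _).trans ((congrArg (L a).toPt
          (Algebra.TensorProduct.lift_comp_includeLeft _ _ fun _ _ => .all _ _)).trans h)
      · exact (hr _ _).trans ((congrArg (M b).toPt (AlgHom.ext fun x =>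
          (by simp : Algebra.TensorProduct.lift θ η (fun _ _ => .all _ _) (1 ⊗ₜ x) = η x))).trans h')
    · rintro ⟨⟨a', b'⟩, ζ⟩ rfl
      cases hu ⟨a', _⟩ (hl _ ζ).symm
      cases hu' ⟨b', _⟩ (hr _ ζ).symm
      congr 1
      exact eq_lift_comp ζ
  · rw [Fintype.sum_mul_sum, Fintype.sum_prod_type]
    exact Finset.sum_congr rfl fun a _ => Finset.sum_congr rfl fun b _ =>
      (Pres.count_tensor _ _).symm

open Classical in
/-- The number of points of a scheme over `k` in an ultraproduct of finite fields. -/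
def countCl (Λ : Ultra k) (s : X ⟶ SpecBase k) : (Λ.U : Filter Λ.I).Germ ℤ :=
  if h : ∃ r, HasCount Λ s r then h.choose else 0

theorem Var.hasCount (hs : Var s) : HasCount Λ s (countCl Λ s) := by
  have h := hs.exists_hasCount Λ
  rw [countCl, dif_pos h]
  exact h.choose_spec

theorem HasCount.eq (h : HasCount Λ s r) (hs : IsSeparated s) : countCl Λ s = r := by
  have h' : ∃ r, HasCount Λ s r := ⟨r, h⟩
  rw [countCl, dif_pos h']
  exact h'.choose_spec.unique h

/-- Counting points in an ultraproduct of finite fields is a motivic measure. -/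
def countMeasure (Λ : Ultra k) :
    MotivicMeasure k ((Λ.U : Filter Λ.I).Germ ℤ) where
  cl _ s := countCl Λ s
  cl_point := by
    rw [← Pres.count_base (Λ := Λ)]
    refine (HasCount.of_isIso (Pres.base Λ) (𝟙 _) ?_).eq inferInstance
    exact (Category.comp_id _).trans (Spec.map_id (.of k)).symm
  cl_iso sX sY e h1 h2 h3 he := by
    have h : Var sX := ⟨h1, h2, h3⟩
    exact ((h.hasCount.map_iso e.hom he).eq
      (h.of_iso e.inv (by rw [← he, Iso.inv_hom_id_assoc])).sep).symm
  cl_scissor sX i h1 h2 h3 _ U hU := by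
    have h : Var sX := ⟨h1, h2, h3⟩
    exact (HasCount.scissor i U.ι (by simpa using hU) (h.comp_open U.ι).hasCount
      (h.comp_closed i).hasCount).eq h3
  cl_prod sX sY h1 h2 h3 h4 h5 h6 :=
    (HasCount.prod (Var.hasCount ⟨h1, h2, h3⟩) (Var.hasCount ⟨h4, h5, h6⟩)).eq inferInstance

theorem countMeasure_lef_not_isUnit : ¬ IsUnit (countMeasure Λ).lef := by
  have h : (countMeasure Λ).lef = (Pres.line Λ).count :=
    (HasCount.of_isIso (Pres.line Λ) (𝟙 _) (Category.id_comp _)).eq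
      (var_specStr inferInstance).sep
  rw [h]
  exact Pres.not_isUnit_count_line

end

theorem isJacobsonRing_int : IsJacobsonRing ℤ := by
  rw [isJacobsonRing_iff_prime_eq]
  intro P hP
  by_cases h : P = ⊥
  · subst h
    refine le_antisymm (fun x hx => ?_) Ideal.le_jacobson
    rcases Int.isUnit_iff.1 (Ideal.mem_jacobson_bot.1 hx x) with h | h <;>
      exact (Ideal.mem_bot).2 (by nlinarith)
  · exact Ideal.jacobson_eq_self_of_isMaximal (H := hP.isMaximal h)

theorem finite_of_finiteType_int {A E : Type*} [CommRing A] [Field E] [Algebra.FiniteType ℤ A]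
    (f : A →+* E) (hf : Function.Surjective f) : Finite E := by
  have := isJacobsonRing_int
  have : Algebra.FiniteType ℤ E := .of_surjective f.toIntAlgHom hf
  have : Module.Finite ℤ E := finite_of_finite_type_of_isJacobsonRing ℤ E
  refine Module.finite_of_fg_torsion E fun x => ?_
  by_contra hx
  have h0 (n : ℤ) (hn : (n : E) = 0) : n = 0 := by
    by_contra h
    exact hx ⟨⟨n, mem_nonZeroDivisors_of_ne_zero h⟩, by
      rw [Submonoid.smul_def, zsmul_eq_mul, hn, zero_mul]⟩
  have h1 := isField_of_isIntegral_of_isField (R := ℤ) (S := E)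
    ((injective_iff_map_eq_zero _).2 fun n hn => h0 n (by simpa using hn)) (Field.toIsField E)
  exact Int.not_isField h1

/-- The ideal of sequences vanishing along an ultrafilter. -/
def ultraIdeal {I : Type*} (U : Ultrafilter I) (E : I → Type*) [∀ i, Field (E i)] :
    Ideal (∀ i, E i) where
  carrier := {x | ∀ᶠ i in U, x i = 0}
  zero_mem' := .of_forall fun _ => rfl
  add_mem' hx hy := by
    filter_upwards [hx, hy] with i h h'
    simp [h, h']
  smul_mem' c x hx := by
    filter_upwards [hx] with i h
    simp [h]

instance {I : Type*} (U : Ultrafilter I) (E : I → Type*) [∀ i, Field (E i)] :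
    (ultraIdeal U E).IsMaximal := by
  refine Ideal.isMaximal_iff.2 ⟨fun h => ?_, fun J x hJ hx hxJ => ?_⟩
  · obtain ⟨i, hi⟩ := Filter.Eventually.exists h
    exact one_ne_zero hi
  · have h1 : 1 - x⁻¹ * x ∈ J := hJ (by
      filter_upwards [Ultrafilter.eventually_not.2 hx] with i hi
      simp [inv_mul_cancel₀ hi])
    simpa using J.add_mem h1 (J.mul_mem_left x⁻¹ hxJ)

/-- Every field embeds into an ultraproduct of finite fields. -/
theorem exists_ultra (k : Type u) [Field k] : Nonempty (Ultra k) := by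
  classical
  let U : Ultrafilter (Finset k) := .of Filter.atTop
  have hU (a : k) : ∀ᶠ S : Finset k in U, a ∈ Algebra.adjoin ℤ (S : Set k) := by
    refine Ultrafilter.of_le _ ((Filter.eventually_ge_atTop {a}).mono fun S hS => ?_)
    exact Algebra.subset_adjoin (hS (Finset.mem_singleton_self a))
  choose M hM using fun S : Finset k => Ideal.exists_maximal (Algebra.adjoin ℤ (S : Set k))
  let E (S : Finset k) : Type u := Algebra.adjoin ℤ (S : Set k) ⧸ M S
  let _ (S : Finset k) : Field (E S) := Ideal.Quotient.field (M S)
  have (S : Finset k) : Finite (E S) := by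
    have : Algebra.FiniteType ℤ (Algebra.adjoin ℤ (S : Set k)) :=
      (Subalgebra.fg_iff_finiteType _).1 ⟨S, rfl⟩
    exact finite_of_finiteType_int (E := E S) (Ideal.Quotient.mk (M S)) Ideal.Quotient.mk_surjective
  let F : Type u := (∀ S, E S) ⧸ ultraIdeal U E
  let _ : Field F := Ideal.Quotient.field _
  let mk : (∀ S, E S) →+* F := Ideal.Quotient.mk _
  have hmk (x) : mk x = 0 ↔ ∀ᶠ i in U, x i = 0 := Ideal.Quotient.eq_zero_iff_mem
  have hmk' {x y} (h : ∀ᶠ i in U, x i = y i) : mk x = mk y := by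
    rw [← sub_eq_zero, ← map_sub, hmk]
    exact h.mono fun i hi => sub_eq_zero.2 hi
  let f (a : k) (S : Finset k) : E S :=
    if h : a ∈ Algebra.adjoin ℤ (S : Set k) then Ideal.Quotient.mk (M S) ⟨a, h⟩ else 0
  have hf {a : k} {S : Finset k} (h : a ∈ Algebra.adjoin ℤ (S : Set k)) :
      f a S = Ideal.Quotient.mk (M S) ⟨a, h⟩ := dif_pos h
  let φ : k →+* F := RingHom.mk' ⟨⟨fun a => mk (f a), (hmk' (.of_forall fun S => by
      rw [hf (one_mem _)]
      rfl)).trans (map_one mk)⟩, fun a b => by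
    rw [← map_mul]
    refine hmk' ?_
    filter_upwards [hU a, hU b] with S ha hb
    rw [Pi.mul_apply, hf ha, hf hb, hf (mul_mem ha hb)]
    exact map_mul (Ideal.Quotient.mk (M S)) ⟨a, ha⟩ ⟨b, hb⟩⟩ fun a b => by
    change mk _ = mk _ + mk _
    rw [← map_add]
    refine hmk' ?_
    filter_upwards [hU a, hU b] with S ha hb
    rw [Pi.add_apply, hf ha, hf hb, hf (add_mem ha hb)]
    exact map_add (Ideal.Quotient.mk (M S)) ⟨a, ha⟩ ⟨b, hb⟩
  let _ : Algebra k F := φ.toAlgebra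
  exact ⟨.ofData _ U E F mk Ideal.Quotient.mk_surjective hmk⟩

end

end MotivicSurface

open MotivicSurface

/-- Let `k` be an algebraically closed field of characteristic zero and
let `X` be a rational normal projective surface over `k` with a unique singular point `x`,
admitting a resolution of singularities `π : X̃ ⟶ X` with `X̃` smooth projective rational,
`π` an isomorphism over `X ∖ {x}`, and exceptional divisor `E = π⁻¹(x)` a cycle of three
lines (three copies of `ℙ¹_k` meeting pairwise in single points, with empty triple
intersection).  Then `[X] ≡ 2 mod 𝕃` in `K₀(Var_k)`; in particular `X` is a rational
normal projective surface whose class is not congruent to `1 mod 𝕃`. -/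
theorem singular_rational_surface_class_eq_two (k : Type u) [Field k] [IsAlgClosed k]
    [CharZero k] (X : Scheme.{u}) (sX : X ⟶ SpecBase k)
    -- `X` is an integral projective surface over `k`, normal (stalks integrally closed)
    (hint : IsIntegral X) (hproper : IsProper sX)
    (hnormal : ∀ x : X, IsIntegrallyClosed (X.presheaf.stalk x))
    (hdim : topologicalKrullDim X = (2 : WithBot ℕ∞))
    -- `X` is rational
    (hrat : ∃ m : ℕ, BirationalOver k X (ProjSpace k m) sX (ProjSpace.toSpec k m))
    -- `x` is the unique singular point of `X`
    (x : X) (hsing : ¬ IsSmooth sX)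
    -- the resolution of singularities `π : X̃ ⟶ X`, with `X̃` smooth projective rational
    (Xt : Scheme.{u}) (π : Xt ⟶ X)
    (hXtsmooth : IsSmooth (π ≫ sX)) (hXtproper : IsProper (π ≫ sX))
    (hXtrat : ∃ m : ℕ, BirationalOver k Xt (ProjSpace k m) (π ≫ sX) (ProjSpace.toSpec k m))
    -- `π` is an isomorphism over `X ∖ {x}`
    (V : X.Opens) (hV : (V : Set X) = {x}ᶜ) (hiso : IsIso (π ∣_ V))
    -- the exceptional divisor `E = π⁻¹(x)` is a cycle of three lines
    (ℓ : Fin 3 → ((ProjSpace k 1) ⟶ Xt)) (hci : ∀ i, IsClosedImmersion (ℓ i))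
    (hk : ∀ i, ℓ i ≫ π ≫ sX = ProjSpace.toSpec k 1)
    (hE : (⋃ i, Set.range (ℓ i).base) = π.base ⁻¹' {x})
    (hpair : ∀ i j, i ≠ j → ∃ p : Xt, Set.range (ℓ i).base ∩ Set.range (ℓ j).base = {p})
    (htriple : Set.range (ℓ 0).base ∩ Set.range (ℓ 1).base ∩ Set.range (ℓ 2).base = ∅) :
    (∀ (R : Type u) [CommRing R] (μ : MotivicMeasure k R),
        μ.cl X sX - 2 ∈ Ideal.span {μ.lef}) ∧
      ¬ (∀ (R : Type u) [CommRing R] (μ : MotivicMeasure k R),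
          μ.cl X sX - 1 ∈ Ideal.span {μ.lef}) := by
  obtain ⟨m, hb⟩ := hrat
  obtain ⟨m', hb'⟩ := hXtrat
  obtain rfl := eq_two_of_birational hdim hb
  have := irreducibleSpace_of_birational hb'
  have : Smooth (π ≫ sX) := hXtsmooth
  obtain ⟨f, hf, j, _, hj⟩ :=
    exists_mor_resolution hb V (nonempty_of_compl_singleton hdim hV) π hiso
  have key (R : Type u) [CommRing R] (μ : MotivicMeasure k R) :
      μ.cl X sX - 2 ∈ Ideal.span {μ.lef} :=
    cl_sub_two_mem μ .of_isProper x π .of_isProper V hV hiso ℓ hci hk hE hpair htriple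
      (cl_sub_one_mem_of_smooth (π ≫ sX) hf j hj μ)
  refine ⟨key, fun h => ?_⟩
  obtain ⟨Λ⟩ := exists_ultra k
  have h1 := Ideal.sub_mem _ (h _ (countMeasure Λ)) (key _ (countMeasure Λ))
  rw [sub_sub_sub_cancel_left, Ideal.mem_span_singleton, ← one_add_one_eq_two, add_sub_cancel_right] at h1
  exact countMeasure_lef_not_isUnit (isUnit_of_dvd_one h1)
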